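/- Let K be a real quadratic extension of ℚ with K ≠ ℚ(√5). Then the naïve Mertens-type conjecture over K is false, i.e., it is NOT the case that −1 ≤ M_K^- ≤ M_K^+ ≤ 1. -/

import Mathlib

noncomputable section

open NumberField Filter Topology MeasureTheory Complex

open scoped Classical

/-- The Möbius function on integral ideals of a number field `K`. -/
def moebiusK (K : Type) [Field K] [NumberField K] (I : Ideal (𝓞 K)) : ℤ :=
  if Squarefree I then (-1) ^ (UniqueFactorizationMonoid.factors I).card else 0

/-- The Mertens function of a number field `K`: the sum of `μ_K(𝔞)` over nonzero integral
ideals `𝔞` of norm at most `x`, where ideals of norm exactly `x` count with weight `1/2`. -/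
def mertensK (K : Type) [Field K] [NumberField K] (x : ℝ) : ℝ :=
  ∑' I : Ideal (𝓞 K),
    if I ≠ ⊥ ∧ (Ideal.absNorm I : ℝ) < x then (moebiusK K I : ℝ)
    else if I ≠ ⊥ ∧ (Ideal.absNorm I : ℝ) = x then (moebiusK K I : ℝ) / 2
    else 0

/-- `M_K^- = liminf_{x → ∞} M_K(x) / x^{1/2}`, as an extended real number. -/
def MKminus (K : Type) [Field K] [NumberField K] : EReal :=
  Filter.liminf (fun x : ℝ => ((mertensK K x / Real.sqrt x : ℝ) : EReal)) Filter.atTop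

/-- `M_K^+ = limsup_{x → ∞} M_K(x) / x^{1/2}`, as an extended real number. -/
def MKplus (K : Type) [Field K] [NumberField K] : EReal :=
  Filter.limsup (fun x : ℝ => ((mertensK K x / Real.sqrt x : ℝ) : EReal)) Filter.atTop

/-- The naïve Mertens-type conjecture over `K`: `-1 ≤ M_K^- ≤ M_K^+ ≤ 1`. -/
def NaiveMertensConj (K : Type) [Field K] [NumberField K] : Prop :=
  -1 ≤ MKminus K ∧ MKminus K ≤ MKplus K ∧ MKplus K ≤ 1

/-- A predicate identifying the Dedekind zeta function of `K`: a function analytic away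
from `s = 1` agreeing with the Dirichlet series `∑ N(𝔞)^{-s}` on `Re s > 1`. -/
def IsDedekindZeta (K : Type) [Field K] [NumberField K] (Z : ℂ → ℂ) : Prop :=
  (∀ s : ℂ, s ≠ 1 → DifferentiableAt ℂ Z s) ∧
  ∀ s : ℂ, 1 < s.re →
    Z s = ∑' I : {I : Ideal (𝓞 K) // I ≠ ⊥}, (Ideal.absNorm I.1 : ℂ) ^ (-s)

/-- The Riemann hypothesis for a zeta function `Z`: all nontrivial zeros lie on `Re s = 1/2`. -/
def ZetaRH (Z : ℂ → ℂ) : Prop :=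
  ∀ ρ : ℂ, Z ρ = 0 → 0 < ρ.re → ρ.re < 1 → ρ.re = 1 / 2

section

open scoped Real

set_option autoImplicit false

/-- Boundary integral over the rectangle `[a, b] × [c, d]`, counterclockwise. -/
def rectInt (f : ℂ → ℂ) (a b c d : ℝ) : ℂ :=
  (((∫ x : ℝ in a..b, f (x + c * I)) - ∫ x : ℝ in a..b, f (x + d * I)) +
    I • ∫ y : ℝ in c..d, f (b + y * I)) - I • ∫ y : ℝ in c..d, f (a + y * I)

lemma rectInt_congr {f g : ℂ → ℂ} {a b c d : ℝ} (hab : a ≤ b) (hcd : c ≤ d)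
    (h : ∀ x y : ℝ, x ∈ Set.Icc a b → y ∈ Set.Icc c d → (x = a ∨ x = b ∨ y = c ∨ y = d) →
      f (x + y * I) = g (x + y * I)) : rectInt f a b c d = rectInt g a b c d := by
  unfold rectInt
  congr 1
  · congr 1
    · congr 1
      · refine intervalIntegral.integral_congr fun x hx => ?_
        rw [Set.uIcc_of_le hab] at hx
        exact h x c hx ⟨le_rfl, hcd⟩ (by simp)
      · refine intervalIntegral.integral_congr fun x hx => ?_
        rw [Set.uIcc_of_le hab] at hx
        exact h x d hx ⟨hcd, le_rfl⟩ (by simp)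
    · congr 1
      refine intervalIntegral.integral_congr fun x hx => ?_
      rw [Set.uIcc_of_le hcd] at hx
      exact h b x ⟨hab, le_rfl⟩ hx (by simp)
  · congr 1
    refine intervalIntegral.integral_congr fun x hx => ?_
    rw [Set.uIcc_of_le hcd] at hx
    exact h a x ⟨le_rfl, hab⟩ hx (by simp)

lemma rectInt_eq_zero {f : ℂ → ℂ} {a b c d : ℝ} (hab : a ≤ b) (hcd : c ≤ d)
    (hf : ∀ x y : ℝ, x ∈ Set.Icc a b → y ∈ Set.Icc c d → DifferentiableAt ℂ f (x + y * I)) :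
    rectInt f a b c d = 0 := by
  have := Complex.integral_boundary_rect_eq_zero_of_differentiableOn f (a + c * I) (b + d * I) ?_
  · simpa [rectInt] using this
  · intro z hz
    simp only [add_re, ofReal_re, mul_re, I_re, mul_zero, ofReal_im, I_im, mul_one, sub_self,
      add_zero, add_im, mul_im, zero_add, Set.uIcc_of_le hab, Set.uIcc_of_le hcd,
      Complex.mem_reProdIm] at hz
    have := hf z.re z.im hz.1 hz.2
    rw [re_add_im] at this
    exact this.differentiableWithinAt

/-- Continuity on the boundary, in the form needed for linearity of `rectInt`. -/
def RectCont (f : ℂ → ℂ) (a b c d : ℝ) : Prop :=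
  ∀ x y : ℝ, x ∈ Set.Icc a b → y ∈ Set.Icc c d → (x = a ∨ x = b ∨ y = c ∨ y = d) →
    ContinuousAt f (x + y * I)

lemma RectCont.integrable {f : ℂ → ℂ} {a b c d : ℝ} (hab : a ≤ b) (hcd : c ≤ d)
    (hf : RectCont f a b c d) :
    IntervalIntegrable (fun x : ℝ => f (x + c * I)) volume a b ∧
    IntervalIntegrable (fun x : ℝ => f (x + d * I)) volume a b ∧
    IntervalIntegrable (fun y : ℝ => f (b + y * I)) volume c d ∧
    IntervalIntegrable (fun y : ℝ => f (a + y * I)) volume c d := by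
  refine ⟨?_, ?_, ?_, ?_⟩
  · refine ContinuousOn.intervalIntegrable fun x hx => ?_
    rw [Set.uIcc_of_le hab] at hx
    exact (ContinuousAt.comp (f := fun x : ℝ => (x : ℂ) + c * I) (hf x c hx ⟨le_rfl, hcd⟩ (by simp))
      (by fun_prop)).continuousWithinAt
  · refine ContinuousOn.intervalIntegrable fun x hx => ?_
    rw [Set.uIcc_of_le hab] at hx
    exact (ContinuousAt.comp (f := fun x : ℝ => (x : ℂ) + d * I) (hf x d hx ⟨hcd, le_rfl⟩ (by simp))
      (by fun_prop)).continuousWithinAt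
  · refine ContinuousOn.intervalIntegrable fun x hx => ?_
    rw [Set.uIcc_of_le hcd] at hx
    exact (ContinuousAt.comp (f := fun x : ℝ => (b : ℂ) + x * I) (hf b x ⟨hab, le_rfl⟩ hx (by simp))
      (by fun_prop)).continuousWithinAt
  · refine ContinuousOn.intervalIntegrable fun x hx => ?_
    rw [Set.uIcc_of_le hcd] at hx
    exact (ContinuousAt.comp (f := fun x : ℝ => (a : ℂ) + x * I) (hf a x ⟨le_rfl, hab⟩ hx (by simp))
      (by fun_prop)).continuousWithinAt

lemma rectInt_add {f g : ℂ → ℂ} {a b c d : ℝ} (hab : a ≤ b) (hcd : c ≤ d)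
    (hf : RectCont f a b c d) (hg : RectCont g a b c d) :
    rectInt (fun s => f s + g s) a b c d = rectInt f a b c d + rectInt g a b c d := by
  obtain ⟨h1, h2, h3, h4⟩ := hf.integrable hab hcd
  obtain ⟨k1, k2, k3, k4⟩ := hg.integrable hab hcd
  unfold rectInt
  rw [intervalIntegral.integral_add h1 k1, intervalIntegral.integral_add h2 k2,
    intervalIntegral.integral_add h3 k3, intervalIntegral.integral_add h4 k4]
  simp only [smul_eq_mul]
  ring

lemma rectInt_const_mul {f : ℂ → ℂ} {a b c d : ℝ} (r : ℂ) :
    rectInt (fun s => r * f s) a b c d = r * rectInt f a b c d := by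
  unfold rectInt
  simp only [intervalIntegral.integral_const_mul, smul_eq_mul]
  ring

lemma integral_inv_segment (z : ℝ → ℂ) (m : ℂ) {p q : ℝ} (hpq : p ≤ q)
    (hz : ∀ t ∈ Set.Icc p q, HasDerivAt z m t) (hs : ∀ t ∈ Set.Icc p q, z t ∈ slitPlane) :
    m * ∫ t in p..q, (z t)⁻¹ = log (z q) - log (z p) := by
  rw [← intervalIntegral.integral_const_mul]
  refine intervalIntegral.integral_eq_sub_of_hasDerivAt (f := fun t => log (z t)) ?_ ?_
  · intro t ht
    rw [Set.uIcc_of_le hpq] at ht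
    have := (hz t ht).clog_real (hs t ht)
    simpa [div_eq_mul_inv] using this
  · refine ContinuousOn.intervalIntegrable fun t ht => ?_
    rw [Set.uIcc_of_le hpq] at ht
    exact (continuousAt_const.mul ((hz t ht).continuousAt.inv₀
      (slitPlane_ne_zero (hs t ht)))).continuousWithinAt

lemma rectInt_inv {a b c d : ℝ} {ρ : ℂ} (ha : a < ρ.re) (hb : ρ.re < b) (hc : c < ρ.im)
    (hd : ρ.im < d) : rectInt (fun s => (s - ρ)⁻¹) a b c d = 2 * π * I := by
  have hre : ∀ x y : ℝ, ((x : ℂ) + y * I - ρ).re = x - ρ.re := by intro x y; simp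
  have him : ∀ x y : ℝ, ((x : ℂ) + y * I - ρ).im = y - ρ.im := by intro x y; simp
  have hne : ∀ x y : ℝ, x ≠ ρ.re ∨ y ≠ ρ.im → ((x : ℂ) + y * I - ρ) ≠ 0 := by
    intro x y h h0
    have h1 := hre x y; have h2 := him x y
    rw [h0] at h1 h2
    simp at h1 h2
    rcases h with h | h
    · exact h (by linarith)
    · exact h (by linarith)
  have hinteg : ∀ (y : ℝ) (p q : ℝ), y ≠ ρ.im →
      IntervalIntegrable (fun x : ℝ => ((x : ℂ) + y * I - ρ)⁻¹) volume p q := by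
    intro y p q hy
    refine Continuous.intervalIntegrable ?_ _ _
    exact Continuous.inv₀ (by fun_prop) fun x => hne x y (Or.inr hy)
  have dx : ∀ (y t : ℝ), HasDerivAt (fun x : ℝ => (x : ℂ) + y * I - ρ) 1 t := by
    intro y t
    exact ((HasDerivAt.ofReal_comp (hasDerivAt_id t)).add_const (y * I)).sub_const ρ |>.congr_deriv
      (by simp)
  have dy : ∀ (x t : ℝ), HasDerivAt (fun y : ℝ => (x : ℂ) + y * I - ρ) I t := by
    intro x t
    exact (((HasDerivAt.ofReal_comp (hasDerivAt_id t)).mul_const I).const_add (x : ℂ)).sub_const ρ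
      |>.congr_deriv (by simp)
  have key1 : (∫ x : ℝ in ρ.re..b, ((x : ℂ) + c * I - ρ)⁻¹)
      = log (b + c * I - ρ) - log (ρ.re + c * I - ρ) := by
    have := integral_inv_segment (fun x : ℝ => (x : ℂ) + c * I - ρ) 1 hb.le (fun t _ => dx c t)
      (fun t _ => Or.inr (by rw [him]; linarith))
    simpa using this
  have key2 : I * (∫ y : ℝ in c..d, ((b : ℂ) + y * I - ρ)⁻¹)
      = log (b + d * I - ρ) - log (b + c * I - ρ) := by
    exact integral_inv_segment (fun y : ℝ => (b : ℂ) + y * I - ρ) I (by linarith) (fun t _ => dy b t)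
      (fun t _ => Or.inl (by rw [hre]; linarith))
  have key3 : (∫ x : ℝ in ρ.re..b, ((x : ℂ) + d * I - ρ)⁻¹)
      = log (b + d * I - ρ) - log (ρ.re + d * I - ρ) := by
    have := integral_inv_segment (fun x : ℝ => (x : ℂ) + d * I - ρ) 1 hb.le (fun t _ => dx d t)
      (fun t _ => Or.inr (by rw [him]; linarith))
    simpa using this
  have ng : ∀ z : ℂ, z⁻¹ = -(-z)⁻¹ := fun z => by rw [inv_neg, neg_neg]
  have key4 : (∫ x : ℝ in a..ρ.re, ((x : ℂ) + d * I - ρ)⁻¹)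
      = log (-(ρ.re + d * I - ρ)) - log (-(a + d * I - ρ)) := by
    have := integral_inv_segment (fun x : ℝ => -((x : ℂ) + d * I - ρ)) (-1) ha.le
      (fun t _ => (dx d t).neg)
      (fun t _ => Or.inr (by rw [neg_im, him]; linarith))
    rw [← this]
    simp only [neg_mul, one_mul, ← intervalIntegral.integral_neg]
    exact intervalIntegral.integral_congr fun x _ => ng _
  have key5 : (∫ x : ℝ in a..ρ.re, ((x : ℂ) + c * I - ρ)⁻¹)
      = log (-(ρ.re + c * I - ρ)) - log (-(a + c * I - ρ)) := by
    have := integral_inv_segment (fun x : ℝ => -((x : ℂ) + c * I - ρ)) (-1) ha.le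
      (fun t _ => (dx c t).neg)
      (fun t _ => Or.inr (by rw [neg_im, him]; linarith))
    rw [← this]
    simp only [neg_mul, one_mul, ← intervalIntegral.integral_neg]
    exact intervalIntegral.integral_congr fun x _ => ng _
  have key6 : I * (∫ y : ℝ in c..d, ((a : ℂ) + y * I - ρ)⁻¹)
      = log (-(a + d * I - ρ)) - log (-(a + c * I - ρ)) := by
    have := integral_inv_segment (fun y : ℝ => -((a : ℂ) + y * I - ρ)) (-I) (p := c) (q := d) (by linarith)
      (fun t _ => (dy a t).neg)
      (fun t _ => Or.inl (by rw [neg_re, hre]; linarith))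
    rw [← this]
    simp only [neg_mul, ← mul_neg, ← intervalIntegral.integral_neg]
    congr 1
    exact intervalIntegral.integral_congr fun x _ => ng _
  have e1 : (ρ.re : ℂ) + c * I - ρ = -(((ρ.im - c : ℝ) : ℂ) * I) := by
    apply Complex.ext <;> simp
  have e2 : (ρ.re : ℂ) + d * I - ρ = ((d - ρ.im : ℝ) : ℂ) * I := by
    apply Complex.ext <;> simp
  have l1 : log (((ρ.im - c : ℝ) : ℂ) * I) - log (-(((ρ.im - c : ℝ) : ℂ) * I)) = π * I := by
    have hp : 0 < ρ.im - c := by linarith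
    rw [log_ofReal_mul hp I_ne_zero, ← mul_neg, log_ofReal_mul hp (neg_ne_zero.2 I_ne_zero),
      log_I, log_neg_I]
    ring
  have l2 : log (((d - ρ.im : ℝ) : ℂ) * I) - log (-(((d - ρ.im : ℝ) : ℂ) * I)) = π * I := by
    have hp : 0 < d - ρ.im := by linarith
    rw [log_ofReal_mul hp I_ne_zero, ← mul_neg, log_ofReal_mul hp (neg_ne_zero.2 I_ne_zero),
      log_I, log_neg_I]
    ring
  unfold rectInt
  rw [← intervalIntegral.integral_add_adjacent_intervals (hinteg c a ρ.re hc.ne) (hinteg c _ _ hc.ne),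
    ← intervalIntegral.integral_add_adjacent_intervals (hinteg d a ρ.re hd.ne') (hinteg d _ _ hd.ne'),
    smul_eq_mul, smul_eq_mul, key1, key2, key3, key4, key5, key6, e1, e2, neg_neg]
  linear_combination l1 + l2

theorem rectInt_eq_sum_residues {f : ℂ → ℂ} {a b c d : ℝ} (hab : a ≤ b) (hcd : c ≤ d)
    (S : Finset ℂ) (hS : ∀ ρ ∈ S, a < ρ.re ∧ ρ.re < b ∧ c < ρ.im ∧ ρ.im < d) (r : ℂ → ℂ)
    (hf : ∀ x y : ℝ, x ∈ Set.Icc a b → y ∈ Set.Icc c d → (x + y * I : ℂ) ∉ S →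
      DifferentiableAt ℂ f (x + y * I))
    (hr : ∀ ρ ∈ S, Tendsto (fun s => (s - ρ) * f s) (𝓝[≠] ρ) (𝓝 (r ρ))) :
    rectInt f a b c d = 2 * π * I * ∑ ρ ∈ S, r ρ := by
  set P : ℂ → ℂ := fun s => ∑ ρ ∈ S, r ρ * (s - ρ)⁻¹ with hP
  set g : ℂ → ℂ := fun s => f s - P s with hg
  have hPd : ∀ s ∉ S, DifferentiableAt ℂ P s := by
    intro s hs
    refine DifferentiableAt.fun_sum fun ρ hρ => ?_
    have : s - ρ ≠ 0 := sub_ne_zero.2 fun h => hs (h ▸ hρ)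
    exact (((differentiableAt_id).sub_const ρ).inv this).const_mul _
  have hgd : ∀ x y : ℝ, x ∈ Set.Icc a b → y ∈ Set.Icc c d → (x + y * I : ℂ) ∉ S →
      DifferentiableAt ℂ g (x + y * I) := fun x y hx hy hs => (hf x y hx hy hs).sub (hPd _ hs)
  set G : ℂ → ℂ := fun s => if s ∈ S then limUnder (𝓝[≠] s) g else g s with hG
  have hbd : ∀ x y : ℝ, (x = a ∨ x = b ∨ y = c ∨ y = d) → (x + y * I : ℂ) ∉ S := by
    intro x y h hs
    have := hS _ hs
    simp at this
    rcases h with h | h | h | h <;> subst h <;> linarith [this.1, this.2.1, this.2.2.1, this.2.2.2]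
  have hopen : ∀ s ∉ S, ∀ᶠ z in 𝓝 s, z ∉ S := by
    intro s hs
    exact S.finite_toSet.isClosed.isOpen_compl.mem_nhds hs
  have hG0 : rectInt G a b c d = 0 := by
    refine rectInt_eq_zero hab hcd fun x y hx hy => ?_
    by_cases hs : (x + y * I : ℂ) ∈ S
    · set p : ℂ := x + y * I with hp
      obtain ⟨h1, h2, h3, h4⟩ := hS p hs
      have hT : ∀ᶠ z in 𝓝 p, (a < z.re ∧ z.re < b ∧ c < z.im ∧ z.im < d) ∧ z ∉ S.erase p := by
        refine Filter.Eventually.and ?_ ?_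
        · exact ((continuous_re.continuousAt.eventually_const_lt h1).and
            ((continuous_re.continuousAt.eventually_lt_const h2).and
            ((continuous_im.continuousAt.eventually_const_lt h3).and
            (continuous_im.continuousAt.eventually_lt_const h4))))
        · exact (S.erase p).finite_toSet.isClosed.isOpen_compl.mem_nhds (by simp)
      have hdiff : DifferentiableOn ℂ g
          ({z | (a < z.re ∧ z.re < b ∧ c < z.im ∧ z.im < d) ∧ z ∉ S.erase p} \ {p}) := by
        intro z hz
        have := hgd z.re z.im ⟨hz.1.1.1.le, hz.1.1.2.1.le⟩ ⟨hz.1.1.2.2.1.le, hz.1.1.2.2.2.le⟩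
        rw [re_add_im] at this
        refine (this fun hzS => hz.1.2 (Finset.mem_erase.2 ⟨hz.2, hzS⟩)).differentiableWithinAt
      have hlim : Tendsto (fun z => (z - p) * g z) (𝓝[≠] p) (𝓝 0) := by
        have h5 : Tendsto (fun z => (z - p) * f z - (z - p) * ∑ ρ ∈ S.erase p, r ρ * (z - ρ)⁻¹ - r p)
            (𝓝[≠] p) (𝓝 (r p - (p - p) * ∑ ρ ∈ S.erase p, r ρ * (p - ρ)⁻¹ - r p)) := by
          refine ((hr p hs).sub ?_).sub_const _
          have : ContinuousAt (fun z => (z - p) * ∑ ρ ∈ S.erase p, r ρ * (z - ρ)⁻¹) p := by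
            refine ContinuousAt.mul (by fun_prop) ?_
            refine tendsto_finsetSum _ fun ρ hρ => ?_
            have : p - ρ ≠ 0 := sub_ne_zero.2 (Finset.ne_of_mem_erase hρ).symm
            have h6 : ContinuousAt (fun z : ℂ => (z - ρ)⁻¹) p := ContinuousAt.inv₀ (by fun_prop) this
            exact h6.const_mul (r ρ)
          exact this.tendsto.mono_left nhdsWithin_le_nhds
        simp only [sub_self, zero_mul, sub_zero] at h5
        refine h5.congr' ?_
        filter_upwards [self_mem_nhdsWithin] with z hz
        have hz' : z - p ≠ 0 := sub_ne_zero.2 hz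
        simp only [hg, hP]
        rw [← Finset.add_sum_erase _ _ hs]
        field_simp
        ring
      have hlo : (fun z => g z - g p) =o[𝓝[≠] p] fun z => (z - p)⁻¹ := by
        rw [Asymptotics.isLittleO_iff_tendsto']
        · have : Tendsto (fun z => (z - p) * g z - (z - p) * g p) (𝓝[≠] p) (𝓝 (0 - (p - p) * g p)) := by
            refine hlim.sub ?_
            exact (ContinuousAt.tendsto (f := fun z => (z - p) * g p) (by fun_prop)).mono_left
              nhdsWithin_le_nhds
          simp only [sub_self, zero_mul] at this
          refine this.congr fun z => ?_
          rw [div_inv_eq_mul]; ring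
        · filter_upwards [self_mem_nhdsWithin] with z hz h0
          exact absurd (inv_eq_zero.1 h0) (sub_ne_zero.2 hz)
      have := (Complex.differentiableOn_update_limUnder_of_isLittleO hT hdiff hlo).differentiableAt hT
      refine this.congr_of_eventuallyEq ?_
      filter_upwards [hT] with z hz
      by_cases hzp : z = p
      · subst hzp; simp [hG, hs]
      · have : z ∉ S := fun h => hz.2 (Finset.mem_erase.2 ⟨hzp, h⟩)
        simp [hG, this, hzp]
    · refine (hgd x y hx hy hs).congr_of_eventuallyEq ?_
      filter_upwards [hopen _ hs] with z hz
      simp [hG, hz]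
  have hGg : rectInt G a b c d = rectInt g a b c d :=
    rectInt_congr hab hcd fun x y _ _ h => by simp [hG, hbd x y h]
  have hPsum : ∀ T ⊆ S, rectInt (fun s => ∑ ρ ∈ T, r ρ * (s - ρ)⁻¹) a b c d
      = 2 * π * I * ∑ ρ ∈ T, r ρ := by
    intro T
    induction T using Finset.induction_on with
    | empty => intro _; simp [rectInt]
    | insert p T hp ih =>
      intro hT
      have hpS : p ∈ S := hT (Finset.mem_insert_self _ _)
      have hTS : T ⊆ S := fun x hx => hT (Finset.mem_insert_of_mem hx)
      simp only [Finset.sum_insert hp]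
      have hcont : ∀ ρ ∈ S, RectCont (fun s => r ρ * (s - ρ)⁻¹) a b c d := by
        intro ρ hρ x y _ _ h
        have : (x + y * I : ℂ) - ρ ≠ 0 := sub_ne_zero.2 fun e => hbd x y h (e ▸ hρ)
        have h6 : ContinuousAt (fun z : ℂ => (z - ρ)⁻¹) (x + y * I) :=
          ContinuousAt.inv₀ (by fun_prop) this
        exact h6.const_mul (r ρ)
      rw [rectInt_add hab hcd (hcont p hpS) ?_, ih hTS, rectInt_const_mul,
        rectInt_inv (hS p hpS).1 (hS p hpS).2.1 (hS p hpS).2.2.1 (hS p hpS).2.2.2]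
      · ring
      · intro x y hx hy h
        exact tendsto_finsetSum _ fun ρ hρ => hcont ρ (hTS hρ) x y hx hy h
  have hfgP : rectInt f a b c d = rectInt (fun s => g s + P s) a b c d := by
    simp [hg]
  have cP : RectCont P a b c d := fun x y hx hy h => (hPd _ (hbd x y h)).continuousAt
  have cg : RectCont g a b c d := fun x y hx hy h => (hgd x y hx hy (hbd x y h)).continuousAt
  rw [hfgP, rectInt_add hab hcd cg cP, ← hGg, hG0, zero_add, hPsum S subset_rfl]

/-- An entire function of exponential growth in the critical strip, whose zeros near the critical
line are on the line and quantitatively simple. -/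
structure SimpleOnLine (X : ℂ → ℂ) (A C : ℝ) : Prop where
  diff : Differentiable ℂ X
  hA : 0 < A
  hC : 0 ≤ C
  upper : ∀ s : ℂ, 0 ≤ s.re → s.re ≤ 1 → ‖X s‖ ≤ A * Real.exp (C * |s.im|)
  lower : ∀ s : ℂ, 1 / 4 ≤ s.re → s.re ≤ 3 / 4 →
    |s.re - 1 / 2| ≤ A * Real.exp (C * |s.im|) * ‖X s‖

namespace SimpleOnLine

variable {X : ℂ → ℂ} {A C : ℝ}

lemma re_eq_half (h : SimpleOnLine X A C) {s : ℂ} (h1 : 1 / 4 ≤ s.re) (h2 : s.re ≤ 3 / 4)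
    (h0 : X s = 0) : s.re = 1 / 2 := by
  have := h.lower s h1 h2
  rw [h0, norm_zero, mul_zero] at this
  have := abs_nonpos_iff.1 this
  linarith

lemma one_le_deriv (h : SimpleOnLine X A C) {ρ : ℂ} (hρ : ρ.re = 1 / 2) (h0 : X ρ = 0) :
    1 ≤ A * Real.exp (C * |ρ.im|) * ‖deriv X ρ‖ := by
  have hd : HasDerivAt X (deriv X ρ) ρ := (h.diff ρ).hasDerivAt
  have hslope := hd.tendsto_slope
  have hmap : Tendsto (fun δ : ℝ => ρ + δ) (𝓝[>] 0) (𝓝[≠] ρ) := by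
    refine tendsto_nhdsWithin_iff.2 ⟨?_, ?_⟩
    · have : Tendsto (fun δ : ℝ => ρ + (δ : ℂ)) (𝓝 0) (𝓝 (ρ + ((0 : ℝ) : ℂ))) :=
        ContinuousAt.tendsto (f := fun δ : ℝ => ρ + (δ : ℂ)) (by fun_prop)
      simp only [ofReal_zero, add_zero] at this
      exact this.mono_left nhdsWithin_le_nhds
    · filter_upwards [self_mem_nhdsWithin] with δ hδ
      have : (δ : ℂ) ≠ 0 := ofReal_ne_zero.2 (ne_of_gt hδ)
      simpa using this
  have ht := ((hslope.comp hmap).norm).const_mul (A * Real.exp (C * |ρ.im|))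
  refine ge_of_tendsto ht ?_
  have : ∀ᶠ δ : ℝ in 𝓝[>] 0, δ < 1 / 4 :=
    (eventually_lt_nhds (by norm_num : (0 : ℝ) < 1 / 4)).filter_mono nhdsWithin_le_nhds
  filter_upwards [self_mem_nhdsWithin, this] with δ hδ hδ4
  have hδ0 : (0 : ℝ) < δ := hδ
  have hl := h.lower (ρ + δ) (by simp [hρ]; linarith) (by simp [hρ]; linarith)
  simp only [add_re, ofReal_re, add_im, ofReal_im, add_zero, hρ] at hl
  rw [show (1 / 2 : ℝ) + δ - 1 / 2 = δ by ring, abs_of_pos hδ0] at hl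
  simp only [Function.comp, slope, h0, vsub_eq_sub, sub_zero, add_sub_cancel_left, norm_smul,
    norm_inv, norm_real, Real.norm_eq_abs, abs_of_pos hδ0]
  rw [show A * Real.exp (C * |ρ.im|) * (δ⁻¹ * ‖X (ρ + δ)‖)
    = (A * Real.exp (C * |ρ.im|) * ‖X (ρ + δ)‖) / δ by field_simp, le_div_iff₀ hδ0]
  linarith

lemma separation (h : SimpleOnLine X A C) {γ γ' R : ℝ} (hR : |γ| ≤ R)
    (hne : γ ≠ γ') (h0 : X (1 / 2 + γ * I) = 0) (h0' : X (1 / 2 + γ' * I) = 0) :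
    1 ≤ (32 * A ^ 2 * Real.exp (C * (2 * R + 1)) + 8) * |γ - γ'| := by
  by_contra! hcon
  have hR0 : 0 ≤ R := (abs_nonneg _).trans hR
  have hA := h.hA
  have hC := h.hC
  have hpos : 0 < 32 * A ^ 2 * Real.exp (C * (2 * R + 1)) := by positivity
  have hd8 : |γ - γ'| < 1 / 8 := by nlinarith [abs_nonneg (γ - γ')]
  set ρ : ℂ := 1 / 2 + γ * I with hρ
  set ρ' : ℂ := 1 / 2 + γ' * I with hρ'
  have hre : ρ.re = 1 / 2 := by simp [hρ]
  have him : ρ.im = γ := by simp [hρ]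
  set K : ℝ := A * Real.exp (C * (R + 1)) with hK
  have hK0 : 0 < K := by positivity
  have hup : ∀ w : ℂ, ‖w - ρ‖ ≤ 1 / 2 → ‖X w‖ ≤ K := by
    intro w hw
    have h1 := (abs_re_le_norm (w - ρ)).trans hw
    have h2 := (abs_im_le_norm (w - ρ)).trans hw
    rw [sub_re, hre] at h1
    rw [sub_im, him] at h2
    have h1' := abs_le.1 h1
    refine (h.upper w (by linarith [h1'.1]) (by linarith [h1'.2])).trans ?_
    rw [hK]
    gcongr
    have := abs_add_le (w.im - γ) γ
    rw [sub_add_cancel] at this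
    linarith
  have hd1 : ∀ w : ℂ, ‖w - ρ‖ ≤ 1 / 4 → ‖deriv X w‖ ≤ K / (1 / 4) := by
    intro w hw
    refine Complex.norm_deriv_le_of_forall_mem_sphere_norm_le (by norm_num)
      h.diff.diffContOnCl fun z hz => hup z ?_
    rw [mem_sphere_iff_norm] at hz
    calc ‖z - ρ‖ = ‖(z - w) + (w - ρ)‖ := by ring_nf
      _ ≤ 1 / 2 := (norm_add_le _ _).trans (by linarith)
  have hXd : Differentiable ℂ (deriv X) := fun z =>
    ((h.diff.analyticAt z).deriv).differentiableAt
  have hd2 : ∀ w : ℂ, ‖w - ρ‖ ≤ 1 / 8 → ‖deriv (deriv X) w‖ ≤ K / (1 / 4) / (1 / 8) := by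
    intro w hw
    refine Complex.norm_deriv_le_of_forall_mem_sphere_norm_le (by norm_num)
      hXd.diffContOnCl fun z hz => hd1 z ?_
    rw [mem_sphere_iff_norm] at hz
    calc ‖z - ρ‖ = ‖(z - w) + (w - ρ)‖ := by ring_nf
      _ ≤ 1 / 4 := (norm_add_le _ _).trans (by linarith)
  have hdist : ‖ρ' - ρ‖ = |γ - γ'| := by
    rw [hρ, hρ', show (1 / 2 + γ' * I - (1 / 2 + γ * I) : ℂ) = ((γ' - γ : ℝ) : ℂ) * I by
      push_cast; ring, norm_mul, norm_I, mul_one, norm_real, Real.norm_eq_abs, abs_sub_comm]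
  set r := |γ - γ'| with hr
  have hr0 : 0 < r := abs_pos.2 (sub_ne_zero.2 hne)
  have hlip : ∀ w ∈ Metric.closedBall ρ r, ‖deriv X w - deriv X ρ‖ ≤ 32 * K * r := by
    intro w hw
    have := (convex_closedBall ρ r).norm_image_sub_le_of_norm_deriv_le
      (f := deriv X) (C := 32 * K) (fun z _ => hXd z) (fun z hz => ?_)
      (Metric.mem_closedBall_self hr0.le) hw
    · refine this.trans ?_
      rw [mem_closedBall_iff_norm] at hw
      gcongr
    · rw [mem_closedBall_iff_norm] at hz
      exact (hd2 z (by linarith)).trans (by linarith)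
  have hfin := (convex_closedBall ρ r).norm_image_sub_le_of_norm_deriv_le
      (f := fun w => X w - deriv X ρ * w) (C := 32 * K * r)
      (fun z _ => (h.diff z).sub (by fun_prop)) (fun z hz => ?_)
      (Metric.mem_closedBall_self hr0.le) (y := ρ') (by rw [mem_closedBall_iff_norm, hdist])
  · have e : X ρ' - deriv X ρ * ρ' - (X ρ - deriv X ρ * ρ) = -(deriv X ρ * (ρ' - ρ)) := by
      rw [h0, h0']; ring
    rw [e, norm_neg, norm_mul, hdist] at hfin
    have hle : ‖deriv X ρ‖ ≤ 32 * K * r := le_of_mul_le_mul_right hfin hr0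
    have h1 := h.one_le_deriv hre h0
    rw [him] at h1
    have : A * Real.exp (C * |γ|) * ‖deriv X ρ‖ ≤ A * Real.exp (C * R) * (32 * K * r) := by
      gcongr
    have e2 : A * Real.exp (C * R) * (32 * K * r)
        = 32 * A ^ 2 * Real.exp (C * (2 * R + 1)) * r := by
      rw [hK, show C * (2 * R + 1) = C * R + C * (R + 1) by ring, Real.exp_add]; ring
    rw [e2] at this
    nlinarith
  · have : deriv (fun w => X w - deriv X ρ * w) z = deriv X z - deriv X ρ := by
      rw [deriv_fun_sub (h.diff z) (by fun_prop), deriv_const_mul_field, deriv_id'', mul_one]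
    rw [this]
    exact hlip z hz

/-- Ordinates of zeros on the critical line. -/
def ords (X : ℂ → ℂ) : Set ℝ := {γ | X (1 / 2 + γ * I) = 0}

lemma card_le (h : SimpleOnLine X A C) {R : ℝ} (hR : 0 ≤ R) (F : Finset ℝ)
    (hF : ∀ γ ∈ F, γ ∈ ords X ∧ |γ| ≤ R) :
    (F.card : ℝ) ≤ 2 * R * (32 * A ^ 2 * Real.exp (C * (2 * R + 1)) + 8) + 3 := by
  set B := 32 * A ^ 2 * Real.exp (C * (2 * R + 1)) + 8 with hB
  have hB0 : 0 < B := by have := h.hA; positivity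
  have hinj : Set.InjOn (fun γ : ℝ => ⌊γ * B⌋) F := by
    intro γ hγ γ' hγ' he
    by_contra hne
    have hs := h.separation (hF γ hγ).2 hne (hF γ hγ).1 (hF γ' hγ').1
    rw [← hB] at hs
    have := Int.abs_sub_lt_one_of_floor_eq_floor he
    rw [← sub_mul, abs_mul, abs_of_pos hB0] at this
    linarith
  have hmaps : Set.MapsTo (fun γ : ℝ => ⌊γ * B⌋) F (Finset.Icc ⌊-R * B⌋ ⌊R * B⌋) := by
    intro γ hγ
    have := abs_le.1 (hF γ hγ).2
    simp only [Finset.coe_Icc, Set.mem_Icc]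
    exact ⟨Int.floor_le_floor (by nlinarith [this.1]), Int.floor_le_floor (by nlinarith [this.2])⟩
  have hc := Finset.card_le_card_of_injOn _ hmaps hinj
  rw [Int.card_Icc] at hc
  have h1 : ⌊-R * B⌋ ≤ ⌊R * B⌋ := Int.floor_le_floor (by nlinarith)
  have h2 : ((⌊R * B⌋ + 1 - ⌊-R * B⌋).toNat : ℝ) = (⌊R * B⌋ : ℝ) + 1 - ⌊-R * B⌋ := by
    have : (((⌊R * B⌋ + 1 - ⌊-R * B⌋).toNat : ℤ) : ℝ) = ((⌊R * B⌋ + 1 - ⌊-R * B⌋ : ℤ) : ℝ) := by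
      rw [Int.toNat_of_nonneg (by omega)]
    push_cast at this
    exact_mod_cast this
  have h3 : (F.card : ℝ) ≤ ((⌊R * B⌋ + 1 - ⌊-R * B⌋).toNat : ℝ) := by exact_mod_cast hc
  rw [h2] at h3
  have := Int.floor_le (R * B)
  have := Int.lt_floor_add_one (-R * B)
  linarith

end SimpleOnLine

lemma exists_gap (F : Finset ℝ) (a : ℝ) :
    ∃ T ∈ Set.Icc a (a + 1), ∀ γ ∈ F, 1 / (2 * ((F.card : ℝ) + 1)) < |γ - T| := by
  by_contra! hcon
  set r : ℝ := 1 / (2 * ((F.card : ℝ) + 1)) with hr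
  have hsub : Set.Icc a (a + 1) ⊆ ⋃ γ ∈ F, Metric.closedBall γ r := by
    intro T hT
    obtain ⟨γ, hγ, h⟩ := hcon T hT
    refine Set.mem_biUnion hγ ?_
    rw [Metric.mem_closedBall, Real.dist_eq, abs_sub_comm]
    exact h
  have h1 := (measure_mono (μ := volume) hsub).trans (measure_biUnion_finset_le F _)
  simp only [Real.volume_Icc, Real.volume_closedBall, add_sub_cancel_left, ENNReal.ofReal_one,
    Finset.sum_const, nsmul_eq_mul] at h1
  rw [← ENNReal.ofReal_natCast, ← ENNReal.ofReal_mul (by positivity), ENNReal.one_le_ofReal] at h1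
  rw [hr] at h1
  have : (F.card : ℝ) * (2 * (1 / (2 * ((F.card : ℝ) + 1)))) = F.card / (F.card + 1) := by
    field_simp
  rw [this, le_div_iff₀ (by positivity)] at h1
  linarith

namespace SimpleOnLine

variable {X : ℂ → ℂ} {A C : ℝ}

lemma one_le_horizontal (h : SimpleOnLine X A C) {T r : ℝ} (hr : 0 < r) (hr4 : r ≤ 1 / 4)
    (hT : ∀ γ ∈ ords X, r < |γ - T|) {σ : ℝ} (h1 : 1 / 4 ≤ σ) (h2 : σ ≤ 3 / 4) :
    1 ≤ 2 * A * Real.exp (C * (|T| + 1)) / r * ‖X (σ + T * I)‖ := by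
  have hA := h.hA
  have hC := h.hC
  rcases le_total r |σ - 1 / 2| with hσ | hσ
  · have hl := h.lower (σ + T * I) (by simpa using h1) (by simpa using h2)
    simp only [add_re, ofReal_re, mul_re, I_re, mul_zero, ofReal_im, I_im, mul_one, sub_self,
      add_zero, add_im, mul_im, zero_add] at hl
    have h3 : A * Real.exp (C * |T|) * ‖X (σ + T * I)‖ ≤
        2 * A * Real.exp (C * (|T| + 1)) * ‖X (σ + T * I)‖ := by
      gcongr
      · linarith
      · linarith
    rw [div_mul_eq_mul_div, le_div_iff₀ hr]
    linarith
  set s₀ : ℂ := 1 / 2 + T * I with hs₀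
  have hre : ∀ w ∈ Metric.closedBall s₀ r, |w.re - 1 / 2| ≤ r ∧ |w.im - T| ≤ r := by
    intro w hw
    rw [mem_closedBall_iff_norm] at hw
    have a1 := (abs_re_le_norm (w - s₀)).trans hw
    have a2 := (abs_im_le_norm (w - s₀)).trans hw
    simp [hs₀] at a1 a2
    exact ⟨by simpa using a1, a2⟩
  have hstrip : ∀ w ∈ Metric.closedBall s₀ r, 1 / 4 ≤ w.re ∧ w.re ≤ 3 / 4 := by
    intro w hw
    have := abs_le.1 (hre w hw).1
    constructor <;> linarith [this.1, this.2]
  have hne : ∀ w ∈ Metric.closedBall s₀ r, X w ≠ 0 := by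
    intro w hw h0
    have h3 := h.re_eq_half (hstrip w hw).1 (hstrip w hw).2 h0
    have h4 := hT w.im (by
      show X _ = 0
      rw [← h0, ← re_add_im w, h3]; simp)
    linarith [(hre w hw).2]
  have hr0 : (r : ℂ) ≠ 0 := by exact_mod_cast hr.ne'
  set f : ℂ → ℂ := fun w => (1 + (w - s₀) ^ 2 / (r : ℂ) ^ 2) / X w with hf
  have hfd : ∀ w ∈ Metric.closedBall s₀ r, DifferentiableAt ℂ f w := fun w hw =>
    DifferentiableAt.div (by fun_prop) (h.diff w) (hne w hw)
  have hbd : ∀ z ∈ frontier (Metric.ball s₀ r), ‖f z‖ ≤ 2 * A * Real.exp (C * (|T| + 1)) / r := by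
    intro z hz
    rw [frontier_ball _ hr.ne'] at hz
    have hzc := Metric.sphere_subset_closedBall hz
    rw [mem_sphere_iff_norm] at hz
    have hXz : 0 < ‖X z‖ := norm_pos_iff.2 (hne z hzc)
    have hnum : ‖1 + (z - s₀) ^ 2 / (r : ℂ) ^ 2‖ = 2 * |z.re - 1 / 2| / r := by
      have e1 : (r : ℂ) ^ 2 = (z - s₀) * (starRingEnd ℂ) (z - s₀) := by
        rw [mul_conj, normSq_eq_norm_sq, hz]; push_cast; ring
      have e2 : (1 + (z - s₀) ^ 2 / (r : ℂ) ^ 2) =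
          (z - s₀) * ((2 * (z.re - 1 / 2) : ℝ) : ℂ) / (r : ℂ) ^ 2 := by
        rw [eq_div_iff (pow_ne_zero 2 hr0), add_mul, one_mul, div_mul_cancel₀ _ (pow_ne_zero 2 hr0),
          e1, sq, ← mul_add, add_comm, add_conj]
        simp [hs₀]
      rw [e2, norm_div, norm_mul, hz, norm_pow, norm_real, norm_real, Real.norm_eq_abs,
        Real.norm_eq_abs, abs_mul, abs_of_pos hr, abs_two]
      field_simp
    rw [hf]
    simp only
    rw [norm_div, hnum, div_le_iff₀ hXz]
    have hl := h.lower z (hstrip z hzc).1 (hstrip z hzc).2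
    have him : |z.im| ≤ |T| + 1 := by
      have := abs_add_le (z.im - T) T
      rw [sub_add_cancel] at this
      linarith [(hre z hzc).2]
    have hl2 : |z.re - 1 / 2| ≤ A * Real.exp (C * (|T| + 1)) * ‖X z‖ := hl.trans (by gcongr)
    rw [div_mul_eq_mul_div]
    exact div_le_div_of_nonneg_right (by linarith) hr.le
  have hcl : closure (Metric.ball s₀ r) = Metric.closedBall s₀ r := closure_ball _ hr.ne'
  have hd : DiffContOnCl ℂ f (Metric.ball s₀ r) := by
    refine ⟨fun w hw => (hfd w (Metric.ball_subset_closedBall hw)).differentiableWithinAt, ?_⟩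
    rw [hcl]
    exact fun w hw => (hfd w hw).continuousAt.continuousWithinAt
  have hmem : (σ + T * I : ℂ) ∈ Metric.closedBall s₀ r := by
    rw [mem_closedBall_iff_norm, hs₀,
      show (σ + T * I - (1 / 2 + T * I) : ℂ) = ((σ - 1 / 2 : ℝ) : ℂ) by push_cast; ring,
      norm_real]
    exact hσ
  have hfin := Complex.norm_le_of_forall_mem_frontier_norm_le Metric.isBounded_ball hd hbd
    (z := σ + T * I) (by rw [hcl]; exact hmem)
  have hX0 : 0 < ‖X (σ + T * I)‖ := norm_pos_iff.2 (hne _ hmem)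
  rw [hf] at hfin
  simp only at hfin
  rw [norm_div, div_le_iff₀ hX0] at hfin
  refine le_trans ?_ hfin
  rw [hs₀, show (1 + (σ + T * I - (1 / 2 + T * I)) ^ 2 / (r : ℂ) ^ 2 : ℂ)
    = ((1 + (σ - 1 / 2) ^ 2 / r ^ 2 : ℝ) : ℂ) by push_cast; ring, norm_real, Real.norm_eq_abs]
  refine le_trans ?_ (le_abs_self _)
  have : 0 ≤ (σ - 1 / 2) ^ 2 / r ^ 2 := by positivity
  linarith

lemma finite_ords (h : SimpleOnLine X A C) (R : ℝ) : {γ ∈ ords X | |γ| ≤ R}.Finite := by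
  rcases lt_or_ge R 0 with hR | hR
  · convert Set.finite_empty
    ext γ
    simp only [Set.mem_ofPred_eq, Set.mem_empty_iff_false, iff_false, not_and, not_le]
    exact fun _ => hR.trans_le (abs_nonneg _)
  by_contra hinf
  obtain ⟨F, hF, hc⟩ := Set.Infinite.exists_subset_card_eq hinf
    (⌊2 * R * (32 * A ^ 2 * Real.exp (C * (2 * R + 1)) + 8) + 3⌋₊ + 1)
  have := h.card_le hR F fun γ hγ => hF hγ
  rw [hc] at this
  push_cast at this
  linarith [Nat.lt_floor_add_one (2 * R * (32 * A ^ 2 * Real.exp (C * (2 * R + 1)) + 8) + 3)]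

/-- Ordinates of absolute value at most `R`. -/
def ordsLE (h : SimpleOnLine X A C) (R : ℝ) : Finset ℝ := (h.finite_ords R).toFinset

lemma mem_ordsLE (h : SimpleOnLine X A C) {R γ : ℝ} :
    γ ∈ h.ordsLE R ↔ X (1 / 2 + γ * I) = 0 ∧ |γ| ≤ R := by
  simp [ordsLE, ords]

lemma card_ordsLE_le (h : SimpleOnLine X A C) (k : ℝ) (hk : 0 ≤ k) : ∃ K c : ℝ, 0 < K ∧ 0 < c ∧
    ∀ n : ℕ, ((h.ordsLE (n + k)).card : ℝ) ≤ K * Real.exp (c * n) := by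
  have hA := h.hA
  have hC := h.hC
  refine ⟨2 * (1 + k) * (32 * A ^ 2 * Real.exp (C * (2 * k + 1)) + 8) + 3, 2 * C + 1, by positivity,
    by positivity, fun n => ?_⟩
  refine (h.card_le (R := n + k) (by positivity) _ fun γ hγ => ?_).trans ?_
  · rw [mem_ordsLE] at hγ; exact hγ
  have e1 : (n : ℝ) + k ≤ (1 + k) * Real.exp n := by
    have := Real.add_one_le_exp (n : ℝ)
    nlinarith [Nat.cast_nonneg (α := ℝ) n]
  have e2 : (1 : ℝ) ≤ Real.exp (2 * C * n) := Real.one_le_exp (by positivity)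
  have e3 : (1 : ℝ) ≤ Real.exp ((2 * C + 1) * n) := Real.one_le_exp (by positivity)
  have e4 : 32 * A ^ 2 * Real.exp (C * (2 * (n + k) + 1)) + 8 ≤
      (32 * A ^ 2 * Real.exp (C * (2 * k + 1)) + 8) * Real.exp (2 * C * n) := by
    rw [show C * (2 * (n + k) + 1) = C * (2 * k + 1) + 2 * C * n by ring, Real.exp_add]
    nlinarith
  calc 2 * ((n : ℝ) + k) * (32 * A ^ 2 * Real.exp (C * (2 * (n + k) + 1)) + 8) + 3
      ≤ 2 * ((1 + k) * Real.exp n) * ((32 * A ^ 2 * Real.exp (C * (2 * k + 1)) + 8)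
          * Real.exp (2 * C * n)) + 3 * Real.exp ((2 * C + 1) * n) := by
        gcongr
        linarith
    _ = _ := by
        rw [show (2 * C + 1) * (n : ℝ) = n + 2 * C * n by ring, Real.exp_add]
        ring

end SimpleOnLine

lemma exists_recurrence (F : Finset ℝ) (c : ℝ → ℂ) {ε : ℝ} (hε : 0 < ε) (T : ℝ) :
    ∃ τ : ℝ, T ≤ τ ∧ ∀ t : ℝ,
      ‖∑ γ ∈ F, c γ * cexp (γ * (t + τ : ℝ) * I) - ∑ γ ∈ F, c γ * cexp (γ * t * I)‖ ≤ ε := by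
  set x : ℕ → F → ℂ := fun n γ => cexp ((γ.1 * n : ℝ) * I) with hx
  have hK : IsCompact (Set.pi Set.univ fun _ : F => Metric.sphere (0 : ℂ) 1) :=
    isCompact_univ_pi fun _ => isCompact_sphere _ _
  obtain ⟨a, -, φ, hφ, hlim⟩ := hK.tendsto_subseq (x := x) fun n γ _ => by
    rw [mem_sphere_zero_iff_norm, hx]; exact norm_exp_ofReal_mul_I _
  set S : ℝ := ∑ γ ∈ F, ‖c γ‖ with hS
  have hS0 : 0 ≤ S := Finset.sum_nonneg fun _ _ => norm_nonneg _
  have hδ : 0 < ε / (S + 1) := by positivity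
  obtain ⟨j, hj⟩ := Metric.cauchySeq_iff'.1 hlim.cauchySeq (ε / (S + 1)) hδ
  obtain ⟨k, hk⟩ := ((tendsto_natCast_atTop_atTop (R := ℝ)).comp hφ.tendsto_atTop).eventually_ge_atTop
    (φ j + T) |>.and (eventually_ge_atTop j) |>.exists
  simp only [Function.comp] at hk
  refine ⟨φ k - φ j, by linarith [hk.1], fun t => ?_⟩
  rw [← Finset.sum_sub_distrib]
  refine (norm_sum_le _ _).trans ?_
  have hb : ∀ γ ∈ F, ‖c γ * cexp (γ * (t + (φ k - φ j) : ℝ) * I) - c γ * cexp (γ * t * I)‖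
      ≤ ‖c γ‖ * (ε / (S + 1)) := by
    intro γ hγ
    have h1 : dist (x (φ k) ⟨γ, hγ⟩) (x (φ j) ⟨γ, hγ⟩) ≤ ε / (S + 1) :=
      (dist_le_pi_dist _ _ _).trans (hj k hk.2).le
    have e : c γ * cexp (γ * (t + (φ k - φ j) : ℝ) * I) - c γ * cexp (γ * t * I)
        = c γ * (cexp ((γ * (t - φ j) : ℝ) * I) * (x (φ k) ⟨γ, hγ⟩ - x (φ j) ⟨γ, hγ⟩)) := by
      rw [hx]
      simp only
      rw [mul_sub (cexp _), ← Complex.exp_add, ← Complex.exp_add, mul_sub]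
      congr 3 <;> · push_cast; ring
    rw [e, norm_mul, norm_mul, norm_exp_ofReal_mul_I, one_mul, ← dist_eq_norm]
    gcongr
  refine (Finset.sum_le_sum hb).trans ?_
  rw [← Finset.sum_mul, ← hS, mul_div_assoc', div_le_iff₀ (by positivity)]
  nlinarith

lemma exists_exp_quadratic_le (c : ℝ) {κ : ℝ} (hκ : 0 < κ) :
    ∃ M : ℝ, 0 < M ∧ ∀ x : ℝ, Real.exp (c * x) * Real.exp (-κ * x ^ 2) ≤ M * Real.exp (-x) := by
  refine ⟨Real.exp ((c + 1) ^ 2 / (4 * κ)), Real.exp_pos _, fun x => ?_⟩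
  rw [← Real.exp_add, ← Real.exp_add]
  refine Real.exp_le_exp.2 ?_
  have : (c + 1) ^ 2 / (4 * κ) + -x - (c * x + -κ * x ^ 2) = (2 * κ * x - (c + 1)) ^ 2 / (4 * κ) := by
    field_simp; ring
  have : 0 ≤ (2 * κ * x - (c + 1)) ^ 2 / (4 * κ) := by positivity
  linarith

namespace SimpleOnLine

variable {X : ℂ → ℂ} {A C : ℝ}

lemma exists_heights (h : SimpleOnLine X A C) : ∃ (T : ℕ → ℝ) (K c : ℝ), 0 < K ∧ 0 < c ∧
    (∀ n : ℕ, (n : ℝ) ≤ T n ∧ T n ≤ n + 1) ∧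
    ∀ (n : ℕ) (σ y : ℝ), 1 / 4 ≤ σ → σ ≤ 3 / 4 → (y = T n ∨ y = -T n) →
      1 ≤ K * Real.exp (c * n) * ‖X (σ + y * I)‖ := by
  obtain ⟨K, c, hK, hc, hcard⟩ := h.card_ordsLE_le 2 (by norm_num)
  have hA := h.hA
  have hC := h.hC
  set F : ℕ → Finset ℝ := fun n => h.ordsLE (n + 2) ∪ (h.ordsLE (n + 2)).image (fun x => -x) with hF
  choose T hT hgap using fun n : ℕ => exists_gap (F n) n
  have hFc : ∀ n, ((F n).card : ℝ) ≤ 2 * K * Real.exp (c * n) := by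
    intro n
    have h1 : (F n).card ≤ (h.ordsLE (n + 2)).card + (h.ordsLE (n + 2)).card :=
      (Finset.card_union_le _ _).trans (Nat.add_le_add_left Finset.card_image_le _)
    have h2 : ((F n).card : ℝ) ≤ (h.ordsLE (n + 2)).card + (h.ordsLE (n + 2)).card := by
      exact_mod_cast h1
    linarith [hcard n]
  refine ⟨T, 2 * A * Real.exp (C * 2) * (4 * K + 6), C + c, by positivity, by positivity,
    fun n => ⟨(hT n).1, (hT n).2⟩, fun n σ y h1 h2 hy => ?_⟩
  set r : ℝ := 1 / (2 * ((F n).card + 1) + 2) with hr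
  have hr0 : 0 < r := by positivity
  have hrle : r ≤ 1 / (2 * ((F n).card + 1)) := by
    rw [hr]; gcongr; linarith
  have hr4 : r ≤ 1 / 4 := by
    rw [hr]; gcongr
    have : (0 : ℝ) ≤ (F n).card := by positivity
    linarith
  have hn0 : (0 : ℝ) ≤ n := by positivity
  have hT0 : |T n| ≤ n + 1 := by rw [abs_of_nonneg (hn0.trans (hT n).1)]; exact (hT n).2
  have hyT : |y| ≤ n + 1 := by rcases hy with rfl | rfl; exacts [hT0, by rwa [abs_neg]]
  have hgap' : ∀ γ ∈ ords X, r < |γ - y| := by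
    intro γ hγ
    rcases le_or_gt |γ| (n + 2) with hle | hgt
    · have hm : γ ∈ h.ordsLE (n + 2) := h.mem_ordsLE.2 ⟨hγ, hle⟩
      rcases hy with rfl | rfl
      · exact hrle.trans_lt (hgap n γ (Finset.mem_union_left _ hm))
      · have := hgap n (-γ) (Finset.mem_union_right _ (Finset.mem_image_of_mem _ hm))
        refine hrle.trans_lt (this.trans_eq ?_)
        rw [← abs_neg]; ring_nf
    · have := abs_sub_abs_le_abs_sub γ y
      linarith
  have := h.one_le_horizontal hr0 hr4 hgap' h1 h2
  refine this.trans ?_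
  gcongr
  rw [hr, div_div_eq_mul_div, div_one]
  have e1 : Real.exp (C * (|y| + 1)) ≤ Real.exp (C * 2) * Real.exp (C * n) := by
    rw [← Real.exp_add, ← mul_add]
    exact Real.exp_le_exp.2 (mul_le_mul_of_nonneg_left (by linarith) hC)
  have e2 : 2 * ((F n).card + 1 : ℝ) + 2 ≤ (4 * K + 6) * Real.exp (c * n) := by
    have : (1 : ℝ) ≤ Real.exp (c * n) := Real.one_le_exp (by positivity)
    nlinarith [hFc n]
  calc 2 * A * Real.exp (C * (|y| + 1)) * (2 * ((F n).card + 1) + 2)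
      ≤ 2 * A * (Real.exp (C * 2) * Real.exp (C * n)) * ((4 * K + 6) * Real.exp (c * n)) := by
        gcongr
    _ = _ := by rw [add_mul C c, Real.exp_add]; ring

end SimpleOnLine

/-- Laplace-type integral of `g` along the vertical line of abscissa `σ`. -/
def vertInt (g : ℂ → ℂ) (σ t : ℝ) : ℂ := ∫ y : ℝ, cexp (t * (σ + y * I)) * g (σ + y * I)

namespace SimpleOnLine

variable {X P : ℂ → ℂ} {A B C κ : ℝ}

lemma norm_vert_le (h : SimpleOnLine X A C)
    (hPb : ∀ s : ℂ, 1 / 4 ≤ s.re → s.re ≤ 3 / 4 → ‖P s‖ ≤ B * Real.exp (-κ * s.im ^ 2))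
    {σ : ℝ} (h1 : 1 / 4 ≤ σ) (h2 : σ ≤ 3 / 4) (h3 : 1 / 4 ≤ |σ - 1 / 2|) (y : ℝ) :
    ‖P (σ + y * I) / X (σ + y * I)‖ ≤
      4 * A * B * (Real.exp (C * |y|) * Real.exp (-κ * |y| ^ 2)) := by
  have hA := h.hA
  have hl := h.lower (σ + y * I) (by simpa using h1) (by simpa using h2)
  have hp := hPb (σ + y * I) (by simpa using h1) (by simpa using h2)
  simp only [add_re, ofReal_re, mul_re, I_re, mul_zero, ofReal_im, I_im, mul_one, sub_self,
    add_zero, add_im, mul_im, zero_add] at hl hp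
  have hX : 0 < ‖X (σ + y * I)‖ := by
    by_contra hcon
    have : ‖X (σ + y * I)‖ = 0 := le_antisymm (not_lt.1 hcon) (norm_nonneg _)
    rw [this] at hl
    linarith
  have hB : 0 ≤ B * Real.exp (-κ * y ^ 2) := (norm_nonneg _).trans hp
  rw [norm_div, div_le_iff₀ hX, sq_abs]
  calc ‖P (σ + y * I)‖ ≤ B * Real.exp (-κ * y ^ 2) * 1 := by linarith
    _ ≤ B * Real.exp (-κ * y ^ 2) * (4 * (A * Real.exp (C * |y|) * ‖X (σ + y * I)‖)) := by
        gcongr; linarith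
    _ = _ := by ring

lemma integrable_exp_abs_mul (c : ℝ) {κ : ℝ} (hκ : 0 < κ) :
    Integrable fun y : ℝ => Real.exp (c * |y|) * Real.exp (-κ * |y| ^ 2) := by
  have h1 : ∀ a : ℝ, Integrable fun y : ℝ => Real.exp (a * y) * Real.exp (-κ * y ^ 2) := by
    intro a
    have := (integrable_cexp_quadratic (b := κ) (by simpa using hκ) a 0).norm
    refine this.congr (Eventually.of_forall fun y => ?_)
    simp only [← Real.exp_add, norm_exp]
    congr 1
    simp [← ofReal_pow]; ring
  refine ((h1 c).add (h1 (-c))).mono' (by fun_prop) (Eventually.of_forall fun y => ?_)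
  rw [Real.norm_eq_abs, abs_of_pos (by positivity), sq_abs]
  simp only [Pi.add_apply]
  rcases abs_cases y with ⟨e, -⟩ | ⟨e, -⟩ <;> rw [e]
  · have : 0 < Real.exp (-c * y) * Real.exp (-κ * y ^ 2) := by positivity
    linarith
  · have : 0 < Real.exp (c * y) * Real.exp (-κ * y ^ 2) := by positivity
    rw [show c * -y = -c * y by ring]
    linarith

lemma integrable_vert (h : SimpleOnLine X A C) (hκ : 0 < κ)
    (hPd : ∀ s : ℂ, 1 / 4 ≤ s.re → s.re ≤ 3 / 4 → DifferentiableAt ℂ P s)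
    (hPb : ∀ s : ℂ, 1 / 4 ≤ s.re → s.re ≤ 3 / 4 → ‖P s‖ ≤ B * Real.exp (-κ * s.im ^ 2))
    {σ : ℝ} (h1 : 1 / 4 ≤ σ) (h2 : σ ≤ 3 / 4) (h3 : 1 / 4 ≤ |σ - 1 / 2|) (t : ℝ) :
    Integrable fun y : ℝ => cexp (t * (σ + y * I)) * (P (σ + y * I) / X (σ + y * I)) := by
  have hinteg := ((integrable_exp_abs_mul C hκ).const_mul (4 * A * B)).const_mul (Real.exp (t * σ))
  have hcont : Continuous fun y : ℝ =>
      cexp (t * (σ + y * I)) * (P (σ + y * I) / X (σ + y * I)) := by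
    have hlin : Continuous fun y : ℝ => (σ + y * I : ℂ) := by fun_prop
    refine Continuous.mul (by fun_prop) (Continuous.div ?_ (h.diff.continuous.comp hlin) ?_)
    · refine continuous_iff_continuousAt.2 fun y => ?_
      exact ContinuousAt.comp (f := fun y : ℝ => (σ + y * I : ℂ)) (g := P)
        (hPd _ (by simpa using h1) (by simpa using h2)).continuousAt hlin.continuousAt
    · intro y h0
      have := h.re_eq_half (s := σ + y * I) (by simpa using h1) (by simpa using h2) h0
      simp at this
      rw [this] at h3
      norm_num at h3
  refine hinteg.mono' hcont.aestronglyMeasurable (Eventually.of_forall fun y => ?_)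
  rw [norm_mul, norm_exp]
  have e : (t * (σ + y * I) : ℂ).re = t * σ := by simp
  rw [e]
  gcongr
  exact h.norm_vert_le hPb h1 h2 h3 y

/-- The contribution of the zeros with ordinates in `F` to the difference of vertical integrals. -/
def zeroSum (X P : ℂ → ℂ) (F : Finset ℝ) (t : ℝ) : ℂ :=
  ∑ γ ∈ F, 2 * π * P (1 / 2 + γ * I) / deriv X (1 / 2 + γ * I) * cexp (γ * t * I)

lemma vert_sub_eq (h : SimpleOnLine X A C)
    (hPd : ∀ s : ℂ, 1 / 4 ≤ s.re → s.re ≤ 3 / 4 → DifferentiableAt ℂ P s)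
    {T : ℝ} (hT : 0 ≤ T) (hz : ∀ γ : ℝ, |γ| = T → X (1 / 2 + γ * I) ≠ 0) (t : ℝ) :
    let g : ℂ → ℂ := fun s => cexp (t * s) * (P s / X s)
    ((∫ y in -T..T, g ((3 / 4 : ℝ) + y * I)) - ∫ y in -T..T, g ((1 / 4 : ℝ) + y * I)) =
      cexp (t / 2) * zeroSum X P (h.ordsLE T) t +
      I * ((∫ x in (1 / 4 : ℝ)..(3 / 4 : ℝ), g (x + (-T : ℝ) * I)) -
        ∫ x in (1 / 4 : ℝ)..(3 / 4 : ℝ), g (x + T * I)) := by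
  intro g
  set S : Finset ℂ := (h.ordsLE T).image fun γ : ℝ => (1 / 2 + γ * I : ℂ) with hS
  have hmain := rectInt_eq_sum_residues (f := g) (a := 1 / 4) (b := 3 / 4) (c := -T) (d := T)
    (by norm_num) (by linarith) S ?_ (fun ρ => cexp (t * ρ) * (P ρ / deriv X ρ)) ?_ ?_
  · rw [hS, Finset.sum_image (by intro a _ b _ hab; simpa using hab)] at hmain
    have hs : (2 * π * I * ∑ γ ∈ h.ordsLE T, cexp (t * (1 / 2 + γ * I)) *
        (P (1 / 2 + γ * I) / deriv X (1 / 2 + γ * I)) : ℂ) =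
        I * (cexp (t / 2) * zeroSum X P (h.ordsLE T) t) := by
      rw [zeroSum, Finset.mul_sum, Finset.mul_sum, Finset.mul_sum]
      refine Finset.sum_congr rfl fun γ _ => ?_
      rw [show (t * (1 / 2 + γ * I) : ℂ) = t / 2 + γ * t * I by ring, Complex.exp_add]
      ring
    rw [hs, rectInt, smul_eq_mul, smul_eq_mul] at hmain
    linear_combination (-I) * hmain + ((∫ y in -T..T, g ((3 / 4 : ℝ) + y * I)) -
      (∫ y in -T..T, g ((1 / 4 : ℝ) + y * I)) - cexp (t / 2) * zeroSum X P (h.ordsLE T) t) * I_sq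
  · intro ρ hρ
    obtain ⟨γ, hγ, rfl⟩ := Finset.mem_image.1 hρ
    rw [mem_ordsLE] at hγ
    have hlt : |γ| < T := lt_of_le_of_ne hγ.2 fun e => hz γ e hγ.1
    have := abs_lt.1 hlt
    simp
    refine ⟨by norm_num, by norm_num, this⟩
  · intro x y hx hy hmem
    have hX : X (x + y * I) ≠ 0 := by
      intro h0
      have hre := h.re_eq_half (s := x + y * I) (by simpa using hx.1) (by simpa using hx.2) h0
      simp at hre
      refine hmem (Finset.mem_image.2 ⟨y, h.mem_ordsLE.2 ⟨?_, abs_le.2 hy⟩, ?_⟩)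
      · rw [← h0, hre]; simp
      · rw [hre]; simp
    exact DifferentiableAt.mul (by fun_prop)
      ((hPd _ (by simpa using hx.1) (by simpa using hx.2)).div (h.diff _) hX)
  · intro ρ hρ
    obtain ⟨γ, hγ, rfl⟩ := Finset.mem_image.1 hρ
    rw [mem_ordsLE] at hγ
    set ρ : ℂ := 1 / 2 + γ * I with hρ
    have hρre : ρ.re = 1 / 2 := by simp [hρ]
    have hd0 : deriv X ρ ≠ 0 := by
      intro h0
      have := h.one_le_deriv hρre hγ.1
      rw [h0, norm_zero, mul_zero] at this
      linarith
    have hslope := (h.diff ρ).hasDerivAt.tendsto_slope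
    have h2 : Tendsto (fun s => cexp (t * s) * P s) (𝓝[≠] ρ) (𝓝 (cexp (t * ρ) * P ρ)) := by
      have : ContinuousAt (fun s => cexp (t * s) * P s) ρ :=
        ContinuousAt.mul (by fun_prop) (hPd _ (by rw [hρre]; norm_num)
          (by rw [hρre]; norm_num)).continuousAt
      exact this.tendsto.mono_left nhdsWithin_le_nhds
    have h3 := h2.div hslope hd0
    rw [mul_div_assoc] at h3
    refine h3.congr' ?_
    filter_upwards [self_mem_nhdsWithin] with s hs
    have hs' : s - ρ ≠ 0 := sub_ne_zero.2 hs
    simp only [g, slope, hγ.1, vsub_eq_sub, sub_zero, smul_eq_mul, Pi.div_apply]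
    rw [div_eq_mul_inv, div_eq_mul_inv, mul_inv, inv_inv]
    ring

lemma exists_summable_zeroSum_bound (h : SimpleOnLine X A C) (hκ : 0 < κ)
    (hPb : ∀ s : ℂ, 1 / 4 ≤ s.re → s.re ≤ 3 / 4 → ‖P s‖ ≤ B * Real.exp (-κ * s.im ^ 2))
    {T : ℕ → ℝ} (hT : ∀ n : ℕ, (n : ℝ) ≤ T n ∧ T n ≤ n + 1) :
    ∃ b : ℕ → ℝ, Summable b ∧ ∀ n t,
      dist (zeroSum X P (h.ordsLE (T n)) t) (zeroSum X P (h.ordsLE (T (n + 1))) t) ≤ b n := by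
  obtain ⟨K, c, hK, hc, hcard⟩ := h.card_ordsLE_le 2 (by norm_num)
  obtain ⟨M, hM, hMb⟩ := exists_exp_quadratic_le (c + C) hκ
  have hA := h.hA
  have hC := h.hC
  have hB : 0 ≤ B := by
    have := (norm_nonneg _).trans (hPb (1 / 2) (by norm_num) (by norm_num))
    simpa using this
  refine ⟨fun n => K * (2 * π * B * A * Real.exp (C * 2)) * M * Real.exp (-n),
    Real.summable_exp_neg_nat.mul_left _, fun n t => ?_⟩
  have hsub : h.ordsLE (T n) ⊆ h.ordsLE (T (n + 1)) := by
    intro γ hγ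
    rw [mem_ordsLE] at hγ ⊢
    have h1 := (hT (n + 1)).1
    push_cast at h1
    exact ⟨hγ.1, hγ.2.trans ((hT n).2.trans h1)⟩
  rw [dist_comm, dist_eq_norm, zeroSum, zeroSum, ← Finset.sum_sdiff hsub, add_sub_cancel_right]
  have hterm : ∀ γ ∈ h.ordsLE (T (n + 1)) \ h.ordsLE (T n),
      ‖2 * π * P (1 / 2 + γ * I) / deriv X (1 / 2 + γ * I) * cexp (γ * t * I)‖ ≤
        2 * π * B * A * Real.exp (C * 2) * (Real.exp (C * n) * Real.exp (-κ * (n : ℝ) ^ 2)) := by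
    intro γ hγ
    rw [Finset.mem_sdiff, mem_ordsLE, mem_ordsLE] at hγ
    have hγT : T n < |γ| := by
      by_contra hcon
      exact hγ.2 ⟨hγ.1.1, not_lt.1 hcon⟩
    have hγ1 : (n : ℝ) ≤ |γ| := (hT n).1.trans hγT.le
    have hγ2 : |γ| ≤ n + 2 := by
      have := (hT (n + 1)).2
      push_cast at this
      linarith [hγ.1.2]
    have hd := h.one_le_deriv (ρ := 1 / 2 + γ * I) (by simp) hγ.1.1
    have hp := hPb (1 / 2 + γ * I) (by simp; norm_num) (by simp; norm_num)
    have him : (1 / 2 + γ * I : ℂ).im = γ := by simp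
    rw [him] at hd hp
    have hdpos : 0 < ‖deriv X (1 / 2 + γ * I)‖ := by
      by_contra hcon
      rw [le_antisymm (not_lt.1 hcon) (norm_nonneg _)] at hd
      linarith
    have he : ‖cexp (γ * t * I)‖ = 1 := by
      rw [← ofReal_mul]; exact norm_exp_ofReal_mul_I _
    rw [norm_mul, he, mul_one, norm_div, norm_mul, norm_mul, div_le_iff₀ hdpos, norm_real,
      Real.norm_eq_abs, abs_of_pos Real.pi_pos, Complex.norm_two]
    have hp2 : B * Real.exp (-κ * γ ^ 2) ≤ B * Real.exp (-κ * (n : ℝ) ^ 2) := by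
      rw [← sq_abs γ]
      have : (n : ℝ) ^ 2 ≤ |γ| ^ 2 := by gcongr
      gcongr B * Real.exp ?_
      nlinarith
    have hd2 : 1 ≤ A * Real.exp (C * (n + 2)) * ‖deriv X (1 / 2 + γ * I)‖ := hd.trans (by gcongr)
    calc 2 * π * ‖P (1 / 2 + γ * I)‖ ≤ 2 * π * (B * Real.exp (-κ * (n : ℝ) ^ 2)) * 1 := by
          rw [mul_one]; gcongr; exact hp.trans hp2
      _ ≤ 2 * π * (B * Real.exp (-κ * (n : ℝ) ^ 2)) *
          (A * Real.exp (C * (n + 2)) * ‖deriv X (1 / 2 + γ * I)‖) := by gcongr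
      _ = _ := by rw [show C * ((n : ℝ) + 2) = C * 2 + C * n by ring, Real.exp_add]; ring
  refine (norm_sum_le _ _).trans ((Finset.sum_le_card_nsmul _ _ _ hterm).trans ?_)
  rw [nsmul_eq_mul]
  have hc1 : ((h.ordsLE (T (n + 1)) \ h.ordsLE (T n)).card : ℝ) ≤ K * Real.exp (c * n) := by
    refine le_trans ?_ (hcard n)
    norm_cast
    refine Finset.card_le_card (Finset.sdiff_subset.trans fun γ hγ => ?_)
    rw [mem_ordsLE] at hγ ⊢
    have := (hT (n + 1)).2
    push_cast at this ⊢
    exact ⟨hγ.1, by linarith [hγ.2]⟩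
  have hmb := hMb n
  rw [add_mul, Real.exp_add] at hmb
  calc _ ≤ K * Real.exp (c * n) *
        (2 * π * B * A * Real.exp (C * 2) * (Real.exp (C * n) * Real.exp (-κ * (n : ℝ) ^ 2))) := by
        gcongr
    _ = K * (2 * π * B * A * Real.exp (C * 2)) *
        (Real.exp (c * n) * Real.exp (C * n) * Real.exp (-κ * (n : ℝ) ^ 2)) := by ring
    _ ≤ K * (2 * π * B * A * Real.exp (C * 2)) * (M * Real.exp (-n)) := by gcongr
    _ = _ := by ring

lemma horizontal_tendsto (hκ : 0 < κ)
    (hPb : ∀ s : ℂ, 1 / 4 ≤ s.re → s.re ≤ 3 / 4 → ‖P s‖ ≤ B * Real.exp (-κ * s.im ^ 2))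
    {T : ℕ → ℝ} {K c : ℝ} (hK : 0 < K)
    (hT : ∀ n : ℕ, (n : ℝ) ≤ T n ∧ T n ≤ n + 1) (hT' : ∀ (n : ℕ) (σ y : ℝ), 1 / 4 ≤ σ →
      σ ≤ 3 / 4 → (y = T n ∨ y = -T n) → 1 ≤ K * Real.exp (c * n) * ‖X (σ + y * I)‖)
    (t : ℝ) (y : ℕ → ℝ) (hy : ∀ n, y n = T n ∨ y n = -T n) :
    Tendsto (fun n => ∫ x in (1 / 4 : ℝ)..(3 / 4 : ℝ), cexp (t * (x + y n * I)) *
      (P (x + y n * I) / X (x + y n * I))) atTop (𝓝 0) := by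
  obtain ⟨M, hM, hMb⟩ := exists_exp_quadratic_le c hκ
  have hB : 0 ≤ B := by
    have := (norm_nonneg _).trans (hPb (1 / 2) (by norm_num) (by norm_num))
    simpa using this
  have hlim : Tendsto (fun n : ℕ => Real.exp |t| * (B * K) * (M * Real.exp (-(n : ℝ))))
      atTop (𝓝 0) := by
    have := ((Real.tendsto_exp_neg_atTop_nhds_zero.comp
      (tendsto_natCast_atTop_atTop (R := ℝ))).const_mul M).const_mul (Real.exp |t| * (B * K))
    simpa using this
  refine squeeze_zero_norm (fun n => ?_) hlim
  have := intervalIntegral.norm_integral_le_of_norm_le_const (a := (1 / 4 : ℝ)) (b := 3 / 4)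
    (C := Real.exp |t| * (B * K) * (M * Real.exp (-(n : ℝ))))
    (f := fun x : ℝ => cexp (t * (x + y n * I)) * (P (x + y n * I) / X (x + y n * I))) ?_
  · refine this.trans ?_
    have h0 : 0 ≤ Real.exp |t| * (B * K) * (M * Real.exp (-(n : ℝ))) := by positivity
    rw [show |(3 / 4 : ℝ) - 1 / 4| = 1 / 2 by norm_num [abs_of_pos]]
    linarith
  intro x hx
  rw [Set.uIoc_of_le (by norm_num)] at hx
  have hl := hT' n x (y n) hx.1.le hx.2 (hy n)
  have hp := hPb (x + y n * I) (by simpa using hx.1.le) (by simpa using hx.2)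
  have him : (x + y n * I : ℂ).im = y n := by simp
  rw [him] at hp
  have hX : 0 < ‖X (x + y n * I)‖ := by
    by_contra hcon
    rw [le_antisymm (not_lt.1 hcon) (norm_nonneg _)] at hl
    linarith
  have hyn : (n : ℝ) ^ 2 ≤ (y n) ^ 2 := by
    have h1 : (n : ℝ) ^ 2 ≤ T n ^ 2 := pow_le_pow_left₀ (by positivity) (hT n).1 2
    rcases hy n with e | e <;> rw [e] <;> nlinarith
  have hp2 : ‖P (x + y n * I)‖ ≤ B * Real.exp (-κ * (n : ℝ) ^ 2) := by
    refine hp.trans ?_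
    gcongr B * Real.exp ?_
    nlinarith
  rw [norm_mul, norm_exp, norm_div]
  have e1 : (t * (x + y n * I) : ℂ).re ≤ |t| := by
    simp only [mul_re, ofReal_re, add_re, I_re, mul_zero, ofReal_im, I_im, mul_one, sub_self,
      add_zero, zero_mul, sub_zero]
    have := le_abs_self t
    have := neg_abs_le t
    nlinarith [hx.1, hx.2]
  have e2 : ‖P (x + y n * I)‖ / ‖X (x + y n * I)‖ ≤ B * K * (M * Real.exp (-(n : ℝ))) := by
    rw [div_le_iff₀ hX]
    calc ‖P (x + y n * I)‖ ≤ B * Real.exp (-κ * (n : ℝ) ^ 2) * 1 := by linarith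
      _ ≤ B * Real.exp (-κ * (n : ℝ) ^ 2) * (K * Real.exp (c * n) * ‖X (x + y n * I)‖) := by gcongr
      _ = B * K * (Real.exp (c * n) * Real.exp (-κ * (n : ℝ) ^ 2)) * ‖X (x + y n * I)‖ := by ring
      _ ≤ B * K * (M * Real.exp (-n)) * ‖X (x + y n * I)‖ := by
        gcongr B * K * ?_ * _; exact hMb n
  calc _ ≤ Real.exp |t| * (B * K * (M * Real.exp (-(n : ℝ)))) := by gcongr
    _ = _ := by ring

/-- The difference of the two vertical integrals, normalised, is a recurrent function. -/
theorem recurrent (h : SimpleOnLine X A C) (hκ : 0 < κ)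
    (hPd : ∀ s : ℂ, 1 / 4 ≤ s.re → s.re ≤ 3 / 4 → DifferentiableAt ℂ P s)
    (hPb : ∀ s : ℂ, 1 / 4 ≤ s.re → s.re ≤ 3 / 4 → ‖P s‖ ≤ B * Real.exp (-κ * s.im ^ 2))
    {S : ℝ → ℂ} (hS : ∀ t : ℝ, S t = cexp (-(t / 2)) *
      (vertInt (fun s => P s / X s) (3 / 4) t - vertInt (fun s => P s / X s) (1 / 4) t))
    (t₀ T₀ : ℝ) {ε : ℝ} (hε : 0 < ε) : ∃ t, T₀ ≤ t ∧ ‖S t - S t₀‖ ≤ ε := by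
  obtain ⟨T, K, c, hK, hc, hT, hT'⟩ := h.exists_heights
  obtain ⟨b, hb, hbd⟩ := h.exists_summable_zeroSum_bound hκ hPb hT
  have hT0 : ∀ n, 0 ≤ T n := fun n => (Nat.cast_nonneg n).trans (hT n).1
  have hTtop : Tendsto T atTop atTop := tendsto_atTop_mono (fun n => (hT n).1)
    tendsto_natCast_atTop_atTop
  have hlim : ∀ t, Tendsto (fun n => zeroSum X P (h.ordsLE (T n)) t) atTop (𝓝 (S t)) := by
    intro t
    have hi : ∀ σ : ℝ, 1 / 4 ≤ σ → σ ≤ 3 / 4 → 1 / 4 ≤ |σ - 1 / 2| → Tendsto (fun n =>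
        ∫ y in -T n..T n, cexp (t * (σ + y * I)) * (P (σ + y * I) / X (σ + y * I)))
        atTop (𝓝 (vertInt (fun s => P s / X s) σ t)) := fun σ h1 h2 h3 =>
      intervalIntegral_tendsto_integral (h.integrable_vert hκ hPd hPb h1 h2 h3 t)
        (tendsto_neg_atTop_atBot.comp hTtop) hTtop
    have h1 := hi (3 / 4) (by norm_num) (by norm_num) (by norm_num [abs_of_pos])
    have h2 := hi (1 / 4) (by norm_num) (by norm_num) (by norm_num)
    have h3 := SimpleOnLine.horizontal_tendsto hκ hPb hK hT hT' t (fun n => -T n) fun n => Or.inr rfl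
    have h4 := SimpleOnLine.horizontal_tendsto hκ hPb hK hT hT' t T fun n => Or.inl rfl
    have h5 := ((h1.sub h2).sub ((h3.sub h4).const_mul I)).const_mul (cexp (-(t / 2)))
    rw [sub_zero, mul_zero, sub_zero, ← hS] at h5
    refine h5.congr fun n => ?_
    have := h.vert_sub_eq hPd (hT0 n) (fun γ hγ h0 => ?_) t
    · simp only at this
      rw [this, add_sub_cancel_right, ← mul_assoc, ← Complex.exp_add, neg_add_cancel,
        Complex.exp_zero, one_mul]
    · have := hT' n (1 / 2) γ (by norm_num) (by norm_num) (by
        rcases abs_cases γ with ⟨e, -⟩ | ⟨e, -⟩ <;> rw [e] at hγ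
        · exact Or.inl hγ
        · right; linarith)
      push_cast at this
      rw [h0, norm_zero, mul_zero] at this
      linarith
  have hdist : ∀ n t, dist (zeroSum X P (h.ordsLE (T n)) t) (S t) ≤ ∑' m, b (n + m) :=
    fun n t => dist_le_tsum_of_dist_le_of_tendsto b (fun n => hbd n t) hb (hlim t) n
  obtain ⟨n, hn⟩ := ((tendsto_sum_nat_add b).eventually_lt_const
    (show 0 < ε / 3 by positivity)).exists
  simp only [add_comm _ n] at hn
  obtain ⟨τ, hτ, hτs⟩ := exists_recurrence (h.ordsLE (T n))
    (fun γ => 2 * π * P (1 / 2 + γ * I) / deriv X (1 / 2 + γ * I))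
    (show 0 < ε / 3 by positivity) (T₀ - t₀)
  refine ⟨t₀ + τ, by linarith, ?_⟩
  have e1 := hdist n (t₀ + τ)
  have e2 := hdist n t₀
  have e3 : dist (zeroSum X P (h.ordsLE (T n)) (t₀ + τ)) (zeroSum X P (h.ordsLE (T n)) t₀) ≤ ε / 3 := by
    rw [dist_eq_norm]; exact hτs t₀
  rw [← dist_eq_norm]
  have := dist_triangle4 (S (t₀ + τ)) (zeroSum X P (h.ordsLE (T n)) (t₀ + τ))
    (zeroSum X P (h.ordsLE (T n)) t₀) (S t₀)
  rw [dist_comm (S (t₀ + τ)) (zeroSum _ _ _ _)] at this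
  linarith

end SimpleOnLine

lemma Complex.norm_Gamma_le_Gamma_re {s : ℂ} (hs : 0 < s.re) : ‖Gamma s‖ ≤ Real.Gamma s.re := by
  rw [Complex.Gamma_eq_integral hs, Real.Gamma_eq_integral hs, Complex.GammaIntegral]
  refine (norm_integral_le_integral_norm _).trans (le_of_eq ?_)
  refine setIntegral_congr_fun measurableSet_Ioi fun x hx => ?_
  have hx' : (0 : ℝ) < x := hx
  rw [norm_mul, norm_real, Real.norm_eq_abs, abs_of_pos (Real.exp_pos _),
    norm_cpow_eq_rpow_re_of_pos hx', sub_re, one_re]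

lemma Real.Gamma_le_one_of_mem {x : ℝ} (h1 : 1 ≤ x) (h2 : x ≤ 2) : Real.Gamma x ≤ 1 := by
  have := Real.convexOn_Gamma.le_max_of_mem_Icc (x := 1) (y := 2) (z := x) (by simp) (by simp)
    ⟨h1, h2⟩
  simpa using this

lemma Real.Gamma_le_two_of_mem {x : ℝ} (h1 : 1 / 2 ≤ x) (h2 : x ≤ 2) : Real.Gamma x ≤ 2 := by
  have := Real.convexOn_Gamma.le_max_of_mem_Icc (x := 1 / 2) (y := 2) (z := x) (by simp) (by simp)
    ⟨h1, h2⟩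
  rw [Real.Gamma_one_half_eq, Real.Gamma_two] at this
  refine this.trans (max_le ?_ one_le_two)
  rw [Real.sqrt_le_left two_pos.le]
  linarith [Real.pi_lt_four]

lemma Complex.norm_sin_le_exp (z : ℂ) : ‖sin z‖ ≤ Real.exp |z.im| := by
  rw [Complex.sin, norm_div, norm_mul, norm_I, mul_one, Complex.norm_two]
  have h := norm_sub_le (cexp (-z * I)) (cexp (z * I))
  rw [norm_exp, norm_exp] at h
  have e1 : (-z * I).re = z.im := by simp
  have e2 : (z * I).re = -z.im := by simp
  rw [e1, e2] at h
  have h1 : Real.exp z.im ≤ Real.exp |z.im| := Real.exp_le_exp.2 (le_abs_self _)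
  have h2 : Real.exp (-z.im) ≤ Real.exp |z.im| := Real.exp_le_exp.2 (neg_le_abs _)
  linarith

lemma one_le_Gamma_one_add_half {w : ℂ} (h1 : 1 / 2 ≤ w.re) (h2 : w.re ≤ 2)
    (h3 : 1 ≤ |w.im| ∨ w.re ≤ 3 / 4) :
    1 ≤ 3 * Real.exp (2 * |w.im|) * ‖Complex.Gamma (1 + w / 2)‖ := by
  have hw0 : w ≠ 0 := fun h => by rw [h] at h1; norm_num at h1
  have hre : (w / 2).re = w.re / 2 := by
    rw [show w / 2 = w / ((2 : ℝ) : ℂ) by simp, div_ofReal_re]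
  have him : (w / 2).im = w.im / 2 := by
    rw [show w / 2 = w / ((2 : ℝ) : ℂ) by simp, div_ofReal_im]
  have hv : 1 / 2 ≤ ‖1 - w / 2‖ := by
    rcases h3 with h | h
    · have := abs_im_le_norm (1 - w / 2)
      rw [sub_im, one_im, him, zero_sub, abs_neg, abs_div, abs_two] at this
      linarith
    · have := re_le_norm (1 - w / 2)
      rw [sub_re, one_re, hre] at this
      linarith
  have hv0 : 1 - w / 2 ≠ 0 := fun h => by rw [h, norm_zero] at hv; norm_num at hv
  have hg1 : Complex.Gamma (w / 2) ≠ 0 := Complex.Gamma_ne_zero_of_re_pos (by rw [hre]; linarith)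
  have hg2 : Complex.Gamma (2 - w / 2) ≠ 0 :=
    Complex.Gamma_ne_zero_of_re_pos (by rw [sub_re, hre, re_ofNat]; linarith)
  have hG2 : Complex.Gamma (2 - w / 2) = (1 - w / 2) * Complex.Gamma (1 - w / 2) := by
    rw [← Complex.Gamma_add_one _ hv0]; ring_nf
  have hG1 : Complex.Gamma (1 + w / 2) = w / 2 * Complex.Gamma (w / 2) := by
    rw [← Complex.Gamma_add_one _ (by simpa using hw0)]; ring_nf
  have hrefl := Complex.Gamma_mul_Gamma_one_sub (w / 2)
  have hsin : Complex.sin (π * (w / 2)) ≠ 0 := by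
    intro h0
    rw [h0, div_zero] at hrefl
    rcases mul_eq_zero.1 hrefl with h | h
    · exact hg1 h
    · rw [h, mul_zero] at hG2; exact hg2 hG2
  have key : Complex.Gamma (1 + w / 2) * Complex.Gamma (2 - w / 2) * Complex.sin (π * (w / 2)) =
      (w / 2) * (1 - w / 2) * π := by
    rw [hG1, hG2]
    rw [eq_div_iff hsin] at hrefl
    linear_combination (w / 2) * (1 - w / 2) * hrefl
  have hn := congrArg norm key
  simp only [norm_mul] at hn
  rw [norm_real, Real.norm_eq_abs, abs_of_pos Real.pi_pos] at hn
  have hb1 : ‖Complex.Gamma (2 - w / 2)‖ ≤ 1 := by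
    refine (Complex.norm_Gamma_le_Gamma_re ?_).trans (Real.Gamma_le_one_of_mem ?_ ?_) <;>
      rw [sub_re, hre, re_ofNat] <;> linarith
  have hb2 : ‖Complex.sin (π * (w / 2))‖ ≤ Real.exp (2 * |w.im|) := by
    refine (Complex.norm_sin_le_exp _).trans (Real.exp_le_exp.2 ?_)
    rw [im_ofReal_mul, him, abs_mul, abs_of_pos Real.pi_pos, abs_div, abs_two]
    nlinarith [Real.pi_lt_four, abs_nonneg w.im]
  have hb3 : 1 / 4 ≤ ‖w / 2‖ := by
    have := re_le_norm (w / 2)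
    rw [hre] at this
    linarith
  have hpi := Real.pi_gt_three
  have l1 : 1 / 4 * (1 / 2) * 3 ≤ ‖w / 2‖ * ‖1 - w / 2‖ * π := by gcongr
  have l2 : ‖Complex.Gamma (1 + w / 2)‖ * ‖Complex.Gamma (2 - w / 2)‖ *
      ‖Complex.sin (π * (w / 2))‖ ≤ ‖Complex.Gamma (1 + w / 2)‖ * 1 * Real.exp (2 * |w.im|) := by
    gcongr
  nlinarith

/-- The entire numerator `N(s)` in `1 / (s ζ_K(s)) = N(s) / (s² Ξ(s))`, with
`l = log D / 2 - log π`. -/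
def zetaNum (l : ℝ) (s : ℂ) : ℂ := 4 * (s - 1) * cexp (s * l) * Complex.Gamma (1 + s / 2) ^ 2

lemma norm_exp_mul_le (l : ℝ) {s : ℂ} (h : |s.re| ≤ 2) :
    ‖cexp (s * l)‖ ≤ Real.exp (2 * |l|) ∧ Real.exp (-(2 * |l|)) ≤ ‖cexp (s * l)‖ := by
  rw [norm_exp, re_mul_ofReal]
  have : |s.re * l| ≤ 2 * |l| := by rw [abs_mul]; gcongr
  have := abs_le.1 this
  exact ⟨Real.exp_le_exp.2 this.2, Real.exp_le_exp.2 this.1⟩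

lemma differentiableAt_zetaNum (l : ℝ) {s : ℂ} (hs : -2 < s.re) :
    DifferentiableAt ℂ (zetaNum l) s := by
  have hre : 0 < (1 + s / 2).re := by
    rw [add_re, one_re, show s / 2 = s / ((2 : ℝ) : ℂ) by simp, div_ofReal_re]; linarith
  have : DifferentiableAt ℂ Complex.Gamma (1 + s / 2) := by
    refine Complex.differentiableAt_Gamma _ fun m h => ?_
    rw [h] at hre
    simp at hre
    linarith [Nat.cast_nonneg (α := ℝ) m]
  have h2 : DifferentiableAt ℂ (fun s : ℂ => Complex.Gamma (1 + s / 2)) s :=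
    DifferentiableAt.comp (f := fun s : ℂ => 1 + s / 2) s this (by fun_prop)
  unfold zetaNum
  exact DifferentiableAt.mul (by fun_prop) (h2.pow 2)

lemma zetaNum_lower (l : ℝ) : ∃ K : ℝ, 0 < K ∧ ∀ w : ℂ, 1 / 2 ≤ w.re → w.re ≤ 2 →
    (1 ≤ |w.im| ∨ w.re ≤ 3 / 4) → 1 ≤ K * Real.exp (4 * |w.im|) * ‖zetaNum l w‖ := by
  refine ⟨9 * Real.exp (2 * |l|), by positivity, fun w h1 h2 h3 => ?_⟩
  have hG := one_le_Gamma_one_add_half h1 h2 h3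
  have hE := (norm_exp_mul_le l (s := w) (by rw [abs_le]; constructor <;> linarith)).2
  have hw : 1 / 4 ≤ ‖w - 1‖ := by
    rcases h3 with h | h
    · have := abs_im_le_norm (w - 1)
      rw [sub_im, one_im, sub_zero] at this
      linarith
    · have := abs_re_le_norm (w - 1)
      rw [sub_re, one_re] at this
      have := neg_le_abs (w.re - 1)
      linarith
  rw [zetaNum, norm_mul, norm_mul, norm_mul, norm_pow]
  have h4 : ‖(4 : ℂ)‖ = 4 := by simp
  rw [h4]
  have hG2 := mul_le_mul hG hG zero_le_one (by positivity)
  calc (1 : ℝ) ≤ (3 * Real.exp (2 * |w.im|) * ‖Complex.Gamma (1 + w / 2)‖) *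
        (3 * Real.exp (2 * |w.im|) * ‖Complex.Gamma (1 + w / 2)‖) := by linarith
    _ = 9 * Real.exp (2 * |l|) * Real.exp (4 * |w.im|) * (4 * (1 / 4) * Real.exp (-(2 * |l|)) *
        ‖Complex.Gamma (1 + w / 2)‖ ^ 2) := by
        rw [Real.exp_neg, show 4 * |w.im| = 2 * |w.im| + 2 * |w.im| by ring, Real.exp_add]
        have := Real.exp_pos (2 * |l|)
        field_simp
        ring
    _ ≤ _ := by gcongr

lemma norm_le_exp {s : ℂ} (h : |s.re| ≤ 2) : ‖s‖ ≤ 2 * Real.exp |s.im| := by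
  have := norm_le_abs_re_add_abs_im s
  have := Real.add_one_le_exp |s.im|
  have := abs_nonneg s.im
  linarith

lemma zetaNum_upper (l : ℝ) : ∃ K : ℝ, 0 < K ∧ ∀ s : ℂ, -1 ≤ s.re → s.re ≤ 1 →
    ‖zetaNum l s‖ ≤ K * Real.exp |s.im| := by
  refine ⟨4 * 2 * Real.exp (2 * |l|) * 2 ^ 2, by positivity, fun s h1 h2 => ?_⟩
  have hE := (norm_exp_mul_le l (s := s) (by rw [abs_le]; constructor <;> linarith)).1
  have hre : (1 + s / 2).re = 1 + s.re / 2 := by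
    rw [add_re, one_re, show s / 2 = s / ((2 : ℝ) : ℂ) by simp, div_ofReal_re]
  have hG : ‖Complex.Gamma (1 + s / 2)‖ ≤ 2 := by
    refine (Complex.norm_Gamma_le_Gamma_re ?_).trans (Real.Gamma_le_two_of_mem ?_ ?_) <;>
      rw [hre] <;> linarith
  have hs := norm_le_exp (s := s - 1) (by
    rw [sub_re, one_re, abs_le]; constructor <;> linarith)
  rw [sub_im, one_im, sub_zero] at hs
  rw [zetaNum, norm_mul, norm_mul, norm_mul, norm_pow]
  have h4 : ‖(4 : ℂ)‖ = 4 := by simp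
  rw [h4]
  calc 4 * ‖s - 1‖ * ‖cexp (s * l)‖ * ‖Complex.Gamma (1 + s / 2)‖ ^ 2
      ≤ 4 * (2 * Real.exp |s.im|) * Real.exp (2 * |l|) * 2 ^ 2 := by gcongr
    _ = _ := by ring

/-- Summatory function of an arithmetic function. -/
def summatory (a : ℕ → ℤ) (x : ℝ) : ℝ := ∑ k ∈ Finset.Icc 1 ⌊x⌋₊, (a k : ℝ)

lemma summatory_of_lt_one (a : ℕ → ℤ) {x : ℝ} (hx : x < 1) : summatory a x = 0 := by
  rw [summatory, Nat.floor_eq_zero.2 hx]; simp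

lemma measurable_summatory (a : ℕ → ℤ) : Measurable (summatory a) :=
  (measurable_of_countable fun n : ℕ => ∑ k ∈ Finset.Icc 1 n, (a k : ℝ)).comp Nat.measurable_floor

/-- The Mertens-type bound with constant one, asymptotically. -/
def MertensBound (a : ℕ → ℤ) : Prop :=
  ∀ δ : ℝ, 0 < δ → ∀ᶠ x in atTop, |summatory a x| ≤ (1 + δ) * √x

lemma MertensBound.exists_bound {a : ℕ → ℤ} (h : MertensBound a) :
    ∃ C : ℝ, 0 < C ∧ ∀ x, |summatory a x| ≤ C * √x := by
  obtain ⟨x₀, hx₀⟩ := eventually_atTop.1 (h 1 one_pos)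
  set B : ℝ := ∑ k ∈ Finset.Icc 1 ⌊x₀⌋₊, |(a k : ℝ)| with hB
  have hB0 : 0 ≤ B := Finset.sum_nonneg fun _ _ => abs_nonneg _
  refine ⟨B + 2, by positivity, fun x => ?_⟩
  rcases lt_or_ge x 1 with h1 | h1
  · rw [summatory_of_lt_one a h1, abs_zero]; positivity
  have hs : 1 ≤ √x := Real.one_le_sqrt.2 h1
  rcases le_total x₀ x with h2 | h2
  · have := hx₀ x h2
    nlinarith
  · have : |summatory a x| ≤ B := (Finset.abs_sum_le_sum_abs _ _).trans
      (Finset.sum_le_sum_of_subset_of_nonneg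
        (Finset.Icc_subset_Icc_right (Nat.floor_le_floor h2)) fun _ _ _ => abs_nonneg _)
    nlinarith

/-- The function `∫₁^∞ M(x) x^{-s-1} dx`, as a Mellin transform. -/
def mertensMellin (a : ℕ → ℤ) (s : ℂ) : ℂ := mellin (fun x => (summatory a x⁻¹ : ℂ)) s

section

variable {a : ℕ → ℤ} {C : ℝ}

lemma norm_summatory_inv_le (hC : ∀ x, |summatory a x| ≤ C * √x) {x : ℝ} (hx : 0 < x) :
    ‖(summatory a x⁻¹ : ℂ)‖ ≤ C * x ^ (-(1 / 2) : ℝ) := by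
  rw [norm_real, Real.norm_eq_abs]
  refine (hC _).trans_eq ?_
  rw [Real.sqrt_eq_rpow, Real.inv_rpow hx.le, Real.rpow_neg hx.le]

lemma differentiableAt_mertensMellin (hC : ∀ x, |summatory a x| ≤ C * √x) {s : ℂ}
    (hs : 1 / 2 < s.re) : DifferentiableAt ℂ (mertensMellin a) s := by
  refine mellin_differentiableAt_of_isBigO_rpow (a := s.re + 1) (b := 1 / 2) ?_ ?_ (by linarith)
    ?_ hs
  · have hc : ContinuousOn (fun x : ℝ => C * x ^ (-(1 / 2) : ℝ)) (Set.Ioi 0) :=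
      continuousOn_const.mul (ContinuousOn.rpow_const continuousOn_id fun x hx => Or.inl (ne_of_gt hx))
    refine (locallyIntegrableOn_iff isOpen_Ioi.isLocallyClosed).2 fun k hk hkc => ?_
    have hmeas : AEStronglyMeasurable (fun x : ℝ => (summatory a x⁻¹ : ℂ)) volume :=
      (measurable_ofReal.comp ((measurable_summatory a).comp measurable_inv)).aestronglyMeasurable
    refine ((hc.mono hk).integrableOn_compact hkc).mono' hmeas.restrict ?_
    exact (ae_restrict_iff' hkc.measurableSet).2
      (Eventually.of_forall fun y hy => norm_summatory_inv_le hC (hk hy))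
  · refine Asymptotics.IsBigO.of_bound 0 ?_
    filter_upwards [eventually_gt_atTop 1] with x hx
    rw [summatory_of_lt_one a (inv_lt_one_of_one_lt₀ hx)]
    simp
  · refine Asymptotics.IsBigO.of_bound C ?_
    filter_upwards [self_mem_nhdsWithin] with x hx
    refine (norm_summatory_inv_le hC hx).trans_eq ?_
    rw [Real.norm_eq_abs, abs_of_pos (Real.rpow_pos_of_pos hx _)]

lemma norm_mertensMellin_le (hC : ∀ x, |summatory a x| ≤ C * √x) {s : ℂ}
    (hs : 1 / 2 < s.re) : ‖mertensMellin a s‖ ≤ C / (s.re - 1 / 2) := by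
  have hsub : mertensMellin a s = ∫ x in Set.Ioc (0 : ℝ) 1, (x : ℂ) ^ (s - 1) •
      (summatory a x⁻¹ : ℂ) := by
    rw [mertensMellin, mellin]
    refine setIntegral_eq_of_subset_of_forall_sdiff_eq_zero measurableSet_Ioi
      Set.Ioc_subset_Ioi_self fun x hx => ?_
    have hx1 : 1 < x := by
      by_contra hcon
      exact hx.2 ⟨hx.1, not_lt.1 hcon⟩
    rw [summatory_of_lt_one a (inv_lt_one_of_one_lt₀ hx1)]
    simp
  have hi : IntervalIntegrable (fun x : ℝ => C * x ^ (s.re - 3 / 2)) volume 0 1 :=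
    (intervalIntegral.intervalIntegrable_rpow' (by linarith)).const_mul C
  have h0 : ∫ x in Set.Ioc (0 : ℝ) 1, C * x ^ (s.re - 3 / 2) = C / (s.re - 1 / 2) := by
    rw [← intervalIntegral.integral_of_le zero_le_one, intervalIntegral.integral_const_mul,
      integral_rpow (Or.inl (by linarith)), Real.one_rpow, Real.zero_rpow (by linarith)]
    rw [show s.re - 3 / 2 + 1 = s.re - 1 / 2 by ring]
    ring
  rw [hsub, ← h0]
  refine norm_integral_le_of_norm_le
    ((intervalIntegrable_iff_integrableOn_Ioc_of_le zero_le_one).1 hi) ?_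
  refine (ae_restrict_iff' measurableSet_Ioc).2 (Eventually.of_forall fun x hx => ?_)
  rw [norm_smul, norm_cpow_eq_rpow_re_of_pos hx.1]
  have h1 := norm_summatory_inv_le hC hx.1
  have h2 : 0 ≤ x ^ (s - 1).re := Real.rpow_nonneg hx.1.le _
  calc _ ≤ x ^ (s - 1).re * (C * x ^ (-(1 / 2) : ℝ)) := by gcongr
    _ = C * (x ^ (s - 1).re * x ^ (-(1 / 2) : ℝ)) := by ring
    _ = C * x ^ (s.re - 3 / 2) := by
      rw [← Real.rpow_add hx.1, sub_re, one_re]; ring_nf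

lemma LSeries_eq_mul_mertensMellin (hC : ∀ x, |summatory a x| ≤ C * √x) {s : ℂ}
    (hs : 1 / 2 < s.re) (hsum : LSeriesSummable (fun n => (a n : ℂ)) s) :
    LSeries (fun n => (a n : ℂ)) s = s * mertensMellin a s := by
  rw [LSeries_eq_mul_integral (fun n => (a n : ℂ)) (r := 1 / 2) (by norm_num) hs hsum]
  · congr 1
    have : (fun x : ℝ => (summatory a x⁻¹ : ℂ)) =
        fun x : ℝ => (fun y : ℝ => (summatory a y : ℂ)) x⁻¹ := rfl
    rw [mertensMellin, this, mellin_comp_inv (fun y : ℝ => (summatory a y : ℂ)), mellin,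
      ← integral_Ici_eq_integral_Ioi]
    symm
    refine (setIntegral_eq_of_subset_of_forall_sdiff_eq_zero measurableSet_Ioi
      (Set.Ici_subset_Ioi.2 one_pos) fun x hx => ?_).trans ?_
    · rw [summatory_of_lt_one a (not_le.1 hx.2)]
      simp
    · refine setIntegral_congr_fun measurableSet_Ici fun x _ => ?_
      simp only [summatory, smul_eq_mul]
      push_cast
      rw [mul_comm, neg_add', sub_eq_add_neg]
  · refine Asymptotics.IsBigO.of_bound C (Eventually.of_forall fun n => ?_)
    have := hC n
    rw [summatory, Nat.floor_natCast, Real.sqrt_eq_rpow] at this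
    rw [Real.norm_eq_abs, abs_of_nonneg (Real.rpow_nonneg (Nat.cast_nonneg n) _)]
    refine le_trans (le_of_eq ?_) this
    rw [← Real.norm_eq_abs, ← norm_real]
    push_cast
    rfl

end

/-- A completed zeta function `Ξ` together with its inverse Dirichlet series. -/
structure ZetaData (l ρ : ℝ) (Ξ : ℂ → ℂ) (a : ℕ → ℤ) : Prop where
  diff : Differentiable ℂ Ξ
  symm : ∀ s, Ξ (1 - s) = Ξ s
  map_zero : Ξ 0 = ρ
  pos : 0 < ρ
  growth : ∃ A C : ℝ, 0 < A ∧ 0 ≤ C ∧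
    ∀ s : ℂ, 0 ≤ s.re → s.re ≤ 1 → ‖Ξ s‖ ≤ A * Real.exp (C * |s.im|)
  summable : ∀ s : ℂ, 1 < s.re → LSeriesSummable (fun n => (a n : ℂ)) s
  eq_gamma : ∀ s : ℂ, 1 < s.re → Ξ s * LSeries (fun n => (a n : ℂ)) s =
    s * (s - 1) * cexp (s * l) * Gamma (s / 2) ^ 2
  norm_two : ∀ s : ℂ, s.re = 2 → ‖LSeries (fun n => (a n : ℂ)) s‖ ≤ (π ^ 2 / 6) ^ 2

namespace ZetaData

variable {l ρ : ℝ} {Ξ : ℂ → ℂ} {a : ℕ → ℤ} {C : ℝ}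

lemma map_one (h : ZetaData l ρ Ξ a) : Ξ 1 = ρ := by
  rw [← h.symm, sub_self, h.map_zero]

lemma zetaNum_eq_mul_Gamma {s : ℂ} (hs : s ≠ 0) :
    zetaNum l s = s * (s * (s - 1) * cexp (s * l) * Gamma (s / 2) ^ 2) := by
  have h2 : s / 2 ≠ 0 := div_ne_zero hs two_ne_zero
  rw [zetaNum, add_comm 1 (s / 2), Gamma_add_one _ h2]
  ring

lemma zetaNum_eq (h : ZetaData l ρ Ξ a) (hC : ∀ x, |summatory a x| ≤ C * √x) {s : ℂ}
    (hs : 1 / 2 < s.re) : zetaNum l s = s ^ 2 * Ξ s * mertensMellin a s := by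
  have hopen : IsOpen {z : ℂ | 1 / 2 < z.re} := isOpen_lt continuous_const continuous_re
  have h1 : AnalyticOnNhd ℂ (zetaNum l) {z : ℂ | 1 / 2 < z.re} := by
    refine DifferentiableOn.analyticOnNhd (fun z hz => ?_) hopen
    refine (differentiableAt_zetaNum l ?_).differentiableWithinAt
    have : 1 / 2 < z.re := hz
    linarith
  have h2 : AnalyticOnNhd ℂ (fun s => s ^ 2 * Ξ s * mertensMellin a s) {z : ℂ | 1 / 2 < z.re} := by
    refine DifferentiableOn.analyticOnNhd (fun z hz => ?_) hopen
    exact (((differentiableAt_id.pow 2).mul (h.diff z)).mul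
      (differentiableAt_mertensMellin hC hz)).differentiableWithinAt
  refine h1.eqOn_of_preconnected_of_eventuallyEq h2 (convex_halfSpace_re_gt _).isPreconnected
    (z₀ := 2) (by simp; norm_num) ?_ hs
  have : {z : ℂ | 1 < z.re} ∈ 𝓝 (2 : ℂ) :=
    (isOpen_lt continuous_const continuous_re).mem_nhds (by simp)
  filter_upwards [this] with z hz
  have hz : 1 < z.re := hz
  have hz0 : z ≠ 0 := by rintro rfl; norm_num at hz
  rw [zetaNum_eq_mul_Gamma hz0, ← h.eq_gamma z hz,
    LSeries_eq_mul_mertensMellin hC (by linarith) (h.summable z hz)]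
  ring

lemma exists_lower (h : ZetaData l ρ Ξ a) (hC : ∀ x, |summatory a x| ≤ C * √x) (hC0 : 0 < C) :
    ∃ K > 0, ∀ s : ℂ, -1 ≤ s.re → s.re ≤ 2 → (1 ≤ |s.im| ∨ (1 / 4 ≤ s.re ∧ s.re ≤ 3 / 4)) →
      |s.re - 1 / 2| ≤ K * Real.exp (6 * |s.im|) * ‖Ξ s‖ := by
  obtain ⟨K, hK, hKl⟩ := zetaNum_lower l
  have key : ∀ s : ℂ, 1 / 2 < s.re → s.re ≤ 2 → (1 ≤ |s.im| ∨ s.re ≤ 3 / 4) →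
      s.re - 1 / 2 ≤ (4 * K * C) * Real.exp (6 * |s.im|) * ‖Ξ s‖ := by
    intro s h1 h2 h3
    have hl := hKl s h1.le h2 h3
    rw [h.zetaNum_eq hC h1, norm_mul, norm_mul, norm_pow] at hl
    have hF := norm_mertensMellin_le hC h1
    have hs := norm_le_exp (s := s) (abs_le.2 ⟨by linarith, h2⟩)
    have hd : 0 < s.re - 1 / 2 := by linarith
    have h5 : 1 ≤ K * Real.exp (4 * |s.im|) * ((2 * Real.exp |s.im|) ^ 2 * ‖Ξ s‖ *
        (C / (s.re - 1 / 2))) := hl.trans (by gcongr)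
    have h6 : Real.exp (6 * |s.im|) = Real.exp (4 * |s.im|) * Real.exp |s.im| ^ 2 := by
      rw [← Real.exp_nat_mul, ← Real.exp_add]; push_cast; ring_nf
    have h7 : K * Real.exp (4 * |s.im|) * ((2 * Real.exp |s.im|) ^ 2 * ‖Ξ s‖ *
        (C / (s.re - 1 / 2))) = ((4 * K * C) * Real.exp (6 * |s.im|) * ‖Ξ s‖) / (s.re - 1 / 2) := by
      rw [h6]; field_simp; ring
    rw [h7, le_div_iff₀ hd, one_mul] at h5
    exact h5
  refine ⟨4 * K * C, by positivity, fun s h1 h2 h3 => ?_⟩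
  rcases lt_trichotomy s.re (1 / 2) with h4 | h4 | h4
  · have := key (1 - s) (by simp; linarith) (by simp; linarith)
      (by simpa using h3.imp id fun h => by linarith [h.1])
    rw [h.symm] at this
    rw [abs_of_neg (by linarith)]
    simp only [sub_re, one_re, sub_im, one_im, zero_sub, abs_neg] at this
    linarith
  · rw [h4, sub_self, abs_zero]; positivity
  · rw [abs_of_pos (by linarith)]
    exact key s h4 h2 (h3.imp id fun h => h.2)

lemma zetaNum_ne_zero {s : ℂ} (hs : -2 < s.re) (h1 : s ≠ 1) : zetaNum l s ≠ 0 := by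
  rw [zetaNum]
  refine mul_ne_zero (mul_ne_zero (mul_ne_zero (by norm_num) (sub_ne_zero.2 h1)) (exp_ne_zero _))
    (pow_ne_zero 2 (Gamma_ne_zero_of_re_pos ?_))
  simp
  linarith

lemma ne_zero (h : ZetaData l ρ Ξ a) (hC : ∀ x, |summatory a x| ≤ C * √x) {s : ℂ}
    (hs : s.re ≠ 1 / 2) : Ξ s ≠ 0 := by
  have key : ∀ s : ℂ, 1 / 2 < s.re → Ξ s ≠ 0 := by
    intro s hs h0
    by_cases h1 : s = 1
    · rw [h1, h.map_one] at h0
      exact h.pos.ne' (by exact_mod_cast h0)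
    · refine zetaNum_ne_zero (l := l) (by linarith) h1 ?_
      rw [h.zetaNum_eq hC hs, h0]; simp
  rcases lt_or_gt_of_ne hs with h1 | h1
  · rw [← h.symm]
    exact key _ (by simp; linarith)
  · exact key _ h1

lemma simpleOnLine (h : ZetaData l ρ Ξ a) (hC : ∀ x, |summatory a x| ≤ C * √x) (hC0 : 0 < C) :
    ∃ A B : ℝ, SimpleOnLine Ξ A B := by
  obtain ⟨A, B, hA, hB, hAB⟩ := h.growth
  obtain ⟨K, hK, hKl⟩ := h.exists_lower hC hC0
  refine ⟨max A K, max B 6, h.diff, lt_max_of_lt_left hA, le_max_of_le_left hB, ?_, ?_⟩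
  · intro s h0 h1
    refine (hAB s h0 h1).trans ?_
    gcongr
    · exact le_max_left _ _
    · exact le_max_left _ _
  · intro s h0 h1
    refine (hKl s (by linarith) (by linarith) (Or.inr ⟨h0, h1⟩)).trans ?_
    gcongr
    · exact le_max_right _ _
    · exact le_max_right _ _

end ZetaData

/-- `M(e^u) e^{-3u/4}`, whose Fourier transform is the Mellin transform on the line `Re s = 3/4`. -/
def mertensWave (a : ℕ → ℤ) (u : ℝ) : ℝ := summatory a (Real.exp u) * Real.exp (-(3 / 4) * u)

/-- Gaussian average of `mertensWave`. -/
def mertensSmooth (a : ℕ → ℤ) (κ t : ℝ) : ℝ :=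
  ∫ u : ℝ, √(π / κ) * Real.exp (-(t - u) ^ 2 / (4 * κ)) * mertensWave a u

lemma measurable_mertensWave (a : ℕ → ℤ) : Measurable (mertensWave a) :=
  ((measurable_summatory a).comp Real.measurable_exp).mul
    (Real.measurable_exp.comp (measurable_id.const_mul _))

lemma mertensWave_of_neg (a : ℕ → ℤ) {u : ℝ} (hu : u < 0) : mertensWave a u = 0 := by
  rw [mertensWave, summatory_of_lt_one a (by simpa using hu), zero_mul]

lemma sqrt_exp_mul (u : ℝ) : √(Real.exp u) * Real.exp (-(3 / 4) * u) = Real.exp (-(1 / 4) * u) := by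
  rw [Real.sqrt_eq_rpow, ← Real.exp_mul, ← Real.exp_add]; ring_nf

section

variable {a : ℕ → ℤ} {C : ℝ}

lemma abs_mertensWave_le (hC : ∀ x, |summatory a x| ≤ C * √x) (u : ℝ) :
    |mertensWave a u| ≤ C * Real.exp (-(1 / 4) * u) := by
  rw [mertensWave, abs_mul, abs_of_pos (Real.exp_pos (-(3 / 4) * u)), ← sqrt_exp_mul, ← mul_assoc]
  gcongr
  exact hC _

lemma integrable_mertensWave (hC : ∀ x, |summatory a x| ≤ C * √x) :
    Integrable (mertensWave a) := by
  have hI : IntegrableOn (fun u : ℝ => C * Real.exp (-(1 / 4) * u)) (Set.Ici 0) :=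
    ((integrableOn_Ici_iff_integrableOn_Ioi).2
      (integrableOn_exp_mul_Ioi (by norm_num) 0)).const_mul C
  have h1 : IntegrableOn (mertensWave a) (Set.Ici 0) :=
    hI.mono' (measurable_mertensWave a).aestronglyMeasurable
      (Eventually.of_forall fun u => abs_mertensWave_le hC u)
  refine h1.integrable_of_forall_notMem_eq_zero fun u hu => mertensWave_of_neg a (not_le.1 hu)

lemma mertensMellin_eq_integral (a : ℕ → ℤ) (y : ℝ) :
    mertensMellin a ((3 / 4 : ℝ) + y * I) = ∫ u : ℝ, cexp (-(y * u) * I) * mertensWave a u := by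
  rw [mertensMellin, mellin_eq_fourier, Real.fourier_eq']
  refine integral_congr_ae (Eventually.of_forall fun u => ?_)
  simp only [mertensWave, add_re, ofReal_re, mul_re, I_re, mul_zero, ofReal_im, I_im, mul_one,
    sub_self, add_zero, add_im, mul_im, zero_add, Real.exp_neg u, inv_inv, smul_eq_mul,
    RCLike.inner_apply, conj_trivial, real_smul]
  push_cast
  rw [mul_comm (summatory a (Real.exp u) : ℂ)]
  congr 3
  · have : (π : ℂ) ≠ 0 := by exact_mod_cast Real.pi_ne_zero
    field_simp

end

/-- The numerator of the contour integrals. -/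
def hker (l κ : ℝ) (s : ℂ) : ℂ := cexp (κ * (s - 3 / 4) ^ 2) * zetaNum l s

lemma differentiableAt_hker (l κ : ℝ) {s : ℂ} (hs : -2 < s.re) :
    DifferentiableAt ℂ (hker l κ) s :=
  DifferentiableAt.mul (by fun_prop) (differentiableAt_zetaNum l hs)

lemma norm_cexp_gauss (κ : ℝ) (s : ℂ) : ‖cexp (κ * (s - 3 / 4) ^ 2)‖ =
    Real.exp (κ * (s.re - 3 / 4) ^ 2) * Real.exp (-κ * s.im ^ 2) := by
  rw [norm_exp, ← Real.exp_add]
  congr 1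
  simp [pow_two]
  ring

lemma exists_hker_le (l : ℝ) {κ : ℝ} (hκ : 0 < κ) : ∃ B > 0, ∀ s : ℂ, -1 ≤ s.re → s.re ≤ 1 →
    ‖hker l κ s‖ ≤ B * (Real.exp |s.im| * Real.exp (-κ * |s.im| ^ 2)) := by
  obtain ⟨K, hK, h⟩ := zetaNum_upper l
  refine ⟨Real.exp (κ * 4) * K, by positivity, fun s h1 h2 => ?_⟩
  rw [hker, norm_mul, norm_cexp_gauss, sq_abs]
  have h3 : (s.re - 3 / 4) ^ 2 ≤ 4 := by nlinarith
  calc _ ≤ Real.exp (κ * 4) * Real.exp (-κ * s.im ^ 2) * (K * Real.exp |s.im|) := by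
        gcongr
        exact h s h1 h2
    _ = _ := by ring

namespace ZetaData

variable {l ρ κ : ℝ} {Ξ : ℂ → ℂ} {a : ℕ → ℤ} {C : ℝ}

lemma hker_div (h : ZetaData l ρ Ξ a) (hC : ∀ x, |summatory a x| ≤ C * √x) (y : ℝ) :
    hker l κ ((3 / 4 : ℝ) + y * I) / ((3 / 4 : ℝ) + y * I) ^ 2 / Ξ ((3 / 4 : ℝ) + y * I) =
      cexp (-κ * y ^ 2) * mertensMellin a ((3 / 4 : ℝ) + y * I) := by
  have hre : ((3 / 4 : ℝ) + y * I : ℂ).re = 3 / 4 := by simp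
  have h0 : ((3 / 4 : ℝ) + y * I : ℂ) ≠ 0 := by
    intro h; rw [h] at hre; norm_num at hre
  have hX := h.ne_zero hC (s := (3 / 4 : ℝ) + y * I) (by rw [hre]; norm_num)
  rw [hker, h.zetaNum_eq hC (by rw [hre]; norm_num)]
  rw [show (κ : ℂ) * ((3 / 4 : ℝ) + y * I - 3 / 4) ^ 2 = -κ * y ^ 2 by
    push_cast; ring_nf; rw [I_sq]; ring]
  field_simp

lemma vertInt_three_quarters (h : ZetaData l ρ Ξ a) (hC : ∀ x, |summatory a x| ≤ C * √x)
    (hκ : 0 < κ) (t : ℝ) :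
    vertInt (fun s => hker l κ s / s ^ 2 / Ξ s) (3 / 4) t =
      Real.exp (3 / 4 * t) * mertensSmooth a κ t := by
  have hg : Integrable (fun y : ℝ => cexp (-κ * y ^ 2)) :=
    integrable_cexp_neg_mul_sq (b := κ) (by simpa using hκ)
  have hw : Integrable (fun u : ℝ => (mertensWave a u : ℂ)) := (integrable_mertensWave hC).ofReal
  have hprod := hg.mul_prod hw
  have hF : Integrable (Function.uncurry fun (y u : ℝ) =>
      cexp (t * y * I) * cexp (-κ * y ^ 2) * (cexp (-(y * u) * I) * mertensWave a u))
      (volume.prod volume) := by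
    refine hprod.mono ?_ (Eventually.of_forall fun z => ?_)
    · have h1 : Measurable fun z : ℝ × ℝ => (mertensWave a z.2 : ℂ) :=
        measurable_ofReal.comp ((measurable_mertensWave a).comp measurable_snd)
      refine Measurable.aestronglyMeasurable (Measurable.mul ?_ (Measurable.mul ?_ h1))
      · exact Continuous.measurable (by fun_prop)
      · exact Continuous.measurable (by fun_prop)
    · have e1 : ‖cexp (t * z.1 * I)‖ = 1 := by
        have := norm_exp_ofReal_mul_I (t * z.1); push_cast at this; exact this
      have e2 : ‖cexp (-(z.1 * z.2) * I)‖ = 1 := by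
        have := norm_exp_ofReal_mul_I (-(z.1 * z.2)); push_cast at this; exact this
      simp only [Function.uncurry, norm_mul, e1, e2, one_mul]
      exact le_rfl
  have hswap := integral_integral_swap hF
  have hleft : vertInt (fun s => hker l κ s / s ^ 2 / Ξ s) (3 / 4) t = Real.exp (3 / 4 * t) *
      ∫ y : ℝ, ∫ u : ℝ, cexp (t * y * I) * cexp (-κ * y ^ 2) *
        (cexp (-(y * u) * I) * mertensWave a u) := by
    rw [vertInt, ← integral_const_mul]
    refine integral_congr_ae (Eventually.of_forall fun y => ?_)
    simp only
    rw [h.hker_div hC, mertensMellin_eq_integral, integral_const_mul,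
      show (t : ℂ) * ((3 / 4 : ℝ) + y * I) = ((3 / 4 * t : ℝ) : ℂ) + t * y * I by push_cast; ring,
      Complex.exp_add, ofReal_exp]
    ring
  rw [hleft, hswap]
  congr 1
  rw [mertensSmooth, ← integral_complex_ofReal]
  refine integral_congr_ae (Eventually.of_forall fun u => ?_)
  simp only
  have hfi := fourierIntegral_gaussian (b := κ) (by simpa using hκ) (t - u)
  have hsq : ((π : ℂ) / κ) ^ (1 / 2 : ℂ) = (√(π / κ) : ℝ) := by
    rw [Real.sqrt_eq_rpow, ofReal_cpow (by positivity)]; push_cast; rfl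
  rw [hsq] at hfi
  push_cast
  rw [← hfi, ← integral_mul_const]
  refine integral_congr_ae (Eventually.of_forall fun y => ?_)
  simp only
  rw [show I * ((t : ℂ) - u) * y = t * y * I + -(y * u) * I by ring, Complex.exp_add]
  ring

end ZetaData

lemma gauss_mul_exp_eq {κ : ℝ} (hκ : 0 < κ) (t β u : ℝ) :
    √(π / κ) * Real.exp (-(t - u) ^ 2 / (4 * κ)) * Real.exp (-β * u) =
      √(π / κ) * (Real.exp (-β * t) * Real.exp (κ * β ^ 2)) *
        Real.exp (-(1 / (4 * κ)) * (u - (t - 2 * κ * β)) ^ 2) := by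
  rw [mul_assoc, mul_assoc, ← Real.exp_add, ← Real.exp_add, ← Real.exp_add]
  congr 2
  field_simp
  ring

lemma integrable_gauss_mul_exp {κ : ℝ} (hκ : 0 < κ) (t β : ℝ) :
    Integrable fun u : ℝ => √(π / κ) * Real.exp (-(t - u) ^ 2 / (4 * κ)) * Real.exp (-β * u) := by
  simp_rw [gauss_mul_exp_eq hκ]
  exact ((integrable_exp_neg_mul_sq (b := 1 / (4 * κ)) (by positivity)).comp_sub_right
    (t - 2 * κ * β)).const_mul _

lemma integral_gauss_mul_exp {κ : ℝ} (hκ : 0 < κ) (t β : ℝ) :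
    ∫ u : ℝ, √(π / κ) * Real.exp (-(t - u) ^ 2 / (4 * κ)) * Real.exp (-β * u) =
      2 * π * (Real.exp (-β * t) * Real.exp (κ * β ^ 2)) := by
  simp_rw [gauss_mul_exp_eq hκ]
  rw [integral_const_mul, integral_sub_right_eq_self
    (fun u : ℝ => Real.exp (-(1 / (4 * κ)) * u ^ 2)) (t - 2 * κ * β), integral_gaussian]
  have h1 : √(π / κ) * √(π / (1 / (4 * κ))) = 2 * π := by
    rw [← Real.sqrt_mul (by positivity), show π / κ * (π / (1 / (4 * κ))) = (2 * π) ^ 2 by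
      field_simp; ring]
    exact Real.sqrt_sq (by positivity)
  calc _ = (√(π / κ) * √(π / (1 / (4 * κ)))) * (Real.exp (-β * t) * Real.exp (κ * β ^ 2)) := by ring
    _ = _ := by rw [h1]

section

variable {a : ℕ → ℤ} {C : ℝ}

lemma MertensBound.abs_wave_le (h : MertensBound a) {δ : ℝ} (hδ : 0 < δ) :
    ∃ B : ℝ, ∀ u, |mertensWave a u| ≤
      (1 + δ) * Real.exp (-(1 / 4) * u) + B * Real.exp (-(1 / 2) * u) := by
  obtain ⟨C, hC0, hC⟩ := h.exists_bound
  obtain ⟨x₀, hx₀⟩ := eventually_atTop.1 (h δ hδ)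
  obtain ⟨u₀, hu₀⟩ : ∃ u₀, x₀ ≤ Real.exp u₀ := ⟨x₀, by linarith [Real.add_one_le_exp x₀]⟩
  refine ⟨C * Real.exp (1 / 4 * u₀), fun u => ?_⟩
  rcases le_total u₀ u with hu | hu
  · have h1 := hx₀ (Real.exp u) (hu₀.trans (Real.exp_le_exp.2 hu))
    have h2 : |mertensWave a u| ≤ (1 + δ) * Real.exp (-(1 / 4) * u) := by
      rw [mertensWave, abs_mul, abs_of_pos (Real.exp_pos (-(3 / 4) * u)), ← sqrt_exp_mul, ← mul_assoc]
      gcongr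
    have : 0 ≤ C * Real.exp (1 / 4 * u₀) * Real.exp (-(1 / 2) * u) := by positivity
    linarith
  · have h1 := abs_mertensWave_le hC u
    have h2 : C * Real.exp (-(1 / 4) * u) ≤
        C * Real.exp (1 / 4 * u₀) * Real.exp (-(1 / 2) * u) := by
      rw [mul_assoc, ← Real.exp_add]
      gcongr
      linarith
    have : 0 ≤ (1 + δ) * Real.exp (-(1 / 4) * u) := by positivity
    linarith

lemma MertensBound.abs_smooth_le (h : MertensBound a) {δ : ℝ} (hδ : 0 < δ) {κ : ℝ} (hκ : 0 < κ) :
    ∃ B : ℝ, ∀ t, |mertensSmooth a κ t| ≤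
      2 * π * (1 + δ) * Real.exp (κ / 16) * Real.exp (-(1 / 4) * t) +
        B * Real.exp (-(1 / 2) * t) := by
  obtain ⟨B, hB⟩ := h.abs_wave_le hδ
  refine ⟨B * (2 * π * Real.exp (κ * (1 / 2) ^ 2)), fun t => ?_⟩
  have i1 := (integrable_gauss_mul_exp hκ t (1 / 4)).const_mul (1 + δ)
  have i2 := (integrable_gauss_mul_exp hκ t (1 / 2)).const_mul B
  have := norm_integral_le_of_norm_le (i1.add i2) (f := fun u : ℝ =>
    √(π / κ) * Real.exp (-(t - u) ^ 2 / (4 * κ)) * mertensWave a u)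
    (Eventually.of_forall fun u => by
      rw [norm_mul, Real.norm_of_nonneg (by positivity), Real.norm_eq_abs, Pi.add_apply]
      calc _ ≤ √(π / κ) * Real.exp (-(t - u) ^ 2 / (4 * κ)) *
            ((1 + δ) * Real.exp (-(1 / 4) * u) + B * Real.exp (-(1 / 2) * u)) := by
            gcongr; exact hB u
        _ = _ := by ring)
  rw [Real.norm_eq_abs] at this
  refine this.trans_eq ?_
  simp only [Pi.add_apply]
  rw [integral_add i1 i2, integral_const_mul, integral_const_mul, integral_gauss_mul_exp hκ,
    integral_gauss_mul_exp hκ]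
  rw [show κ * (1 / 4 : ℝ) ^ 2 = κ / 16 by ring]
  ring

/-- The Gaussian averages recover the function at points of continuity. -/
lemma tendsto_mertensSmooth (hC : ∀ x, |summatory a x| ≤ C * √x) {t : ℝ}
    (ht : ContinuousAt (mertensWave a) t) :
    Tendsto (fun κ => mertensSmooth a κ t) (𝓝[>] 0) (𝓝 (2 * π * mertensWave a t)) := by
  have hw : Integrable (fun u : ℝ => (mertensWave a u : ℂ)) := (integrable_mertensWave hC).ofReal
  have h1 := Real.tendsto_integral_gaussian_smul' hw (v := t)
    (continuous_ofReal.continuousAt.comp ht)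
  have hc : Tendsto (fun κ : ℝ => (4 * π ^ 2 * κ)⁻¹) (𝓝[>] 0) atTop := by
    refine tendsto_inv_nhdsGT_zero.comp (tendsto_nhdsWithin_iff.2 ⟨?_, ?_⟩)
    · have : Tendsto (fun κ : ℝ => 4 * π ^ 2 * κ) (𝓝 0) (𝓝 (4 * π ^ 2 * 0)) :=
        tendsto_id.const_mul _
      rw [mul_zero] at this
      exact this.mono_left nhdsWithin_le_nhds
    · filter_upwards [self_mem_nhdsWithin] with κ hκ
      have : 0 < κ := hκ
      exact Set.mem_Ioi.2 (by positivity)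
  have h2 := (h1.comp hc).const_mul (2 * π : ℂ)
  have h3 := (continuous_re.tendsto _).comp h2
  have e : (2 * π * (mertensWave a t : ℂ) : ℂ).re = 2 * π * mertensWave a t := by
    rw [show (2 * π * (mertensWave a t : ℂ) : ℂ) = ((2 * π * mertensWave a t : ℝ) : ℂ) by
      push_cast; ring, ofReal_re]
  rw [e] at h3
  refine h3.congr' ?_
  filter_upwards [self_mem_nhdsWithin] with κ hκ
  have hκ : 0 < κ := hκ
  simp only [Function.comp]
  have hsm : (mertensSmooth a κ t : ℂ) = 2 * π * ∫ w : ℝ, ((π * ((4 * π ^ 2 * κ)⁻¹ : ℝ) : ℂ) ^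
      ((Module.finrank ℝ ℝ : ℂ) / 2) * cexp (-π ^ 2 * ((4 * π ^ 2 * κ)⁻¹ : ℝ) * (‖t - w‖ : ℝ) ^ 2)) •
      (mertensWave a w : ℂ) := by
    rw [mertensSmooth, ← integral_complex_ofReal, ← integral_const_mul]
    refine integral_congr_ae (Eventually.of_forall fun u => ?_)
    simp only [Module.finrank_self, Nat.cast_one, smul_eq_mul]
    have hs : (π * ((4 * π ^ 2 * κ)⁻¹ : ℝ) : ℂ) ^ ((1 : ℂ) / 2) =
        (√(π * (4 * π ^ 2 * κ)⁻¹) : ℝ) := by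
      rw [Real.sqrt_eq_rpow, ofReal_cpow (by positivity)]; push_cast; rfl
    have hs2 : √(π / κ) = 2 * π * √(π * (4 * π ^ 2 * κ)⁻¹) := by
      rw [show π / κ = (2 * π) ^ 2 * (π * (4 * π ^ 2 * κ)⁻¹) by field_simp; ring,
        Real.sqrt_mul (by positivity), Real.sqrt_sq (by positivity)]
    have he : cexp (-π ^ 2 * ((4 * π ^ 2 * κ)⁻¹ : ℝ) * (‖t - u‖ : ℝ) ^ 2) =
        (Real.exp (-(t - u) ^ 2 / (4 * κ)) : ℝ) := by
      rw [ofReal_exp]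
      congr 1
      rw [← ofReal_pow ‖t - u‖, Real.norm_eq_abs, sq_abs]
      push_cast
      have : (π : ℂ) ≠ 0 := by exact_mod_cast Real.pi_ne_zero
      have : (κ : ℂ) ≠ 0 := by exact_mod_cast hκ.ne'
      field_simp
    rw [hs, he, hs2]
    push_cast
    ring
  rw [← ofReal_re (mertensSmooth a κ t), hsm]

end

lemma norm_vertInt_le (g : ℂ → ℂ) (σ t : ℝ) :
    ‖vertInt g σ t‖ ≤ Real.exp (t * σ) * ∫ y : ℝ, ‖g (σ + y * I)‖ := by
  rw [vertInt, ← integral_const_mul]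
  refine (norm_integral_le_integral_norm _).trans_eq ?_
  refine integral_congr_ae (Eventually.of_forall fun y => ?_)
  simp [norm_exp]

lemma exists_hker_div_sq_le (l : ℝ) {κ : ℝ} (hκ : 0 < κ) : ∃ B > 0, ∀ s : ℂ, 1 / 4 ≤ s.re →
    s.re ≤ 3 / 4 → ‖hker l κ s / s ^ 2‖ ≤ B * Real.exp (-(κ / 2) * s.im ^ 2) := by
  obtain ⟨B, hB, h⟩ := exists_hker_le l hκ
  obtain ⟨M, hM, hMb⟩ := exists_exp_quadratic_le 1 (half_pos hκ)
  refine ⟨16 * B * M, by positivity, fun s h1 h2 => ?_⟩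
  have hs := h s (by linarith) (by linarith)
  have hn : 1 / 4 ≤ ‖s‖ := h1.trans ((le_abs_self _).trans (abs_re_le_norm s))
  have hm := hMb |s.im|
  have hm1 : Real.exp (-|s.im|) ≤ 1 := Real.exp_le_one_iff.2 (by simp)
  rw [norm_div, norm_pow, div_le_iff₀ (by positivity)]
  have e : Real.exp (-κ * |s.im| ^ 2) =
      Real.exp (-(κ / 2) * |s.im| ^ 2) * Real.exp (-(κ / 2) * s.im ^ 2) := by
    rw [← Real.exp_add, sq_abs]; ring_nf
  rw [one_mul] at hm
  calc ‖hker l κ s‖ ≤ B * (Real.exp |s.im| * Real.exp (-(κ / 2) * |s.im| ^ 2)) *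
        Real.exp (-(κ / 2) * s.im ^ 2) := by rw [e] at hs; linarith
    _ ≤ B * (M * 1) * Real.exp (-(κ / 2) * s.im ^ 2) := by
        gcongr ?_ * _
        exact mul_le_mul_of_nonneg_left (hm.trans (by gcongr)) hB.le
    _ = 16 * B * M * Real.exp (-(κ / 2) * s.im ^ 2) * (1 / 4) ^ 2 := by ring
    _ ≤ _ := by gcongr


namespace ZetaData

variable {l ρ κ : ℝ} {Ξ : ℂ → ℂ} {a : ℕ → ℤ} {C : ℝ}

/-- Recurrence turns the asymptotic Mertens bound into a bound valid for every `t`. -/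
lemma norm_vertInt_sub_le (h : ZetaData l ρ Ξ a) (hM : MertensBound a) (hκ : 0 < κ) (t₀ : ℝ) :
    ‖vertInt (fun s => hker l κ s / s ^ 2 / Ξ s) (3 / 4) t₀ -
      vertInt (fun s => hker l κ s / s ^ 2 / Ξ s) (1 / 4) t₀‖ ≤
      2 * π * Real.exp (κ / 16) * Real.exp (t₀ / 2) := by
  obtain ⟨C, hC0, hC⟩ := hM.exists_bound
  obtain ⟨A, B, hX⟩ := h.simpleOnLine hC hC0
  obtain ⟨B', hB', hP⟩ := exists_hker_div_sq_le l hκ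
  set Q : ℂ → ℂ := fun s => hker l κ s / s ^ 2 / Ξ s with hQ
  set S : ℝ → ℂ := fun t => cexp (-(t / 2)) * (vertInt Q (3 / 4) t - vertInt Q (1 / 4) t) with hS
  have hd : ∀ s : ℂ, 1 / 4 ≤ s.re → s.re ≤ 3 / 4 →
      DifferentiableAt ℂ (fun s => hker l κ s / s ^ 2) s := by
    intro s h1 _
    have : s ≠ 0 := by rintro rfl; norm_num at h1
    exact (differentiableAt_hker l κ (by linarith)).div (by fun_prop) (pow_ne_zero 2 this)
  have hnorm : ∀ t : ℝ, ‖cexp (-(t / 2))‖ = Real.exp (-(t / 2)) := by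
    intro t; rw [norm_exp]; simp
  have hle : ‖S t₀‖ ≤ 2 * π * Real.exp (κ / 16) := by
    refine le_of_forall_pos_le_add fun ε hε => ?_
    set E := 2 * π * Real.exp (κ / 16) with hE
    have hE0 : 0 < E := by positivity
    obtain ⟨B₁, hB₁⟩ := hM.abs_smooth_le (δ := ε / (4 * E)) (by positivity) hκ
    set B₂ := ∫ y : ℝ, ‖Q ((1 / 4 : ℝ) + y * I)‖ with hB₂
    have hub : ∀ t : ℝ, ‖S t‖ ≤ E + ε / 4 + (|B₁| + B₂) * Real.exp (-(1 / 4) * t) := by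
      intro t
      have h1 : ‖vertInt Q (3 / 4) t‖ ≤ Real.exp (3 / 4 * t) * (2 * π * (1 + ε / (4 * E)) *
          Real.exp (κ / 16) * Real.exp (-(1 / 4) * t) + |B₁| * Real.exp (-(1 / 2) * t)) := by
        rw [hQ, h.vertInt_three_quarters hC hκ, norm_mul, norm_real, norm_real,
          Real.norm_of_nonneg (Real.exp_pos _).le, Real.norm_eq_abs]
        gcongr
        refine (hB₁ t).trans ?_
        gcongr
        exact le_abs_self _
      have h2 := norm_vertInt_le Q (1 / 4) t
      have e1 : Real.exp (-(t / 2)) * (Real.exp (3 / 4 * t) * Real.exp (-(1 / 4) * t)) = 1 := by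
        rw [← Real.exp_add, ← Real.exp_add, Real.exp_eq_one_iff]; ring
      have e2 : Real.exp (-(t / 2)) * (Real.exp (3 / 4 * t) * Real.exp (-(1 / 2) * t)) =
          Real.exp (-(1 / 4) * t) := by
        rw [← Real.exp_add, ← Real.exp_add]; ring_nf
      have e3 : Real.exp (-(t / 2)) * Real.exp (t * (1 / 4)) = Real.exp (-(1 / 4) * t) := by
        rw [← Real.exp_add]; ring_nf
      have e4 : 2 * π * (1 + ε / (4 * E)) * Real.exp (κ / 16) = E + ε / 4 := by
        rw [show 2 * π * (1 + ε / (4 * E)) * Real.exp (κ / 16) = E * (1 + ε / (4 * E)) by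
          rw [hE]; ring]
        field_simp
      rw [hS, norm_mul, hnorm]
      calc _ ≤ Real.exp (-(t / 2)) * (Real.exp (3 / 4 * t) * (2 * π * (1 + ε / (4 * E)) *
          Real.exp (κ / 16) * Real.exp (-(1 / 4) * t) + |B₁| * Real.exp (-(1 / 2) * t)) +
          Real.exp (t * (1 / 4)) * B₂) := by
            gcongr
            exact (norm_sub_le _ _).trans (add_le_add h1 h2)
        _ = (2 * π * (1 + ε / (4 * E)) * Real.exp (κ / 16)) *
            (Real.exp (-(t / 2)) * (Real.exp (3 / 4 * t) * Real.exp (-(1 / 4) * t))) +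
            |B₁| * (Real.exp (-(t / 2)) * (Real.exp (3 / 4 * t) * Real.exp (-(1 / 2) * t))) +
            B₂ * (Real.exp (-(t / 2)) * Real.exp (t * (1 / 4))) := by ring
        _ = _ := by rw [e1, e2, e3, e4]; ring
    have hlim : Tendsto (fun t : ℝ => (|B₁| + B₂) * Real.exp (-(1 / 4) * t)) atTop (𝓝 0) := by
      have : Tendsto (fun t : ℝ => Real.exp (-(1 / 4) * t)) atTop (𝓝 0) :=
        Real.tendsto_exp_atBot.comp (tendsto_id.const_mul_atTop_of_neg (by norm_num))
      simpa using this.const_mul (|B₁| + B₂)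
    obtain ⟨T₀, hT₀⟩ := eventually_atTop.1 (hlim.eventually (gt_mem_nhds (show 0 < ε / 4 by positivity)))
    obtain ⟨t, ht, hts⟩ := hX.recurrent (half_pos hκ) hd hP (S := S) (fun t => rfl) t₀ T₀
      (show 0 < ε / 4 by positivity)
    have h1 := hub t
    have h2 := hT₀ t ht
    have h3 : ‖S t₀‖ ≤ ‖S t‖ + ‖S t - S t₀‖ := by
      calc ‖S t₀‖ = ‖S t - (S t - S t₀)‖ := by rw [sub_sub_cancel]
        _ ≤ _ := norm_sub_le _ _
    linarith
  have h1 : vertInt Q (3 / 4) t₀ - vertInt Q (1 / 4) t₀ = Real.exp (t₀ / 2) * S t₀ := by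
    rw [hS]
    simp only
    rw [← mul_assoc, ofReal_exp, ← Complex.exp_add]
    simp
  rw [h1, norm_mul, norm_real, Real.norm_of_nonneg (Real.exp_pos _).le, mul_comm]
  gcongr

end ZetaData

lemma integrable_inv_one_add_sq_mul_inv_sqrt :
    Integrable fun v : ℝ => 1 / √(1 + v ^ 2) * (1 / (1 + v ^ 2)) := by
  refine integrable_inv_one_add_sq.mono' ?_ (Eventually.of_forall fun v => ?_)
  · refine Continuous.aestronglyMeasurable ?_
    refine Continuous.mul (Continuous.div (by fun_prop) (by fun_prop) fun v => ?_)
      (Continuous.div (by fun_prop) (by fun_prop) fun v => ?_) <;> positivity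
  · rw [Real.norm_of_nonneg (by positivity), ← one_div]
    have : 1 ≤ √(1 + v ^ 2) := Real.one_le_sqrt.2 (by nlinarith)
    exact mul_le_of_le_one_left (by positivity) ((div_le_one (by positivity)).2 this)

lemma integral_inv_one_add_sq_mul_inv_sqrt :
    ∫ v : ℝ, 1 / √(1 + v ^ 2) * (1 / (1 + v ^ 2)) = 2 := by
  have h1 : ∀ v : ℝ, HasDerivAt (fun v => Real.sin (Real.arctan v))
      (1 / √(1 + v ^ 2) * (1 / (1 + v ^ 2))) v := by
    intro v
    have := (Real.hasDerivAt_sin (Real.arctan v)).comp v (Real.hasDerivAt_arctan v)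
    rwa [Real.cos_arctan] at this
  have h2 : Tendsto (fun v => Real.sin (Real.arctan v)) atTop (𝓝 1) := by
    have := (Real.continuous_sin.tendsto (π / 2)).comp
      (Real.tendsto_arctan_atTop.mono_right nhdsWithin_le_nhds)
    rwa [Real.sin_pi_div_two] at this
  have h3 : Tendsto (fun v => Real.sin (Real.arctan v)) atBot (𝓝 (-1)) := by
    have := (Real.continuous_sin.tendsto (-(π / 2))).comp
      (Real.tendsto_arctan_atBot.mono_right nhdsWithin_le_nhds)
    rwa [Real.sin_neg, Real.sin_pi_div_two] at this
  rw [integral_of_hasDerivAt_of_tendsto h1 integrable_inv_one_add_sq_mul_inv_sqrt h3 h2]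
  norm_num

lemma norm_Gamma_half_sq_le (y : ℝ) :
    ‖Gamma (1 / 2 + y * I)‖ ^ 2 ≤ π * ‖Gamma (1 + y * I)‖ ^ 2 := by
  have h1 := Gamma_mul_Gamma_eq_betaIntegral (s := 1 / 2 + y * I) (t := 1 / 2) (by simp) (by simp)
  have h2 := Gamma_mul_Gamma_eq_betaIntegral (s := 1 / 2) (t := 1 / 2) (by simp) (by simp)
  rw [show (1 / 2 + y * I + 1 / 2 : ℂ) = 1 + y * I by ring] at h1
  rw [show (1 / 2 + 1 / 2 : ℂ) = 1 by norm_num, Gamma_one, one_mul, Gamma_one_half_eq] at h2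
  have hpi : (π : ℂ) ^ (1 / 2 : ℂ) = (√π : ℝ) := by
    rw [Real.sqrt_eq_rpow, ofReal_cpow Real.pi_pos.le]; push_cast; rfl
  have hb : ‖betaIntegral (1 / 2 + y * I) (1 / 2)‖ ≤ π := by
    have e : betaIntegral (1 / 2) (1 / 2) = ((∫ x in (0 : ℝ)..1,
        x ^ (-(1 / 2) : ℝ) * (1 - x) ^ (-(1 / 2) : ℝ) : ℝ) : ℂ) := by
      rw [betaIntegral, ← intervalIntegral.integral_ofReal]
      refine intervalIntegral.integral_congr fun x hx => ?_
      rw [Set.uIcc_of_le zero_le_one] at hx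
      rw [ofReal_mul, ofReal_cpow hx.1, ofReal_cpow (by linarith [hx.2])]
      push_cast
      norm_num
    have e2 : (∫ x in (0 : ℝ)..1, x ^ (-(1 / 2) : ℝ) * (1 - x) ^ (-(1 / 2) : ℝ)) = π := by
      rw [e, hpi, ← ofReal_mul, Real.mul_self_sqrt Real.pi_pos.le] at h2
      exact_mod_cast h2.symm
    rw [← e2, betaIntegral]
    refine (intervalIntegral.norm_integral_le_integral_norm zero_le_one).trans_eq ?_
    refine intervalIntegral.integral_congr fun x hx => ?_
    rw [Set.uIcc_of_le zero_le_one] at hx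
    have hx1 : (0 : ℝ) ≤ 1 - x := by linarith [hx.2]
    rw [norm_mul, show (1 - x : ℂ) = ((1 - x : ℝ) : ℂ) by push_cast; rfl,
      norm_cpow_eq_rpow_re_of_nonneg hx.1 (by norm_num),
      norm_cpow_eq_rpow_re_of_nonneg hx1 (by norm_num)]
    norm_num
  have h3 := congrArg norm h1
  rw [norm_mul, norm_mul, Gamma_one_half_eq, hpi, norm_real,
    Real.norm_of_nonneg (Real.sqrt_nonneg _)] at h3
  have h4 : ‖Gamma (1 / 2 + y * I)‖ * √π ≤ ‖Gamma (1 + y * I)‖ * π := by rw [h3]; gcongr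
  have hs := Real.sqrt_pos.2 Real.pi_pos
  have hs2 := Real.mul_self_sqrt Real.pi_pos.le
  have h5 : ‖Gamma (1 / 2 + y * I)‖ ≤ ‖Gamma (1 + y * I)‖ * √π := by
    refine le_of_mul_le_mul_right ?_ hs
    rw [mul_assoc, hs2]; exact h4
  calc _ ≤ (‖Gamma (1 + y * I)‖ * √π) ^ 2 := by gcongr
    _ = _ := by rw [mul_pow, Real.sq_sqrt Real.pi_pos.le, mul_comm]

namespace ZetaData

variable {l ρ κ : ℝ} {Ξ : ℂ → ℂ} {a : ℕ → ℤ} {C : ℝ}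

lemma norm_left_le (h : ZetaData l ρ Ξ a) (hC : ∀ x, |summatory a x| ≤ C * √x) (hκ : 0 < κ) (y : ℝ) :
    ‖hker l κ ((-1 : ℝ) + y * I) / ((-1 : ℝ) + y * I) ^ 2 / Ξ ((-1 : ℝ) + y * I)‖ ≤
      Real.exp (κ * 4) * (4 * π * (π ^ 2 / 6) ^ 2 * Real.exp (-3 * l)) *
        (1 / √(1 + y ^ 2) * (1 / (1 + y ^ 2))) := by
  set s : ℂ := (-1 : ℝ) + y * I with hs
  have hre : s.re = -1 := by simp [hs]
  have him : s.im = y := by simp [hs]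
  have h0 : s ≠ 0 := by intro h; rw [h] at hre; norm_num at hre
  have h1 : s - 1 ≠ 0 := by
    intro h; rw [sub_eq_zero] at h; rw [h] at hre; norm_num at hre
  have hX := h.ne_zero hC (s := s) (by rw [hre]; norm_num)
  have hL := h.norm_two (1 - s) (by rw [sub_re, hre, one_re]; norm_num)
  have hE := h.eq_gamma (1 - s) (by rw [sub_re, hre, one_re]; norm_num)
  rw [h.symm] at hE
  set L := LSeries (fun n => (a n : ℂ)) (1 - s)
  have hΓ : Gamma ((1 - s) / 2) ≠ 0 := Gamma_ne_zero_of_re_pos (by simp [hre])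
  have hkey : zetaNum l s / s ^ 2 / Ξ s =
      4 * L * cexp ((2 * s - 1) * l) * (Gamma (1 + s / 2) / Gamma ((1 - s) / 2)) ^ 2 / s ^ 3 := by
    rw [zetaNum, show (2 * s - 1) * (l : ℂ) = s * l - (1 - s) * l by ring, Complex.exp_sub]
    have h2 := exp_ne_zero ((1 - s) * l)
    clear_value s L
    generalize Gamma (1 + s / 2) = G at *
    generalize Gamma ((1 - s) / 2) = G' at *
    generalize cexp ((1 - s) * l) = e at *
    field_simp
    linear_combination (-G ^ 2) * hE
  have hsn : ‖s‖ = √(1 + y ^ 2) := by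
    rw [norm_def, normSq_apply, hre, him]; ring_nf
  have hG : ‖Gamma (1 + s / 2) / Gamma ((1 - s) / 2)‖ ^ 2 ≤ π := by
    have e1 : 1 + s / 2 = 1 / 2 + (y / 2 : ℝ) * I := by rw [hs]; push_cast; ring
    have e2 : (1 - s) / 2 = (starRingEnd ℂ) (1 + (y / 2 : ℝ) * I) := by
      have h1 : (starRingEnd ℂ) (1 + (y / 2 : ℝ) * I) = 1 + (y / 2 : ℝ) * -I := by
        simp only [map_add, map_mul, _root_.map_one, conj_I, conj_ofReal]
      rw [h1, hs]; push_cast; ring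
    rw [norm_div, div_pow, div_le_iff₀ (by positivity), e1, e2, Gamma_conj, norm_conj]
    exact norm_Gamma_half_sq_le _
  have hexp : ‖cexp ((2 * s - 1) * l)‖ = Real.exp (-3 * l) := by
    rw [norm_exp]; congr 1; simp [hre]; ring
  rw [hker, mul_div_assoc, mul_div_assoc, norm_mul, hkey, norm_cexp_gauss, hre, him, norm_div,
    norm_mul, norm_mul, norm_mul, norm_pow, norm_pow, hexp, hsn]
  have hg : Real.exp (κ * (-1 - 3 / 4) ^ 2) * Real.exp (-κ * y ^ 2) ≤ Real.exp (κ * 4) := by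
    rw [← Real.exp_add]; gcongr; nlinarith [sq_nonneg y]
  have h3 : √(1 + y ^ 2) ^ 3 = √(1 + y ^ 2) * (1 + y ^ 2) := by
    rw [pow_succ, Real.sq_sqrt (by positivity)]; ring
  rw [h3]
  calc _ ≤ Real.exp (κ * 4) * (‖(4 : ℂ)‖ * (π ^ 2 / 6) ^ 2 * Real.exp (-3 * l) * π /
        (√(1 + y ^ 2) * (1 + y ^ 2))) := by gcongr
    _ = _ := by
      have : ‖(4 : ℂ)‖ = 4 := by norm_num
      rw [this]
      field_simp

end ZetaData

lemma re_line (σ y : ℝ) : ((σ : ℂ) + y * I).re = σ := by simp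

lemma im_line (σ y : ℝ) : ((σ : ℂ) + y * I).im = y := by simp

lemma integrable_inv_sq_line {σ : ℝ} (hσ : σ ≠ 0) :
    Integrable fun y : ℝ => (((σ : ℂ) + y * I) ^ 2)⁻¹ := by
  have hn : ∀ y : ℝ, ‖((σ : ℂ) + y * I) ^ 2‖ = σ ^ 2 + y ^ 2 := by
    intro y; rw [norm_pow, ← normSq_eq_norm_sq, normSq_apply, re_line, im_line]; ring
  have h0 : ∀ y : ℝ, ((σ : ℂ) + y * I) ^ 2 ≠ 0 := by
    intro y; rw [← norm_pos_iff, hn]; positivity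
  have h1 : Integrable fun y : ℝ => (σ ^ 2)⁻¹ * (1 + (y * σ⁻¹) ^ 2)⁻¹ :=
    (integrable_inv_one_add_sq.comp_mul_right' (inv_ne_zero hσ)).const_mul _
  refine h1.mono' (Continuous.aestronglyMeasurable (Continuous.inv₀ (by fun_prop) h0))
    (Eventually.of_forall fun y => ?_)
  rw [norm_inv, hn, ← mul_inv]
  refine le_of_eq (congrArg _ ?_)
  field_simp

lemma integral_inv_sq_line {σ : ℝ} (hσ : σ ≠ 0) :
    ∫ y : ℝ, (((σ : ℂ) + y * I) ^ 2)⁻¹ = 0 := by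
  have h0 : ∀ y : ℝ, ((σ : ℂ) + y * I) ≠ 0 := by
    intro y h; apply hσ; rw [← re_line σ y, h, zero_re]
  have h1 : ∀ y : ℝ, HasDerivAt (fun y : ℝ => I * ((σ : ℂ) + y * I)⁻¹)
      (((σ : ℂ) + y * I) ^ 2)⁻¹ y := by
    intro y
    have h2 : HasDerivAt (fun y : ℝ => (σ : ℂ) + y * I) I y := by
      simpa using ((ofRealCLM.hasDerivAt (x := y)).mul_const I).const_add (σ : ℂ)
    have := (h2.inv (h0 y)).const_mul I
    refine this.congr_deriv ?_
    rw [mul_div_assoc', mul_neg, I_mul_I, neg_neg, one_div]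
  have hlim : ∀ F : Filter ℝ, Tendsto (fun y : ℝ => |y|) F atTop →
      Tendsto (fun y : ℝ => I * ((σ : ℂ) + y * I)⁻¹) F (𝓝 0) := by
    intro F hF
    refine squeeze_zero_norm' (a := fun y => |y|⁻¹) ?_ (tendsto_inv_atTop_zero.comp hF)
    filter_upwards [hF.eventually_gt_atTop 0] with y hy
    rw [norm_mul, norm_I, one_mul, norm_inv]
    refine inv_anti₀ hy ?_
    have := abs_im_le_norm ((σ : ℂ) + y * I)
    rwa [im_line] at this
  rw [integral_of_hasDerivAt_of_tendsto h1 (integrable_inv_sq_line hσ)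
    (hlim _ tendsto_abs_atBot_atTop) (hlim _ tendsto_abs_atTop_atTop), sub_zero]

namespace ZetaData

variable {l ρ κ : ℝ} {Ξ : ℂ → ℂ} {a : ℕ → ℤ} {C : ℝ}

lemma integrable_left (h : ZetaData l ρ Ξ a) (hC : ∀ x, |summatory a x| ≤ C * √x) (hκ : 0 < κ)
    (t : ℝ) : Integrable fun y : ℝ => cexp (t * ((-1 : ℝ) + y * I)) *
      (hker l κ ((-1 : ℝ) + y * I) / ((-1 : ℝ) + y * I) ^ 2 / Ξ ((-1 : ℝ) + y * I)) := by
  have hlin : Continuous fun y : ℝ => (((-1 : ℝ) : ℂ) + y * I) := by fun_prop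
  have hk : Continuous fun y : ℝ => hker l κ ((-1 : ℝ) + y * I) :=
    continuous_iff_continuousAt.2 fun y => ContinuousAt.comp (f := fun y : ℝ => (((-1 : ℝ) : ℂ) + y * I))
      (differentiableAt_hker l κ (by rw [re_line]; norm_num)).continuousAt hlin.continuousAt
  have hX : Continuous fun y : ℝ => Ξ ((-1 : ℝ) + y * I) := h.diff.continuous.comp hlin
  have h0 : ∀ y : ℝ, (((-1 : ℝ) : ℂ) + y * I) ^ 2 ≠ 0 := by
    intro y h0
    have := congrArg re (pow_eq_zero_iff two_ne_zero |>.1 h0)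
    rw [re_line, zero_re] at this; norm_num at this
  have hX0 : ∀ y : ℝ, Ξ ((-1 : ℝ) + y * I) ≠ 0 := fun y => h.ne_zero hC (by rw [re_line]; norm_num)
  refine (integrable_inv_one_add_sq_mul_inv_sqrt.const_mul (Real.exp (-t) * (Real.exp (κ * 4) *
    (4 * π * (π ^ 2 / 6) ^ 2 * Real.exp (-3 * l))))).mono'
    (Continuous.aestronglyMeasurable (Continuous.mul (by fun_prop)
      ((hk.div (hlin.pow 2) h0).div hX hX0))) (Eventually.of_forall fun y => ?_)
  have e : ‖cexp (t * ((-1 : ℝ) + y * I))‖ = Real.exp (-t) := by rw [norm_exp]; simp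
  rw [norm_mul, e, mul_assoc (Real.exp (-t))]
  gcongr
  exact h.norm_left_le hC hκ y

lemma norm_vertInt_left_le (h : ZetaData l ρ Ξ a) (hC : ∀ x, |summatory a x| ≤ C * √x)
    (hκ : 0 < κ) (t : ℝ) : ‖vertInt (fun s => hker l κ s / s ^ 2 / Ξ s) (-1) t‖ ≤
      Real.exp (-t) * Real.exp (κ * 4) * (2 * π * (4 * (π ^ 2 / 6) ^ 2 * Real.exp (-3 * l))) := by
  refine (norm_vertInt_le _ _ _).trans ?_
  rw [mul_neg_one, mul_assoc]
  gcongr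
  have hI := integrable_inv_one_add_sq_mul_inv_sqrt.const_mul (Real.exp (κ * 4) *
    (4 * π * (π ^ 2 / 6) ^ 2 * Real.exp (-3 * l)))
  refine (integral_mono_of_nonneg (Eventually.of_forall fun _ => norm_nonneg _) hI
    (Eventually.of_forall fun y => h.norm_left_le hC hκ y)).trans_eq ?_
  rw [integral_const_mul, integral_inv_one_add_sq_mul_inv_sqrt]
  ring

/-- The kernel without the double pole at `0`. -/
def kerFun (l κ : ℝ) (Ξ : ℂ → ℂ) (t : ℝ) (s : ℂ) : ℂ := cexp (t * s) * (hker l κ s / Ξ s)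

lemma differentiableAt_kerFun (h : ZetaData l ρ Ξ a) (hC : ∀ x, |summatory a x| ≤ C * √x)
    (t : ℝ) {s : ℂ} (h1 : -1 ≤ s.re) (h2 : s.re ≤ 1 / 4) :
    DifferentiableAt ℂ (kerFun l κ Ξ t) s :=
  DifferentiableAt.mul (by fun_prop) ((differentiableAt_hker l κ (by linarith)).div (h.diff s)
    (h.ne_zero hC (by linarith)))

lemma exists_kerFun_le (h : ZetaData l ρ Ξ a) (hC : ∀ x, |summatory a x| ≤ C * √x) (hC0 : 0 < C)
    (hκ : 0 < κ) (t : ℝ) : ∃ M : ℝ, ∀ s : ℂ, -1 ≤ s.re → s.re ≤ 1 / 4 → 1 ≤ |s.im| →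
      ‖kerFun l κ Ξ t s‖ ≤ M := by
  obtain ⟨K, hK, hKl⟩ := h.exists_lower hC hC0
  obtain ⟨B, hB, hBl⟩ := exists_hker_le l hκ
  obtain ⟨M, hM, hMl⟩ := exists_exp_quadratic_le 7 hκ
  refine ⟨Real.exp |t| * (4 * K * B * M), fun s h1 h2 h3 => ?_⟩
  have hX := hKl s h1 (by linarith) (Or.inl h3)
  have hX0 : 0 < ‖Ξ s‖ := norm_pos_iff.2 (h.ne_zero hC (by linarith))
  have hX1 : 1 ≤ 4 * K * Real.exp (6 * |s.im|) * ‖Ξ s‖ := by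
    rw [abs_of_neg (by linarith)] at hX; linarith
  have hb := hBl s h1 (by linarith)
  have hm := hMl |s.im|
  have hm1 : Real.exp (-|s.im|) ≤ 1 := Real.exp_le_one_iff.2 (by simp)
  have ht : ‖cexp (t * s)‖ ≤ Real.exp |t| := by
    rw [norm_exp]
    gcongr
    simp only [mul_re, ofReal_re, ofReal_im, zero_mul, sub_zero]
    refine (le_abs_self _).trans ?_
    rw [abs_mul]
    exact mul_le_of_le_one_right (abs_nonneg t) (abs_le.2 ⟨h1, by linarith⟩)
  rw [kerFun, norm_mul, norm_div]
  gcongr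
  rw [div_le_iff₀ hX0]
  calc ‖hker l κ s‖ ≤ B * (Real.exp |s.im| * Real.exp (-κ * |s.im| ^ 2)) *
        (4 * K * Real.exp (6 * |s.im|) * ‖Ξ s‖) := hb.trans (le_mul_of_one_le_right (by positivity) hX1)
    _ = 4 * K * B * (Real.exp (7 * |s.im|) * Real.exp (-κ * |s.im| ^ 2)) * ‖Ξ s‖ := by
        rw [show 7 * |s.im| = |s.im| + 6 * |s.im| by ring, Real.exp_add]; ring
    _ ≤ 4 * K * B * (M * 1) * ‖Ξ s‖ := by
        gcongr 4 * K * B * ?_ * _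
        exact hm.trans (by gcongr)
    _ = _ := by ring

lemma vertInt_shift (h : ZetaData l ρ Ξ a) (hC : ∀ x, |summatory a x| ≤ C * √x) (hC0 : 0 < C)
    (hκ : 0 < κ) (t : ℝ) :
    vertInt (fun s => hker l κ s / s ^ 2 / Ξ s) (1 / 4) t -
      vertInt (fun s => hker l κ s / s ^ 2 / Ξ s) (-1) t = 2 * π * deriv (kerFun l κ Ξ t) 0 := by
  set G := kerFun l κ Ξ t with hG
  obtain ⟨M, hM⟩ := h.exists_kerFun_le (l := l) hC hC0 hκ t
  obtain ⟨A, B, hX⟩ := h.simpleOnLine hC hC0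
  obtain ⟨B', hB', hP⟩ := exists_hker_div_sq_le l hκ
  have hd : ∀ s : ℂ, 1 / 4 ≤ s.re → s.re ≤ 3 / 4 →
      DifferentiableAt ℂ (fun s => hker l κ s / s ^ 2) s := by
    intro s h1 _
    have : s ≠ 0 := by rintro rfl; norm_num at h1
    exact (differentiableAt_hker l κ (by linarith)).div (by fun_prop) (pow_ne_zero 2 this)
  set f : ℂ → ℂ := fun s => G s * (s ^ 2)⁻¹ - G 0 * (s ^ 2)⁻¹ with hf
  have hrect : ∀ T : ℝ, 0 < T → rectInt f (-1) (1 / 4) (-T) T = 2 * π * I * deriv G 0 := by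
    intro T hT
    rw [rectInt_eq_sum_residues (by norm_num) (by linarith) {0} ?_ (fun _ => deriv G 0) ?_ ?_]
    · simp
    · intro p hp
      rw [Finset.mem_singleton] at hp
      subst hp
      simpa using hT
    · intro x y hx hy hs
      have hs0 : (x + y * I : ℂ) ≠ 0 := by simpa using hs
      have hi : DifferentiableAt ℂ (fun s : ℂ => (s ^ 2)⁻¹) (x + y * I) :=
        DifferentiableAt.inv (by fun_prop) (pow_ne_zero 2 hs0)
      exact ((h.differentiableAt_kerFun hC t (by rw [re_line]; exact hx.1)
        (by rw [re_line]; exact hx.2)).mul hi).sub (hi.const_mul _)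
    · intro p hp
      rw [Finset.mem_singleton] at hp
      subst hp
      have := hasDerivAt_iff_tendsto_slope.1
        (h.differentiableAt_kerFun (κ := κ) hC t (s := 0) (by simp) (by simp)).hasDerivAt
      refine this.congr' ?_
      filter_upwards [self_mem_nhdsWithin] with s hs
      have hs : s ≠ 0 := hs
      rw [slope_def_field, hf, ← hG]
      simp only [sub_zero]
      field_simp
  have hinteg : ∀ σ : ℝ, σ ≠ 0 → (Integrable fun y : ℝ => cexp (t * (σ + y * I)) *
      (hker l κ (σ + y * I) / (σ + y * I) ^ 2 / Ξ (σ + y * I))) →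
      Tendsto (fun T : ℝ => ∫ y in (-T)..T, f (σ + y * I)) atTop
        (𝓝 (vertInt (fun s => hker l κ s / s ^ 2 / Ξ s) σ t)) := by
    intro σ hσ hI
    have e : (fun y : ℝ => f (σ + y * I)) = fun y : ℝ => cexp (t * (σ + y * I)) *
      (hker l κ (σ + y * I) / (σ + y * I) ^ 2 / Ξ (σ + y * I)) - G 0 * ((σ + y * I) ^ 2)⁻¹ := by
      funext y
      simp only [hf, hG, kerFun]
      ring
    have hI2 := (integrable_inv_sq_line hσ).const_mul (G 0)
    have hI3 : Integrable fun y : ℝ => f (σ + y * I) := by rw [e]; exact hI.sub hI2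
    have hv : ∫ y : ℝ, f (σ + y * I) = vertInt (fun s => hker l κ s / s ^ 2 / Ξ s) σ t := by
      rw [e, integral_sub hI hI2, integral_const_mul, integral_inv_sq_line hσ, mul_zero, sub_zero,
        vertInt]
    rw [← hv]
    exact intervalIntegral_tendsto_integral hI3 tendsto_neg_atTop_atBot tendsto_id
  have l1 := hinteg (1 / 4) (by norm_num)
    (hX.integrable_vert (half_pos hκ) hd hP le_rfl (by norm_num) (by norm_num [abs_of_neg]) t)
  have l2 := hinteg (-1) (by norm_num) (h.integrable_left hC hκ t)
  have hhor : ∀ ε : ℝ, |ε| = 1 → Tendsto (fun T : ℝ => ∫ x in (-1 : ℝ)..(1 / 4), f (x + (ε * T : ℝ) * I))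
      atTop (𝓝 0) := by
    intro ε hε
    have hz : Tendsto (fun T : ℝ => (M + ‖G 0‖) * (T ^ 2)⁻¹ * |1 / 4 - (-1)|) atTop (𝓝 0) := by
      have : Tendsto (fun T : ℝ => (T ^ 2)⁻¹) atTop (𝓝 0) :=
        tendsto_inv_atTop_zero.comp (tendsto_pow_atTop two_ne_zero)
      simpa using (this.const_mul (M + ‖G 0‖)).mul_const |(1 / 4 : ℝ) - (-1)|
    refine squeeze_zero_norm' ?_ hz
    filter_upwards [eventually_ge_atTop 1] with T hT
    refine intervalIntegral.norm_integral_le_of_norm_le_const fun x hx => ?_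
    rw [Set.uIoc_of_le (by norm_num)] at hx
    have him : |((x : ℂ) + (ε * T : ℝ) * I).im| = T := by
      rw [im_line, abs_mul, hε, one_mul, abs_of_pos (by linarith)]
    have hTn : T ≤ ‖(x : ℂ) + (ε * T : ℝ) * I‖ := by
      rw [← him]; exact (abs_im_le_norm _).trans (by rw [him])
    have hb := hM ((x : ℂ) + (ε * T : ℝ) * I) (by rw [re_line]; exact hx.1.le)
      (by rw [re_line]; exact hx.2) (by rw [him]; exact hT)
    have hM0 : 0 ≤ M := (norm_nonneg _).trans hb
    simp only [hf]
    rw [← sub_mul, norm_mul, norm_inv, norm_pow]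
    gcongr
    exact (norm_sub_le _ _).trans (by gcongr)
  have h1 := hhor (-1) (by simp)
  have h2 := hhor 1 (by simp)
  simp only [one_mul, neg_one_mul] at h1 h2
  have hlim := ((h1.sub h2).add (l1.const_smul I)).sub (l2.const_smul I)
  have hlim2 : Tendsto (fun T : ℝ => rectInt f (-1) (1 / 4) (-T) T) atTop
      (𝓝 (2 * π * I * deriv G 0)) :=
    tendsto_const_nhds.congr' (by
      filter_upwards [eventually_gt_atTop 0] with T hT
      exact (hrect T hT).symm)
  have := tendsto_nhds_unique hlim2 hlim
  rw [sub_zero, zero_add, ← smul_sub, smul_eq_mul] at this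
  refine mul_left_cancel₀ I_ne_zero ?_
  rw [← this]
  ring

end ZetaData

namespace ZetaData

variable {l ρ κ : ℝ} {Ξ : ℂ → ℂ} {a : ℕ → ℤ} {C : ℝ}

lemma deriv_kerFun (h : ZetaData l ρ Ξ a) (κ t : ℝ) : deriv (kerFun l κ Ξ t) 0 =
    cexp (κ * (3 / 4) ^ 2) * (-(4 / ρ)) *
      (t - 3 / 2 * κ + l - 1 - Real.eulerMascheroniConstant - deriv Ξ 0 / ρ) := by
  have hρ : (ρ : ℂ) ≠ 0 := by exact_mod_cast h.pos.ne'
  have h1 : HasDerivAt (fun s : ℂ => cexp (t * s)) (1 * t) 0 := by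
    simpa using ((hasDerivAt_id (0 : ℂ)).const_mul (t : ℂ)).cexp
  have h2 : HasDerivAt (fun s : ℂ => cexp (κ * (s - 3 / 4) ^ 2))
      (cexp (κ * (3 / 4) ^ 2) * (-(3 / 2) * κ)) 0 := by
    have := ((((hasDerivAt_id (0 : ℂ)).sub_const (3 / 4)).pow 2).const_mul (κ : ℂ)).cexp
    refine this.congr_deriv ?_
    simp
    ring
  have h3 : HasDerivAt (fun s : ℂ => 4 * (s - 1)) 4 0 := by
    simpa using ((hasDerivAt_id (0 : ℂ)).sub_const 1).const_mul 4
  have h4 : HasDerivAt (fun s : ℂ => cexp (s * l)) l 0 := by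
    simpa using ((hasDerivAt_id (0 : ℂ)).mul_const (l : ℂ)).cexp
  have h5 : HasDerivAt (fun s : ℂ => Gamma (1 + s / 2) ^ 2)
      (-Real.eulerMascheroniConstant) 0 := by
    have hg : HasDerivAt Gamma (-Real.eulerMascheroniConstant : ℂ) (1 + 0 / 2) := by
      simpa using hasDerivAt_Gamma_one
    have hl : HasDerivAt (fun s : ℂ => 1 + s / 2) (1 / 2) 0 := by
      simpa using ((hasDerivAt_id (0 : ℂ)).div_const 2).const_add 1
    have := (hg.comp (0 : ℂ) hl).pow 2
    refine this.congr_deriv ?_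
    simp
    ring
  have h6 := ((h.diff 0).hasDerivAt).inv (by rw [h.map_zero]; exact hρ)
  have h7 := h1.mul ((h2.mul (((h3.mul h4).mul h5))).mul h6)
  have h8 : kerFun l κ Ξ t = (fun s : ℂ => cexp (t * s)) * (((fun s : ℂ => cexp (κ * (s - 3 / 4) ^ 2)) *
      (((fun s : ℂ => 4 * (s - 1)) * fun s : ℂ => cexp (s * l)) *
        fun s : ℂ => Gamma (1 + s / 2) ^ 2)) * Ξ⁻¹) := by
    funext s
    simp [kerFun, hker, zetaNum]
    ring
  rw [h8, h7.deriv]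
  simp only [Pi.mul_apply, Pi.inv_apply, h.map_zero]
  simp
  field_simp
  ring

/-- The main inequality, before removing the smoothing. -/
lemma norm_smooth_sub_le (h : ZetaData l ρ Ξ a) (hM : MertensBound a) (hκ : 0 < κ) (t : ℝ) :
    ‖(Real.exp (3 / 4 * t) * mertensSmooth a κ t : ℂ) - 2 * π * deriv (kerFun l κ Ξ t) 0‖ ≤
      2 * π * Real.exp (κ / 16) * Real.exp (t / 2) +
      Real.exp (-t) * Real.exp (κ * 4) * (2 * π * (4 * (π ^ 2 / 6) ^ 2 * Real.exp (-3 * l))) := by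
  obtain ⟨C, hC0, hC⟩ := hM.exists_bound
  have h1 := h.norm_vertInt_sub_le hM hκ t
  have h2 := h.norm_vertInt_left_le hC hκ t
  have h3 := h.vertInt_shift hC hC0 hκ t
  rw [h.vertInt_three_quarters hC hκ] at h1
  rw [← h3]
  refine le_trans ?_ ((norm_add_le _ _).trans (add_le_add h1 h2))
  refine le_of_eq (congrArg _ ?_)
  ring

lemma abs_summatory_exp_add_le (h : ZetaData l ρ Ξ a) (hM : MertensBound a) {t : ℝ}
    (ht : ContinuousAt (mertensWave a) t) :
    |summatory a (Real.exp t) + 4 / ρ * (t + l - 1 - Real.eulerMascheroniConstant -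
      (deriv Ξ 0).re / ρ)| ≤
      Real.exp (t / 2) + 4 * (π ^ 2 / 6) ^ 2 * Real.exp (-3 * l) * Real.exp (-t) := by
  obtain ⟨C, hC0, hC⟩ := hM.exists_bound
  have hκ : ∀ f : ℝ → ℝ, Continuous f → Tendsto f (𝓝[>] 0) (𝓝 (f 0)) := fun f hf =>
    (hf.tendsto 0).mono_left nhdsWithin_le_nhds
  have hL : Tendsto (fun κ : ℝ => ‖(Real.exp (3 / 4 * t) * mertensSmooth a κ t : ℂ) -
      2 * π * deriv (kerFun l κ Ξ t) 0‖) (𝓝[>] 0) (𝓝 ‖(Real.exp (3 / 4 * t) *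
      (2 * π * mertensWave a t : ℝ) : ℂ) - 2 * π * (cexp ((0 : ℝ) * (3 / 4) ^ 2) * (-(4 / ρ)) *
      (t - 3 / 2 * (0 : ℝ) + l - 1 - Real.eulerMascheroniConstant - deriv Ξ 0 / ρ))‖) := by
    refine Tendsto.norm (Tendsto.sub ?_ ?_)
    · exact ((continuous_ofReal.tendsto _).comp (tendsto_mertensSmooth hC ht)).const_mul _
    · simp_rw [h.deriv_kerFun]
      have : Continuous fun κ : ℝ => (2 * π * (cexp (κ * (3 / 4) ^ 2) * (-(4 / ρ)) *
        (t - 3 / 2 * κ + l - 1 - Real.eulerMascheroniConstant - deriv Ξ 0 / ρ)) : ℂ) := by fun_prop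
      exact (this.tendsto 0).mono_left nhdsWithin_le_nhds
  have hR := hκ (fun κ => 2 * π * Real.exp (κ / 16) * Real.exp (t / 2) +
      Real.exp (-t) * Real.exp (κ * 4) * (2 * π * (4 * (π ^ 2 / 6) ^ 2 * Real.exp (-3 * l))))
    (by fun_prop)
  have key := le_of_tendsto_of_tendsto hL hR (by
    filter_upwards [self_mem_nhdsWithin] with κ hκ
    exact h.norm_smooth_sub_le hM hκ t)
  have hw : Real.exp (3 / 4 * t) * (2 * π * mertensWave a t) = 2 * π * summatory a (Real.exp t) := by
    have : Real.exp (3 / 4 * t) * Real.exp (-(3 / 4) * t) = 1 := by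
      rw [← Real.exp_add, Real.exp_eq_one_iff]; ring
    rw [mertensWave]
    linear_combination (2 * π * summatory a (Real.exp t)) * this
  have hw' : (Real.exp (3 / 4 * t) * (2 * π * mertensWave a t : ℝ) : ℂ) =
      2 * π * summatory a (Real.exp t) := by exact_mod_cast congrArg ofReal hw
  rw [hw'] at key
  simp only [ofReal_zero, zero_mul, Complex.exp_zero, mul_zero, sub_zero, zero_div, Real.exp_zero,
    one_mul, mul_one] at key
  rw [show (2 * π * summatory a (Real.exp t) : ℂ) - 2 * π * (-(4 / ρ) *
      (t + l - 1 - Real.eulerMascheroniConstant - deriv Ξ 0 / ρ)) = ((2 * π : ℝ) : ℂ) *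
      (summatory a (Real.exp t) + (4 / ρ : ℝ) * ((t + l - 1 - Real.eulerMascheroniConstant : ℝ) -
        deriv Ξ 0 / ρ)) by push_cast; ring, norm_mul, norm_real, Real.norm_of_nonneg (by positivity),
    show 2 * π * Real.exp (t / 2) + Real.exp (-t) * (2 * π * (4 * (π ^ 2 / 6) ^ 2 *
      Real.exp (-3 * l))) = 2 * π * (Real.exp (t / 2) + 4 * (π ^ 2 / 6) ^ 2 * Real.exp (-3 * l) *
        Real.exp (-t)) by ring] at key
  have key2 := le_of_mul_le_mul_left key (by positivity)
  refine le_trans ?_ ((abs_re_le_norm _).trans key2)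
  refine le_of_eq (congrArg _ ?_)
  rw [add_re, ofReal_re, re_ofReal_mul, sub_re, ofReal_re, div_ofReal_re]

lemma continuousAt_mertensWave (a : ℕ → ℤ) {n : ℕ} {t : ℝ} (h1 : (n : ℝ) < Real.exp t)
    (h2 : Real.exp t < n + 1) : ContinuousAt (mertensWave a) t := by
  refine ContinuousAt.mul ?_ (by fun_prop)
  have hev : ∀ᶠ u in 𝓝 t, summatory a (Real.exp u) = summatory a n := by
    have c1 : ∀ᶠ u in 𝓝 t, (n : ℝ) < Real.exp u :=
      Real.continuous_exp.continuousAt.eventually (lt_mem_nhds h1)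
    have c2 : ∀ᶠ u in 𝓝 t, Real.exp u < n + 1 :=
      Real.continuous_exp.continuousAt.eventually (gt_mem_nhds h2)
    filter_upwards [c1, c2] with u hu1 hu2
    rw [summatory, summatory, (Nat.floor_eq_iff (Real.exp_pos u).le).2 ⟨hu1.le, hu2⟩,
      Nat.floor_natCast]
  exact continuousAt_const.congr (hev.mono fun u hu => hu.symm)

/-- Under the Mertens-type bound, the Mertens function stays within `√n + O(1/n)` of the
contribution of the double pole at the origin. -/
theorem abs_summatory_add_le (h : ZetaData l ρ Ξ a) (hM : MertensBound a) {n : ℕ} (hn : 1 ≤ n) :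
    |summatory a n + 4 / ρ * (Real.log n + l - 1 - Real.eulerMascheroniConstant -
      (deriv Ξ 0).re / ρ)| ≤ √n + 4 * (π ^ 2 / 6) ^ 2 * Real.exp (-3 * l) / n := by
  have hn0 : (0 : ℝ) < n := by exact_mod_cast hn
  have hL : Tendsto (fun t : ℝ => |summatory a n + 4 / ρ * (t + l - 1 -
      Real.eulerMascheroniConstant - (deriv Ξ 0).re / ρ)|) (𝓝[>] (Real.log n)) (𝓝 _) :=
    (Continuous.tendsto (by fun_prop) (Real.log n)).mono_left nhdsWithin_le_nhds
  have hR : Tendsto (fun t : ℝ => Real.exp (t / 2) + 4 * (π ^ 2 / 6) ^ 2 * Real.exp (-3 * l) *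
      Real.exp (-t)) (𝓝[>] (Real.log n)) (𝓝 _) :=
    (Continuous.tendsto (by fun_prop) (Real.log n)).mono_left nhdsWithin_le_nhds
  have key := le_of_tendsto_of_tendsto hL hR (by
    have c2 : ∀ᶠ t in 𝓝[>] (Real.log n), t < Real.log (n + 1) :=
      nhdsWithin_le_nhds (gt_mem_nhds (Real.log_lt_log hn0 (by linarith)))
    filter_upwards [self_mem_nhdsWithin, c2] with t ht1 ht2
    have h1 : (n : ℝ) < Real.exp t := by rw [← Real.exp_log hn0]; exact Real.exp_lt_exp.2 ht1
    have h2 : Real.exp t < n + 1 := by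
      rw [← Real.exp_log (show (0 : ℝ) < n + 1 by linarith)]; exact Real.exp_lt_exp.2 ht2
    have := h.abs_summatory_exp_add_le hM (continuousAt_mertensWave a h1 h2)
    rwa [summatory, (Nat.floor_eq_iff (Real.exp_pos t).le).2 ⟨h1.le, h2⟩,
      ← Nat.floor_natCast (R := ℝ) n] at this)
  rw [Real.exp_neg, Real.exp_log hn0] at key
  have e : Real.exp (Real.log n / 2) = √n := by
    rw [Real.sqrt_eq_rpow, Real.rpow_def_of_pos hn0]; ring_nf
  rw [e, ← div_eq_mul_inv] at key
  exact key

end ZetaData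

/-- An even, completely multiplicative, `D`-periodic function that is its own finite Fourier
transform, up to the factor `√D`. -/
structure EvenChar (D : ℕ) (χ : ℤ → ℤ) : Prop where
  one_lt : 1 < D
  map_zero : χ 0 = 0
  map_one : χ 1 = 1
  map_mul : ∀ m n, χ (m * n) = χ m * χ n
  map_neg : ∀ n, χ (-n) = χ n
  periodic : ∀ n, χ (n + D) = χ n
  abs_le : ∀ n, |χ n| ≤ 1
  gauss : ∀ k : ℤ, ∑ r ∈ Finset.range D, (χ r : ℂ) * cexp (2 * π * I * (r * k / D)) = √D * χ k

namespace EvenChar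

open ArithmeticFunction

variable {D : ℕ} {χ : ℤ → ℤ}

/-- The restriction of `χ` to `ℕ` as an arithmetic function. -/
def toArith (h : EvenChar D χ) : ArithmeticFunction ℤ := ⟨fun n => χ n, h.map_zero⟩

/-- The number of ideals of given norm. -/
def idealCount (h : EvenChar D χ) : ArithmeticFunction ℤ :=
  (zeta : ArithmeticFunction ℤ) * h.toArith

/-- The Dirichlet inverse of `idealCount`. -/
def idealMoebius (h : EvenChar D χ) : ArithmeticFunction ℤ :=
  moebius * ArithmeticFunction.pmul moebius h.toArith

lemma toArith_apply (h : EvenChar D χ) (n : ℕ) : h.toArith n = χ n := rfl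

lemma toArith_mul (h : EvenChar D χ) (f : ArithmeticFunction ℤ) :
    h.toArith * ArithmeticFunction.pmul f h.toArith =
      ArithmeticFunction.pmul ((zeta : ArithmeticFunction ℤ) * f) h.toArith := by
  ext n
  rw [mul_apply, pmul_apply, mul_apply, Finset.sum_mul]
  refine Finset.sum_congr rfl fun p hp => ?_
  obtain ⟨rfl, hn⟩ := Nat.mem_divisorsAntidiagonal.1 hp
  have h1 : p.1 ≠ 0 := left_ne_zero_of_mul hn
  simp only [pmul_apply, toArith_apply, Nat.cast_mul, h.map_mul, natCoe_apply, zeta_apply, h1]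
  simp
  ring

lemma idealCount_mul_idealMoebius (h : EvenChar D χ) : h.idealCount * h.idealMoebius = 1 := by
  have h1 : h.toArith * ArithmeticFunction.pmul moebius h.toArith = 1 := by
    rw [toArith_mul, coe_zeta_mul_moebius]
    ext n
    rw [pmul_apply, one_apply]
    split_ifs with hn
    · subst hn; simp [toArith_apply, h.map_one]
    · simp
  rw [idealCount, idealMoebius, mul_mul_mul_comm, coe_zeta_mul_moebius, h1, mul_one]

lemma isMultiplicative_toArith (h : EvenChar D χ) : h.toArith.IsMultiplicative :=
  ⟨by simp [toArith_apply, h.map_one], fun _ => by simp [toArith_apply, h.map_mul]⟩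

lemma isMultiplicative_idealCount (h : EvenChar D χ) : h.idealCount.IsMultiplicative :=
  isMultiplicative_zeta.natCast.mul h.isMultiplicative_toArith

lemma eq_zero_or (h : EvenChar D χ) (n : ℤ) : χ n = 0 ∨ χ n = 1 ∨ χ n = -1 := by
  have := _root_.abs_le.1 (h.abs_le n)
  omega

lemma map_pow (h : EvenChar D χ) (n : ℤ) (k : ℕ) : χ (n ^ k) = χ n ^ k := by
  induction k with
  | zero => simp [h.map_one]
  | succ k ih => rw [pow_succ, h.map_mul, ih, pow_succ]

lemma idealCount_nonneg (h : EvenChar D χ) (n : ℕ) : 0 ≤ h.idealCount n := by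
  rcases eq_or_ne n 0 with rfl | hn
  · simp
  rw [h.isMultiplicative_idealCount.multiplicative_factorization _ hn]
  refine Finset.prod_nonneg fun p hp => ?_
  have hp : p.Prime := Nat.prime_of_mem_primeFactors hp
  simp only [idealCount]
  rw [coe_zeta_mul_apply, Nat.sum_divisors_prime_pow hp]
  simp only [toArith_apply, Nat.cast_pow, h.map_pow]
  rcases h.eq_zero_or p with e | e | e <;> rw [e]
  · exact Finset.sum_nonneg fun i _ => by positivity
  · simp; positivity
  · rw [neg_one_geom_sum]; split_ifs <;> norm_num

lemma idealCount_one (h : EvenChar D χ) : h.idealCount 1 = 1 :=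
  h.isMultiplicative_idealCount.map_one

lemma abs_toArith_le (h : EvenChar D χ) (n : ℕ) : |h.toArith n| ≤ 1 := h.abs_le n

end EvenChar

lemma LSeriesSummable_of_abs_le_one {f : ArithmeticFunction ℤ} (hf : ∀ n, |f n| ≤ 1) {s : ℂ}
    (hs : 1 < s.re) : LSeriesSummable (fun n => ((f : ArithmeticFunction ℂ) n)) s := by
  refine LSeriesSummable_of_bounded_of_one_lt_re (m := 1) (fun n _ => ?_) hs
  rw [ArithmeticFunction.intCoe_apply, Complex.norm_intCast]
  exact_mod_cast hf n

lemma norm_LSeries_two_le {f : ArithmeticFunction ℤ} (hf : ∀ n, |f n| ≤ 1) {s : ℂ}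
    (hs : s.re = 2) : ‖LSeries (fun n => ((f : ArithmeticFunction ℂ) n)) s‖ ≤ π ^ 2 / 6 := by
  rw [← hasSum_zeta_two.tsum_eq]
  refine tsum_of_norm_bounded hasSum_zeta_two.summable.hasSum fun n => ?_
  rcases eq_or_ne n 0 with rfl | hn
  · simp
  rw [LSeries.norm_term_eq, if_neg hn, hs, ArithmeticFunction.intCoe_apply, Complex.norm_intCast]
  have : |(f n : ℝ)| ≤ 1 := by exact_mod_cast hf n
  rw [show ((n : ℝ) ^ (2 : ℝ)) = (n : ℝ) ^ 2 by norm_cast]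
  gcongr

namespace EvenChar

open ArithmeticFunction

variable {D : ℕ} {χ : ℤ → ℤ}

lemma abs_moebius_mul_le (h : EvenChar D χ) (n : ℕ) :
    |ArithmeticFunction.pmul moebius h.toArith n| ≤ 1 := by
  rw [pmul_apply, abs_mul]
  exact mul_le_one₀ abs_moebius_le_one (abs_nonneg _) (h.abs_toArith_le n)

lemma summable_idealMoebius (h : EvenChar D χ) {s : ℂ} (hs : 1 < s.re) :
    LSeriesSummable (fun n => (h.idealMoebius n : ℂ)) s := by
  have := LSeriesSummable_mul (LSeriesSummable_of_abs_le_one (f := moebius)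
    (fun n => abs_moebius_le_one) hs) (LSeriesSummable_of_abs_le_one h.abs_moebius_mul_le hs)
  rw [← intCoe_mul] at this
  exact this

lemma norm_LSeries_idealMoebius_le (h : EvenChar D χ) {s : ℂ} (hs : s.re = 2) :
    ‖LSeries (fun n => (h.idealMoebius n : ℂ)) s‖ ≤ (π ^ 2 / 6) ^ 2 := by
  have hs1 : 1 < s.re := by rw [hs]; norm_num
  have := LSeries_mul' (LSeriesSummable_of_abs_le_one (f := moebius)
    (fun n => abs_moebius_le_one) hs1) (LSeriesSummable_of_abs_le_one h.abs_moebius_mul_le hs1)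
  rw [← intCoe_mul] at this
  change LSeries (fun n => (h.idealMoebius n : ℂ)) s = _ at this
  rw [this, norm_mul, sq]
  exact mul_le_mul (norm_LSeries_two_le (fun n => abs_moebius_le_one) hs)
    (norm_LSeries_two_le h.abs_moebius_mul_le hs) (norm_nonneg _) (by positivity)

lemma abs_zeta_le (n : ℕ) : |(zeta : ArithmeticFunction ℤ) n| ≤ 1 := by
  rw [natCoe_apply, zeta_apply]
  split_ifs <;> simp

lemma summable_idealCount (h : EvenChar D χ) {s : ℂ} (hs : 1 < s.re) :
    LSeriesSummable (fun n => (h.idealCount n : ℂ)) s := by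
  have := LSeriesSummable_mul (LSeriesSummable_of_abs_le_one abs_zeta_le hs)
    (LSeriesSummable_of_abs_le_one h.abs_toArith_le hs)
  rw [← intCoe_mul] at this
  exact this

lemma norm_LSeries_idealCount_le (h : EvenChar D χ) {s : ℂ} (hs : s.re = 2) :
    ‖LSeries (fun n => (h.idealCount n : ℂ)) s‖ ≤ (π ^ 2 / 6) ^ 2 := by
  have hs1 : 1 < s.re := by rw [hs]; norm_num
  have := LSeries_mul' (LSeriesSummable_of_abs_le_one abs_zeta_le hs1)
    (LSeriesSummable_of_abs_le_one h.abs_toArith_le hs1)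
  rw [← intCoe_mul] at this
  change LSeries (fun n => (h.idealCount n : ℂ)) s = _ at this
  rw [this, norm_mul, sq]
  exact mul_le_mul (norm_LSeries_two_le abs_zeta_le hs)
    (norm_LSeries_two_le h.abs_toArith_le hs) (norm_nonneg _) (by positivity)

lemma LSeries_idealCount_mul (h : EvenChar D χ) {s : ℂ} (hs : 1 < s.re) :
    LSeries (fun n => (h.idealCount n : ℂ)) s * LSeries (fun n => (h.idealMoebius n : ℂ)) s = 1 := by
  have := LSeries_mul' (f := (h.idealCount : ArithmeticFunction ℂ))
    (g := (h.idealMoebius : ArithmeticFunction ℂ)) (h.summable_idealCount hs)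
    (h.summable_idealMoebius hs)
  rw [← intCoe_mul, h.idealCount_mul_idealMoebius, intCoe_one] at this
  refine Eq.trans this.symm ?_
  exact (congrArg (fun f => LSeries f s) one_eq_delta).trans (congrFun LSeries_delta s)

end EvenChar

namespace EvenChar

open HurwitzZeta

/-- The theta series `∑ χ(n) exp(-π n² u² / D)` over all integers. -/
def charTheta (χ : ℤ → ℤ) (D : ℕ) (u : ℝ) : ℝ :=
  ∑ r ∈ Finset.range D, (χ r : ℝ) * evenKernel ((r / D : ℝ) : UnitAddCircle) (D * u ^ 2)

variable {D : ℕ} {χ : ℤ → ℤ}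

lemma pos (h : EvenChar D χ) : (0 : ℝ) < D := by
  have := h.one_lt
  exact_mod_cast (by omega : 0 < D)

lemma periodic_mul (h : EvenChar D χ) (n m : ℤ) : χ (n + D * m) = χ n := by
  induction m using Int.induction_on with
  | zero => simp
  | succ m ih => rw [← ih, ← h.periodic (n + D * m)]; ring_nf
  | pred m ih => rw [← ih, ← h.periodic (n + D * (-m - 1))]; ring_nf

lemma hasSum_charTheta (h : EvenChar D χ) {u : ℝ} (hu : 0 < u) :
    HasSum (fun n : ℤ => (χ n : ℝ) * Real.exp (-π * n ^ 2 * (u ^ 2 / D))) (charTheta χ D u) := by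
  have hD := h.pos
  have key : ∀ r ∈ Finset.range D, HasSum (fun n : ℤ => if n % D = r then
      (χ n : ℝ) * Real.exp (-π * n ^ 2 * (u ^ 2 / D)) else 0)
      ((χ r : ℝ) * evenKernel ((r / D : ℝ) : UnitAddCircle) (D * u ^ 2)) := by
    intro r hr
    have hr : r < D := Finset.mem_range.1 hr
    have hinj : Function.Injective (fun m : ℤ => (r : ℤ) + D * m) := by
      intro m m' hm
      have hD' : D ≠ 0 := by exact_mod_cast hD.ne'
      simpa [hD'] using hm
    refine (hinj.hasSum_iff ?_).1 ?_
    · intro n hn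
      rw [if_neg]
      intro hnr
      exact hn ⟨n / D, by simp only [← hnr]; exact Int.emod_add_mul_ediv n D⟩
    · have := (hasSum_int_evenKernel (r / D) (show 0 < D * u ^ 2 by positivity)).mul_left (χ r : ℝ)
      refine this.congr_fun ?_
      intro m
      simp only [Function.comp_apply]
      have e : ((r : ℤ) + D * m) % D = r := by
        rw [Int.add_mul_emod_self_left, Int.emod_eq_of_lt (by positivity) (by exact_mod_cast hr)]
      rw [if_pos e, h.periodic_mul]
      congr 2
      push_cast
      field_simp
      ring
  refine (hasSum_sum key).congr_fun fun n => ?_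
  have hD' : (D : ℤ) ≠ 0 := by exact_mod_cast hD.ne'
  have h0 := Int.emod_nonneg n hD'
  have h1 := Int.emod_lt_of_pos n (show (0 : ℤ) < D by exact_mod_cast hD)
  rw [Finset.sum_eq_single (n % D).toNat]
  · rw [if_pos (by omega)]
  · intro b _ hb
    rw [if_neg (by omega)]
  · intro hb
    exact absurd (Finset.mem_range.2 (by omega)) hb

lemma charTheta_one_div (h : EvenChar D χ) {u : ℝ} (hu : 0 < u) :
    charTheta χ D (1 / u) = u * charTheta χ D u := by
  have hD := h.pos
  have ht : 0 < u ^ 2 / D := by positivity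
  have key := hasSum_sum (s := Finset.range D) fun r _ =>
    (hasSum_int_cosKernel (r / D) ht).mul_left (χ r : ℂ)
  have h2 := (Complex.hasSum_ofReal.2 (h.hasSum_charTheta hu)).mul_left (√D : ℂ)
  have e := key.unique (h2.congr_fun fun n => ?_)
  · have e3 : ∀ r : ℕ, evenKernel ((r / D : ℝ) : UnitAddCircle) (D * (1 / u) ^ 2) =
        u / √D * cosKernel ((r / D : ℝ) : UnitAddCircle) (u ^ 2 / D) := by
      intro r
      rw [evenKernel_functional_equation]
      congr 1
      · rw [← Real.sqrt_eq_rpow, Real.sqrt_mul hD.le, Real.sqrt_sq (by positivity)]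
        field_simp
      · congr 1; field_simp
    have e4 : ∑ r ∈ Finset.range D, (χ r : ℝ) * cosKernel ((r / D : ℝ) : UnitAddCircle) (u ^ 2 / D)
        = √D * charTheta χ D u := by exact_mod_cast e
    rw [charTheta]
    simp only [e3]
    have hs : √(D : ℝ) ≠ 0 := (Real.sqrt_pos.2 hD).ne'
    calc _ = u / √D * ∑ r ∈ Finset.range D,
        (χ r : ℝ) * cosKernel ((r / D : ℝ) : UnitAddCircle) (u ^ 2 / D) := by
          rw [Finset.mul_sum]; exact Finset.sum_congr rfl fun _ _ => by ring
      _ = _ := by rw [e4]; field_simp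
  · have := h.gauss n
    push_cast
    rw [← mul_assoc, ← this, Finset.sum_mul]
    refine Finset.sum_congr rfl fun r _ => ?_
    rw [show 2 * (π : ℂ) * I * (r / D) * n = 2 * π * I * (r * n / D) by ring]
    ring

lemma continuousOn_charTheta (h : EvenChar D χ) : ContinuousOn (charTheta χ D) (Set.Ioi 0) := by
  have hD := h.pos
  refine continuousOn_finsetSum _ fun r _ => continuousOn_const.mul ?_
  refine (continuousOn_evenKernel _).comp (by fun_prop) fun u hu => ?_
  have : (0 : ℝ) < u := hu
  exact Set.mem_Ioi.2 (by positivity)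

lemma isBigO_charTheta (h : EvenChar D χ) (r : ℝ) :
    charTheta χ D =O[atTop] (fun u => u ^ r) := by
  have hD := h.pos
  refine Asymptotics.IsBigO.fun_sum (A := fun (m : ℕ) (u : ℝ) =>
    (χ m : ℝ) * evenKernel ((m / D : ℝ) : UnitAddCircle) (D * u ^ 2)) fun m hm => ?_
  rcases eq_or_ne m 0 with rfl | hm0
  · simp only [Nat.cast_zero, h.map_zero]
    simpa using Asymptotics.isBigO_zero _ _
  refine Asymptotics.IsBigO.const_mul_left ?_ _
  obtain ⟨p, hp, hO⟩ := isBigO_atTop_evenKernel_sub ((m / D : ℝ) : UnitAddCircle)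
  have hne : ((m / D : ℝ) : UnitAddCircle) ≠ 0 := by
    intro h0
    obtain ⟨k, hk⟩ := (AddCircle.coe_eq_zero_iff (1 : ℝ)).1 h0
    have hm1 : (m : ℝ) / D < 1 := by
      rw [div_lt_one hD]; exact_mod_cast Finset.mem_range.1 hm
    have hm2 : 0 < (m : ℝ) / D := by positivity
    rw [← hk] at hm1 hm2
    simp only [zsmul_eq_mul, mul_one] at hm1 hm2
    have : k < 1 := by exact_mod_cast hm1
    have : 0 < k := by exact_mod_cast hm2
    omega
  simp only [hne, if_false, sub_zero] at hO
  have h1 : Tendsto (fun u : ℝ => D * u ^ 2) atTop atTop :=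
    (tendsto_pow_atTop two_ne_zero).const_mul_atTop hD
  have h2 := (hO.trans (isLittleO_exp_neg_mul_rpow_atTop hp (r / 2)).isBigO).comp_tendsto h1
  refine h2.trans (Asymptotics.IsBigO.of_bound (|(D : ℝ) ^ (r / 2)|) ?_)
  filter_upwards [eventually_gt_atTop 0] with u hu
  simp only [Function.comp_apply]
  rw [Real.mul_rpow hD.le (by positivity), ← Real.rpow_natCast u 2, ← Real.rpow_mul hu.le, norm_mul,
    Real.norm_eq_abs]
  rw [Nat.cast_ofNat, mul_div_cancel₀ r two_ne_zero, ← Real.norm_eq_abs]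

/-- The theta series as a Mellin pair of weight one. -/
def thetaPair (h : EvenChar D χ) : WeakFEPair ℂ where
  f u := charTheta χ D u
  g u := charTheta χ D u
  k := 1
  ε := 1
  f₀ := 0
  g₀ := 0
  hf_int := (continuous_ofReal.comp_continuousOn h.continuousOn_charTheta).locallyIntegrableOn
    measurableSet_Ioi
  hg_int := (continuous_ofReal.comp_continuousOn h.continuousOn_charTheta).locallyIntegrableOn
    measurableSet_Ioi
  hk := one_pos
  hε := one_ne_zero
  h_feq x hx := by rw [h.charTheta_one_div hx]; simp
  hf_top r := by
    simp only [sub_zero]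
    exact Asymptotics.IsBigO.of_norm_left (by simpa using (h.isBigO_charTheta r).norm_left)
  hg_top r := by
    simp only [sub_zero]
    exact Asymptotics.IsBigO.of_norm_left (by simpa using (h.isBigO_charTheta r).norm_left)

lemma isStrong_thetaPair (h : EvenChar D χ) : IsStrongFEPair h.thetaPair := ⟨rfl, rfl⟩

lemma integrableOn_charTheta (h : EvenChar D χ) (σ : ℝ) :
    IntegrableOn (fun u => u ^ σ * charTheta χ D u) (Set.Ioi 0) := by
  have := (h.isStrong_thetaPair.hasMellin ((σ : ℂ) + 1)).1
  rw [MellinConvergent] at this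
  have h2 := this.re
  refine (integrableOn_congr_fun (fun u hu => ?_) measurableSet_Ioi).1 h2
  have hu : (0 : ℝ) < u := hu
  change ((u : ℂ) ^ ((σ : ℂ) + 1 - 1) • ((charTheta χ D u : ℝ) : ℂ)).re = _
  rw [add_sub_cancel_right, ← ofReal_cpow hu.le, smul_eq_mul, ← ofReal_mul, ofReal_re]

lemma integral_charTheta_div (h : EvenChar D χ) :
    ∫ u in Set.Ioi 0, charTheta χ D u / u = ∫ u in Set.Ioi 0, charTheta χ D u := by
  rw [← integral_comp_rpow_Ioi (charTheta χ D) (p := -1) (by norm_num)]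
  refine setIntegral_congr_fun measurableSet_Ioi fun u hu => ?_
  have hu : (0 : ℝ) < u := hu
  simp only [Real.rpow_neg_one, smul_eq_mul]
  rw [← one_div, h.charTheta_one_div hu, show (-1 - 1 : ℝ) = ((-2 : ℤ) : ℝ) by norm_num,
    Real.rpow_intCast]
  rw [abs_neg, abs_one, zpow_neg]
  field_simp

lemma hasSum_charTheta_pnat (h : EvenChar D χ) {u : ℝ} (hu : 0 < u) :
    HasSum (fun n : ℕ+ => 2 * ((χ n : ℝ) * Real.exp (-π * n ^ 2 * (u ^ 2 / D))))
      (charTheta χ D u) := by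
  have h1 := (h.hasSum_charTheta hu).nat_add_neg
  simp only [h.map_zero, Int.cast_zero, zero_mul, add_zero, h.map_neg] at h1
  refine ((PNat.coe_injective.hasSum_iff (fun n hn => ?_)).2 h1).congr_fun fun n => ?_
  · have : n = 0 := by
      by_contra h0
      exact hn ⟨⟨n, Nat.pos_of_ne_zero h0⟩, rfl⟩
    subst this
    simp [h.map_zero]
  · simp only [Function.comp_apply]
    push_cast
    ring_nf

end EvenChar

/-- The Jacobi theta function without its constant term. -/
def psiTheta (v : ℝ) : ℝ := HurwitzZeta.evenKernel 0 (v ^ 2) - 1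

lemma psiTheta_one_div {v : ℝ} (hv : 0 < v) : psiTheta (1 / v) = v * psiTheta v + v - 1 := by
  rw [psiTheta, psiTheta, HurwitzZeta.evenKernel_functional_equation,
    ← HurwitzZeta.evenKernel_eq_cosKernel_of_zero, ← Real.sqrt_eq_rpow,
    Real.sqrt_sq (by positivity)]
  rw [show 1 / (1 / v) ^ 2 = v ^ 2 by field_simp, show 1 / (1 / v) = v by field_simp]
  ring

lemma hasSum_psiTheta {v : ℝ} (hv : 0 < v) :
    HasSum (fun n : ℕ+ => 2 * Real.exp (-π * n ^ 2 * v ^ 2)) (psiTheta v) := by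
  have h1 := HurwitzZeta.hasSum_nat_cosKernel₀ 0 (show 0 < v ^ 2 by positivity)
  refine (Equiv.pnatEquivNat.symm.hasSum_iff.1 ?_)
  rw [psiTheta, HurwitzZeta.evenKernel_eq_cosKernel_of_zero]
  refine h1.congr_fun fun n => ?_
  simp [Equiv.pnatEquivNat]

lemma hasMellin_gaussian {b : ℝ} (hb : 0 < b) {s : ℂ} (hs : 0 < s.re) :
    HasMellin (fun x : ℝ => ((Real.exp (-b * x ^ 2) : ℝ) : ℂ)) s
      (1 / 2 * (b : ℂ) ^ (-(s / 2)) * Gamma (s / 2)) := by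
  have hs2 : 0 < (s / (2 : ℝ)).re := by
    rw [div_ofReal_re]; positivity
  set g : ℝ → ℂ := fun t => (fun y : ℝ => ((Real.exp (-y) : ℝ) : ℂ)) (b * t) with hg
  have e : (fun x : ℝ => ((Real.exp (-b * x ^ 2) : ℝ) : ℂ)) = fun x : ℝ => g (x ^ (2 : ℝ)) := by
    funext x
    simp [hg]
  have h1 : MellinConvergent (fun y : ℝ => ((Real.exp (-y) : ℝ) : ℂ)) (s / (2 : ℝ)) := by
    have := GammaIntegral_convergent hs2
    simp only [mul_comm] at this
    exact this
  rw [e]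
  constructor
  · rw [MellinConvergent.comp_rpow two_ne_zero]
    exact (MellinConvergent.comp_mul_left hb).2 h1
  · rw [mellin_comp_rpow, hg, mellin_comp_mul_left (fun y : ℝ => ((Real.exp (-y) : ℝ) : ℂ)) _ hb,
      ← GammaIntegral_eq_mellin,
      ← Gamma_eq_integral hs2]
    simp only [abs_two, real_smul, smul_eq_mul]
    push_cast
    ring

lemma cpow_eq_exp_log {x : ℝ} (hx : 0 < x) (w : ℂ) : (x : ℂ) ^ w = cexp (Real.log x * w) := by
  rw [cpow_def_of_ne_zero (by exact_mod_cast hx.ne'), ofReal_log hx.le]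

/-- The kernel `∫ exp(-π (y² / u² + u² / D)) du / u`. -/
def divKernel (D y : ℝ) : ℝ :=
  ∫ u in Set.Ioi 0, Real.exp (-π * (y ^ 2 / u ^ 2)) * Real.exp (-π * (u ^ 2 / D)) / u

section divKernel

variable {D : ℝ}

lemma exp_neg_le_pow {t : ℝ} (ht : 0 < t) (j : ℕ) : Real.exp (-t) ≤ j.factorial / t ^ j := by
  rw [Real.exp_neg, inv_le_comm₀ (Real.exp_pos _) (by positivity), inv_div]
  exact Real.pow_div_factorial_le_exp t ht.le j

lemma divKernel_integrand_le {y u : ℝ} (hy : 0 < y) (hu : 0 < u) (j : ℕ) :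
    Real.exp (-π * (y ^ 2 / u ^ 2)) * Real.exp (-π * (u ^ 2 / D)) / u ≤
      j.factorial / (π ^ j * y ^ (2 * j)) *
        (u ^ ((2 * j - 1 : ℝ)) * Real.exp (-(π / D) * u ^ 2)) := by
  have h1 := exp_neg_le_pow (show 0 < π * (y ^ 2 / u ^ 2) by positivity) j
  rw [← neg_mul] at h1
  have e : u ^ ((2 * j - 1 : ℝ)) = u ^ (2 * j) / u := by
    rw [Real.rpow_sub_one hu.ne', ← Real.rpow_natCast u (2 * j)]
    push_cast
    rfl
  rw [e, show -(π / D) * u ^ 2 = -π * (u ^ 2 / D) by ring]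
  calc _ ≤ j.factorial / (π * (y ^ 2 / u ^ 2)) ^ j * Real.exp (-π * (u ^ 2 / D)) / u := by gcongr
    _ = _ := by
      rw [mul_pow, div_pow, ← pow_mul, ← pow_mul]
      field_simp

lemma integrableOn_gauss_moment (hD : 0 < D) {j : ℕ} (hj : 1 ≤ j) :
    IntegrableOn (fun u : ℝ => u ^ ((2 * j - 1 : ℝ)) * Real.exp (-(π / D) * u ^ 2)) (Set.Ioi 0) := by
  have : (1 : ℝ) ≤ j := by exact_mod_cast hj
  exact integrableOn_rpow_mul_exp_neg_mul_sq (by positivity) (by linarith)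

lemma integrableOn_divKernel (hD : 0 < D) {y : ℝ} (hy : 0 < y) :
    IntegrableOn (fun u : ℝ => Real.exp (-π * (y ^ 2 / u ^ 2)) * Real.exp (-π * (u ^ 2 / D)) / u)
      (Set.Ioi 0) := by
  refine Integrable.mono' ((integrableOn_gauss_moment hD le_rfl).const_mul
    ((1 : ℕ).factorial / (π ^ 1 * y ^ (2 * 1))))
    (Measurable.aestronglyMeasurable (by fun_prop)) ?_
  refine (ae_restrict_iff' measurableSet_Ioi).2 (ae_of_all _ fun u hu => ?_)
  have hu : (0 : ℝ) < u := hu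
  rw [Real.norm_of_nonneg (by positivity)]
  exact divKernel_integrand_le hy hu 1

lemma divKernel_le (hD : 0 < D) {j : ℕ} (hj : 1 ≤ j) :
    ∃ C, 0 ≤ C ∧ ∀ y, 0 < y → divKernel D y ≤ C / y ^ (2 * j) := by
  refine ⟨j.factorial / π ^ j *
    ∫ u in Set.Ioi 0, u ^ ((2 * j - 1 : ℝ)) * Real.exp (-(π / D) * u ^ 2), ?_, fun y hy => ?_⟩
  · refine mul_nonneg (by positivity) (setIntegral_nonneg measurableSet_Ioi fun u hu => ?_)
    have hu : (0 : ℝ) < u := hu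
    positivity
  · rw [div_mul_eq_mul_div, div_div, ← div_mul_eq_mul_div, ← integral_const_mul]
    exact setIntegral_mono_on (integrableOn_divKernel hD hy)
      ((integrableOn_gauss_moment hD hj).const_mul _) measurableSet_Ioi
      fun u hu => divKernel_integrand_le hy hu j

lemma divKernel_nonneg (D y : ℝ) : 0 ≤ divKernel D y := by
  refine setIntegral_nonneg measurableSet_Ioi fun u hu => ?_
  have hu : (0 : ℝ) < u := hu
  positivity

lemma divKernel_pos (hD : 0 < D) {y : ℝ} (hy : 0 < y) : 0 < divKernel D y := by
  rw [divKernel, setIntegral_pos_iff_support_of_nonneg_ae _ (integrableOn_divKernel hD hy)]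
  · have : Set.Ioi (0 : ℝ) ⊆ Function.support (fun u : ℝ => Real.exp (-π * (y ^ 2 / u ^ 2)) *
        Real.exp (-π * (u ^ 2 / D)) / u) := by
      intro u hu
      have hu : (0 : ℝ) < u := hu
      exact (by positivity : (0 : ℝ) < _).ne'
    rw [Set.inter_eq_right.2 this]
    simp
  · refine (ae_restrict_iff' measurableSet_Ioi).2 (ae_of_all _ fun u hu => ?_)
    have hu : (0 : ℝ) < u := hu
    simp only [Pi.zero_apply]
    positivity

lemma antitoneOn_divKernel (hD : 0 < D) : AntitoneOn (divKernel D) (Set.Ioi 0) := by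
  intro y hy z hz hyz
  have hy : 0 < y := hy
  refine setIntegral_mono_on (integrableOn_divKernel hD hz) (integrableOn_divKernel hD hy)
    measurableSet_Ioi fun u hu => ?_
  have hu : (0 : ℝ) < u := hu
  have : -π * (z ^ 2 / u ^ 2) ≤ -π * (y ^ 2 / u ^ 2) := by
    rw [neg_mul, neg_mul, neg_le_neg_iff]; gcongr
  gcongr

lemma integral_eq_divKernel {m n x : ℝ} (hn : 0 < n) :
    ∫ u in Set.Ioi 0, Real.exp (-π * m ^ 2 * (x / u) ^ 2) * Real.exp (-π * n ^ 2 * (u ^ 2 / D)) / u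
      = divKernel D (m * n * x) := by
  have := integral_comp_mul_left_Ioi (fun u : ℝ => Real.exp (-π * ((m * n * x) ^ 2 / u ^ 2)) *
    Real.exp (-π * (u ^ 2 / D)) / u) 0 hn
  rw [mul_zero, smul_eq_mul, eq_inv_mul_iff_mul_eq₀ hn.ne'] at this
  rw [divKernel, ← this, ← integral_const_mul]
  refine setIntegral_congr_fun measurableSet_Ioi fun u hu => ?_
  have hu : (0 : ℝ) < u := hu
  rw [show -π * ((m * n * x) ^ 2 / (n * u) ^ 2) = -π * m ^ 2 * (x / u) ^ 2 by field_simp,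
    show -π * ((n * u) ^ 2 / D) = -π * n ^ 2 * (u ^ 2 / D) by ring]
  field_simp

lemma norm_cpow_sub_one {x : ℝ} (hx : 0 < x) (s : ℂ) :
    ‖(x : ℂ) ^ (s - 1)‖ = x ^ (s.re - 1) := by
  rw [norm_cpow_eq_rpow_re_of_pos hx]
  simp

lemma integrable_mellin_divKernel (hD : 0 < D) {s : ℂ} (hs : 0 < s.re) :
    Integrable (Function.uncurry fun x u : ℝ => (x : ℂ) ^ (s - 1) *
      ((Real.exp (-π * (x ^ 2 / u ^ 2)) * Real.exp (-π * (u ^ 2 / D)) / u : ℝ) : ℂ))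
      ((volume.restrict (Set.Ioi 0)).prod (volume.restrict (Set.Ioi 0))) := by
  have hm : Measurable (Function.uncurry fun x u : ℝ => (x : ℂ) ^ (s - 1) *
      ((Real.exp (-π * (x ^ 2 / u ^ 2)) * Real.exp (-π * (u ^ 2 / D)) / u : ℝ) : ℂ)) := by
    unfold Function.uncurry
    fun_prop
  have hx : ∀ u : ℝ, 0 < u → HasMellin (fun x : ℝ => ((Real.exp (-(π / u ^ 2) * x ^ 2) : ℝ) : ℂ))
      (s.re : ℂ) _ := fun u hu => hasMellin_gaussian (by positivity) (by simpa using hs)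
  have hx' : ∀ u : ℝ, 0 < u → HasMellin (fun x : ℝ => ((Real.exp (-(π / u ^ 2) * x ^ 2) : ℝ) : ℂ))
      s _ := fun u hu => hasMellin_gaussian (by positivity) hs
  rw [integrable_prod_iff' hm.aestronglyMeasurable]
  constructor
  · refine (ae_restrict_iff' measurableSet_Ioi).2 (ae_of_all _ fun u hu => ?_)
    have hu : (0 : ℝ) < u := hu
    have := ((hx' u hu).1.integrable).mul_const ((Real.exp (-π * (u ^ 2 / D)) / u : ℝ) : ℂ)
    refine this.congr (ae_of_all _ fun x => ?_)
    simp only [Function.uncurry, smul_eq_mul]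
    rw [show -π * (x ^ 2 / u ^ 2) = -(π / u ^ 2) * x ^ 2 by ring]
    push_cast
    ring
  · have hi : IntegrableOn (fun u : ℝ => 1 / 2 * π ^ (-(s.re / 2)) * Real.Gamma (s.re / 2) *
        (u ^ (s.re - 1) * Real.exp (-(π / D) * u ^ 2))) (Set.Ioi 0) :=
      (integrableOn_rpow_mul_exp_neg_mul_sq (by positivity) (by linarith)).const_mul _
    refine hi.congr ((ae_restrict_iff' measurableSet_Ioi).2 (ae_of_all _ fun u hu => ?_))
    have hu : (0 : ℝ) < u := hu
    have h2 := integral_rpow_mul_exp_neg_mul_rpow (p := 2) (q := s.re - 1) (b := π / u ^ 2)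
      two_pos (by linarith) (by positivity)
    rw [show -(s.re - 1 + 1) / 2 = -(s.re / 2) by ring, show (s.re - 1 + 1) / 2 = s.re / 2 by ring,
      Real.div_rpow (by positivity) (by positivity), ← Real.rpow_natCast u 2,
      ← Real.rpow_mul hu.le, show ((2 : ℕ) : ℝ) * -(s.re / 2) = -s.re by push_cast; ring,
      Real.rpow_neg hu.le s.re, div_inv_eq_mul] at h2
    calc _ = (∫ x in Set.Ioi 0, x ^ (s.re - 1) * Real.exp (-(π / u ^ (2 : ℝ)) * x ^ (2 : ℝ))) *
          (Real.exp (-π * (u ^ 2 / D)) / u) := by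
          simp only []
          rw [Real.rpow_sub_one hu.ne', show -(π / D) * u ^ 2 = -π * (u ^ 2 / D) by ring]
          norm_cast at h2 ⊢
          rw [h2]
          ring
      _ = _ := by
        rw [← integral_mul_const]
        refine setIntegral_congr_fun measurableSet_Ioi fun x hx => ?_
        have hx : (0 : ℝ) < x := hx
        simp only [Function.uncurry]
        rw [norm_mul, norm_cpow_sub_one hx, norm_real, Real.norm_of_nonneg (by positivity),
          show -π * (x ^ 2 / u ^ 2) = -(π / u ^ 2) * x ^ 2 by ring]
        norm_cast
        ring

/-- The Mellin transform of the kernel. -/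
lemma hasMellin_divKernel (hD : 0 < D) {s : ℂ} (hs : 0 < s.re) :
    HasMellin (fun x : ℝ => (divKernel D x : ℂ)) s
      (1 / 4 * (π : ℂ) ^ (-(s / 2)) * ((π / D : ℝ) : ℂ) ^ (-(s / 2)) * Gamma (s / 2) ^ 2) := by
  have h1 := integrable_mellin_divKernel hD hs
  have e : ∀ x : ℝ, ∫ u in Set.Ioi 0, (x : ℂ) ^ (s - 1) *
      ((Real.exp (-π * (x ^ 2 / u ^ 2)) * Real.exp (-π * (u ^ 2 / D)) / u : ℝ) : ℂ) =
      (x : ℂ) ^ (s - 1) * divKernel D x := by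
    intro x
    refine (integral_const_mul _ _).trans ?_
    congr 1
    exact integral_ofReal
  constructor
  · refine h1.integral_prod_left.congr (ae_of_all _ fun x => ?_)
    simp only [Function.uncurry]
    rw [e x, smul_eq_mul]
  · have h2 := integral_integral_swap h1
    rw [mellin]
    simp only [smul_eq_mul]
    simp only [e] at h2
    rw [h2]
    have h3 := (hasMellin_gaussian (show 0 < π / D by positivity) hs).2
    rw [mellin] at h3
    rw [show (1 / 4 * (π : ℂ) ^ (-(s / 2)) * ((π / D : ℝ) : ℂ) ^ (-(s / 2)) * Gamma (s / 2) ^ 2) =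
      (1 / 2 * (π : ℂ) ^ (-(s / 2)) * Gamma (s / 2)) *
      (1 / 2 * ((π / D : ℝ) : ℂ) ^ (-(s / 2)) * Gamma (s / 2)) by ring, ← h3, ← integral_const_mul]
    refine setIntegral_congr_fun measurableSet_Ioi fun u hu => ?_
    have hu : (0 : ℝ) < u := hu
    have hu' : (u : ℂ) ≠ 0 := by exact_mod_cast hu.ne'
    have h4 := (hasMellin_gaussian (show 0 < π / u ^ 2 by positivity) hs).2
    rw [mellin] at h4
    calc _ = (∫ x : ℝ in Set.Ioi 0, (x : ℂ) ^ (s - 1) • ((Real.exp (-(π / u ^ 2) * x ^ 2) : ℝ) : ℂ)) *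
          ((Real.exp (-π * (u ^ 2 / D)) / u : ℝ) : ℂ) := by
          rw [← integral_mul_const]
          refine setIntegral_congr_fun measurableSet_Ioi fun x _ => ?_
          simp only [smul_eq_mul]
          rw [show -π * (x ^ 2 / u ^ 2) = -(π / u ^ 2) * x ^ 2 by ring]
          push_cast
          ring
      _ = _ := by
        rw [h4, cpow_eq_exp_log (by positivity : 0 < π / u ^ 2), Real.log_div (by positivity)
          (by positivity), Real.log_pow, cpow_eq_exp_log Real.pi_pos, cpow_sub _ _ hu', cpow_one,
          cpow_eq_exp_log hu, show ((Real.log π - (2 : ℕ) * Real.log u : ℝ) : ℂ) * -(s / 2) =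
          Real.log π * -(s / 2) + Real.log u * s by push_cast; ring, Complex.exp_add, smul_eq_mul,
          show -(π / D) * u ^ 2 = -π * (u ^ 2 / D) by ring]
        push_cast
        ring

end divKernel

namespace EvenChar

variable {D : ℕ} {χ : ℤ → ℤ}

/-- The theta function `4 ∑ c(N) k(N x)` attached to the ideal counting function. -/
def dedekindTheta (h : EvenChar D χ) (x : ℝ) : ℝ :=
  ∑' N : ℕ, 4 * ((h.idealCount N : ℝ) * divKernel D (N * x))

lemma summable_idealCount_div (h : EvenChar D χ) {j : ℕ} (hj : 1 ≤ j) :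
    Summable fun N : ℕ => (h.idealCount N : ℝ) / (N : ℝ) ^ (2 * j) := by
  have hs : 1 < ((2 * j : ℕ) : ℂ).re := by
    rw [natCast_re]; exact_mod_cast (by omega : 1 < 2 * j)
  have := (h.summable_idealCount hs).norm
  refine this.congr fun N => ?_
  rcases eq_or_ne N 0 with rfl | hN
  · simp
  rw [LSeries.term_of_ne_zero hN, cpow_natCast, norm_div, norm_pow, norm_natCast, norm_intCast,
    ← Int.cast_abs, abs_of_nonneg (h.idealCount_nonneg N)]

lemma idealCount_mul_divKernel_le (h : EvenChar D χ) {j : ℕ} {C : ℝ}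
    (hC : ∀ y, 0 < y → divKernel D y ≤ C / y ^ (2 * j)) {x : ℝ} (hx : 0 < x) (N : ℕ) :
    4 * ((h.idealCount N : ℝ) * divKernel D (N * x)) ≤
      4 * C / x ^ (2 * j) * ((h.idealCount N : ℝ) / (N : ℝ) ^ (2 * j)) := by
  rcases eq_or_ne N 0 with rfl | hN
  · simp
  have hN' : (0 : ℝ) < N := by positivity
  have h0 : (0 : ℝ) ≤ h.idealCount N := by exact_mod_cast h.idealCount_nonneg N
  have := mul_le_mul_of_nonneg_left (hC (N * x) (by positivity)) h0
  calc _ ≤ 4 * (h.idealCount N * (C / (N * x) ^ (2 * j))) := by linarith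
    _ = _ := by rw [mul_pow]; field_simp

lemma dedekindTheta_term_nonneg (h : EvenChar D χ) (x : ℝ) (N : ℕ) :
    0 ≤ 4 * ((h.idealCount N : ℝ) * divKernel D (N * x)) := by
  have h0 : (0 : ℝ) ≤ h.idealCount N := by exact_mod_cast h.idealCount_nonneg N
  have := divKernel_nonneg D (N * x)
  positivity

lemma summable_dedekindTheta (h : EvenChar D χ) {x : ℝ} (hx : 0 < x) :
    Summable fun N : ℕ => 4 * ((h.idealCount N : ℝ) * divKernel D (N * x)) := by
  obtain ⟨C, -, hC⟩ := divKernel_le h.pos (le_refl 1)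
  exact Summable.of_nonneg_of_le (h.dedekindTheta_term_nonneg x)
    (h.idealCount_mul_divKernel_le hC hx) ((h.summable_idealCount_div le_rfl).mul_left _)

lemma dedekindTheta_nonneg (h : EvenChar D χ) (x : ℝ) : 0 ≤ h.dedekindTheta x :=
  tsum_nonneg (h.dedekindTheta_term_nonneg x)

lemma le_dedekindTheta (h : EvenChar D χ) {x : ℝ} (hx : 0 < x) :
    4 * divKernel D x ≤ h.dedekindTheta x := by
  have := (h.summable_dedekindTheta hx).le_tsum 1 fun N _ => h.dedekindTheta_term_nonneg x N
  simpa [h.idealCount_one, dedekindTheta] using this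

lemma dedekindTheta_pos (h : EvenChar D χ) {x : ℝ} (hx : 0 < x) : 0 < h.dedekindTheta x :=
  (by linarith [divKernel_pos h.pos hx] : 0 < 4 * divKernel D x).trans_le (h.le_dedekindTheta hx)

lemma dedekindTheta_le (h : EvenChar D χ) {j : ℕ} (hj : 1 ≤ j) :
    ∃ C, ∀ x, 0 < x → h.dedekindTheta x ≤ C / x ^ (2 * j) := by
  obtain ⟨C, -, hC⟩ := divKernel_le h.pos hj
  refine ⟨4 * C * ∑' N : ℕ, (h.idealCount N : ℝ) / (N : ℝ) ^ (2 * j), fun x hx => ?_⟩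
  rw [mul_div_right_comm, ← tsum_mul_left]
  exact (h.summable_dedekindTheta hx).tsum_le_tsum (h.idealCount_mul_divKernel_le hC hx)
    ((h.summable_idealCount_div hj).mul_left _)

lemma antitoneOn_dedekindTheta (h : EvenChar D χ) :
    AntitoneOn h.dedekindTheta (Set.Ioi 0) := by
  intro x hx y hy hxy
  have hx : 0 < x := hx
  have hy : 0 < y := hy
  refine (h.summable_dedekindTheta hy).tsum_le_tsum (fun N => ?_) (h.summable_dedekindTheta hx)
  rcases eq_or_ne N 0 with rfl | hN
  · simp
  have hN' : (0 : ℝ) < N := by positivity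
  have h0 : (0 : ℝ) ≤ h.idealCount N := by exact_mod_cast h.idealCount_nonneg N
  have := antitoneOn_divKernel h.pos (show 0 < N * x by positivity) (show 0 < N * y by positivity)
    (by gcongr)
  gcongr

lemma isBigO_dedekindTheta (h : EvenChar D χ) (r : ℝ) :
    h.dedekindTheta =O[atTop] fun x => x ^ r := by
  obtain ⟨j, hj⟩ := exists_nat_ge (max 1 (-r))
  have hj1 : 1 ≤ j := by exact_mod_cast (le_max_left _ _).trans hj
  obtain ⟨C, hC⟩ := h.dedekindTheta_le hj1
  refine Asymptotics.IsBigO.of_bound |C| ?_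
  filter_upwards [eventually_ge_atTop 1] with x hx
  have hx0 : 0 < x := by linarith
  rw [Real.norm_of_nonneg (h.dedekindTheta_nonneg x), Real.norm_of_nonneg (by positivity)]
  refine (hC x hx0).trans ?_
  rw [div_eq_mul_inv, ← Real.rpow_natCast, ← Real.rpow_neg hx0.le]
  refine mul_le_mul (le_abs_self _) (Real.rpow_le_rpow_of_exponent_le hx ?_) (by positivity)
    (abs_nonneg _)
  have := (le_max_right _ _).trans hj
  push_cast
  have : (0:ℝ) ≤ j := by positivity
  linarith

lemma locallyIntegrableOn_dedekindTheta (h : EvenChar D χ) :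
    LocallyIntegrableOn (fun x => (h.dedekindTheta x : ℂ)) (Set.Ioi 0) := by
  rw [locallyIntegrableOn_iff isOpen_Ioi.isLocallyClosed]
  intro k hk hkc
  exact Integrable.ofReal ((h.antitoneOn_dedekindTheta.mono hk).integrableOn_isCompact hkc)

lemma summable_prod_divKernel (h : EvenChar D χ) {x : ℝ} (hx : 0 < x) :
    Summable fun p : ℕ+ × ℕ+ => divKernel D (p.1 * p.2 * x) := by
  obtain ⟨C, hC0, hC⟩ := divKernel_le h.pos (le_refl 1)
  have hsum : Summable fun n : ℕ+ => 1 / (n : ℝ) ^ 2 :=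
    (Real.summable_one_div_nat_pow.2 one_lt_two).comp_injective PNat.coe_injective
  have := ((hsum.mul_of_nonneg hsum (fun n => by positivity)
    (fun n => by positivity)).mul_left (C / x ^ 2))
  refine Summable.of_nonneg_of_le (fun p => divKernel_nonneg _ _) (fun p => ?_) this
  have h1 : (0 : ℝ) < p.1 := by exact_mod_cast p.1.pos
  have h2 : (0 : ℝ) < p.2 := by exact_mod_cast p.2.pos
  refine (hC _ (by positivity)).trans (le_of_eq ?_)
  rw [mul_pow, mul_pow, mul_one]
  field_simp

lemma hasSum_dedekindTheta_prod (h : EvenChar D χ) {x : ℝ} (hx : 0 < x) :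
    HasSum (fun p : ℕ+ × ℕ+ => 4 * ((χ p.2 : ℝ) * divKernel D (p.1 * p.2 * x)))
      (h.dedekindTheta x) := by
  have hs : Summable (fun p : ℕ+ × ℕ+ => 4 * ((χ p.2 : ℝ) * divKernel D (p.1 * p.2 * x))) := by
    refine Summable.of_norm_bounded ((h.summable_prod_divKernel hx).mul_left 4) fun p => ?_
    rw [norm_mul, norm_mul, Real.norm_of_nonneg (divKernel_nonneg _ _), Real.norm_of_nonneg
      (by norm_num : (0:ℝ) ≤ 4), Real.norm_eq_abs, ← Int.cast_abs]
    have := divKernel_nonneg D (p.1 * p.2 * x)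
    have h1 : ((|χ p.2| : ℤ) : ℝ) ≤ 1 := by exact_mod_cast h.abs_le _
    nlinarith
  have h1 := (sigmaAntidiagonalEquivProd.hasSum_iff.2 hs.hasSum).sigma
    (g := fun N : ℕ+ => 4 * ((h.idealCount N : ℝ) * divKernel D (N * x))) fun N => ?_
  · have h2 : HasSum (fun N : ℕ+ => 4 * ((h.idealCount N : ℝ) * divKernel D (N * x)))
        (h.dedekindTheta x) := by
      refine (PNat.coe_injective.hasSum_iff (f := fun N : ℕ => 4 * ((h.idealCount N : ℝ) *
        divKernel D (N * x))) fun N hN => ?_).2 (h.summable_dedekindTheta hx).hasSum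
      have : N = 0 := by
        by_contra h0
        exact hN ⟨⟨N, Nat.pos_of_ne_zero h0⟩, rfl⟩
      simp [this]
    rw [h2.unique h1]
    exact hs.hasSum
  · have e : (4 * ((h.idealCount N : ℝ) * divKernel D (N * x))) =
        ∑ p ∈ (N : ℕ).divisorsAntidiagonal, 4 * ((χ p.2 : ℝ) * divKernel D (p.1 * p.2 * x)) := by
      rw [← Finset.mul_sum, idealCount, ArithmeticFunction.coe_zeta_mul_apply,
        ← Nat.sum_divisorsAntidiagonal' (f := fun _ b => h.toArith b), Int.cast_sum, Finset.sum_mul]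
      congr 1
      refine Finset.sum_congr rfl fun p hp => ?_
      rw [← (Nat.mem_divisorsAntidiagonal.1 hp).1]
      push_cast
      rfl
    rw [e, ← Finset.sum_coe_sort]
    exact hasSum_fintype _

lemma dedekindTheta_eq_integral (h : EvenChar D χ) {x : ℝ} (hx : 0 < x) :
    h.dedekindTheta x = ∫ u in Set.Ioi 0, psiTheta (x / u) * charTheta χ D u / u := by
  set F : ℕ+ × ℕ+ → ℝ → ℝ := fun p u => 4 * ((χ p.2 : ℝ) * (Real.exp (-π * (p.1 : ℝ) ^ 2 * (x / u) ^ 2)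
    * Real.exp (-π * (p.2 : ℝ) ^ 2 * (u ^ 2 / D)) / u)) with hF
  have hD := h.pos
  have hi : ∀ p : ℕ+ × ℕ+, IntegrableOn (fun u : ℝ => Real.exp (-π * (p.1 : ℝ) ^ 2 * (x / u) ^ 2)
      * Real.exp (-π * (p.2 : ℝ) ^ 2 * (u ^ 2 / D)) / u) (Set.Ioi 0) := by
    intro p
    have h1 : (0 : ℝ) < p.1 := by exact_mod_cast p.1.pos
    have h2 : (0 : ℝ) < p.2 := by exact_mod_cast p.2.pos
    by_contra hc
    have := integral_undef hc
    rw [integral_eq_divKernel h2] at this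
    exact (divKernel_pos h.pos (by positivity)).ne' this
  have hFi : ∀ p, IntegrableOn (F p) (Set.Ioi 0) := fun p => ((hi p).const_mul _).const_mul _
  have hval : ∀ p, ∫ u in Set.Ioi 0, F p u = 4 * ((χ p.2 : ℝ) * divKernel D (p.1 * p.2 * x)) := by
    intro p
    rw [← integral_eq_divKernel (by exact_mod_cast p.2.pos), ← integral_const_mul,
      ← integral_const_mul]
  have hnorm : ∀ p, ∫ u in Set.Ioi 0, ‖F p u‖ =
      4 * (|(χ p.2 : ℝ)| * divKernel D (p.1 * p.2 * x)) := by
    intro p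
    rw [← integral_eq_divKernel (by exact_mod_cast p.2.pos), ← integral_const_mul,
      ← integral_const_mul]
    refine setIntegral_congr_fun measurableSet_Ioi fun u hu => ?_
    have hu : (0 : ℝ) < u := hu
    rw [norm_mul, norm_mul, Real.norm_eq_abs (χ _ : ℝ), Real.norm_of_nonneg (by norm_num),
      Real.norm_of_nonneg (by positivity)]
  have hsum := hasSum_integral_of_summable_integral_norm hFi
    ((h.hasSum_dedekindTheta_prod hx).summable.norm.congr fun p => by
      rw [hnorm, norm_mul, norm_mul, Real.norm_of_nonneg (divKernel_nonneg _ _),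
        Real.norm_of_nonneg (by norm_num), Real.norm_eq_abs])
  simp only [hval] at hsum
  rw [(h.hasSum_dedekindTheta_prod hx).unique hsum]
  refine setIntegral_congr_fun measurableSet_Ioi fun u hu => ?_
  have hu : (0 : ℝ) < u := hu
  have h1 := hasSum_psiTheta (show 0 < x / u by positivity)
  have h2 := h.hasSum_charTheta_pnat hu
  have h3 := (h1.mul h2 (Summable.mul_norm h1.summable.norm h2.summable.norm).of_norm).div_const u
  refine (h3.congr_fun fun p => ?_).tsum_eq
  simp only [hF]
  ring

/-- The residue. -/
def residue (χ : ℤ → ℤ) (D : ℕ) : ℝ := ∫ u in Set.Ioi 0, charTheta χ D u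

lemma dedekindTheta_one_div (h : EvenChar D χ) {x : ℝ} (hx : 0 < x) :
    h.dedekindTheta (1 / x) = x * h.dedekindTheta x + residue χ D * x - residue χ D := by
  have hi : IntegrableOn (fun u => psiTheta (x / u) * charTheta χ D u / u) (Set.Ioi 0) := by
    by_contra hc
    have := integral_undef hc
    rw [← h.dedekindTheta_eq_integral hx] at this
    exact (h.dedekindTheta_pos hx).ne' this
  have h0 : IntegrableOn (fun u => charTheta χ D u) (Set.Ioi 0) := by
    simpa using h.integrableOn_charTheta 0
  have h1 : IntegrableOn (fun u => charTheta χ D u / u) (Set.Ioi 0) := by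
    refine (integrableOn_congr_fun (fun u hu => ?_) measurableSet_Ioi).1
      (h.integrableOn_charTheta (-1))
    rw [Real.rpow_neg_one]
    ring
  calc h.dedekindTheta (1 / x) = ∫ u in Set.Ioi 0, psiTheta (1 / x / u) * charTheta χ D u / u :=
      h.dedekindTheta_eq_integral (by positivity)
    _ = ∫ u in Set.Ioi 0, (x * (psiTheta (x / u) * charTheta χ D u / u) +
          x * (charTheta χ D u / u) - charTheta χ D u) := by
      rw [← integral_comp_rpow_Ioi _ (p := -1) (by norm_num)]
      refine setIntegral_congr_fun measurableSet_Ioi fun u hu => ?_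
      have hu : (0 : ℝ) < u := hu
      simp only [Real.rpow_neg_one, smul_eq_mul]
      rw [← one_div u, h.charTheta_one_div hu, show 1 / x / (1 / u) = 1 / (x / u) by field_simp,
        psiTheta_one_div (by positivity), show (-1 - 1 : ℝ) = ((-2 : ℤ) : ℝ) by norm_num,
        Real.rpow_intCast, abs_neg, abs_one, zpow_neg]
      norm_cast
      field_simp
    _ = _ := by
      have hadd : IntegrableOn (fun u => x * (psiTheta (x / u) * charTheta χ D u / u) +
        x * (charTheta χ D u / u)) (Set.Ioi 0) := (hi.const_mul x).add (h1.const_mul x)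
      rw [integral_sub hadd h0,
        integral_add (hi.const_mul x) (h1.const_mul x), integral_const_mul, integral_const_mul,
        h.integral_charTheta_div, ← h.dedekindTheta_eq_integral hx, residue]
      ring

lemma residue_pos (h : EvenChar D χ) : 0 < residue χ D := by
  have hk := h.dedekindTheta_pos one_pos
  obtain ⟨C, hC⟩ := h.dedekindTheta_le (le_refl 1)
  have hC0 : 0 ≤ C := by
    have := (h.dedekindTheta_nonneg 1).trans (hC 1 one_pos)
    simpa using this
  by_contra! hc
  set x := 1 + C / h.dedekindTheta 1 with hx
  have hx1 : 1 ≤ x := by rw [hx]; linarith [div_nonneg hC0 hk.le]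
  have hx0 : 0 < x := by linarith
  have h1 := h.dedekindTheta_one_div hx0
  have h2 : h.dedekindTheta 1 ≤ h.dedekindTheta (1 / x) :=
    h.antitoneOn_dedekindTheta (show 0 < 1 / x by positivity) (show (0:ℝ) < 1 by norm_num)
      (by rw [div_le_one hx0]; exact hx1)
  have h3 := mul_le_mul_of_nonneg_left (hC x hx0) hx0.le
  have h4 : x * (C / x ^ (2 * 1)) = C / x := by rw [mul_one]; field_simp
  have h5 : residue χ D * x - residue χ D ≤ 0 := by nlinarith
  have h6 : h.dedekindTheta 1 ≤ C / x := by linarith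
  rw [le_div_iff₀ hx0, hx, mul_add, mul_div_cancel₀ _ hk.ne'] at h6
  linarith

end EvenChar

namespace EvenChar

variable {D : ℕ} {χ : ℤ → ℤ}

/-- The pair of theta functions. -/
def dedekindPair (h : EvenChar D χ) : WeakFEPair ℂ where
  f x := h.dedekindTheta x + residue χ D
  g x := h.dedekindTheta x + residue χ D
  k := 1
  ε := 1
  f₀ := residue χ D
  g₀ := residue χ D
  hf_int := h.locallyIntegrableOn_dedekindTheta.add (locallyIntegrableOn_const _)
  hg_int := h.locallyIntegrableOn_dedekindTheta.add (locallyIntegrableOn_const _)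
  hk := one_pos
  hε := one_ne_zero
  h_feq x hx := by
    have := h.dedekindTheta_one_div hx
    rw [this, Real.rpow_one]
    push_cast
    rw [smul_eq_mul]
    ring
  hf_top r := by
    simp only [add_sub_cancel_right]
    exact Complex.isBigO_ofReal_left.2 (h.isBigO_dedekindTheta r)
  hg_top r := by
    simp only [add_sub_cancel_right]
    exact Complex.isBigO_ofReal_left.2 (h.isBigO_dedekindTheta r)

lemma mellin_dedekindTheta (h : EvenChar D χ) {s : ℂ} (hs : 1 < s.re) :
    mellin (fun x => (h.dedekindTheta x : ℂ)) s =
      4 * LSeries (fun n => (h.idealCount n : ℂ)) s * mellin (fun x => (divKernel D x : ℂ)) s := by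
  have hk := hasMellin_divKernel h.pos (show 0 < s.re by linarith)
  set g : ℝ → ℝ := fun x => ‖(x : ℂ) ^ (s - 1) • (divKernel D x : ℂ)‖ with hg
  set F : ℕ → ℝ → ℂ := fun N x => (x : ℂ) ^ (s - 1) •
    ((4 * ((h.idealCount N : ℝ) * divKernel D (N * x)) : ℝ) : ℂ) with hF
  have hFi : ∀ N, IntegrableOn (F N) (Set.Ioi 0) := by
    intro N
    rcases eq_or_ne N 0 with rfl | hN
    · simp [hF]
    have hN' : (0 : ℝ) < N := by positivity
    have := ((MellinConvergent.comp_mul_left (s := s) hN').2 hk.1).const_smul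
      (4 * (h.idealCount N : ℂ))
    refine this.congr_fun (fun x _ => ?_) measurableSet_Ioi
    simp only [hF, smul_eq_mul]
    push_cast
    ring
  have hnorm : ∀ N, ∫ x in Set.Ioi 0, ‖F N x‖ =
      4 * ‖LSeries.term (fun n => (h.idealCount n : ℂ)) s N‖ * ∫ x in Set.Ioi 0, g x := by
    intro N
    rcases eq_or_ne N 0 with rfl | hN
    · simp [hF]
    have hN' : (0 : ℝ) < N := by positivity
    have h1 := integral_comp_mul_left_Ioi g 0 hN'
    rw [mul_zero, smul_eq_mul, eq_inv_mul_iff_mul_eq₀ hN'.ne'] at h1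
    rw [← h1, ← mul_assoc, ← integral_const_mul]
    refine setIntegral_congr_fun measurableSet_Ioi fun x hx => ?_
    have hx : (0 : ℝ) < x := hx
    simp only [hF, hg]
    rw [LSeries.term_of_ne_zero hN, norm_smul, norm_smul, norm_cpow_sub_one hx,
      norm_cpow_sub_one (by positivity), norm_div, norm_natCast_cpow_of_pos (by positivity),
      ofReal_mul, norm_mul, ofReal_mul, norm_mul, norm_real (4 : ℝ), ofReal_intCast,
      Real.mul_rpow hN'.le hx.le, Real.rpow_sub_one hN'.ne',
      Real.norm_of_nonneg (by norm_num : (0 : ℝ) ≤ 4)]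
    have : (N : ℝ) ^ s.re ≠ 0 := (Real.rpow_pos_of_pos hN' _).ne'
    field_simp
  have hterm : ∀ N, ∫ x in Set.Ioi 0, F N x =
      4 * LSeries.term (fun n => (h.idealCount n : ℂ)) s N *
        mellin (fun x => (divKernel D x : ℂ)) s := by
    intro N
    rcases eq_or_ne N 0 with rfl | hN
    · simp [hF]
    have hN' : (0 : ℝ) < N := by positivity
    have h1 := mellin_comp_mul_left (fun x => (divKernel D x : ℂ)) s hN'
    rw [LSeries.term_of_ne_zero hN]
    rw [smul_eq_mul, mellin] at h1
    calc _ = 4 * (h.idealCount N : ℂ) * ∫ x : ℝ in Set.Ioi 0,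
          (x : ℂ) ^ (s - 1) • (divKernel D (N * x) : ℂ) := by
          rw [← integral_const_mul]
          refine setIntegral_congr_fun measurableSet_Ioi fun x _ => ?_
          simp only [hF, smul_eq_mul]
          push_cast
          ring
      _ = _ := by
        rw [h1, cpow_neg, ofReal_natCast]
        ring
  have hsum := hasSum_integral_of_summable_integral_norm hFi
    (((h.summable_idealCount hs).norm.mul_left 4).mul_right (∫ x in Set.Ioi 0, g x) |>.congr
      fun N => (hnorm N).symm)
  simp only [hterm] at hsum
  have h2 := (((h.summable_idealCount hs).hasSum.mul_left 4).mul_right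
    (mellin (fun x => (divKernel D x : ℂ)) s)).unique hsum
  rw [LSeries, h2, mellin]
  refine setIntegral_congr_fun measurableSet_Ioi fun x hx => ?_
  have hx : (0 : ℝ) < x := hx
  have h3 := (Complex.hasSum_ofReal.2 (h.summable_dedekindTheta hx).hasSum).mul_left
    ((x : ℂ) ^ (s - 1))
  exact h3.tsum_eq.symm

/-- The completed zeta function multiplied by `s (s - 1)`. -/
def xi (h : EvenChar D χ) (s : ℂ) : ℂ := s * (s - 1) * h.dedekindPair.Λ₀ s + residue χ D

lemma xi_eq (h : EvenChar D χ) {s : ℂ} (hs : 1 < s.re) :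
    h.xi s = s * (s - 1) * cexp (s * ((Real.log D / 2 - Real.log π : ℝ) : ℂ)) * Gamma (s / 2) ^ 2 *
      LSeries (fun n => (h.idealCount n : ℂ)) s := by
  have hD := h.pos
  have h1 := (h.dedekindPair.hasMellin (s := s) hs).2
  have h2 : mellin (fun x => h.dedekindPair.f x - h.dedekindPair.f₀) s =
      mellin (fun x => (h.dedekindTheta x : ℂ)) s := by
    congr 1
    ext x
    exact add_sub_cancel_right _ _
  rw [h2, h.mellin_dedekindTheta hs, (hasMellin_divKernel hD (by linarith)).2,
    cpow_eq_exp_log Real.pi_pos, cpow_eq_exp_log (by positivity : 0 < π / D),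
    Real.log_div (by positivity) (by positivity)] at h1
  have hs0 : s ≠ 0 := by rintro rfl; norm_num at hs
  have hs1 : s - 1 ≠ 0 := by
    intro h0
    rw [sub_eq_zero.1 h0] at hs
    norm_num at hs
  have hs1' : 1 - s ≠ 0 := by rw [← neg_sub]; exact neg_ne_zero.2 hs1
  have e : cexp (s * ((Real.log D / 2 - Real.log π : ℝ) : ℂ)) = cexp (Real.log π * -(s / 2)) *
      cexp ((Real.log π - Real.log D : ℝ) * -(s / 2)) := by
    rw [← Complex.exp_add]
    push_cast
    ring_nf
  rw [xi, WeakFEPair.Λ₀_eq, ← h1, e]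
  change s * (s - 1) * (_ + (1 / s) • (residue χ D : ℂ) + (1 / (((1 : ℝ) : ℂ) - s)) • (residue χ D : ℂ)) + _ = _
  rw [ofReal_one, smul_eq_mul, smul_eq_mul]
  field_simp
  ring

lemma f_modif_nonneg (h : EvenChar D χ) {x : ℝ} (hx : 0 < x) :
    ∃ y : ℝ, 0 ≤ y ∧ h.dedekindPair.f_modif x = y := by
  rcases lt_trichotomy x 1 with hx1 | rfl | hx1
  · refine ⟨1 / x * h.dedekindTheta (1 / x), mul_nonneg (by positivity)
      (h.dedekindTheta_nonneg _), ?_⟩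
    have h1 := h.dedekindTheta_one_div (show 0 < 1 / x by positivity)
    rw [one_div_one_div] at h1
    rw [WeakFEPair.f_modif, Pi.add_apply, Set.indicator_of_notMem (by simpa using hx1.le),
      Set.indicator_of_mem (Set.mem_Ioo.2 ⟨hx, hx1⟩), zero_add]
    change (h.dedekindTheta x : ℂ) + residue χ D - ((1 : ℂ) * ((x ^ (-1 : ℝ) : ℝ) : ℂ)) • (residue χ D : ℂ) = _
    rw [h1, Real.rpow_neg_one, smul_eq_mul]
    push_cast
    ring
  · exact ⟨0, le_rfl, by simp [WeakFEPair.f_modif]⟩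
  · refine ⟨h.dedekindTheta x, h.dedekindTheta_nonneg _, ?_⟩
    rw [WeakFEPair.f_modif, Pi.add_apply, Set.indicator_of_mem (by simpa using hx1),
      Set.indicator_of_notMem (fun hh => by linarith [hh.2]), add_zero]
    exact add_sub_cancel_right _ _

lemma re_Λ₀_nonneg (h : EvenChar D χ) (σ : ℝ) : 0 ≤ (h.dedekindPair.Λ₀ σ).re := by
  have h1 := h.dedekindPair.isStrongFEPair_toStrongFEPair.hasMellin (σ : ℂ)
  have h2 : h.dedekindPair.Λ₀ σ = ∫ x : ℝ in Set.Ioi 0, (x : ℂ) ^ ((σ : ℂ) - 1) •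
    h.dedekindPair.f_modif x := rfl
  rw [h2]
  have h3 : Integrable (fun x : ℝ => (x : ℂ) ^ ((σ : ℂ) - 1) • h.dedekindPair.f_modif x)
    (volume.restrict (Set.Ioi 0)) := h1.1
  have h4 := integral_re h3
  change ∫ x : ℝ in Set.Ioi 0, ((x : ℂ) ^ ((σ : ℂ) - 1) • h.dedekindPair.f_modif x).re = _ at h4
  refine le_of_le_of_eq ?_ h4
  refine setIntegral_nonneg measurableSet_Ioi fun x hx => ?_
  have hx : (0 : ℝ) < x := hx
  obtain ⟨y, hy, e⟩ := h.f_modif_nonneg hx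
  rw [e, smul_eq_mul, show (σ : ℂ) - 1 = ((σ - 1 : ℝ) : ℂ) by push_cast; rfl,
    ← ofReal_cpow hx.le, ← ofReal_mul, ofReal_re]
  positivity

lemma exists_norm_Λ₀_le (h : EvenChar D χ) :
    ∃ B, 0 ≤ B ∧ ∀ s : ℂ, 0 ≤ s.re → s.re ≤ 1 → ‖h.dedekindPair.Λ₀ s‖ ≤ B := by
  have hc : ∀ s : ℂ, Integrable (fun x : ℝ => ‖(x : ℂ) ^ (s - 1) • h.dedekindPair.f_modif x‖)
    (volume.restrict (Set.Ioi 0)) := fun s =>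
    (h.dedekindPair.isStrongFEPair_toStrongFEPair.hasMellin s).1.norm
  refine ⟨∫ x : ℝ in Set.Ioi 0, (‖(x : ℂ) ^ ((0 : ℂ) - 1) • h.dedekindPair.f_modif x‖ +
    ‖(x : ℂ) ^ ((1 : ℂ) - 1) • h.dedekindPair.f_modif x‖), integral_nonneg fun x => by positivity,
    fun s hs0 hs1 => ?_⟩
  refine (norm_integral_le_integral_norm _).trans ?_
  refine setIntegral_mono_on (hc s) ((hc 0).add (hc 1)) measurableSet_Ioi fun x hx => ?_
  have hx : (0 : ℝ) < x := hx
  rw [norm_smul, norm_smul, norm_smul, norm_cpow_sub_one hx, norm_cpow_sub_one hx,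
    norm_cpow_sub_one hx, ← add_mul]
  refine mul_le_mul_of_nonneg_right ?_ (norm_nonneg _)
  rw [zero_re, one_re]
  rcases le_total x 1 with h1 | h1
  · exact (Real.rpow_le_rpow_of_exponent_ge hx h1 (by linarith)).trans
      (le_add_of_nonneg_right (by positivity))
  · exact (Real.rpow_le_rpow_of_exponent_le h1 (by linarith)).trans
      (le_add_of_nonneg_left (by positivity))

lemma differentiable_xi (h : EvenChar D χ) : Differentiable ℂ h.xi :=
  ((differentiable_id.mul (differentiable_id.sub_const 1)).mul
    h.dedekindPair.differentiable_Λ₀).add_const _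

lemma Λ₀_one_sub (h : EvenChar D χ) (s : ℂ) :
    h.dedekindPair.Λ₀ (1 - s) = h.dedekindPair.Λ₀ s := by
  have h1 := h.dedekindPair.functional_equation₀ s
  have h2 : h.dedekindPair.symm.f_modif = h.dedekindPair.f_modif := by
    ext x
    simp [WeakFEPair.f_modif, WeakFEPair.symm, dedekindPair]
  rw [WeakFEPair.Λ₀, WeakFEPair.Λ₀, h2] at h1
  rw [WeakFEPair.Λ₀]
  refine Eq.trans ?_ (h1.trans (one_smul ℂ _))
  congr 1

/-- The analytic data attached to an even real primitive character. -/
theorem zetaData (h : EvenChar D χ) : ZetaData (Real.log D / 2 - Real.log π) (residue χ D) h.xi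
    (fun n => h.idealMoebius n) where
  diff := h.differentiable_xi
  symm s := by
    rw [xi, xi, Λ₀_one_sub]
    ring
  map_zero := by simp [xi]
  pos := h.residue_pos
  growth := by
    obtain ⟨B, hB0, hB⟩ := h.exists_norm_Λ₀_le
    have hρ := h.residue_pos
    refine ⟨B + residue χ D, 2, by positivity, by norm_num, fun s h0 h1 => ?_⟩
    have e1 : ‖s‖ ≤ Real.exp |s.im| := by
      have := norm_le_abs_re_add_abs_im s
      rw [abs_of_nonneg h0] at this
      linarith [Real.add_one_le_exp |s.im|]
    have e2 : ‖s - 1‖ ≤ Real.exp |s.im| := by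
      have := norm_le_abs_re_add_abs_im (s - 1)
      rw [sub_re, sub_im, one_re, one_im, sub_zero, abs_of_nonpos (by linarith)] at this
      linarith [Real.add_one_le_exp |s.im|]
    have e3 : Real.exp (2 * |s.im|) = Real.exp |s.im| * Real.exp |s.im| := by
      rw [← Real.exp_add]; ring_nf
    have e4 : 1 ≤ Real.exp (2 * |s.im|) := Real.one_le_exp (by positivity)
    rw [xi]
    calc _ ≤ ‖s‖ * ‖s - 1‖ * ‖h.dedekindPair.Λ₀ s‖ + residue χ D := by
          refine (norm_add_le _ _).trans ?_
          rw [norm_mul, norm_mul, norm_real, Real.norm_of_nonneg hρ.le]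
      _ ≤ Real.exp |s.im| * Real.exp |s.im| * B + residue χ D * Real.exp (2 * |s.im|) := by
          refine add_le_add (mul_le_mul (mul_le_mul e1 e2 (norm_nonneg _) (by positivity))
            (hB s h0 h1) (norm_nonneg _) (by positivity)) ?_
          exact le_mul_of_one_le_right hρ.le e4
      _ = _ := by rw [e3]; ring
  summable s hs := h.summable_idealMoebius hs
  eq_gamma s hs := by
    rw [h.xi_eq hs, mul_assoc, h.LSeries_idealCount_mul hs, mul_one]
  norm_two s hs := h.norm_LSeries_idealMoebius_le hs

lemma re_deriv_xi_zero_nonpos (h : EvenChar D χ) : (deriv h.xi 0).re ≤ 0 := by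
  have h1 : HasDerivAt h.xi ((1 * (0 - 1) + 0 * 1) * h.dedekindPair.Λ₀ 0 +
      0 * (0 - 1) * deriv h.dedekindPair.Λ₀ 0) 0 :=
    (((hasDerivAt_id (0 : ℂ)).mul ((hasDerivAt_id (0 : ℂ)).sub_const 1)).mul
      (h.dedekindPair.differentiable_Λ₀ 0).hasDerivAt).add_const _
  have h2 := h.re_Λ₀_nonneg 0
  rw [ofReal_zero] at h2
  rw [h1.deriv]
  simpa using h2

lemma residue_le (h : EvenChar D χ) : residue χ D ≤ π ^ 2 / 18 * D := by
  have hD := h.pos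
  have h1 := h.xi_eq (s := 2) (by norm_num)
  have h2 := h.norm_LSeries_idealCount_le (s := 2) (by norm_num)
  have h3 := h.re_Λ₀_nonneg 2
  have h4 : residue χ D ≤ (h.xi 2).re := by
    rw [xi, add_re, ofReal_re, show (2 : ℂ) * (2 - 1) = ((2 : ℝ) : ℂ) by norm_num, re_ofReal_mul]
    rw [ofReal_ofNat] at h3
    linarith
  refine h4.trans ((re_le_norm _).trans ?_)
  rw [h1, div_self two_ne_zero, Gamma_one, one_pow, mul_one, norm_mul, norm_mul, norm_exp]
  have e1 : ‖(2 : ℂ) * (2 - 1)‖ = 2 := by norm_num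
  have e2 : ((2 : ℂ) * ((Real.log D / 2 - Real.log π : ℝ) : ℂ)).re = Real.log (D / π ^ 2) := by
    rw [show (2 : ℂ) = ((2 : ℝ) : ℂ) by norm_num, ← ofReal_mul, ofReal_re,
      Real.log_div (by positivity) (by positivity), Real.log_pow]
    push_cast
    ring
  rw [e1, e2, Real.exp_log (by positivity)]
  calc _ ≤ 2 * (D / π ^ 2) * (π ^ 2 / 6) ^ 2 := by gcongr
    _ = _ := by field_simp; norm_num

end EvenChar

section GaussSumSq

open HurwitzZeta

lemma hasSum_periodic_mul_gaussian {N : ℕ} (hN : 0 < N) {f : ℤ → ℂ}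
    (hf : ∀ n m : ℤ, f (n + N * m) = f n) {t : ℝ} (ht : 0 < t) :
    HasSum (fun n : ℤ => f n * ((Real.exp (-π * n ^ 2 * t) : ℝ) : ℂ))
      (∑ r ∈ Finset.range N, f r * (evenKernel ((r / N : ℝ) : UnitAddCircle) (N ^ 2 * t) : ℂ)) := by
  have hN' : (0 : ℝ) < N := by exact_mod_cast hN
  have key : ∀ r ∈ Finset.range N, HasSum (fun n : ℤ => if n % N = r then
      f n * ((Real.exp (-π * n ^ 2 * t) : ℝ) : ℂ) else 0)
      (f r * (evenKernel ((r / N : ℝ) : UnitAddCircle) (N ^ 2 * t) : ℂ)) := by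
    intro r hr
    have hr : r < N := Finset.mem_range.1 hr
    have hinj : Function.Injective (fun m : ℤ => (r : ℤ) + N * m) := by
      intro m m' hm
      simpa [hN.ne'] using hm
    refine (hinj.hasSum_iff ?_).1 ?_
    · intro n hn
      rw [if_neg]
      intro hnr
      exact hn ⟨n / N, by simp only [← hnr]; exact Int.emod_add_mul_ediv n N⟩
    · have := (Complex.hasSum_ofReal.2 (hasSum_int_evenKernel (r / N)
        (show 0 < N ^ 2 * t by positivity))).mul_left (f r)
      refine this.congr_fun ?_
      intro m
      simp only [Function.comp_apply]
      have e : ((r : ℤ) + N * m) % N = r := by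
        rw [Int.add_mul_emod_self_left, Int.emod_eq_of_lt (by positivity) (by exact_mod_cast hr)]
      rw [if_pos e, hf]
      congr 3
      push_cast
      field_simp
      ring
  refine (hasSum_sum key).congr_fun fun n => ?_
  have h0 := Int.emod_nonneg n (show (N : ℤ) ≠ 0 by omega)
  have h1 := Int.emod_lt_of_pos n (show (0 : ℤ) < N by omega)
  rw [Finset.sum_eq_single (n % N).toNat]
  · rw [if_pos (by omega)]
  · intro b _ hb
    rw [if_neg (by omega)]
  · intro hb
    exact absurd (Finset.mem_range.2 (by omega)) hb

lemma tendsto_sqrt_mul_evenKernel (a : UnitAddCircle) :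
    Tendsto (fun t : ℝ => √t * evenKernel a t) (𝓝[>] 0) (𝓝 1) := by
  obtain ⟨p, hp, hO⟩ := isBigO_atTop_cosKernel_sub a
  have h1 : Tendsto (fun x => cosKernel a x - 1) atTop (𝓝 0) := by
    refine hO.trans_tendsto ?_
    exact Real.tendsto_exp_atBot.comp (tendsto_id.const_mul_atTop_of_neg (neg_lt_zero.2 hp))
  have h2 : Tendsto (fun x => cosKernel a x) atTop (𝓝 1) := by
    simpa using h1.add_const 1
  refine (h2.comp tendsto_inv_nhdsGT_zero).congr' ?_
  filter_upwards [self_mem_nhdsWithin] with t ht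
  have ht : 0 < t := ht
  rw [evenKernel_functional_equation, ← Real.sqrt_eq_rpow, ← mul_assoc, mul_one_div,
    div_self (Real.sqrt_pos.2 ht).ne', one_mul, Function.comp_apply, one_div]

lemma tendsto_sqrt_mul_periodic {N : ℕ} (hN : 0 < N) {f : ℤ → ℂ}
    (hf : ∀ n m : ℤ, f (n + N * m) = f n) :
    Tendsto (fun t : ℝ => (√t : ℂ) * ∑' n : ℤ, f n * ((Real.exp (-π * n ^ 2 * t) : ℝ) : ℂ)) (𝓝[>] 0)
      (𝓝 ((∑ r ∈ Finset.range N, f r) / N)) := by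
  have hN' : (0 : ℝ) < N := by exact_mod_cast hN
  have h1 : Tendsto (fun t : ℝ => (N : ℝ) ^ 2 * t) (𝓝[>] 0) (𝓝[>] 0) := by
    refine tendsto_nhdsWithin_iff.2 ⟨?_, ?_⟩
    · have : Tendsto (fun t : ℝ => (N : ℝ) ^ 2 * t) (𝓝 0) (𝓝 ((N : ℝ) ^ 2 * 0)) :=
        (continuous_const.mul continuous_id).tendsto 0
      rw [mul_zero] at this
      exact this.mono_left nhdsWithin_le_nhds
    · filter_upwards [self_mem_nhdsWithin] with t ht
      have ht : 0 < t := ht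
      exact Set.mem_Ioi.2 (by positivity)
  have h2 : ∀ r ∈ Finset.range N, Tendsto (fun t : ℝ => f r / N * ((√(N ^ 2 * t) *
      evenKernel ((r / N : ℝ) : UnitAddCircle) (N ^ 2 * t) : ℝ) : ℂ)) (𝓝[>] 0) (𝓝 (f r / N * (1 : ℝ))) :=
    fun r _ => ((continuous_ofReal.tendsto _).comp
      ((tendsto_sqrt_mul_evenKernel ((r / N : ℝ) : UnitAddCircle)).comp h1)).const_mul _
  have h3 := tendsto_finsetSum _ h2
  simp only [ofReal_one, mul_one, ← Finset.sum_div] at h3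
  refine h3.congr' ?_
  filter_upwards [self_mem_nhdsWithin] with t ht
  have ht : 0 < t := ht
  rw [(hasSum_periodic_mul_gaussian hN hf ht).tsum_eq, Finset.mul_sum]
  refine Finset.sum_congr rfl fun r _ => ?_
  rw [Real.sqrt_mul (by positivity), Real.sqrt_sq hN'.le]
  have : (N : ℂ) ≠ 0 := by exact_mod_cast hN'.ne'
  push_cast
  field_simp

lemma tendsto_jacobiTheta_of_im {ι : Type*} {l : Filter ι} {τ : ι → ℂ}
    (h : Tendsto (fun i => (τ i).im) l atTop) : Tendsto (fun i => jacobiTheta (τ i)) l (𝓝 1) := by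
  have h1 : Tendsto (fun τ => jacobiTheta τ - 1) (Filter.comap Complex.im atTop) (𝓝 0) := by
    refine isBigO_at_im_infty_jacobiTheta_sub_one.trans_tendsto ?_
    exact Real.tendsto_exp_atBot.comp (tendsto_comap.const_mul_atTop_of_neg
      (neg_lt_zero.2 Real.pi_pos))
  have h2 := (h1.comp (tendsto_comap_iff.2 h)).add_const 1
  simpa using h2

lemma jacobiTheta_eq (τ : ℂ) :
    jacobiTheta τ = 1 / (-I * τ) ^ (1 / 2 : ℂ) * jacobiTheta (-1 / τ) := by
  rw [jacobiTheta_eq_jacobiTheta₂, jacobiTheta₂_functional_equation, jacobiTheta_eq_jacobiTheta₂]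
  simp

lemma hasSum_jacobiTheta {τ : ℂ} (hτ : 0 < τ.im) :
    HasSum (fun n : ℤ => cexp (π * I * (n : ℂ) ^ 2 * τ)) (jacobiTheta τ) := by
  rw [jacobiTheta_eq_jacobiTheta₂]
  refine (hasSum_jacobiTheta₂_term 0 hτ).congr_fun fun n => ?_
  rw [jacobiTheta₂_term]
  ring_nf

/-- Translation of theta by a multiple of `1/2` period. -/
lemma jacobiTheta_sub_natCast {τ : ℂ} (hτ : 0 < τ.im) (N : ℕ) :
    jacobiTheta (τ - N / 2) = (1 - cexp (-(π * I * N / 2))) * jacobiTheta (4 * τ) +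
      cexp (-(π * I * N / 2)) * jacobiTheta τ := by
  have hτ' : 0 < (τ - N / 2).im := by
    rw [sub_im, show (N : ℂ) / 2 = ((N / 2 : ℝ) : ℂ) by push_cast; rfl, ofReal_im]
    linarith
  have h4 : 0 < (4 * τ).im := by
    rw [show (4 : ℂ) * τ = ((4 : ℝ) : ℂ) * τ by norm_num, im_ofReal_mul]
    linarith
  set c := cexp (-(π * I * N / 2)) with hc
  have hinj : Function.Injective (fun m : ℤ => 2 * m) := fun a b hab => by
    simpa using hab
  have h1 : HasSum (fun n : ℤ => if 2 ∣ n then cexp (π * I * (n : ℂ) ^ 2 * τ) else 0)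
      (jacobiTheta (4 * τ)) := by
    refine (hinj.hasSum_iff ?_).1 ?_
    · intro n hn
      rw [if_neg]
      rintro ⟨m, rfl⟩
      exact hn ⟨m, rfl⟩
    · refine (hasSum_jacobiTheta h4).congr_fun fun n => ?_
      rw [Function.comp_apply, if_pos (dvd_mul_right _ _)]
      push_cast
      ring_nf
  refine (hasSum_jacobiTheta hτ').unique (((h1.mul_left (1 - c)).add
    ((hasSum_jacobiTheta hτ).mul_left c)).congr_fun fun n => ?_)
  have e : cexp (π * I * (n : ℂ) ^ 2 * (τ - N / 2)) =
      cexp (-(π * I * N / 2)) ^ (n ^ 2).toNat * cexp (π * I * (n : ℂ) ^ 2 * τ) := by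
    rw [← Complex.exp_nat_mul, ← Complex.exp_add]
    have : (((n ^ 2).toNat : ℕ) : ℂ) = (n : ℂ) ^ 2 := by
      have := Int.toNat_of_nonneg (sq_nonneg n)
      exact_mod_cast congrArg (Int.cast : ℤ → ℂ) this
    rw [this]
    ring_nf
  have hc4 : c ^ 4 = 1 := by
    rw [hc, ← Complex.exp_nat_mul, Complex.exp_eq_one_iff]
    exact ⟨-N, by push_cast; ring⟩
  rw [e]
  split_ifs with h2
  · obtain ⟨m, rfl⟩ := h2
    have : ((2 * m) ^ 2).toNat = 4 * (m ^ 2).toNat := by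
      have := sq_nonneg m
      have e2 : (2 * m) ^ 2 = 4 * m ^ 2 := by ring
      omega
    rw [this, pow_mul, hc4, one_pow]
    ring
  · obtain ⟨m, hm⟩ : ∃ m, n = 2 * m + 1 := ⟨n / 2, by omega⟩
    have : (n ^ 2).toNat = 4 * (m ^ 2 + m).toNat + 1 := by
      have := sq_nonneg m
      have h3 : 0 ≤ m ^ 2 + m := by nlinarith [Int.emod_two_eq_zero_or_one m, sq_nonneg (2 * m + 1)]
      have e2 : n ^ 2 = 4 * (m ^ 2 + m) + 1 := by rw [hm]; ring
      omega
    rw [this, pow_succ, pow_mul, hc4, one_pow]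
    ring

end GaussSumSq

section GaussSumSq

lemma ofReal_mul_cpow {t : ℝ} (ht : 0 < t) (z : ℂ) {s : ℂ} (hs : s ≠ 0) :
    ((t : ℂ) * z) ^ s = (t : ℂ) ^ s * z ^ s := by
  have ht' : (t : ℂ) ≠ 0 := by exact_mod_cast ht.ne'
  rcases eq_or_ne z 0 with rfl | hz
  · simp [zero_cpow hs]
  · rw [cpow_def_of_ne_zero (mul_ne_zero ht' hz), cpow_def_of_ne_zero ht', cpow_def_of_ne_zero hz,
      log_ofReal_mul ht hz, ofReal_log ht.le, add_mul, Complex.exp_add]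

lemma tendsto_sqrt_mul_jacobiTheta {b : ℝ → ℂ} {β : ℝ} (hβ : 0 < β)
    (hb : Tendsto b (𝓝[>] 0) (𝓝 β)) :
    Tendsto (fun t : ℝ => (√t : ℂ) * jacobiTheta (I * b t * t)) (𝓝[>] 0)
      (𝓝 ((1 / √β : ℝ) : ℂ)) := by
  have hβ' : (β : ℂ) ≠ 0 := by exact_mod_cast hβ.ne'
  have h1 : Tendsto (fun t : ℝ => (-1 / (I * b t * t)).im) (𝓝[>] 0) atTop := by
    have h2 : Tendsto (fun t => ((b t)⁻¹).re) (𝓝[>] 0) (𝓝 β⁻¹) := by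
      have := (continuous_re.tendsto _).comp (hb.inv₀ hβ')
      rwa [← ofReal_inv, ofReal_re] at this
    refine (h2.pos_mul_atTop (inv_pos.2 hβ) tendsto_inv_nhdsGT_zero).congr fun t => ?_
    have : -1 / (I * b t * t) = ((t⁻¹ : ℝ) : ℂ) * (I * (b t)⁻¹) := by
      rw [div_eq_mul_inv, mul_inv, mul_inv, inv_I]
      push_cast
      ring
    rw [this, im_ofReal_mul, I_mul_im, mul_comm]
  have h3 : Tendsto (fun t => 1 / (b t) ^ (1 / 2 : ℂ) * jacobiTheta (-1 / (I * b t * t))) (𝓝[>] 0)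
      (𝓝 (1 / (β : ℂ) ^ (1 / 2 : ℂ) * 1)) := by
    refine Tendsto.mul (Tendsto.div tendsto_const_nhds (hb.cpow tendsto_const_nhds (by simp [hβ])) ?_)
      (tendsto_jacobiTheta_of_im h1)
    rw [Ne, cpow_eq_zero_iff]
    simp [hβ']
  have e : (1 / (β : ℂ) ^ (1 / 2 : ℂ) * 1) = ((1 / √β : ℝ) : ℂ) := by
    rw [Real.sqrt_eq_rpow, ofReal_div, ofReal_cpow hβ.le]
    push_cast
    ring
  rw [← e]
  refine h3.congr' ?_
  filter_upwards [self_mem_nhdsWithin] with t ht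
  have ht : 0 < t := ht
  have hs : (√t : ℂ) ≠ 0 := by exact_mod_cast (Real.sqrt_pos.2 ht).ne'
  rw [jacobiTheta_eq (I * b t * t), show -I * (I * b t * t) = t * b t by
    linear_combination (-(b t * t)) * I_mul_I, ofReal_mul_cpow ht _ (by norm_num)]
  rw [show ((t : ℂ)) ^ (1 / 2 : ℂ) = (√t : ℂ) by
    rw [Real.sqrt_eq_rpow, ofReal_cpow ht.le]; push_cast; rfl]
  field_simp

theorem sum_exp_sq {N : ℕ} (hN : 0 < N) :
    (∑ n ∈ Finset.range N, cexp (2 * π * I * n ^ 2 / N)) * (1 - I) = √N * (1 + (-I) ^ N) := by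
  have hN' : (0 : ℝ) < N := by exact_mod_cast hN
  have hNC : (N : ℂ) ≠ 0 := by exact_mod_cast hN'.ne'
  have hper : ∀ n m : ℤ, cexp (2 * π * I * ((n + N * m : ℤ) : ℂ) ^ 2 / N) =
      cexp (2 * π * I * (n : ℂ) ^ 2 / N) := by
    intro n m
    rw [Complex.exp_eq_exp_iff_exists_int]
    refine ⟨2 * n * m + N * m ^ 2, ?_⟩
    push_cast
    field_simp
    ring
  have hL := tendsto_sqrt_mul_periodic hN (f := fun n => cexp (2 * π * I * (n : ℂ) ^ 2 / N)) hper
  set c : ℂ := cexp (-(π * I * N / 2)) with hc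
  have hcI : c = (-I) ^ N := by
    rw [hc, ← Complex.exp_neg_pi_div_two_mul_I, ← Complex.exp_nat_mul]
    ring_nf
  have hbt : Tendsto (fun t : ℝ => (N : ℂ) ^ 2 / (4 + 2 * I * N * t)) (𝓝[>] 0)
      (𝓝 ((N ^ 2 / 4 : ℝ) : ℂ)) := by
    have : ContinuousAt (fun t : ℝ => (N : ℂ) ^ 2 / (4 + 2 * I * N * t)) 0 := by
      refine ContinuousAt.div (by fun_prop) (by fun_prop) (by norm_num)
    have h := this.tendsto
    simp only [ofReal_zero, mul_zero, add_zero] at h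
    push_cast
    exact h.mono_left nhdsWithin_le_nhds
  have h1 := tendsto_sqrt_mul_jacobiTheta (by positivity) hbt
  have h4 := tendsto_sqrt_mul_jacobiTheta (β := 4 * (N ^ 2 / 4)) (by positivity)
    (b := fun t => 4 * ((N : ℂ) ^ 2 / (4 + 2 * I * N * t))) (by
      rw [ofReal_mul]; exact_mod_cast hbt.const_mul 4)
  have hτ : Tendsto (fun t : ℝ => -I * (2 / N + I * t)) (𝓝[>] 0) (𝓝 (-I * (2 / N))) := by
    have : Continuous fun t : ℝ => -I * (2 / N + I * t) := by fun_prop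
    have h := this.tendsto 0
    simp only [ofReal_zero, mul_zero, add_zero] at h
    exact h.mono_left nhdsWithin_le_nhds
  have hslit : -I * (2 / N : ℂ) ∈ slitPlane := by
    right
    rw [show -I * (2 / N : ℂ) = I * ((-(2 / N) : ℝ) : ℂ) by push_cast; ring, I_mul_im, ofReal_re]
    exact (neg_neg_of_pos (by positivity)).ne
  have hne : -I * (2 / N : ℂ) ≠ 0 := slitPlane_ne_zero hslit
  have hR := ((tendsto_const_nhds (x := (1 : ℂ))).div (hτ.cpow (tendsto_const_nhds (x := (1 / 2 : ℂ))) hslit) (by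
    rw [Ne, cpow_eq_zero_iff]; tauto)).mul ((h4.const_mul (1 - c)).add (h1.const_mul c))
  have hsq : (-I * (2 / N : ℂ)) ^ (1 / 2 : ℂ) = (1 - I) / √N := by
    have e : -I * (2 / N : ℂ) = ((1 - I) / √N) ^ (2 : ℕ) := by
      rw [div_pow, ← ofReal_pow, Real.sq_sqrt hN'.le]
      push_cast
      field_simp
      linear_combination -I_sq
    rw [e, show (1 / 2 : ℂ) = ((2 : ℕ) : ℂ)⁻¹ by norm_num]
    have e2 : (1 - I) / (√N : ℂ) = ((1 / √N : ℝ) : ℂ) * (1 - I) := by push_cast; ring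
    have harg : ((1 - I) / (√N : ℂ)).arg = -(π / 4) := by
      rw [e2, arg_real_mul _ (by positivity)]
      rw [show (1 - I : ℂ) = (√2 : ℝ) * (Complex.cos ((-(π / 4) : ℝ)) + Complex.sin ((-(π / 4) : ℝ)) * I) by
        rw [← ofReal_cos, ← ofReal_sin, Real.cos_neg, Real.sin_neg, Real.cos_pi_div_four,
          Real.sin_pi_div_four]
        have : ((√2 : ℝ) : ℂ) * (√2 : ℝ) = 2 := by exact_mod_cast Real.mul_self_sqrt zero_le_two
        push_cast
        linear_combination (I - 1) / 2 * this]
      exact arg_mul_cos_add_sin_mul_I (by positivity) ⟨by linarith [Real.pi_pos], by linarith [Real.pi_pos]⟩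
    refine pow_cpow_nat_inv (by norm_num) ?_ ?_
    · rw [harg]; linarith [Real.pi_pos]
    · rw [harg]; norm_num; linarith [Real.pi_pos]
  have key := tendsto_nhds_unique (hL.congr' ?_) hR
  · rw [hsq, show (4 : ℝ) * (N ^ 2 / 4) = (N : ℝ) ^ 2 by ring, Real.sqrt_sq hN'.le,
      Real.sqrt_div (by positivity), Real.sqrt_sq hN'.le,
      show √(4 : ℝ) = 2 by rw [show (4 : ℝ) = 2 ^ 2 by norm_num]; exact Real.sqrt_sq zero_le_two,
      ← hcI] at *
    have h1I : (1 - I : ℂ) ≠ 0 := by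
      intro h0
      simpa using congrArg re h0
    have hsN : (√N : ℂ) ≠ 0 := by exact_mod_cast (Real.sqrt_pos.2 hN').ne'
    push_cast at key ⊢
    field_simp at key ⊢
    linear_combination key
  · filter_upwards [self_mem_nhdsWithin] with t ht
    have ht : 0 < t := ht
    have him : 0 < (2 / N + I * t : ℂ).im := by
      rw [show (2 / N + I * t : ℂ) = ((2 / N : ℝ) : ℂ) + t * I by push_cast; ring]
      simpa using ht
    have e1 : ∑' n : ℤ, cexp (2 * π * I * (n : ℂ) ^ 2 / N) * ((Real.exp (-π * n ^ 2 * t) : ℝ) : ℂ) =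
        jacobiTheta (2 / N + I * t) := by
      rw [← (hasSum_jacobiTheta him).tsum_eq]
      refine tsum_congr fun n => ?_
      push_cast
      rw [← Complex.exp_add]
      congr 1
      linear_combination (-(π * n ^ 2 * t : ℂ)) * I_mul_I
    have hd : (4 + 2 * I * N * t : ℂ) ≠ 0 := by
      intro h0
      have := congrArg re h0
      simp at this
    have hd2 : (2 / N + I * t : ℂ) ≠ 0 := by
      intro h0
      rw [h0] at him
      simp at him
    set w : ℂ := I * ((N : ℂ) ^ 2 / (4 + 2 * I * N * t)) * t with hw
    have e2 : -1 / (2 / N + I * t : ℂ) = w - N / 2 := by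
      have hd3 : (2 + I * N * t : ℂ) ≠ 0 := by
        intro h0
        apply hd
        linear_combination 2 * h0
      rw [hw, show (4 + 2 * I * N * t : ℂ) = 2 * (2 + I * N * t) by ring,
        show (2 / N + I * t : ℂ) = (2 + I * N * t) / N by field_simp]
      field_simp
      ring
    have hwim : 0 < w.im := by
      have : (w - N / 2).im = w.im := by
        rw [sub_im, show (N : ℂ) / 2 = ((N / 2 : ℝ) : ℂ) by push_cast; rfl, ofReal_im, sub_zero]
      rw [← this, ← e2, neg_div, neg_im, one_div, inv_im]
      have := normSq_pos.2 hd2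
      rw [neg_div, neg_neg]
      positivity
    rw [e1, jacobiTheta_eq (2 / N + I * t), e2, jacobiTheta_sub_natCast hwim]
    have e3 : I * (4 * ((N : ℂ) ^ 2 / (4 + 2 * I * N * t))) * t = 4 * w := by rw [hw]; ring
    simp only [e3, Pi.div_apply]
    ring

end GaussSumSq

/-- A periodic multiplicative function which is an eigenvector of the discrete Fourier transform. -/
structure GaussEigen (N : ℕ) (φ : ℤ → ℤ) (g : ℂ) : Prop where
  pos : 0 < N
  map_mul : ∀ m n, φ (m * n) = φ m * φ n
  periodic : ∀ n, φ (n + N) = φ n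
  sum_eq : ∀ k : ℤ, ∑ r ∈ Finset.range N, (φ r : ℂ) * cexp (2 * π * I * (r * k / N)) = g * φ k

lemma sum_range_zmod {M : Type*} [AddCommMonoid M] {N : ℕ} [NeZero N] (f : ZMod N → M) :
    ∑ r ∈ Finset.range N, f r = ∑ x, f x := by
  refine Finset.sum_nbij' (fun r => (r : ZMod N)) ZMod.val (fun _ _ => Finset.mem_univ _)
    (fun x _ => Finset.mem_range.2 x.val_lt) (fun r hr => ?_) (fun x _ => ?_) (fun _ _ => rfl)
  · exact ZMod.val_cast_of_lt (Finset.mem_range.1 hr)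
  · exact ZMod.natCast_zmod_val x

lemma periodic_mul_of_periodic {α : Type*} {N : ℕ} {f : ℤ → α} (hf : ∀ n, f (n + N) = f n) (n m : ℤ) :
    f (n + N * m) = f n := by
  have h : Function.Periodic f (N : ℤ) := hf
  have := h.int_mul m n
  rwa [mul_comm]

namespace GaussEigen

lemma _root_.sum_range_mul_coprime {N₁ N₂ : ℕ} (h₁ : 0 < N₁) (h₂ : 0 < N₂) (hc : N₁.Coprime N₂)
    {f : ℤ → ℂ} (hf : ∀ n, f (n + (N₁ * N₂ : ℕ)) = f n) :
    ∑ r ∈ Finset.range (N₁ * N₂), f r =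
      ∑ a ∈ Finset.range N₁, ∑ b ∈ Finset.range N₂, f (a * N₂ + b * N₁) := by
  rw [← Finset.sum_product']
  have hpos : 0 < N₁ * N₂ := Nat.mul_pos h₁ h₂
  have hinj : Set.InjOn (fun p : ℕ × ℕ => (p.1 * N₂ + p.2 * N₁) % (N₁ * N₂))
      (Finset.range N₁ ×ˢ Finset.range N₂ : Finset (ℕ × ℕ)) := by
    rintro ⟨a, b⟩ hab ⟨a', b'⟩ hab' h
    simp only [Finset.coe_product, Finset.coe_range, Set.mem_prod, Set.mem_Iio] at hab hab'
    have h : a * N₂ + b * N₁ ≡ a' * N₂ + b' * N₁ [MOD N₁ * N₂] := h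
    have e1 : a * N₂ ≡ a' * N₂ [MOD N₁] := by
      have := h.of_mul_right N₂
      simpa [Nat.ModEq, Nat.add_mul_mod_self_right] using this
    have e2 : b * N₁ ≡ b' * N₁ [MOD N₂] := by
      have := h.of_mul_left N₁
      rw [add_comm, add_comm (a' * N₂)] at this
      simpa [Nat.ModEq, Nat.add_mul_mod_self_right] using this
    have e1 := Nat.ModEq.cancel_right_of_coprime (by rwa [Nat.coprime_iff_gcd_eq_one] at hc) e1
    have e2 := Nat.ModEq.cancel_right_of_coprime (by rw [Nat.gcd_comm]; exact hc) e2
    rw [Prod.mk.injEq]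
    exact ⟨e1.eq_of_lt_of_lt hab.1 hab'.1, e2.eq_of_lt_of_lt hab.2 hab'.2⟩
  have himg : (Finset.range N₁ ×ˢ Finset.range N₂).image
      (fun p : ℕ × ℕ => (p.1 * N₂ + p.2 * N₁) % (N₁ * N₂)) = Finset.range (N₁ * N₂) := by
    refine Finset.eq_of_subset_of_card_le ?_ ?_
    · intro x hx
      obtain ⟨p, -, rfl⟩ := Finset.mem_image.1 hx
      exact Finset.mem_range.2 (Nat.mod_lt _ hpos)
    · rw [Finset.card_image_of_injOn hinj, Finset.card_product]
      simp
  rw [← himg, Finset.sum_image hinj]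
  refine Finset.sum_congr rfl fun p _ => ?_
  have := periodic_mul_of_periodic hf (p.1 * N₂ + p.2 * N₁)
    (-(((p.1 * N₂ + p.2 * N₁) / (N₁ * N₂) : ℕ) : ℤ))
  rw [← this]
  congr 1
  have := Nat.mod_add_div (p.1 * N₂ + p.2 * N₁) (N₁ * N₂)
  zify at this ⊢
  linear_combination this

theorem mul {N₁ N₂ : ℕ} {φ₁ φ₂ : ℤ → ℤ} {g₁ g₂ : ℂ} (h₁ : GaussEigen N₁ φ₁ g₁)
    (h₂ : GaussEigen N₂ φ₂ g₂) (hc : N₁.Coprime N₂) :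
    GaussEigen (N₁ * N₂) (fun n => φ₁ n * φ₂ n) (g₁ * g₂ * φ₁ N₂ * φ₂ N₁) := by
  have hN₁ : (N₁ : ℂ) ≠ 0 := by exact_mod_cast h₁.pos.ne'
  have hN₂ : (N₂ : ℂ) ≠ 0 := by exact_mod_cast h₂.pos.ne'
  have hp₁ : ∀ n, φ₁ (n + (N₁ * N₂ : ℕ)) = φ₁ n := fun n => by
    push_cast; exact periodic_mul_of_periodic h₁.periodic n N₂
  have hp₂ : ∀ n, φ₂ (n + (N₁ * N₂ : ℕ)) = φ₂ n := fun n => by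
    push_cast; rw [mul_comm]; exact periodic_mul_of_periodic h₂.periodic n N₁
  refine ⟨Nat.mul_pos h₁.pos h₂.pos, fun m n => by rw [h₁.map_mul, h₂.map_mul]; ring,
    fun n => by rw [hp₁, hp₂], fun k => ?_⟩
  have := sum_range_mul_coprime h₁.pos h₂.pos hc (f := fun n : ℤ => ((φ₁ n * φ₂ n : ℤ) : ℂ) *
    cexp (2 * π * I * (n * k / (N₁ * N₂ : ℕ)))) (by
      intro n
      rw [hp₁, hp₂]
      congr 1
      rw [Complex.exp_eq_exp_iff_exists_int]
      refine ⟨k, ?_⟩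
      push_cast
      field_simp)
  simp only [Int.cast_natCast] at this
  rw [this]
  have e : ∀ a ∈ Finset.range N₁, ∀ b ∈ Finset.range N₂,
      ((φ₁ (a * N₂ + b * N₁) * φ₂ (a * N₂ + b * N₁) : ℤ) : ℂ) *
        cexp (2 * π * I * (((a * N₂ + b * N₁ : ℤ) : ℂ) * k / (N₁ * N₂ : ℕ))) =
      (φ₁ N₂ * φ₂ N₁) * (((φ₁ a : ℂ) * cexp (2 * π * I * (a * k / N₁))) *
        ((φ₂ b : ℂ) * cexp (2 * π * I * (b * k / N₂)))) := by
    intro a _ b _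
    have e1 : φ₁ (a * N₂ + b * N₁) = φ₁ a * φ₁ N₂ := by
      rw [mul_comm (b : ℤ), periodic_mul_of_periodic h₁.periodic, h₁.map_mul]
    have e2 : φ₂ (a * N₂ + b * N₁) = φ₂ b * φ₂ N₁ := by
      rw [add_comm, mul_comm (a : ℤ), periodic_mul_of_periodic h₂.periodic, h₂.map_mul]
    have e3 : (2 * π * I * (((a * N₂ + b * N₁ : ℤ) : ℂ) * k / (N₁ * N₂ : ℕ))) =
        2 * π * I * (a * k / N₁) + 2 * π * I * (b * k / N₂) := by
      push_cast
      field_simp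
    rw [e1, e2, e3, Complex.exp_add]
    push_cast
    ring
  rw [Finset.sum_congr rfl fun a ha => Finset.sum_congr rfl (e a ha)]
  simp only [← Finset.mul_sum, ← Finset.sum_mul]
  rw [h₁.sum_eq, h₂.sum_eq]
  push_cast
  ring

lemma congr {N : ℕ} {φ φ' : ℤ → ℤ} {g g' : ℂ} (h : GaussEigen N φ g) (hφ : ∀ n, φ n = φ' n)
    (hg : g = g') : GaussEigen N φ' g' := by
  rwa [← hg, ← show φ = φ' from funext hφ]

end GaussEigen

/-- The square root of `χ₄(m) m`. -/
def gaussRoot (m : ℕ) : ℂ := if m % 4 = 1 then (√m : ℂ) else √m * I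

lemma gaussSum_quadraticChar (p : ℕ) [Fact p.Prime] (hp : p ≠ 2) :
    ∑ x : ZMod p, (quadraticChar (ZMod p) x : ℂ) * ZMod.stdAddChar x = gaussRoot p := by
  have hp' : p.Prime := Fact.out
  have h0 : ∑ x : ZMod p, (ZMod.stdAddChar x : ℂ) = 0 := by
    refine AddChar.sum_eq_zero_of_ne_one fun h1 => ?_
    have := (ZMod.isPrimitive_stdAddChar p) (one_ne_zero)
    rw [AddChar.mulShift_one] at this
    exact this h1
  have h1 : ∑ y : ZMod p, (ZMod.stdAddChar (y ^ 2) : ℂ) =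
      ∑ x : ZMod p, ((quadraticChar (ZMod p) x : ℂ) * ZMod.stdAddChar x + ZMod.stdAddChar x) := by
    rw [← Finset.sum_fiberwise Finset.univ (fun y : ZMod p => y ^ 2)]
    refine Finset.sum_congr rfl fun x _ => ?_
    rw [Finset.sum_congr rfl (g := fun _ => ZMod.stdAddChar x) (by
      intro y hy; rw [(Finset.mem_filter.1 hy).2]), Finset.sum_const, nsmul_eq_mul]
    have := quadraticChar_card_sqrts (F := ZMod p) (by rwa [ZMod.ringChar_zmod_n]) x
    have h2 : (({y | y ^ 2 = x} : Finset (ZMod p)).card : ℤ) = quadraticChar (ZMod p) x + 1 := by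
      rw [← this]
      congr 2
      ext y
      simp
    have h3 : (({y | y ^ 2 = x} : Finset (ZMod p)).card : ℂ) = quadraticChar (ZMod p) x + 1 := by
      exact_mod_cast h2
    rw [h3]
    ring
  rw [Finset.sum_add_distrib, h0, add_zero] at h1
  rw [← h1, ← sum_range_zmod]
  have h2 := sum_exp_sq hp'.pos
  have h3 : ∑ r ∈ Finset.range p, (ZMod.stdAddChar ((r : ZMod p) ^ 2) : ℂ) =
      ∑ n ∈ Finset.range p, cexp (2 * π * I * n ^ 2 / p) := by
    refine Finset.sum_congr rfl fun n _ => ?_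
    have := ZMod.stdAddChar_coe (N := p) ((n : ℤ) ^ 2)
    push_cast at this
    exact this
  rw [h3]
  have hI : (1 - I : ℂ) ≠ 0 := by
    intro h0
    simpa using congrArg re h0
  refine mul_right_cancel₀ hI ?_
  rw [h2, gaussRoot]
  have hodd : p % 4 = 1 ∨ p % 4 = 3 := by
    have := hp'.eq_two_or_odd
    omega
  have hp4 : (-I) ^ p = (-I) ^ (p % 4) := by
    conv_lhs => rw [← Nat.div_add_mod p 4, pow_add, pow_mul]
    rw [show (-I) ^ 4 = 1 by rw [neg_pow, I_pow_four]; norm_num, one_pow, one_mul]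
  rw [hp4]
  rcases hodd with h | h
  · rw [h, if_pos rfl]
    ring
  · rw [h, if_neg (by norm_num), show (-I) ^ 3 = I by rw [neg_pow, I_pow_three]; norm_num]
    linear_combination (√p : ℂ) * I_sq

lemma gaussEigen_prime (p : ℕ) [Fact p.Prime] (hp : p ≠ 2) :
    GaussEigen p (fun n => jacobiSym n p) (gaussRoot p) := by
  have hp' : p.Prime := Fact.out
  have hpC : (p : ℂ) ≠ 0 := by exact_mod_cast hp'.ne_zero
  have hJ : ∀ n : ℤ, jacobiSym n p = quadraticChar (ZMod p) n := fun n => by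
    rw [← jacobiSym.legendreSym.to_jacobiSym, legendreSym]
  refine ⟨hp'.pos, fun m n => jacobiSym.mul_left _ _ _, fun n => ?_, fun k => ?_⟩
  · rw [hJ, hJ]
    simp
  · simp only [hJ]
    have h1 : ∑ r ∈ Finset.range p, ((quadraticChar (ZMod p) ((r : ℤ) : ZMod p) : ℤ) : ℂ) *
        cexp (2 * π * I * (r * k / p)) =
        ∑ x : ZMod p, (quadraticChar (ZMod p) x : ℂ) * ZMod.stdAddChar (x * (k : ZMod p)) := by
      rw [← sum_range_zmod]
      refine Finset.sum_congr rfl fun r _ => ?_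
      have := ZMod.stdAddChar_coe (N := p) ((r : ℤ) * k)
      push_cast at this
      rw [this]
      push_cast
      ring_nf
    rw [h1]
    by_cases hk : (k : ZMod p) = 0
    · simp only [hk, mul_zero, AddChar.map_zero_eq_one, mul_one, MulChar.map_zero, Int.cast_zero]
      have := quadraticChar_sum_zero (F := ZMod p) (by rwa [ZMod.ringChar_zmod_n])
      exact_mod_cast congrArg (Int.cast : ℤ → ℂ) this
    · rw [← gaussSum_quadraticChar p hp, Finset.sum_mul]
      refine Fintype.sum_equiv (Equiv.mulRight₀ (k : ZMod p) hk) _ _ fun x => ?_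
      rw [Equiv.mulRight₀_apply, _root_.map_mul (quadraticChar (ZMod p))]
      have h2 : ((quadraticChar (ZMod p) (k : ZMod p) : ℤ) : ℂ) ^ 2 = 1 := by
        exact_mod_cast congrArg (Int.cast : ℤ → ℂ) (quadraticChar_sq_one hk)
      push_cast
      linear_combination (-((quadraticChar (ZMod p) x : ℤ) : ℂ) * ZMod.stdAddChar (x * (k : ZMod p))) * h2

lemma gaussRoot_mul {a b : ℕ} (ha : Odd a) (hb : Odd b) (hc : a.Coprime b) :
    gaussRoot a * gaussRoot b * jacobiSym b a * jacobiSym a b = gaussRoot (a * b) := by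
  have hsq : jacobiSym b a ^ 2 = 1 := jacobiSym.sq_one (by simpa [Nat.gcd_comm] using hc)
  have hsqC : (jacobiSym b a : ℂ) ^ 2 = 1 := by exact_mod_cast congrArg (Int.cast : ℤ → ℂ) hsq
  have hs : (√((a * b : ℕ) : ℝ) : ℂ) = √a * √b := by
    push_cast
    rw [Real.sqrt_mul (Nat.cast_nonneg a), ofReal_mul]
  have ha4 : a % 4 = 1 ∨ a % 4 = 3 := by rcases ha with ⟨k, rfl⟩; omega
  have hb4 : b % 4 = 1 ∨ b % 4 = 3 := by rcases hb with ⟨k, rfl⟩; omega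
  rcases ha4 with h | h <;> rcases hb4 with h' | h'
  · rw [jacobiSym.quadratic_reciprocity_one_mod_four h hb]
    simp only [gaussRoot, hs, h, h', Nat.mul_mod, reduceIte, Nat.reduceMul, Nat.reduceMod]
    linear_combination (√a : ℂ) * √b * hsqC
  · rw [jacobiSym.quadratic_reciprocity_one_mod_four h hb]
    simp only [gaussRoot, hs, h, h', Nat.mul_mod, reduceIte, Nat.reduceMul, Nat.reduceMod,
      OfNat.ofNat_ne_one]
    linear_combination (√a : ℂ) * √b * I * hsqC
  · rw [jacobiSym.quadratic_reciprocity_one_mod_four' ha h']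
    simp only [gaussRoot, hs, h, h', Nat.mul_mod, reduceIte, Nat.reduceMul, Nat.reduceMod,
      OfNat.ofNat_ne_one]
    linear_combination (√a : ℂ) * √b * I * hsqC
  · rw [jacobiSym.quadratic_reciprocity_three_mod_four h h']
    simp only [gaussRoot, hs, h, h', Nat.mul_mod, reduceIte, Nat.reduceMul, Nat.reduceMod,
      OfNat.ofNat_ne_one]
    push_cast
    linear_combination (√a : ℂ) * √b * (hsqC - (jacobiSym b a : ℂ) ^ 2 * I_sq)

theorem gaussEigen_jacobiSym {m : ℕ} (hm : Odd m) (hsq : Squarefree m) :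
    GaussEigen m (fun n => jacobiSym n m) (gaussRoot m) := by
  induction m using Nat.recOnPosPrimePosCoprime with
  | prime_pow p n hp hn =>
    have := Fact.mk hp
    obtain rfl : n = 1 := ((Nat.squarefree_pow_iff hp.ne_one hn.ne').1 hsq).2
    rw [pow_one] at hm ⊢
    refine gaussEigen_prime p ?_
    rintro rfl
    exact absurd hm (by decide)
  | zero => exact absurd hm (by decide)
  | one => exact ⟨one_pos, by simp, by simp, by simp [gaussRoot]⟩
  | coprime a b _ _ hc iha ihb =>
    have ha := Nat.odd_mul.1 hm
    refine ((iha ha.1 hsq.of_mul_left).mul (ihb ha.2 hsq.of_mul_right) hc).congr (fun n => ?_)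
      (gaussRoot_mul ha.1 ha.2 hc)
    exact (jacobiSym.mul_right' n ha.1.pos.ne' ha.2.pos.ne').symm

lemma gaussEigen_of_pow {N : ℕ} (hN : 0 < N) {φ : ℤ → ℤ} {g : ℂ}
    (hmul : ∀ m n, φ (m * n) = φ m * φ n) (hper : ∀ n, φ (n + N) = φ n)
    (H : ∀ k < N, ∑ r ∈ Finset.range N, (φ r : ℂ) * cexp (2 * π * I / N) ^ (r * k % N) = g * φ k) :
    GaussEigen N φ g := by
  refine ⟨hN, hmul, hper, fun k => ?_⟩
  have hNC : (N : ℂ) ≠ 0 := by exact_mod_cast hN.ne'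
  have h0 := Int.emod_nonneg k (show (N : ℤ) ≠ 0 by omega)
  have h1 := Int.emod_lt_of_pos k (show (0 : ℤ) < N by omega)
  obtain ⟨j, hj⟩ := Int.eq_ofNat_of_zero_le h0
  have hk : k = j + N * (k / N) := by rw [← hj]; exact (Int.emod_add_mul_ediv k N).symm
  have hφ : φ k = φ j := by rw [hk, periodic_mul_of_periodic hper]
  rw [hφ, ← H j (by omega)]
  refine Finset.sum_congr rfl fun r _ => ?_
  congr 1
  rw [← Complex.exp_nat_mul, Complex.exp_eq_exp_iff_exists_int]
  refine ⟨r * (k / N) + ((r * j / N : ℕ) : ℤ), ?_⟩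
  have h2 : ((r * j % N : ℕ) : ℂ) = r * j - N * (r * j / N : ℕ) := by
    have := Nat.mod_add_div (r * j) N
    have := congrArg (Nat.cast : ℕ → ℂ) this
    push_cast at this ⊢
    linear_combination this
  have h3 : (k : ℂ) = j + N * (k / N : ℤ) := by
    have := congrArg (Int.cast : ℤ → ℂ) hk
    push_cast at this
    exact this
  rw [h2, h3, Int.cast_add, Int.cast_mul, Int.cast_natCast, Int.cast_natCast]
  field_simp
  ring

lemma gaussEigen_χ₄ : GaussEigen 4 (fun n => ZMod.χ₄ n) (2 * I) := by
  refine gaussEigen_of_pow (by norm_num) (fun m n => by rw [Int.cast_mul, map_mul])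
    (fun n => by push_cast; rw [show (4 : ZMod 4) = 0 from rfl, add_zero]) ?_
  have hI : cexp (2 * π * I / (4 : ℕ)) = I := by
    rw [show 2 * π * I / (4 : ℕ) = π / 2 * I by push_cast; ring, Complex.exp_pi_div_two_mul_I]
  rw [hI]
  have h0 : ZMod.χ₄ 0 = 0 := rfl
  have h1 : ZMod.χ₄ 1 = 1 := rfl
  have h2 : ZMod.χ₄ 2 = 0 := rfl
  have h3 : ZMod.χ₄ 3 = -1 := rfl
  intro k hk
  interval_cases k <;> simp [Finset.sum_range_succ, h0, h1, h2, h3, I_pow_three] <;> ring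

lemma exp_two_pi_div_eight : cexp (2 * π * I / (8 : ℕ)) = (1 + I) * (√8 : ℝ) / 4 := by
  have h8 : √(8 : ℝ) = 2 * √2 := by
    rw [show (8 : ℝ) = 2 ^ 2 * 2 by norm_num, Real.sqrt_mul (by norm_num), Real.sqrt_sq zero_le_two]
  rw [show 2 * π * I / (8 : ℕ) = ((π / 4 : ℝ) : ℂ) * I by push_cast; ring, exp_mul_I, ← ofReal_cos,
    ← ofReal_sin, Real.cos_pi_div_four, Real.sin_pi_div_four, h8]
  push_cast
  ring

lemma sqrt_eight_sq : ((√8 : ℝ) : ℂ) ^ 2 = 8 := by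
  exact_mod_cast Real.sq_sqrt (show (0 : ℝ) ≤ 8 by norm_num)

lemma exp_eight_powers : cexp (2 * π * I / (8 : ℕ)) ^ 2 = I ∧
    cexp (2 * π * I / (8 : ℕ)) ^ 3 = (I - 1) * (√8 : ℝ) / 4 ∧
    cexp (2 * π * I / (8 : ℕ)) ^ 4 = -1 ∧
    cexp (2 * π * I / (8 : ℕ)) ^ 5 = -((1 + I) * (√8 : ℝ) / 4) ∧
    cexp (2 * π * I / (8 : ℕ)) ^ 6 = -I ∧
    cexp (2 * π * I / (8 : ℕ)) ^ 7 = -((I - 1) * (√8 : ℝ) / 4) := by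
  have h2 : cexp (2 * π * I / (8 : ℕ)) ^ 2 = I := by
    rw [exp_two_pi_div_eight]
    linear_combination (1 + I) ^ 2 / 16 * sqrt_eight_sq + (1 / 2) * I_sq
  have h3 : cexp (2 * π * I / (8 : ℕ)) ^ 3 = (I - 1) * (√8 : ℝ) / 4 := by
    rw [pow_succ, h2, exp_two_pi_div_eight]
    linear_combination ((√8 : ℝ) : ℂ) / 4 * I_sq
  have h4 : cexp (2 * π * I / (8 : ℕ)) ^ 4 = -1 := by
    rw [show 4 = 2 * 2 from rfl, pow_mul, h2, I_sq]
  refine ⟨h2, h3, h4, ?_, ?_, ?_⟩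
  · rw [show 5 = 4 + 1 from rfl, pow_add, h4, exp_two_pi_div_eight]; ring
  · rw [show 6 = 4 + 2 from rfl, pow_add, h4, h2]; ring
  · rw [show cexp (2 * π * I / (8 : ℕ)) ^ 7 = _ from pow_add _ 4 3, h4, h3]; ring

lemma gaussEigen_χ₈ : GaussEigen 8 (fun n => ZMod.χ₈ n) ((√8 : ℝ)) := by
  refine gaussEigen_of_pow (by norm_num) (fun m n => by rw [Int.cast_mul, map_mul])
    (fun n => by push_cast; rw [show (8 : ZMod 8) = 0 from rfl, add_zero]) ?_
  obtain ⟨e2, e3, e4, e5, e6, e7⟩ := exp_eight_powers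
  have e1 := exp_two_pi_div_eight
  generalize cexp (2 * π * I / (8 : ℕ)) = ζ at *
  have h0 : ZMod.χ₈ 0 = 0 := rfl
  have h1 : ZMod.χ₈ 1 = 1 := rfl
  have h2 : ZMod.χ₈ 2 = 0 := rfl
  have h3 : ZMod.χ₈ 3 = -1 := rfl
  have h4 : ZMod.χ₈ 4 = 0 := rfl
  have h5 : ZMod.χ₈ 5 = -1 := rfl
  have h6 : ZMod.χ₈ 6 = 0 := rfl
  have h7 : ZMod.χ₈ 7 = 1 := rfl
  intro k hk
  interval_cases k <;> simp [Finset.sum_range_succ, h0, h1, h2, h3, h4, h5, h6, h7, e2, e3, e4, e5,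
    e6, e7] <;> (try rw [e1]) <;> ring

lemma gaussEigen_χ₈' : GaussEigen 8 (fun n => ZMod.χ₈' n) (I * (√8 : ℝ)) := by
  refine gaussEigen_of_pow (by norm_num) (fun m n => by rw [Int.cast_mul, map_mul])
    (fun n => by push_cast; rw [show (8 : ZMod 8) = 0 from rfl, add_zero]) ?_
  obtain ⟨e2, e3, e4, e5, e6, e7⟩ := exp_eight_powers
  have e1 := exp_two_pi_div_eight
  generalize cexp (2 * π * I / (8 : ℕ)) = ζ at *
  have h0 : ZMod.χ₈' 0 = 0 := rfl
  have h1 : ZMod.χ₈' 1 = 1 := rfl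
  have h2 : ZMod.χ₈' 2 = 0 := rfl
  have h3 : ZMod.χ₈' 3 = 1 := rfl
  have h4 : ZMod.χ₈' 4 = 0 := rfl
  have h5 : ZMod.χ₈' 5 = -1 := rfl
  have h6 : ZMod.χ₈' 6 = 0 := rfl
  have h7 : ZMod.χ₈' 7 = -1 := rfl
  intro k hk
  interval_cases k <;> simp [Finset.sum_range_succ, h0, h1, h2, h3, h4, h5, h6, h7, e2, e3, e4, e5,
    e6, e7] <;> (try rw [e1]) <;> ring

/-- Positive fundamental discriminants greater than `1`. -/
def IsFundamental (D : ℕ) : Prop :=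
  1 < D ∧ (D % 4 = 1 ∧ Squarefree D ∨ D % 16 = 12 ∧ Squarefree (D / 4) ∨
    D % 16 = 8 ∧ Squarefree (D / 8))

/-- The quadratic character attached to a fundamental discriminant. -/
def kroneckerChar (D : ℕ) (n : ℤ) : ℤ :=
  if D % 4 = 1 then jacobiSym n D
  else if D % 16 = 12 then ZMod.χ₄ n * jacobiSym n (D / 4)
  else if D / 8 % 4 = 1 then ZMod.χ₈ n * jacobiSym n (D / 8)
  else ZMod.χ₈' n * jacobiSym n (D / 8)

/-- The shape of the character for each of the four types of fundamental discriminants. -/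
lemma IsFundamental.induction {P : ℕ → (ℤ → ℤ) → Prop}
    (h1 : ∀ m, 1 < m → m % 4 = 1 → Squarefree m → P m fun n => jacobiSym n m)
    (h4 : ∀ m, m % 4 = 3 → Squarefree m → P (4 * m) fun n => ZMod.χ₄ n * jacobiSym n m)
    (h8 : ∀ m, m % 4 = 1 → Squarefree m → P (8 * m) fun n => ZMod.χ₈ n * jacobiSym n m)
    (h8' : ∀ m, m % 4 = 3 → Squarefree m → P (8 * m) fun n => ZMod.χ₈' n * jacobiSym n m)
    {D : ℕ} (hD : IsFundamental D) : P D (kroneckerChar D) := by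
  obtain ⟨hD1, ⟨h, hs⟩ | ⟨h, hs⟩ | ⟨h, hs⟩⟩ := hD
  · convert h1 D hD1 h hs using 1
    funext n
    rw [kroneckerChar, if_pos h]
  · convert h4 (D / 4) (by omega) hs using 1
    · omega
    · funext n
      rw [kroneckerChar, if_neg (by omega), if_pos h]
  · rcases (show D / 8 % 4 = 1 ∨ D / 8 % 4 = 3 by omega) with h' | h'
    · convert h8 (D / 8) h' hs using 1
      · omega
      · funext n
        rw [kroneckerChar, if_neg (by omega), if_neg (by omega), if_pos h']
    · convert h8' (D / 8) h' hs using 1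
      · omega
      · funext n
        rw [kroneckerChar, if_neg (by omega), if_neg (by omega), if_neg (by omega)]

lemma χ₄_eq_of_mod {m : ℕ} : (m % 4 = 1 → ZMod.χ₄ m = 1) ∧ (m % 4 = 3 → ZMod.χ₄ m = -1) := by
  rw [ZMod.χ₄_nat_mod_four]
  exact ⟨fun h => by rw [h]; rfl, fun h => by rw [h]; rfl⟩

lemma χ₄_mul_χ₈ (x : ZMod 8) : ZMod.χ₈' x = ZMod.χ₄ (x.cast) * ZMod.χ₈ x := by
  revert x; decide

lemma χ₈'_eq (n : ℤ) : ZMod.χ₈' n = ZMod.χ₄ n * ZMod.χ₈ n := by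
  rw [χ₄_mul_χ₈, ZMod.cast_intCast (by norm_num)]

lemma χ₈_sq {m : ℕ} (hm : Odd m) : ZMod.χ₈ m ^ 2 = 1 := by
  rw [← jacobiSym.at_two hm]
  refine jacobiSym.sq_one ?_
  have := Nat.coprime_two_left.2 hm
  exact_mod_cast this

lemma jacobiSym_two_pow {m : ℕ} (hm : Odd m) : jacobiSym 4 m = 1 ∧ jacobiSym 8 m = ZMod.χ₈ m := by
  refine ⟨jacobiSym.at_four hm, ?_⟩
  rw [show (8 : ℤ) = 4 * 2 by norm_num, jacobiSym.mul_left, jacobiSym.at_four hm, one_mul,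
    jacobiSym.at_two hm]

lemma jacobiSym_neg_of_mod {m : ℕ} (n : ℤ) : (m % 4 = 1 → jacobiSym (-n) m = jacobiSym n m) ∧
    (m % 4 = 3 → jacobiSym (-n) m = -jacobiSym n m) := by
  refine ⟨fun h => ?_, fun h => ?_⟩
  · rw [jacobiSym.neg n (Nat.odd_iff.2 (by omega)), χ₄_eq_of_mod.1 h, one_mul]
  · rw [jacobiSym.neg n (Nat.odd_iff.2 (by omega)), χ₄_eq_of_mod.2 h, neg_one_mul]

lemma GaussEigen.evenChar {D : ℕ} {φ : ℤ → ℤ} (h : GaussEigen D φ (√D : ℝ)) (hD : 1 < D)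
    (h0 : φ 0 = 0) (h1 : φ 1 = 1) (hneg : ∀ n, φ (-n) = φ n) (habs : ∀ n, |φ n| ≤ 1) :
    EvenChar D φ :=
  ⟨hD, h0, h1, h.map_mul, hneg, h.periodic, habs, h.sum_eq⟩

lemma abs_jacobiSym_le (n : ℤ) (m : ℕ) : |jacobiSym n m| ≤ 1 := by
  rcases jacobiSym.trichotomy n m with h | h | h <;> rw [h] <;> norm_num

lemma abs_χ_le : (∀ x, |ZMod.χ₄ x| ≤ 1) ∧ (∀ x, |ZMod.χ₈ x| ≤ 1) ∧ (∀ x, |ZMod.χ₈' x| ≤ 1) := by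
  refine ⟨by decide, by decide, by decide⟩

lemma abs_mul_le_one {a b : ℤ} (ha : |a| ≤ 1) (hb : |b| ≤ 1) : |a * b| ≤ 1 := by
  rw [abs_mul]
  exact mul_le_one₀ ha (abs_nonneg _) hb

lemma sqrt_nat_mul (a b : ℕ) : ((√((a * b : ℕ) : ℝ) : ℝ) : ℂ) = (√(a : ℝ) : ℝ) * (√(b : ℝ) : ℝ) := by
  rw [Nat.cast_mul, Real.sqrt_mul (Nat.cast_nonneg a), ofReal_mul]

lemma coprime_two_pow {m : ℕ} (hm : m % 2 = 1) (k : ℕ) : (2 ^ k).Coprime m :=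
  Nat.Coprime.pow_left _ (Nat.coprime_two_left.2 (Nat.odd_iff.2 hm))

theorem evenChar_kroneckerChar {D : ℕ} (hD : IsFundamental D) : EvenChar D (kroneckerChar D) := by
  refine IsFundamental.induction (P := EvenChar) ?_ ?_ ?_ ?_ hD
  · intro m h1 h hs
    have ho : Odd m := Nat.odd_iff.2 (by omega)
    refine (((gaussEigen_jacobiSym ho hs).congr (fun _ => rfl) ?_)).evenChar h1
      (jacobiSym.zero_left h1) (jacobiSym.one_left _) (fun n => (jacobiSym_neg_of_mod n).1 h)
      (fun n => abs_jacobiSym_le n m)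
    rw [gaussRoot, if_pos h]
  · intro m h hs
    have ho : Odd m := Nat.odd_iff.2 (by omega)
    refine ((gaussEigen_χ₄.mul (gaussEigen_jacobiSym ho hs)
      (coprime_two_pow (by omega) 2)).congr (fun _ => rfl) ?_).evenChar (by omega) (by simp)
      (by simp) (fun n => ?_) (fun n => abs_mul_le_one (abs_χ_le.1 _) (abs_jacobiSym_le n m))
    · have h4 := (jacobiSym_two_pow ho).1
      have hχ := χ₄_eq_of_mod.2 h
      rw [gaussRoot, if_neg (by omega), sqrt_nat_mul]
      push_cast
      rw [h4, hχ, show √(4 : ℝ) = 2 by rw [show (4 : ℝ) = 2 ^ 2 by norm_num]; exact Real.sqrt_sq zero_le_two]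
      push_cast
      linear_combination (-2 * (√m : ℂ)) * I_sq
    · have e : ZMod.χ₄ ((-n : ℤ) : ZMod 4) = - ZMod.χ₄ n := by
        rw [Int.cast_neg, neg_eq_neg_one_mul, map_mul]
        rw [show ZMod.χ₄ (-1) = -1 from rfl, neg_one_mul]
      rw [e, (jacobiSym_neg_of_mod n).2 h, neg_mul_neg]
  · intro m h hs
    have ho : Odd m := Nat.odd_iff.2 (by omega)
    refine ((gaussEigen_χ₈.mul (gaussEigen_jacobiSym ho hs)
      (coprime_two_pow (by omega) 3)).congr (fun _ => rfl) ?_).evenChar (by omega) (by simp)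
      (by simp) (fun n => ?_) (fun n => abs_mul_le_one (abs_χ_le.2.1 _) (abs_jacobiSym_le n m))
    · have h4 := (jacobiSym_two_pow ho).2
      have hχ : (ZMod.χ₈ (m : ZMod 8) : ℂ) ^ 2 = 1 := by
        exact_mod_cast congrArg (Int.cast : ℤ → ℂ) (χ₈_sq ho)
      rw [gaussRoot, if_pos h, sqrt_nat_mul]
      push_cast
      rw [h4]
      linear_combination (√8 : ℂ) * (√m : ℂ) * hχ
    · have e : ZMod.χ₈ ((-n : ℤ) : ZMod 8) = ZMod.χ₈ n := by
        rw [Int.cast_neg, neg_eq_neg_one_mul, map_mul]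
        rw [show ZMod.χ₈ (-1) = 1 from rfl, one_mul]
      rw [e, (jacobiSym_neg_of_mod n).1 h]
  · intro m h hs
    have ho : Odd m := Nat.odd_iff.2 (by omega)
    refine ((gaussEigen_χ₈'.mul (gaussEigen_jacobiSym ho hs)
      (coprime_two_pow (by omega) 3)).congr (fun _ => rfl) ?_).evenChar (by omega) (by simp)
      (by simp) (fun n => ?_) (fun n => abs_mul_le_one (abs_χ_le.2.2 _) (abs_jacobiSym_le n m))
    · have h4 := (jacobiSym_two_pow ho).2
      have hχ : (ZMod.χ₈ (m : ZMod 8) : ℂ) ^ 2 = 1 := by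
        exact_mod_cast congrArg (Int.cast : ℤ → ℂ) (χ₈_sq ho)
      have hχ' := χ₈'_eq m
      rw [Int.cast_natCast, Int.cast_natCast, χ₄_eq_of_mod.2 h] at hχ'
      rw [gaussRoot, if_neg (by omega), sqrt_nat_mul]
      push_cast
      rw [h4, hχ']
      push_cast
      linear_combination (√8 : ℂ) * (√m : ℂ) * (hχ - (ZMod.χ₈ (m : ZMod 8) : ℂ) ^ 2 * I_sq)
    · have e : ZMod.χ₈' ((-n : ℤ) : ZMod 8) = - ZMod.χ₈' n := by
        rw [Int.cast_neg, neg_eq_neg_one_mul, map_mul]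
        rw [show ZMod.χ₈' (-1) = -1 from rfl, neg_one_mul]
      rw [e, (jacobiSym_neg_of_mod n).2 h, neg_mul_neg]

theorem kroneckerChar_prime {D : ℕ} (hD : IsFundamental D) {p : ℕ} (hp : p.Prime) (hp2 : p ≠ 2) :
    kroneckerChar D p = jacobiSym D p := by
  have hpo : Odd p := hp.odd_of_ne_two hp2
  have hp4 : p % 4 = 1 ∨ p % 4 = 3 := by rcases hpo with ⟨k, rfl⟩; omega
  refine IsFundamental.induction (P := fun D χ => χ p = jacobiSym D p) ?_ ?_ ?_ ?_ hD
  · intro m h1 h hs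
    exact jacobiSym.quadratic_reciprocity_one_mod_four' hpo h
  · intro m h hs
    have ho : Odd m := Nat.odd_iff.2 (by omega)
    simp only
    rw [Nat.cast_mul, jacobiSym.mul_left, Nat.cast_ofNat, (jacobiSym_two_pow hpo).1, one_mul,
      Int.cast_natCast]
    rcases hp4 with hp4 | hp4
    · rw [χ₄_eq_of_mod.1 hp4, jacobiSym.quadratic_reciprocity_one_mod_four hp4 ho, one_mul]
    · rw [χ₄_eq_of_mod.2 hp4, jacobiSym.quadratic_reciprocity_three_mod_four hp4 h, neg_one_mul, neg_neg]
  · intro m h hs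
    simp only
    rw [Nat.cast_mul, jacobiSym.mul_left, Nat.cast_ofNat, (jacobiSym_two_pow hpo).2,
      Int.cast_natCast, jacobiSym.quadratic_reciprocity_one_mod_four' hpo h]
  · intro m h hs
    have ho : Odd m := Nat.odd_iff.2 (by omega)
    simp only
    rw [Nat.cast_mul, jacobiSym.mul_left, Nat.cast_ofNat, (jacobiSym_two_pow hpo).2,
      χ₈'_eq, Int.cast_natCast, Int.cast_natCast]
    rcases hp4 with hp4 | hp4
    · rw [χ₄_eq_of_mod.1 hp4, jacobiSym.quadratic_reciprocity_one_mod_four hp4 ho, one_mul]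
    · rw [χ₄_eq_of_mod.2 hp4, jacobiSym.quadratic_reciprocity_three_mod_four hp4 h]
      ring

theorem kroneckerChar_two {D : ℕ} (hD : IsFundamental D) :
    kroneckerChar D 2 = if D % 2 = 0 then 0 else if D % 8 = 1 then 1 else -1 := by
  refine IsFundamental.induction
    (P := fun D χ => χ 2 = if D % 2 = 0 then 0 else if D % 8 = 1 then 1 else -1) ?_ ?_ ?_ ?_ hD
  · intro m h1 h hs
    have ho : Odd m := Nat.odd_iff.2 (by omega)
    simp only
    rw [if_neg (by omega), jacobiSym.at_two ho, ZMod.χ₈_nat_mod_eight]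
    rcases (show m % 8 = 1 ∨ m % 8 = 5 by omega) with h | h <;> rw [h] <;> rfl
  · intro m h hs
    rw [if_pos (by omega)]
    exact zero_mul _
  · intro m h hs
    rw [if_pos (by omega)]
    exact zero_mul _
  · intro m h hs
    rw [if_pos (by omega)]
    exact zero_mul _

variable {K : Type} [Field K] [NumberField K]

/-- `1, θ` is a basis of the ring of integers of the quadratic field `K`, with
`θ² = tθ - n`. -/
structure QuadraticGenerator (K : Type) [Field K] [NumberField K] (θ : 𝓞 K) (t n : ℤ) : Prop where
  sq : θ * θ = t * θ - n
  exists_eq : ∀ z : 𝓞 K, ∃ x y : ℤ, z = x + y * θ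
  eq_zero : ∀ x y : ℤ, (x + y * θ : 𝓞 K) = 0 → x = 0 ∧ y = 0
  finrank_eq : Module.finrank ℚ K = 2
  discr_eq : NumberField.discr K = t ^ 2 - 4 * n

theorem exists_basis_eq_one (hdeg : Module.finrank ℚ K = 2) :
    ∃ (b : Module.Basis (Fin 2) ℤ (𝓞 K)), b 0 = 1 := by
  let b : Module.Basis (Fin 2) ℤ (𝓞 K) :=
    Module.finBasisOfFinrankEq ℤ (𝓞 K) (by rw [RingOfIntegers.rank, hdeg])
  have h1 := b.sum_repr 1
  rw [Fin.sum_univ_two] at h1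
  set x := b.repr 1 0
  set y := b.repr 1 1
  have hu : IsUnit ((Int.gcd x y : ℕ) : ℤ) := by
    obtain ⟨c, hc⟩ := Int.gcd_dvd_left x y
    obtain ⟨d, hd⟩ := Int.gcd_dvd_right x y
    have h2 : algebraMap ℤ (𝓞 K) (Int.gcd x y : ℕ) * (c • b 0 + d • b 1) = 1 := by
      rw [← h1, eq_intCast, ← zsmul_eq_mul, smul_add, smul_smul, smul_smul, ← hc, ← hd]
    have h3 := congrArg (Algebra.norm ℤ) h2
    rw [map_mul, Algebra.norm_algebraMap_of_basis b, Fintype.card_fin, (Algebra.norm ℤ).map_one] at h3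
    refine IsUnit.of_mul_eq_one (((Int.gcd x y : ℕ) : ℤ) * Algebra.norm ℤ (c • b 0 + d • b 1)) ?_
    rw [← h3]; ring
  have hg : Int.gcd x y = 1 := by
    have := Int.isUnit_iff.1 hu
    omega
  have hb := Int.gcd_eq_gcd_ab x y
  rw [hg, Nat.cast_one] at hb
  set u := Int.gcdA x y
  set v := Int.gcdB x y
  have hb0 : b 0 = u • (1 : 𝓞 K) - y • (-v • b 0 + u • b 1) := by
    have : b 0 = (x * u + y * v) • b 0 := by rw [← hb, one_smul]
    rw [← h1]
    nth_rw 1 [this]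
    module
  have hb1 : b 1 = v • (1 : 𝓞 K) + x • (-v • b 0 + u • b 1) := by
    have : b 1 = (x * u + y * v) • b 1 := by rw [← hb, one_smul]
    rw [← h1]
    nth_rw 1 [this]
    module
  have hli : LinearIndependent ℤ ![(1 : 𝓞 K), -v • b 0 + u • b 1] := by
    rw [LinearIndependent.pair_iff]
    intro r s h
    have h2 : (r * x - s * v) • b 0 + (r * y + s * u) • b 1 = 0 := by
      rw [← h, ← h1]; module
    have h3 := LinearIndependent.pair_iff.1
      (show LinearIndependent ℤ ![b 0, b 1] by
        convert b.linearIndependent using 1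
        ext i; fin_cases i <;> rfl) _ _ h2
    constructor
    · linear_combination u * h3.1 + v * h3.2 + r * hb
    · linear_combination -y * h3.1 + x * h3.2 + s * hb
  refine ⟨Module.Basis.mk hli ?_, by rw [Module.Basis.mk_apply]; rfl⟩
  rw [← b.span_eq, Submodule.span_le]
  rintro _ ⟨i, rfl⟩
  rw [Matrix.range_cons, Matrix.range_cons, Matrix.range_empty, Set.union_empty,
    Set.singleton_union]
  have hm1 : (1 : 𝓞 K) ∈ Submodule.span ℤ {1, -v • b 0 + u • b 1} :=
    Submodule.subset_span (Set.mem_insert _ _)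
  have hm2 : -v • b 0 + u • b 1 ∈ Submodule.span ℤ {1, -v • b 0 + u • b 1} :=
    Submodule.subset_span (Set.mem_insert_of_mem _ rfl)
  fin_cases i
  · change b 0 ∈ _
    have h := Submodule.sub_mem _ (Submodule.smul_mem _ u hm1) (Submodule.smul_mem _ y hm2)
    rwa [← hb0] at h
  · change b 1 ∈ _
    have h := Submodule.add_mem _ (Submodule.smul_mem _ v hm1) (Submodule.smul_mem _ x hm2)
    rwa [← hb1] at h

theorem exists_quadraticGenerator (hdeg : Module.finrank ℚ K = 2) :
    ∃ (θ : 𝓞 K) (t n : ℤ), QuadraticGenerator K θ t n := by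
  obtain ⟨b, hb⟩ := exists_basis_eq_one hdeg
  set θ := b 1 with hθ
  have hrep (z : 𝓞 K) : z = (b.repr z 0 : ℤ) + (b.repr z 1 : ℤ) * θ := by
    conv_lhs => rw [← b.sum_repr z, Fin.sum_univ_two, hb, zsmul_eq_mul, zsmul_eq_mul, mul_one]
  have hlin (x y : ℤ) (h : (x + y * θ : 𝓞 K) = 0) : x = 0 ∧ y = 0 := by
    refine LinearIndependent.pair_iff.1
      (show LinearIndependent ℤ ![b 0, b 1] by
        convert b.linearIndependent using 1
        ext i; fin_cases i <;> rfl) _ _ ?_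
    rw [hb, zsmul_eq_mul, zsmul_eq_mul, mul_one, h]
  have hsq := hrep (θ * θ)
  set d := b.repr (θ * θ) 0 with hd
  set c := b.repr (θ * θ) 1 with hc
  have htr1 : Algebra.trace ℤ (𝓞 K) 1 = 2 := by
    have := Algebra.trace_algebraMap_of_basis b (1 : ℤ)
    rwa [map_one, Fintype.card_fin] at this
  have hθr0 : b.repr θ 0 = 0 := by simp [hθ]
  have hθr1 : b.repr θ 1 = 1 := by simp [hθ]
  have htrθ : Algebra.trace ℤ (𝓞 K) θ = c := by
    rw [Algebra.trace_eq_matrix_trace b, Matrix.trace, Fin.sum_univ_two, Matrix.diag_apply,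
      Matrix.diag_apply, Algebra.leftMulMatrix_eq_repr_mul, Algebra.leftMulMatrix_eq_repr_mul, hb,
      mul_one, hθr0, zero_add]
  have htrθθ : Algebra.trace ℤ (𝓞 K) (θ * θ) = 2 * d + c * c := by
    rw [hsq, map_add, ← mul_one (d : 𝓞 K), ← zsmul_eq_mul, ← zsmul_eq_mul, map_smul, map_smul, htr1,
      htrθ, smul_eq_mul, smul_eq_mul]
    ring
  refine ⟨θ, c, -d, ⟨?_, fun z => ⟨_, _, hrep z⟩, hlin, hdeg, ?_⟩⟩
  · rw [hsq]; push_cast; ring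
  · rw [← NumberField.discr_eq_discr K b, Algebra.discr_def, Matrix.det_fin_two]
    simp only [Algebra.traceMatrix_apply, Algebra.traceForm_apply, hb, ← hθ, mul_one, one_mul, htr1,
      htrθ, htrθθ]
    ring

/-- A quotient of algebraic integers satisfying a monic quadratic equation is integral. -/
theorem exists_mul_eq_of_mul_self_eq {w : 𝓞 K} {m c d : ℤ} (hm : m ≠ 0)
    (h : w * w = m * c * w - m ^ 2 * d) : ∃ z : 𝓞 K, m * z = w := by
  have hm' : (m : K) ≠ 0 := Int.cast_ne_zero.2 hm
  have hinteg : IsIntegral ℤ ((w : K) / m) := by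
    refine ⟨Polynomial.X ^ 2 - Polynomial.C c * Polynomial.X + Polynomial.C d, ?_, ?_⟩
    · monicity!
    · have h' := congrArg (algebraMap (𝓞 K) K) h
      simp only [map_mul, map_sub, map_pow, map_intCast] at h'
      simp only [Polynomial.eval₂_add, Polynomial.eval₂_sub, Polynomial.eval₂_mul,
        Polynomial.eval₂_X_pow, Polynomial.eval₂_C, Polynomial.eval₂_X]
      rw [eq_intCast, eq_intCast]
      field_simp
      linear_combination h'
  obtain ⟨z, hz⟩ := IsIntegralClosure.isIntegral_iff (A := 𝓞 K).1 hinteg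
  refine ⟨z, FaithfulSMul.algebraMap_injective (𝓞 K) K ?_⟩
  rw [map_mul, map_intCast, hz]
  field_simp

namespace QuadraticGenerator

variable {θ : 𝓞 K} {t n : ℤ}

theorem dvd_of_mul_eq (h : QuadraticGenerator K θ t n) {m x y : ℤ} {z : 𝓞 K}
    (hz : m * z = x + y * θ) : m ∣ x ∧ m ∣ y := by
  obtain ⟨a, b, rfl⟩ := h.exists_eq z
  obtain ⟨h1, h2⟩ := h.eq_zero (x - m * a) (y - m * b) (by
    push_cast
    linear_combination -hz)
  exact ⟨⟨a, by linarith⟩, ⟨b, by linarith⟩⟩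

theorem not_sq_dvd_discr (h : QuadraticGenerator K θ t n) {p : ℤ} (hp : p ≠ 0) (h2 : ¬ p ∣ 2) :
    ¬ p ^ 2 ∣ discr K := by
  rintro ⟨k, hk⟩
  rw [h.discr_eq] at hk
  have hk' : ((t : 𝓞 K) ^ 2 - 4 * n) = p ^ 2 * k := by exact_mod_cast hk
  obtain ⟨z, hz⟩ := exists_mul_eq_of_mul_self_eq (w := 2 * θ - (t : 𝓞 K)) (m := p) (c := 0) (d := -k) hp (by
    push_cast
    linear_combination 4 * h.sq + hk')
  refine h2 (h.dvd_of_mul_eq (x := -t) (y := 2) (z := z) ?_).2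
  rw [hz]; push_cast; ring

theorem not_two_dvd {s : ℤ} (h : QuadraticGenerator K θ (2 * s) n) :
    (s ^ 2 - n) % 4 = 2 ∨ (s ^ 2 - n) % 4 = 3 := by
  have hsq := h.sq
  by_contra! hc
  rcases (show (s ^ 2 - n) % 4 = 0 ∨ (s ^ 2 - n) % 4 = 1 by lia) with h0 | h1
  · obtain ⟨k, hk⟩ := Int.dvd_of_emod_eq_zero h0
    have hk' : ((s : 𝓞 K) ^ 2 - n) = 4 * k := by exact_mod_cast hk
    obtain ⟨z, hz⟩ := exists_mul_eq_of_mul_self_eq (w := θ - (s : 𝓞 K)) (m := 2) (c := 0) (d := -k)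
      two_ne_zero (by
        push_cast at hsq ⊢
        linear_combination hsq + hk')
    have := (h.dvd_of_mul_eq (m := 2) (x := -s) (y := 1) (z := z) (by
      rw [hz]; push_cast; ring)).2
    lia
  · obtain ⟨k, hk⟩ := Int.dvd_self_sub_of_emod_eq h1
    have hk' : ((s : 𝓞 K) ^ 2 - n) - 1 = 4 * k := by exact_mod_cast hk
    obtain ⟨z, hz⟩ := exists_mul_eq_of_mul_self_eq (w := 1 + θ - (s : 𝓞 K)) (m := 2) (c := 1) (d := -k)
      two_ne_zero (by
        push_cast at hsq ⊢
        linear_combination hsq + hk')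
    have := (h.dvd_of_mul_eq (m := 2) (x := 1 - s) (y := 1) (z := z) (by
      rw [hz]; push_cast; ring)).2
    lia

end QuadraticGenerator

theorem isFundamental_of_discr_eq (hdeg : Module.finrank ℚ K = 2) {D : ℕ} (hD : discr K = D) :
    IsFundamental D := by
  obtain ⟨θ, t, n, h⟩ := exists_quadraticGenerator hdeg
  have hD2 : 1 < D := by
    have := NumberField.abs_discr_gt_two (K := K) (by rw [hdeg]; norm_num)
    rw [hD, Nat.abs_cast] at this
    lia
  have hodd (p : ℕ) (hp : p.Prime) (hp2 : p ≠ 2) : ¬ p * p ∣ D := by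
    intro hdvd
    refine h.not_sq_dvd_discr (p := p) (by exact_mod_cast hp.ne_zero) ?_ ?_
    · intro h2
      exact hp2 ((Nat.prime_dvd_prime_iff_eq hp Nat.prime_two).1 (by exact_mod_cast h2))
    · rw [hD, pow_two]; exact_mod_cast hdvd
  have hsqf (c m : ℕ) (hc : D = c * m) (hm : m % 2 = 1) : Squarefree m := by
    rw [Nat.squarefree_iff_prime_squarefree]
    intro p hp hpm
    refine hodd p hp ?_ (hc ▸ hpm.mul_left c)
    rintro rfl
    have := (dvd_mul_right 2 2).trans hpm
    lia
  have hd := h.discr_eq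
  rw [hD] at hd
  refine ⟨hD2, ?_⟩
  obtain ⟨s, rfl | rfl⟩ := Int.even_or_odd' t
  · have h3 := h.not_two_dvd
    have h4 : (D : ℤ) = 4 * (s ^ 2 - n) := by rw [hd]; ring
    generalize s ^ 2 - n = m at h3 h4
    rcases h3 with h3 | h3
    · exact Or.inr (Or.inr ⟨by lia, hsqf 8 _ (by lia) (by lia)⟩)
    · exact Or.inr (Or.inl ⟨by lia, hsqf 4 _ (by lia) (by lia)⟩)
  · have h4 : (D : ℤ) = 4 * (s ^ 2 + s - n) + 1 := by rw [hd]; ring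
    exact Or.inl ⟨by lia, hsqf 1 _ (by lia) (by lia)⟩

theorem Ideal.eq_of_le_of_absNorm_eq {I J : Ideal (𝓞 K)} (hle : J ≤ I)
    (hn : Ideal.absNorm J = Ideal.absNorm I) (h0 : Ideal.absNorm I ≠ 0) : J = I := by
  obtain ⟨A, rfl⟩ := Ideal.dvd_iff_le.2 hle
  rw [map_mul] at hn
  have hA : A = ⊤ :=
    Ideal.absNorm_eq_one_iff.1 (Nat.eq_of_mul_eq_mul_left (Nat.pos_of_ne_zero h0) (by rw [hn, mul_one]))
  rw [hA, Ideal.mul_top]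

theorem intCast_mem_iff_of_absNorm_eq_prime {p : ℕ} (hp : p.Prime) {I : Ideal (𝓞 K)}
    (hI : Ideal.absNorm I = p) (k : ℤ) : (k : 𝓞 K) ∈ I ↔ (p : ℤ) ∣ k := by
  have hpI : ((p : ℤ) : 𝓞 K) ∈ I := by
    have := Ideal.absNorm_mem I
    rw [hI] at this
    exact_mod_cast this
  constructor
  · intro hk
    by_contra hdvd
    obtain ⟨u, v, huv⟩ := (Nat.prime_iff_prime_int.1 hp).irreducible.coprime_iff_not_dvd.2 hdvd
    have h1 : (1 : 𝓞 K) ∈ I := by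
      have := I.add_mem (I.mul_mem_left (u : 𝓞 K) hpI) (I.mul_mem_left (v : 𝓞 K) hk)
      rwa [← Int.cast_mul, ← Int.cast_mul, ← Int.cast_add, huv, Int.cast_one] at this
    rw [(Ideal.eq_top_iff_one I).2 h1, Ideal.absNorm_top] at hI
    exact hp.one_lt.ne hI
  · rintro ⟨c, rfl⟩
    rw [Int.cast_mul]
    exact I.mul_mem_right _ hpI

theorem exists_sub_mem_of_absNorm_eq_prime {p : ℕ} (hp : p.Prime) {I : Ideal (𝓞 K)}
    (hI : Ideal.absNorm I = p) (z : 𝓞 K) : ∃ a ∈ Finset.range p, z - ((a : ℤ) : 𝓞 K) ∈ I := by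
  have hcard : Nat.card (𝓞 K ⧸ I) = p := by
    rw [← Submodule.cardQuot_apply, ← Ideal.absNorm_apply, hI]
  have : Finite (𝓞 K ⧸ I) := Nat.finite_of_card_ne_zero (hcard ▸ hp.ne_zero)
  have hinj : Function.Injective (fun a : Fin p => Ideal.Quotient.mk I ((a : ℕ) : ℤ)) := by
    intro a b hab
    have h := Ideal.Quotient.eq.1 hab
    rw [← Int.cast_sub, intCast_mem_iff_of_absNorm_eq_prime hp hI] at h
    have ha := a.2
    have hb := b.2
    have := Int.eq_zero_of_abs_lt_dvd h (by rw [abs_lt]; omega)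
    ext
    lia
  obtain ⟨a, ha⟩ := (hinj.bijective_of_nat_card_le (by rw [hcard, Nat.card_fin])).2
    (Ideal.Quotient.mk I z)
  exact ⟨a, Finset.mem_range.2 a.2, Ideal.Quotient.eq.1 ha.symm⟩

namespace QuadraticGenerator

variable {θ : 𝓞 K} {t n : ℤ}

theorem absNorm_span_natCast (h : QuadraticGenerator K θ t n) (m : ℕ) :
    Ideal.absNorm (Ideal.span {(m : 𝓞 K)}) = m ^ 2 := by
  rw [Ideal.absNorm_span_singleton, ← map_natCast (algebraMap ℤ (𝓞 K)), Algebra.norm_algebraMap,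
    RingOfIntegers.rank, h.finrank_eq, Int.natAbs_pow, Int.natAbs_natCast]

theorem dvd_of_mem_span (h : QuadraticGenerator K θ t n) {p a : ℤ} (ha : p ∣ a ^ 2 - t * a + n)
    {x y : ℤ} (hxy : (x + y * θ : 𝓞 K) ∈ Ideal.span {(p : 𝓞 K), θ - a}) : p ∣ x + a * y := by
  obtain ⟨u, v, huv⟩ := Ideal.mem_span_pair.1 hxy
  obtain ⟨u0, u1, rfl⟩ := h.exists_eq u
  obtain ⟨v0, v1, rfl⟩ := h.exists_eq v
  obtain ⟨hx, hy⟩ := h.eq_zero (x - (p * u0 - a * v0 - n * v1))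
    (y - (p * u1 + v0 + t * v1 - a * v1)) (by
      push_cast
      linear_combination -huv + (v1 : 𝓞 K) * h.sq)
  obtain ⟨c, hc⟩ := ha
  exact ⟨u0 + a * u1 - c * v1, by linear_combination hx + a * hy - v1 * hc⟩

theorem absNorm_span_pair (h : QuadraticGenerator K θ t n) {p : ℕ} (hp : p.Prime) {a : ℤ}
    (ha : (p : ℤ) ∣ a ^ 2 - t * a + n) :
    Ideal.absNorm (Ideal.span {((p : ℤ) : 𝓞 K), θ - a}) = p := by
  have hle : Ideal.span {(p : 𝓞 K)} ≤ Ideal.span {((p : ℤ) : 𝓞 K), θ - a} := by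
    rw [Ideal.span_singleton_le_iff_mem]
    exact Ideal.subset_span (Or.inl (by push_cast; rfl))
  have hdvd := Ideal.absNorm_dvd_absNorm_of_le hle
  rw [h.absNorm_span_natCast] at hdvd
  obtain ⟨k, hk, hk'⟩ := (Nat.dvd_prime_pow hp).1 hdvd
  interval_cases k
  · exfalso
    rw [pow_zero, Ideal.absNorm_eq_one_iff, Ideal.eq_top_iff_one] at hk'
    have := h.dvd_of_mem_span ha (x := 1) (y := 0) (by push_cast; simpa using hk')
    rw [mul_zero, add_zero] at this
    exact hp.one_lt.ne' (by exact_mod_cast Int.eq_one_of_dvd_one (by positivity) this)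
  · rw [hk', pow_one]
  · exfalso
    have heq := Ideal.eq_of_le_of_absNorm_eq hle (by rw [h.absNorm_span_natCast, hk'])
      (by rw [hk']; exact pow_ne_zero _ hp.ne_zero)
    have hm : θ - a ∈ Ideal.span {(p : 𝓞 K)} := heq ▸ Ideal.subset_span (Or.inr rfl)
    obtain ⟨z, hz⟩ := Ideal.mem_span_singleton.1 hm
    have := (h.dvd_of_mul_eq (m := p) (x := -a) (y := 1) (z := z) (by
      push_cast; rw [← hz]; ring)).2
    exact hp.one_lt.ne' (by exact_mod_cast Int.eq_one_of_dvd_one (by positivity) this)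

theorem ncard_absNorm_eq_prime (h : QuadraticGenerator K θ t n) {p : ℕ} (hp : p.Prime) :
    {I : Ideal (𝓞 K) | Ideal.absNorm I = p}.ncard =
      ((Finset.range p).filter fun a : ℕ => (p : ℤ) ∣ (a : ℤ) ^ 2 - t * a + n).card := by
  rw [← Set.ncard_coe_finset]
  symm
  refine Set.ncard_congr (fun a _ => Ideal.span {((p : ℤ) : 𝓞 K), θ - ((a : ℤ) : 𝓞 K)}) ?_ ?_ ?_
  · intro a ha
    exact h.absNorm_span_pair hp (Finset.mem_filter.1 ha).2
  · intro a b ha hb hab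
    have ha' := Finset.mem_filter.1 ha
    have hb' := Finset.mem_filter.1 hb
    have hm : θ - ((a : ℤ) : 𝓞 K) ∈ Ideal.span {((p : ℤ) : 𝓞 K), θ - ((b : ℤ) : 𝓞 K)} :=
      hab ▸ Ideal.subset_span (Or.inr rfl)
    have h1 := h.dvd_of_mem_span hb'.2 (x := -a) (y := 1) (by push_cast at hm ⊢; convert hm using 1; ring)
    have h2 := Finset.mem_range.1 ha'.1
    have h3 := Finset.mem_range.1 hb'.1
    have := Int.eq_zero_of_abs_lt_dvd h1 (by rw [abs_lt]; lia)
    lia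
  · intro I hI
    obtain ⟨a, ha, hm⟩ := exists_sub_mem_of_absNorm_eq_prime hp hI θ
    have hpI : ((p : ℤ) : 𝓞 K) ∈ I :=
      (intCast_mem_iff_of_absNorm_eq_prime hp hI _).2 dvd_rfl
    have hdvd : (p : ℤ) ∣ (a : ℤ) ^ 2 - t * a + n := by
      rw [← intCast_mem_iff_of_absNorm_eq_prime hp hI]
      have := I.mul_mem_left (t - θ - ((a : ℤ) : 𝓞 K)) hm
      convert this using 1
      push_cast
      linear_combination h.sq
    refine ⟨a, Finset.mem_filter.2 ⟨ha, hdvd⟩, ?_⟩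
    refine Ideal.eq_of_le_of_absNorm_eq ?_ ?_ ?_
    · rw [Ideal.span_le]
      rintro _ (rfl | rfl)
      · exact hpI
      · exact hm
    · rw [h.absNorm_span_pair hp hdvd, hI]
    · rw [hI]; exact hp.ne_zero

end QuadraticGenerator

theorem card_filter_dvd_quadratic {p : ℕ} [Fact p.Prime] (hp2 : p ≠ 2) (t n : ℤ) :
    (((Finset.range p).filter fun a : ℕ => (p : ℤ) ∣ (a : ℤ) ^ 2 - t * a + n).card : ℤ) =
      legendreSym p (t ^ 2 - 4 * n) + 1 := by
  have hp := Fact.out (p := p.Prime)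
  have h2 : (2 : ZMod p) ≠ 0 := by
    intro h
    have : ((2 : ℕ) : ZMod p) = 0 := by exact_mod_cast h
    rw [ZMod.natCast_eq_zero_iff] at this
    exact hp2 ((Nat.prime_dvd_prime_iff_eq hp Nat.prime_two).1 this)
  have h4 (a : ZMod p) : (2 * a - t) ^ 2 = ((t ^ 2 - 4 * n : ℤ) : ZMod p) ↔ a ^ 2 - t * a + n = 0 := by
    rw [← sub_eq_zero, show (2 * a - t) ^ 2 - ((t ^ 2 - 4 * n : ℤ) : ZMod p) =
      2 * 2 * (a ^ 2 - t * a + n) by push_cast; ring, mul_eq_zero, mul_self_eq_zero,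
      or_iff_right h2]
  have h5 (a : ℕ) : (p : ℤ) ∣ (a : ℤ) ^ 2 - t * a + n ↔ (a : ZMod p) ^ 2 - t * a + n = 0 := by
    rw [← ZMod.intCast_zmod_eq_zero_iff_dvd]
    push_cast
    rfl
  rw [← legendreSym.card_sqrts p hp2]
  congr 1
  refine Finset.card_bij (fun a _ => 2 * (a : ZMod p) - t) ?_ ?_ ?_
  · intro a ha
    rw [Set.mem_toFinset, Set.mem_ofPred_eq, h4, ← h5]
    exact (Finset.mem_filter.1 ha).2
  · intro a ha b hb hab
    have ha' := Finset.mem_range.1 (Finset.mem_filter.1 ha).1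
    have hb' := Finset.mem_range.1 (Finset.mem_filter.1 hb).1
    have h6 := mul_left_cancel₀ h2 (sub_left_injective hab)
    rw [ZMod.natCast_eq_natCast_iff] at h6
    exact Nat.ModEq.eq_of_lt_of_lt h6 ha' hb'
  · intro x hx
    rw [Set.mem_toFinset, Set.mem_ofPred_eq] at hx
    have hv : (2 : ZMod p) * ((((x + t) / 2 : ZMod p).val : ℕ) : ZMod p) - t = x := by
      rw [ZMod.natCast_zmod_val, mul_div_cancel₀ _ h2, add_sub_cancel_right]
    refine ⟨((x + t) / 2).val, Finset.mem_filter.2 ⟨Finset.mem_range.2 (ZMod.val_lt _), ?_⟩, hv⟩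
    rw [h5, ← h4, hv, hx]

theorem card_filter_dvd_quadratic_two (t n : ℤ) :
    (((Finset.range 2).filter fun a : ℕ => (2 : ℤ) ∣ (a : ℤ) ^ 2 - t * a + n).card : ℤ) =
      if (t ^ 2 - 4 * n) % 2 = 0 then 1 else if (t ^ 2 - 4 * n) % 8 = 1 then 2 else 0 := by
  rw [Finset.card_filter, Finset.sum_range_succ, Finset.sum_range_one]
  obtain ⟨s, rfl | rfl⟩ := Int.even_or_odd' t
  · have hd : ((2 * s) ^ 2 - 4 * n) % 2 = 0 := by
      rw [show (2 * s) ^ 2 - 4 * n = 2 * (2 * s ^ 2 - 2 * n) by ring]; lia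
    rw [if_pos hd]
    split_ifs <;> push_cast at * <;> lia
  · obtain ⟨q, hq⟩ := (Int.even_mul_succ_self s).exists_two_nsmul
    rw [nsmul_eq_mul] at hq
    have hd : (2 * s + 1) ^ 2 - 4 * n = 8 * q + 1 - 4 * n := by
      push_cast at hq; linear_combination 4 * hq
    rw [hd]
    split_ifs <;> push_cast at * <;> lia

theorem ncard_absNorm_eq_prime (hdeg : Module.finrank ℚ K = 2) {D : ℕ} (hD : discr K = D)
    {p : ℕ} (hp : p.Prime) :
    ({I : Ideal (𝓞 K) | Ideal.absNorm I = p}.ncard : ℤ) = 1 + kroneckerChar D p := by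
  obtain ⟨θ, t, n, h⟩ := exists_quadraticGenerator hdeg
  have hf := isFundamental_of_discr_eq hdeg hD
  rw [h.ncard_absNorm_eq_prime hp]
  have hd := h.discr_eq
  rw [hD] at hd
  rcases eq_or_ne p 2 with rfl | hp2
  · rw [Nat.cast_ofNat, card_filter_dvd_quadratic_two, kroneckerChar_two hf, ← hd]
    split_ifs <;> lia
  · have : Fact p.Prime := ⟨hp⟩
    rw [card_filter_dvd_quadratic hp2, kroneckerChar_prime hf hp hp2, ← hd,
      jacobiSym.legendreSym.to_jacobiSym, add_comm]

open scoped ArithmeticFunction ArithmeticFunction.Moebius in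
theorem EvenChar.idealMoebius_prime_pow {D : ℕ} {χ : ℤ → ℤ} (h : EvenChar D χ) {p : ℕ}
    (hp : p.Prime) (k : ℕ) :
    h.idealMoebius (p ^ k) =
      if k = 0 then 1 else if k = 1 then -1 - χ p else if k = 2 then χ p else 0 := by
  have hf (i : ℕ) : μ (p ^ i) = if i = 0 then 1 else if i = 1 then -1 else 0 := by
    rcases Nat.eq_zero_or_pos i with rfl | hi
    · simp
    · rw [ArithmeticFunction.moebius_apply_prime_pow hp hi.ne', if_neg hi.ne']
  have hg (i : ℕ) : (ArithmeticFunction.pmul μ h.toArith) (p ^ i) =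
      if i = 0 then 1 else if i = 1 then -χ p else 0 := by
    rw [ArithmeticFunction.pmul_apply, hf]
    split_ifs with h1 h2
    · rw [h1, pow_zero, h.isMultiplicative_toArith.1, one_mul]
    · rw [h2, pow_one, h.toArith_apply, neg_one_mul]
    · rw [zero_mul]
  rw [EvenChar.idealMoebius, ArithmeticFunction.mul_apply,
    Nat.sum_divisorsAntidiagonal (fun a b => μ a * (ArithmeticFunction.pmul μ h.toArith) b),
    Nat.sum_divisors_prime_pow hp]
  have hdiv {i : ℕ} (hi : i ≤ k) : p ^ k / p ^ i = p ^ (k - i) := Nat.pow_div hi hp.pos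
  rw [Finset.sum_congr rfl fun i hi => by
    rw [hdiv (Nat.lt_succ_iff.1 (Finset.mem_range.1 hi)), hf, hg]]
  rcases k with _ | _ | _ | k
  · simp
  · simp [Finset.sum_range_succ]; ring
  · simp [Finset.sum_range_succ]
  · rw [if_neg (by omega), if_neg (by omega), if_neg (by omega)]
    refine Finset.sum_eq_zero fun i _ => ?_
    rcases i with _ | _ | i <;> simp

theorem card_factors_mul {I J : Ideal (𝓞 K)} (hI : I ≠ 0) (hJ : J ≠ 0) :
    (UniqueFactorizationMonoid.factors (I * J)).card =
      (UniqueFactorizationMonoid.factors I).card + (UniqueFactorizationMonoid.factors J).card := by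
  rw [Multiset.card_eq_card_of_rel (UniqueFactorizationMonoid.factors_mul hI hJ), Multiset.card_add]

theorem moebiusK_zero : moebiusK K 0 = 0 := by
  rw [moebiusK, if_neg not_squarefree_zero]

theorem moebiusK_one : moebiusK K 1 = 1 := by
  rw [moebiusK, if_pos squarefree_one, UniqueFactorizationMonoid.factors_one, Multiset.card_zero,
    pow_zero]

theorem moebiusK_mul {I J : Ideal (𝓞 K)} (h : IsRelPrime I J) :
    moebiusK K (I * J) = moebiusK K I * moebiusK K J := by
  simp only [moebiusK, squarefree_mul_iff, h, true_and]
  by_cases hI : Squarefree I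
  · by_cases hJ : Squarefree J
    · rw [if_pos ⟨hI, hJ⟩, if_pos hI, if_pos hJ, card_factors_mul hI.ne_zero hJ.ne_zero, pow_add]
    · rw [if_neg (fun h => hJ h.2), if_neg hJ, mul_zero]
  · rw [if_neg (fun h => hI h.1), if_neg hI, zero_mul]

theorem moebiusK_prime {P : Ideal (𝓞 K)} (hP : Prime P) : moebiusK K P = -1 := by
  have hrel : Multiset.Rel Associated (UniqueFactorizationMonoid.factors P) {P} := by
    refine UniqueFactorizationMonoid.factors_unique
      (fun x hx => UniqueFactorizationMonoid.irreducible_of_factor x hx) ?_ ?_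
    · intro x hx
      rw [Multiset.mem_singleton.1 hx]
      exact hP.irreducible
    · rw [Multiset.prod_singleton]
      exact UniqueFactorizationMonoid.factors_prod hP.ne_zero
  rw [moebiusK, if_pos hP.irreducible.squarefree, Multiset.card_eq_card_of_rel hrel,
    Multiset.card_singleton, pow_one]

/-- The finite set of ideals of absolute norm `n`. -/
def idealsOfNorm (K : Type) [Field K] [NumberField K] (n : ℕ) : Finset (Ideal (𝓞 K)) :=
  (Ideal.finite_setOfPred_absNorm_eq (S := 𝓞 K) n).toFinset

theorem mem_idealsOfNorm {n : ℕ} {I : Ideal (𝓞 K)} :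
    I ∈ idealsOfNorm K n ↔ Ideal.absNorm I = n := by
  rw [idealsOfNorm, Set.Finite.mem_toFinset, Set.mem_ofPred_eq]

/-- The sum of the Möbius function over the ideals of a given norm. -/
def moebiusNormSum (K : Type) [Field K] [NumberField K] : ArithmeticFunction ℤ where
  toFun n := ∑ I ∈ idealsOfNorm K n, moebiusK K I
  map_zero' := Finset.sum_eq_zero fun I hI => by
    rw [Ideal.absNorm_eq_zero_iff.1 (mem_idealsOfNorm.1 hI)]
    exact moebiusK_zero

theorem moebiusNormSum_apply (n : ℕ) :
    moebiusNormSum K n = ∑ I ∈ idealsOfNorm K n, moebiusK K I := rfl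

theorem prime_of_absNorm_eq_prime {p : ℕ} (hp : p.Prime) {I : Ideal (𝓞 K)}
    (hI : Ideal.absNorm I = p) : Prime I :=
  Ideal.prime_of_isPrime (by rintro rfl; rw [Ideal.absNorm_bot] at hI; exact hp.ne_zero hI.symm)
    (Ideal.isPrime_of_irreducible_absNorm (by rw [hI]; exact hp))

theorem dvd_span_of_absNorm_eq {n : ℕ} {I : Ideal (𝓞 K)} (hI : Ideal.absNorm I = n) :
    I ∣ Ideal.span {(n : 𝓞 K)} := by
  rw [Ideal.dvd_span_singleton, ← hI]
  exact Ideal.absNorm_mem I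

theorem moebiusNormSum_one : moebiusNormSum K 1 = 1 := by
  have : idealsOfNorm K 1 = {1} := by
    ext I
    rw [mem_idealsOfNorm, Ideal.absNorm_eq_one_iff, Finset.mem_singleton, Ideal.one_eq_top]
  rw [moebiusNormSum_apply, this, Finset.sum_singleton, moebiusK_one]

theorem moebiusNormSum_prime {p : ℕ} (hp : p.Prime) :
    moebiusNormSum K p = -({I : Ideal (𝓞 K) | Ideal.absNorm I = p}.ncard : ℤ) := by
  rw [moebiusNormSum_apply, Finset.sum_congr rfl fun I hI =>
    moebiusK_prime (prime_of_absNorm_eq_prime hp (mem_idealsOfNorm.1 hI)), Finset.sum_const,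
    Set.ncard_eq_toFinset_card _ (Ideal.finite_setOfPred_absNorm_eq p)]
  simp [idealsOfNorm]

theorem dvd_span_of_squarefree_of_absNorm_eq {p k : ℕ} {I : Ideal (𝓞 K)} (hs : Squarefree I)
    (hI : Ideal.absNorm I = p ^ k) : I ∣ Ideal.span {(p : 𝓞 K)} := by
  have h := dvd_span_of_absNorm_eq hI
  rcases Nat.eq_zero_or_pos k with rfl | hk
  · rw [pow_zero, Ideal.absNorm_eq_one_iff] at hI
    rw [hI]
    exact Ideal.dvd_iff_le.2 le_top
  · rwa [Nat.cast_pow, ← Ideal.span_singleton_pow, hs.dvd_pow_iff_dvd hk.ne'] at h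

theorem absNorm_span_natCast (hdeg : Module.finrank ℚ K = 2) (m : ℕ) :
    Ideal.absNorm (Ideal.span {(m : 𝓞 K)}) = m ^ 2 := by
  obtain ⟨θ, t, n, h⟩ := exists_quadraticGenerator hdeg
  exact h.absNorm_span_natCast m

theorem moebiusNormSum_prime_pow_of_three_le (hdeg : Module.finrank ℚ K = 2) {p k : ℕ}
    (hp : p.Prime) (hk : 3 ≤ k) : moebiusNormSum K (p ^ k) = 0 := by
  refine Finset.sum_eq_zero fun I hI => ?_
  rw [moebiusK, if_neg]
  intro hs
  have hn := mem_idealsOfNorm.1 hI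
  have h := map_dvd Ideal.absNorm (dvd_span_of_squarefree_of_absNorm_eq hs hn)
  rw [hn, absNorm_span_natCast hdeg, Nat.pow_dvd_pow_iff_le_right hp.one_lt] at h
  omega

theorem moebiusNormSum_prime_sq (hdeg : Module.finrank ℚ K = 2) {p : ℕ} (hp : p.Prime) :
    moebiusNormSum K (p ^ 2) = moebiusK K (Ideal.span {(p : 𝓞 K)}) := by
  refine Finset.sum_eq_single_of_mem _ (mem_idealsOfNorm.2 (absNorm_span_natCast hdeg p)) ?_
  intro I hI hne
  rw [moebiusK, if_neg]
  intro hs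
  have hn := mem_idealsOfNorm.1 hI
  refine hne (Ideal.eq_of_le_of_absNorm_eq
    (Ideal.dvd_iff_le.1 (dvd_span_of_squarefree_of_absNorm_eq hs hn)) ?_ ?_).symm
  · rw [absNorm_span_natCast hdeg, hn]
  · rw [hn]; exact pow_ne_zero _ hp.ne_zero

theorem moebiusK_span_prime (hdeg : Module.finrank ℚ K = 2) {p : ℕ} (hp : p.Prime) :
    moebiusK K (Ideal.span {(p : 𝓞 K)}) = ({I : Ideal (𝓞 K) | Ideal.absNorm I = p}.ncard : ℤ) - 1 := by
  have hN := absNorm_span_natCast (K := K) hdeg p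
  have hne : Ideal.span {(p : 𝓞 K)} ≠ 0 := by
    intro h
    rw [h] at hN
    exact pow_ne_zero 2 hp.ne_zero (by rw [← hN]; exact Ideal.absNorm_bot)
  rcases Set.eq_empty_or_nonempty {I : Ideal (𝓞 K) | Ideal.absNorm I = p} with h0 | ⟨P, hP⟩
  · rw [h0, Set.ncard_empty]
    refine (moebiusK_prime (UniqueFactorizationMonoid.irreducible_iff_prime.1 ⟨?_, ?_⟩)).trans rfl
    · rw [Ideal.isUnit_iff, ← Ideal.absNorm_eq_one_iff, hN]
      exact (Nat.one_lt_pow two_ne_zero hp.one_lt).ne'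
    · intro A B hAB
      have hA : Ideal.absNorm A ∣ p ^ 2 := by rw [← hN, hAB, map_mul]; exact dvd_mul_right _ _
      obtain ⟨k, hk, hk'⟩ := (Nat.dvd_prime_pow hp).1 hA
      rw [Ideal.isUnit_iff, Ideal.isUnit_iff, ← Ideal.absNorm_eq_one_iff, ← Ideal.absNorm_eq_one_iff]
      interval_cases k
      · exact Or.inl (by rw [hk', pow_zero])
      · exact (Set.eq_empty_iff_forall_notMem.1 h0 A (by rw [Set.mem_ofPred_eq, hk', pow_one])).elim
      · rw [hAB, map_mul, hk'] at hN
        exact Or.inr (Nat.eq_of_mul_eq_mul_left (pow_pos hp.pos 2) (by rw [hN, mul_one]))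
  · obtain ⟨Q, hQ⟩ := dvd_span_of_absNorm_eq hP
    have hQn : Ideal.absNorm Q = p := by
      rw [hQ, map_mul, hP, pow_two] at hN
      exact Nat.eq_of_mul_eq_mul_left hp.pos hN
    have hPp := prime_of_absNorm_eq_prime hp hP
    have hQp := prime_of_absNorm_eq_prime hp hQn
    have hset : {I : Ideal (𝓞 K) | Ideal.absNorm I = p} = {P, Q} := by
      ext R
      constructor
      · intro hR
        have hd := dvd_span_of_absNorm_eq hR
        rw [hQ] at hd
        rcases (prime_of_absNorm_eq_prime hp hR).dvd_or_dvd hd with h | h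
        · exact Or.inl (Ideal.eq_of_le_of_absNorm_eq (Ideal.dvd_iff_le.1 h) (by rw [hP, hR])
            (by rw [hR]; exact hp.ne_zero)).symm
        · exact Or.inr (Ideal.eq_of_le_of_absNorm_eq (Ideal.dvd_iff_le.1 h) (by rw [hQn, hR])
            (by rw [hR]; exact hp.ne_zero)).symm
      · rintro (rfl | rfl)
        · exact hP
        · exact hQn
    rw [hset, hQ]
    rcases eq_or_ne P Q with rfl | hPQ
    · rw [Set.pair_eq_singleton, Set.ncard_singleton, moebiusK, if_neg]
      · rfl
      · intro hs
        exact hPp.not_isUnit (hs P dvd_rfl)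
    · rw [Set.ncard_pair hPQ, moebiusK_mul, moebiusK_prime hPp, moebiusK_prime hQp]
      · rfl
      · refine (hPp.irreducible.isRelPrime_iff_not_dvd).2 fun h => hPQ ?_
        exact associated_iff_eq.1 (hPp.associated_of_dvd hQp h)

theorem moebiusNormSum_prime_pow (hdeg : Module.finrank ℚ K = 2) {D : ℕ} (hD : discr K = D)
    {p : ℕ} (hp : p.Prime) (k : ℕ) :
    moebiusNormSum K (p ^ k) =
      (evenChar_kroneckerChar (isFundamental_of_discr_eq hdeg hD)).idealMoebius (p ^ k) := by
  rw [EvenChar.idealMoebius_prime_pow _ hp]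
  have hr := ncard_absNorm_eq_prime hdeg hD hp
  split_ifs with h0 h1 h2
  · rw [h0, pow_zero, moebiusNormSum_one]
  · rw [h1, pow_one, moebiusNormSum_prime hp, hr]; ring
  · rw [h2, moebiusNormSum_prime_sq hdeg hp, moebiusK_span_prime hdeg hp, hr]; ring
  · exact moebiusNormSum_prime_pow_of_three_le hdeg hp (by omega)

theorem EvenChar.isMultiplicative_idealMoebius {D : ℕ} {χ : ℤ → ℤ} (h : EvenChar D χ) :
    h.idealMoebius.IsMultiplicative :=
  ArithmeticFunction.isMultiplicative_moebius.mul
    (ArithmeticFunction.isMultiplicative_moebius.pmul h.isMultiplicative_toArith)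

theorem Ideal.sup_eq_top_of_coprime_absNorm {I J : Ideal (𝓞 K)}
    (h : (Ideal.absNorm I).Coprime (Ideal.absNorm J)) : I ⊔ J = ⊤ := by
  rw [← Ideal.absNorm_eq_one_iff]
  exact Nat.eq_one_of_dvd_coprimes h (Ideal.absNorm_dvd_absNorm_of_le le_sup_left)
    (Ideal.absNorm_dvd_absNorm_of_le le_sup_right)

theorem mul_sup_span_eq (hdeg : Module.finrank ℚ K = 2) {m n : ℕ} (hmn : m.Coprime n)
    {A B : Ideal (𝓞 K)} (hA : Ideal.absNorm A = m) (hB : Ideal.absNorm B = n) :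
    A * B ⊔ Ideal.span {(m : 𝓞 K)} = A := by
  obtain ⟨A', hA'⟩ := dvd_span_of_absNorm_eq hA
  have hN : Ideal.absNorm A' ∣ m ^ 2 := by
    rw [← absNorm_span_natCast hdeg, hA', map_mul]
    exact dvd_mul_left _ _
  have htop : B ⊔ A' = ⊤ := Ideal.sup_eq_top_of_coprime_absNorm (by
    rw [hB]
    exact (hmn.symm.pow_right 2).coprime_dvd_right hN)
  rw [hA', ← Ideal.mul_sup, htop, Ideal.mul_top]

theorem sup_span_mul_sup_span {m n : ℕ} (hmn : m.Coprime n) {I : Ideal (𝓞 K)}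
    (hI : Ideal.absNorm I = m * n) :
    (I ⊔ Ideal.span {(m : 𝓞 K)}) * (I ⊔ Ideal.span {(n : 𝓞 K)}) = I := by
  apply le_antisymm
  · rw [Ideal.sup_mul, Ideal.mul_sup, Ideal.mul_sup, Ideal.span_singleton_mul_span_singleton]
    refine sup_le (sup_le Ideal.mul_le_left Ideal.mul_le_left) (sup_le Ideal.mul_le_right ?_)
    rw [Ideal.span_singleton_le_iff_mem, ← Nat.cast_mul, ← hI]
    exact Ideal.absNorm_mem I
  · have htop : Ideal.span {(m : 𝓞 K)} ⊔ Ideal.span {(n : 𝓞 K)} = ⊤ := by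
      rw [Ideal.eq_top_iff_one, ← Ideal.span_insert, Ideal.mem_span_pair]
      obtain ⟨u, v, huv⟩ := Nat.isCoprime_iff_coprime.2 hmn
      exact ⟨u, v, by exact_mod_cast congrArg (Int.cast (R := 𝓞 K)) huv⟩
    calc I = I * Ideal.span {(m : 𝓞 K)} ⊔ I * Ideal.span {(n : 𝓞 K)} := by
          rw [← Ideal.mul_sup, htop, Ideal.mul_top]
      _ ≤ _ := sup_le
          (by rw [mul_comm]; exact Ideal.mul_mono le_sup_right le_sup_left)
          (Ideal.mul_mono le_sup_left le_sup_right)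

theorem absNorm_sup_span (hdeg : Module.finrank ℚ K = 2) {m n : ℕ} (hmn : m.Coprime n)
    (hm : m ≠ 0) (hn : n ≠ 0) {I : Ideal (𝓞 K)} (hI : Ideal.absNorm I = m * n) :
    Ideal.absNorm (I ⊔ Ideal.span {(m : 𝓞 K)}) = m ∧
      Ideal.absNorm (I ⊔ Ideal.span {(n : 𝓞 K)}) = n := by
  have hprod := congrArg Ideal.absNorm (sup_span_mul_sup_span hmn hI)
  rw [map_mul, hI] at hprod
  have hM (k : ℕ) : Ideal.absNorm (I ⊔ Ideal.span {(k : 𝓞 K)}) ∣ k ^ 2 := by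
    rw [← absNorm_span_natCast hdeg]
    exact Ideal.absNorm_dvd_absNorm_of_le le_sup_right
  have h1 : Ideal.absNorm (I ⊔ Ideal.span {(m : 𝓞 K)}) ∣ m :=
    ((hmn.pow_left 2).coprime_dvd_left (hM m)).dvd_of_dvd_mul_right (hprod ▸ dvd_mul_right _ _)
  have h2 : Ideal.absNorm (I ⊔ Ideal.span {(n : 𝓞 K)}) ∣ n :=
    ((hmn.symm.pow_left 2).coprime_dvd_left (hM n)).dvd_of_dvd_mul_left (hprod ▸ dvd_mul_left _ _)
  have h3 := Nat.le_of_dvd (Nat.pos_of_ne_zero hm) h1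
  have h4 := Nat.le_of_dvd (Nat.pos_of_ne_zero hn) h2
  have h5 : Ideal.absNorm (I ⊔ Ideal.span {(m : 𝓞 K)}) = m := by
    refine le_antisymm h3 (Nat.le_of_mul_le_mul_right ?_ (Nat.pos_of_ne_zero hn))
    rw [← hprod]
    exact Nat.mul_le_mul_left _ h4
  rw [h5] at hprod
  exact ⟨h5, Nat.eq_of_mul_eq_mul_left (Nat.pos_of_ne_zero hm) hprod⟩

theorem isMultiplicative_moebiusNormSum (hdeg : Module.finrank ℚ K = 2) :
    (moebiusNormSum K).IsMultiplicative := by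
  rw [ArithmeticFunction.IsMultiplicative.iff_ne_zero]
  refine ⟨moebiusNormSum_one, fun {m n} hm hn hmn => ?_⟩
  rw [moebiusNormSum_apply, moebiusNormSum_apply, moebiusNormSum_apply, Finset.sum_mul_sum,
    ← Finset.sum_product']
  symm
  refine Finset.sum_nbij' (fun P => P.1 * P.2)
    (fun I => (I ⊔ Ideal.span {(m : 𝓞 K)}, I ⊔ Ideal.span {(n : 𝓞 K)})) ?_ ?_ ?_ ?_ ?_
  · rintro ⟨A, B⟩ h
    obtain ⟨hA, hB⟩ := Finset.mem_product.1 h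
    rw [mem_idealsOfNorm] at hA hB ⊢
    rw [map_mul, hA, hB]
  · intro I hI
    have := absNorm_sup_span hdeg hmn hm hn (mem_idealsOfNorm.1 hI)
    exact Finset.mem_product.2 ⟨mem_idealsOfNorm.2 this.1, mem_idealsOfNorm.2 this.2⟩
  · rintro ⟨A, B⟩ h
    obtain ⟨hA, hB⟩ := Finset.mem_product.1 h
    rw [mem_idealsOfNorm] at hA hB
    refine Prod.ext (mul_sup_span_eq hdeg hmn hA hB) ?_
    simp only
    rw [mul_comm]
    exact mul_sup_span_eq hdeg hmn.symm hB hA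
  · intro I hI
    exact sup_span_mul_sup_span hmn (mem_idealsOfNorm.1 hI)
  · rintro ⟨A, B⟩ h
    obtain ⟨hA, hB⟩ := Finset.mem_product.1 h
    rw [mem_idealsOfNorm] at hA hB
    refine (moebiusK_mul (Ideal.isCoprime_iff_sup_eq.2 ?_).isRelPrime).symm
    exact Ideal.sup_eq_top_of_coprime_absNorm (by rwa [hA, hB])

theorem moebiusNormSum_eq (hdeg : Module.finrank ℚ K = 2) {D : ℕ} (hD : discr K = D) :
    moebiusNormSum K =
      (evenChar_kroneckerChar (isFundamental_of_discr_eq hdeg hD)).idealMoebius := by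
  refine (ArithmeticFunction.IsMultiplicative.eq_iff_eq_on_prime_powers _
    (isMultiplicative_moebiusNormSum hdeg) _ (EvenChar.isMultiplicative_idealMoebius _)).2 ?_
  intro p k hp
  exact moebiusNormSum_prime_pow hdeg hD hp k

theorem mertensK_eq_summatory {x : ℝ} (hx : ∀ k : ℕ, (k : ℝ) ≠ x) (h0 : 0 ≤ x) :
    mertensK K x = summatory (moebiusNormSum K) x := by
  have hlt {k : ℕ} (hk : k ≤ ⌊x⌋₊) : (k : ℝ) < x :=
    lt_of_le_of_ne ((Nat.le_floor_iff h0).1 hk) (hx k)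
  rw [mertensK, tsum_eq_sum (s := (Finset.Icc 1 ⌊x⌋₊).biUnion (idealsOfNorm K)),
    Finset.sum_biUnion]
  · refine Finset.sum_congr rfl fun k hk => ?_
    obtain ⟨hk1, hk2⟩ := Finset.mem_Icc.1 hk
    rw [moebiusNormSum_apply, Int.cast_sum]
    refine Finset.sum_congr rfl fun I hI => ?_
    rw [mem_idealsOfNorm] at hI
    have h0 : I ≠ ⊥ := by
      rintro rfl
      rw [Ideal.absNorm_bot] at hI
      omega
    rw [if_pos ⟨h0, by rw [hI]; exact hlt hk2⟩]
  · intro i _ j _ hij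
    rw [Function.onFun, Finset.disjoint_left]
    intro I hi hj
    exact hij ((mem_idealsOfNorm.1 hi).symm.trans (mem_idealsOfNorm.1 hj))
  · intro I hI
    rw [Finset.mem_biUnion] at hI
    rw [if_neg, if_neg]
    · rintro ⟨-, h⟩
      exact hx _ h
    · rintro ⟨h1, h2⟩
      refine hI ⟨_, Finset.mem_Icc.2 ⟨?_, Nat.le_floor h2.le⟩, mem_idealsOfNorm.2 rfl⟩
      exact Nat.pos_of_ne_zero fun h => h1 (Ideal.absNorm_eq_zero_iff.1 h)

theorem NaiveMertensConj.eventually_abs_le (h : NaiveMertensConj K) {δ : ℝ} (hδ : 0 < δ) :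
    ∀ᶠ x in atTop, |mertensK K x| ≤ (1 + δ) * √x := by
  obtain ⟨h1, -, h2⟩ := h
  have h3 : ((-(1 + δ) : ℝ) : EReal) < MKminus K := lt_of_lt_of_le (by
    rw [show (-1 : EReal) = ((-1 : ℝ) : EReal) by norm_num, EReal.coe_lt_coe_iff]
    linarith) h1
  have h4 : MKplus K < ((1 + δ : ℝ) : EReal) := lt_of_le_of_lt h2 (by
    rw [show (1 : EReal) = ((1 : ℝ) : EReal) by norm_num, EReal.coe_lt_coe_iff]
    linarith)
  filter_upwards [Filter.eventually_lt_of_lt_liminf h3, Filter.eventually_lt_of_limsup_lt h4,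
    eventually_gt_atTop 0] with x h5 h6 hx
  rw [EReal.coe_lt_coe_iff] at h5 h6
  have hs := Real.sqrt_pos.2 hx
  rw [lt_div_iff₀ hs] at h5
  rw [div_lt_iff₀ hs] at h6
  exact _root_.abs_le.2 ⟨by linarith, h6.le⟩

theorem NaiveMertensConj.mertensBound (h : NaiveMertensConj K) :
    MertensBound (moebiusNormSum K) := by
  intro δ hδ
  obtain ⟨X, hX⟩ := eventually_atTop.1 (h.eventually_abs_le hδ)
  filter_upwards [eventually_ge_atTop (max X 0)] with y hy
  have hy0 : 0 ≤ y := (le_max_right _ _).trans hy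
  have ht : Tendsto (fun x => (1 + δ) * √x) (𝓝[>] y) (𝓝 ((1 + δ) * √y)) :=
    ((Real.continuous_sqrt.tendsto y).const_mul _).mono_left nhdsWithin_le_nhds
  refine ge_of_tendsto ht ?_
  filter_upwards [Ioo_mem_nhdsGT (Nat.lt_floor_add_one y)] with x hx
  have hfl : ⌊x⌋₊ = ⌊y⌋₊ :=
    (Nat.floor_eq_iff (hy0.trans hx.1.le)).2 ⟨(Nat.floor_le hy0).trans hx.1.le, hx.2⟩
  have hne (k : ℕ) : (k : ℝ) ≠ x := by
    rintro rfl
    have h1 : k < ⌊y⌋₊ + 1 := by exact_mod_cast hx.2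
    have h2 : (⌊y⌋₊ : ℝ) < k := (Nat.floor_le hy0).trans_lt hx.1
    have : ⌊y⌋₊ < k := by exact_mod_cast h2
    omega
  have := hX x ((le_max_left _ _).trans (hy.trans hx.1.le))
  rwa [mertensK_eq_summatory hne (hy0.trans hx.1.le), summatory, hfl] at this

def jacobiFuel : ℕ → ℕ → ℕ → ℤ
  | 0, a, m => jacobiSym a m
  | f + 1, a, m =>
    bif a.beq 0 then (bif m.beq 1 then 1 else 0)
    else bif (a % 2).beq 0 then
      (bif (m % 8).beq 3 || (m % 8).beq 5 then -jacobiFuel f (a / 2) m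
        else jacobiFuel f (a / 2) m)
    else
      (bif (a % 4).beq 3 && (m % 4).beq 3 then -jacobiFuel f (m % a) a
        else jacobiFuel f (m % a) a)

def chiFour (b : ℕ) : ℤ :=
  bif (b % 2).beq 0 then 0 else bif (b % 4).beq 1 then 1 else -1

def chiEight (b : ℕ) : ℤ :=
  bif (b % 2).beq 0 then 0 else bif (b % 8).beq 1 || (b % 8).beq 7 then 1 else -1

def chiEight' (b : ℕ) : ℤ :=
  bif (b % 2).beq 0 then 0 else bif (b % 8).beq 1 || (b % 8).beq 3 then 1 else -1

def kroneckerFuel (D b : ℕ) : ℤ :=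
  bif (D % 4).beq 1 then jacobiFuel 64 (b % D) D
  else bif (D % 16).beq 12 then chiFour b * jacobiFuel 64 (b % (D / 4)) (D / 4)
  else bif (D / 8 % 4).beq 1 then chiEight b * jacobiFuel 64 (b % (D / 8)) (D / 8)
  else chiEight' b * jacobiFuel 64 (b % (D / 8)) (D / 8)

/-- The list of `g a + ⋯ + g (a + i)`, `i < k`, shifted by `s`. -/
def runningSums (g : ℕ → ℤ) : ℕ → ℕ → ℤ → List ℤ
  | 0, _, _ => []
  | k + 1, a, s => (s + g a) :: runningSums g k (a + 1) (s + g a)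

/-- The values of `n / d`, in increasing order, starting with `v`. -/
def floorValues (n : ℕ) : ℕ → ℕ → List ℕ
  | 0, _ => []
  | f + 1, v => v :: bif v.beq n then [] else floorValues n f (n / (n / (v + 1)))

def lookupTail (k : ℕ) : List (ℕ × ℤ) → Option (ℤ × List (ℕ × ℤ))
  | [] => none
  | (q, x) :: L => bif q.beq k then some (x, L) else lookupTail k L

def blockSum (v : ℕ) : ℕ → ℕ → ℤ → List (ℕ × ℤ) → List (ℕ × ℤ) → ℤ → Option ℤ
  | 0, _, _, _, _, _ => none
  | f + 1, lo, prev, X, L, acc =>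
    bif v.blt lo then some acc
    else match lookupTail (v / lo) L, lookupTail (v / (v / lo)) X with
      | some (x, L'), some (y, X') =>
        blockSum v f (v / (v / lo) + 1) y X' L' (acc - (y - prev) * x)
      | _, _ => none

def invertTable (X : List (ℕ × ℤ)) : List (ℕ × ℤ) → List (ℕ × ℤ) → Option (List (ℕ × ℤ))
  | [], L => some L
  | (v, r) :: R, L =>
    match blockSum v v 2 1 X L r with
    | some m => invertTable X R ((v, m) :: L)
    | none => none

def moebiusTable (n : ℕ) : Option (List (ℕ × ℤ)) :=
  let V := floorValues n n 1
  invertTable (V.map fun v => (v, (v : ℤ))) (V.map fun v => (v, 1)) []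

def charTable (D n : ℕ) : List (ℕ × ℤ) :=
  let P := runningSums (kroneckerFuel D) (min (n + 1) D) 0 0
  (floorValues n n 1).map fun v => (v, P.getD (v % D) 0)

def idealMoebiusSum (D n : ℕ) : Option ℤ :=
  match moebiusTable n with
  | none => none
  | some L => match invertTable (charTable D n) L.reverse [] with
    | some ((k, m) :: _) => bif k.beq n then some m else none
    | _ => none

theorem natBeq_eq_decide (a b : ℕ) : a.beq b = decide (a = b) := by
  rw [Bool.eq_iff_iff, Nat.beq_eq, decide_eq_true_iff]

theorem jacobiFuel_eq (f : ℕ) (a : ℕ) {m : ℕ} (hm : Odd m) :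
    jacobiFuel f a m = jacobiSym a m := by
  induction f generalizing a m with
  | zero => rfl
  | succ f ih =>
    have hm2 : m % 2 = 1 := Nat.odd_iff.mp hm
    unfold jacobiFuel
    by_cases ha : a = 0
    · subst ha
      by_cases h1 : m = 1
      · subst h1
        simp
      · simp [natBeq_eq_decide, h1, jacobiSym.zero_left (show 1 < m by omega)]
    rw [show Nat.beq a 0 = false by simpa [natBeq_eq_decide] using ha, cond_false]
    rcases Nat.mod_two_eq_zero_or_one a with h2 | h2
    · obtain ⟨c, rfl⟩ : 2 ∣ a := Nat.dvd_of_mod_eq_zero h2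
      rw [h2, Nat.mul_div_cancel_left c two_pos, ih c hm, Nat.cast_mul, jacobiSym.mul_left,
        Nat.cast_ofNat, jacobiSym.at_two hm, ZMod.χ₈_nat_eq_if_mod_eight]
      have h8 : m % 8 = 1 ∨ m % 8 = 3 ∨ m % 8 = 5 ∨ m % 8 = 7 := by omega
      rcases h8 with h | h | h | h <;> simp [natBeq_eq_decide, h, hm2]
    · have hodd : Odd a := Nat.odd_iff.mpr h2
      rw [h2, ih _ hodd, ← jacobiSym.quadratic_reciprocity_if h2 hm2, Int.natCast_mod,
        ← jacobiSym.mod_left]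
      have h4 : a % 4 = 1 ∨ a % 4 = 3 := by omega
      have h4' : m % 4 = 1 ∨ m % 4 = 3 := by omega
      rcases h4 with h | h <;> rcases h4' with h' | h' <;> simp [natBeq_eq_decide, h, h']

theorem chiFour_eq (b : ℕ) : chiFour b = ZMod.χ₄ b := by
  rw [ZMod.χ₄_nat_eq_if_mod_four, chiFour]
  have h4 : b % 4 = 0 ∨ b % 4 = 1 ∨ b % 4 = 2 ∨ b % 4 = 3 := by omega
  rcases Nat.mod_two_eq_zero_or_one b with h2 | h2 <;>
    rcases h4 with h | h | h | h <;> simp [natBeq_eq_decide, h, h2]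

theorem chiEight_eq (b : ℕ) : chiEight b = ZMod.χ₈ b := by
  rw [ZMod.χ₈_nat_eq_if_mod_eight, chiEight]
  by_cases h2 : b % 2 = 0
  · simp [natBeq_eq_decide, h2]
  · have h8 : b % 8 = 1 ∨ b % 8 = 3 ∨ b % 8 = 5 ∨ b % 8 = 7 := by omega
    rcases h8 with h | h | h | h <;> simp [natBeq_eq_decide, h, show b % 2 = 1 by omega]

theorem chiEight'_eq (b : ℕ) : chiEight' b = ZMod.χ₈' b := by
  rw [ZMod.χ₈'_nat_eq_if_mod_eight, chiEight']
  by_cases h2 : b % 2 = 0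
  · simp [natBeq_eq_decide, h2]
  · have h8 : b % 8 = 1 ∨ b % 8 = 3 ∨ b % 8 = 5 ∨ b % 8 = 7 := by omega
    rcases h8 with h | h | h | h <;> simp [natBeq_eq_decide, h, show b % 2 = 1 by omega]

theorem kroneckerFuel_eq {D : ℕ} (hD : IsFundamental D) (b : ℕ) :
    kroneckerFuel D b = kroneckerChar D b := by
  obtain ⟨-, h⟩ := hD
  have key : ∀ m : ℕ, Odd m → jacobiFuel 64 (b % m) m = jacobiSym b m := fun m hm => by
    rw [jacobiFuel_eq _ _ hm, Int.natCast_mod, ← jacobiSym.mod_left]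
  unfold kroneckerFuel kroneckerChar
  rcases h with ⟨h, -⟩ | ⟨h, -⟩ | ⟨h, hsq⟩
  · rw [key D (Nat.odd_iff.mpr (by omega))]
    simp [natBeq_eq_decide, h]
  · rw [key (D / 4) (Nat.odd_iff.mpr (by omega)), chiFour_eq]
    simp [natBeq_eq_decide, h, show D % 4 = 0 by omega]
  · rw [key (D / 8) (Nat.odd_iff.mpr (by omega)), chiEight_eq, chiEight'_eq]
    have h8 : D / 8 % 4 = 1 ∨ D / 8 % 4 = 3 := by omega
    rcases h8 with h' | h' <;> simp [natBeq_eq_decide, h, h', show D % 4 = 0 by omega]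

theorem natBlt_eq_decide (a b : ℕ) : a.blt b = decide (a < b) := by
  rw [Bool.eq_iff_iff, Nat.blt_eq, decide_eq_true_iff]

theorem lookupTail_spec {k : ℕ} {L : List (ℕ × ℤ)} {x : ℤ} {L' : List (ℕ × ℤ)}
    (h : lookupTail k L = some (x, L')) : (k, x) ∈ L ∧ L' ⊆ L := by
  induction L with
  | nil => simp [lookupTail] at h
  | cons p L ih =>
    obtain ⟨q, y⟩ := p
    rw [lookupTail, natBeq_eq_decide] at h
    by_cases hq : q = k
    · simp only [hq, decide_true, cond_true, Option.some.injEq, Prod.mk.injEq] at h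
      obtain ⟨rfl, rfl⟩ := h
      simp [hq]
    · simp only [hq, decide_false, cond_false] at h
      exact ⟨List.mem_cons_of_mem _ (ih h).1, List.subset_cons_of_subset _ (ih h).2⟩

/-- Partial sums of an arithmetic function. -/
def partialSum (f : ArithmeticFunction ℤ) (n : ℕ) : ℤ := ∑ k ∈ Finset.Ioc 0 n, f k

theorem blockSum_spec {f g : ArithmeticFunction ℤ} {v : ℕ} (fuel : ℕ) (a : ℕ)
    {X L : List (ℕ × ℤ)} (hX : ∀ p ∈ X, p.2 = partialSum f p.1)
    (hL : ∀ p ∈ L, p.2 = partialSum g p.1) {acc r : ℤ}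
    (h : blockSum v fuel (a + 1) (partialSum f a) X L acc = some r) :
    r = acc - ∑ d ∈ Finset.Ioc a v, f d * partialSum g (v / d) := by
  induction fuel generalizing a X L acc with
  | zero => simp [blockSum] at h
  | succ fuel ih =>
    rw [blockSum, natBlt_eq_decide] at h
    by_cases hv : v < a + 1
    · simp only [hv, decide_true, cond_true, Option.some.injEq] at h
      rw [Finset.Ioc_eq_empty (by omega), Finset.sum_empty, h, sub_zero]
    · simp only [hv, decide_false, cond_false] at h
      split at h
      · rename_i x L' y X' h1 h2
        obtain ⟨m1, s1⟩ := lookupTail_spec h1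
        obtain ⟨m2, s2⟩ := lookupTail_spec h2
        have e1 := hL _ m1
        have e2 := hX _ m2
        simp only at e1 e2
        set b := v / (v / (a + 1)) with hb
        have hpos : 0 < v / (a + 1) := Nat.div_pos (by omega) (by omega)
        have hab : a + 1 ≤ b := by
          rw [hb, Nat.le_div_iff_mul_le hpos, mul_comm]
          exact Nat.div_mul_le_self v (a + 1)
        have hbv : b ≤ v := Nat.div_le_self _ _
        rw [e2] at h
        rw [ih b (fun p hp => hX p (s2 hp)) (fun p hp => hL p (s1 hp)) h,
          ← Finset.sum_Ioc_consecutive _ (show a ≤ b by omega) hbv]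
        have hconst : ∑ d ∈ Finset.Ioc a b, f d * partialSum g (v / d) =
            (partialSum f b - partialSum f a) * x := by
          have hsplit : partialSum f b - partialSum f a = ∑ d ∈ Finset.Ioc a b, f d := by
            rw [partialSum, partialSum,
              ← Finset.sum_Ioc_consecutive _ (Nat.zero_le a) (show a ≤ b by omega)]
            ring
          rw [hsplit, Finset.sum_mul]
          refine Finset.sum_congr rfl fun d hd => ?_
          rw [Finset.mem_Ioc] at hd
          have hd0 : 0 < d := by omega
          have : v / d = v / (a + 1) := by
            apply le_antisymm (Nat.div_le_div_left (by omega) (by omega))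
            rw [Nat.le_div_iff_mul_le hd0, mul_comm]
            exact (Nat.le_div_iff_mul_le hpos).1 hd.2
          rw [this, e1]
        rw [hconst]
        ring
      · exact absurd h (by simp)

theorem invertTable_spec {f g : ArithmeticFunction ℤ} (hf : f 1 = 1) {X : List (ℕ × ℤ)}
    (hX : ∀ p ∈ X, p.2 = partialSum f p.1) {R L T : List (ℕ × ℤ)}
    (hR : ∀ p ∈ R, 0 < p.1 → p.2 = partialSum (f * g) p.1)
    (hL : ∀ p ∈ L, p.2 = partialSum g p.1) (h : invertTable X R L = some T) :
    ∀ p ∈ T, p.2 = partialSum g p.1 := by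
  induction R generalizing L with
  | nil =>
    simp only [invertTable, Option.some.injEq] at h
    exact h ▸ hL
  | cons p R ih =>
    obtain ⟨v, r⟩ := p
    rw [invertTable] at h
    split at h
    · rename_i m hm
      refine ih (fun p hp => hR p (List.mem_cons_of_mem _ hp)) (fun p hp => ?_) h
      rcases List.mem_cons.1 hp with rfl | hp
      · rcases Nat.eq_zero_or_pos v with rfl | hv
        · simp [blockSum] at hm
        have h1 : partialSum f 1 = 1 := by simp [partialSum, hf]
        rw [← h1] at hm
        have := blockSum_spec _ 1 hX hL hm
        have hr : r = partialSum (f * g) v := hR _ List.mem_cons_self hv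
        rw [hr] at this
        simp only [this, partialSum]
        rw [ArithmeticFunction.sum_Ioc_mul_eq_sum_sum,
          ← Finset.sum_Ioc_consecutive _ (Nat.zero_le 1) hv]
        simp [hf]
      · exact hL p hp
    · exact absurd h (by simp)

theorem moebiusTable_spec {n : ℕ} {T : List (ℕ × ℤ)} (h : moebiusTable n = some T) :
    ∀ p ∈ T, p.2 = partialSum ArithmeticFunction.moebius p.1 := by
  rw [moebiusTable] at h
  refine invertTable_spec (f := (ArithmeticFunction.zeta : ArithmeticFunction ℤ)) (by simp)
    (fun p hp => ?_) (fun p hp h0 => ?_) (by simp) h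
  · obtain ⟨v, -, rfl⟩ := List.mem_map.1 hp
    simp only [partialSum, ArithmeticFunction.natCoe_apply]
    rw [← Nat.cast_sum, ArithmeticFunction.sum_Ioc_zeta]
  · obtain ⟨v, -, rfl⟩ := List.mem_map.1 hp
    rw [ArithmeticFunction.coe_zeta_mul_moebius, partialSum,
      ← Finset.sum_Ioc_consecutive _ (Nat.zero_le 1) h0]
    simp only [zero_add, Finset.sum_Ioc_succ_top le_rfl, Finset.Ioc_self, Finset.sum_empty]
    rw [Finset.sum_eq_zero fun i hi => ?_]
    · simp
    · rw [ArithmeticFunction.one_apply_ne (by have := Finset.mem_Ioc.1 hi; omega)]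

theorem le_of_mem_floorValues {n : ℕ} (fuel : ℕ) {v : ℕ} (hv : v ≤ n) :
    ∀ w ∈ floorValues n fuel v, w ≤ n := by
  induction fuel generalizing v with
  | zero => simp [floorValues]
  | succ f ih =>
    intro w hw
    rw [floorValues, List.mem_cons] at hw
    rcases hw with rfl | hw
    · exact hv
    · rw [natBeq_eq_decide] at hw
      by_cases h : v = n
      · simp [h] at hw
      · simp only [h, decide_false, cond_false] at hw
        exact ih (Nat.div_le_self _ _) w hw

theorem runningSums_getD (g : ℕ → ℤ) (k a : ℕ) (s : ℤ) {i : ℕ} (hi : i < k) :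
    (runningSums g k a s).getD i 0 = s + ∑ j ∈ Finset.range (i + 1), g (a + j) := by
  induction k generalizing a s i with
  | zero => omega
  | succ k ih =>
    rw [runningSums]
    cases i with
    | zero => simp
    | succ i =>
      rw [List.getD_cons_succ, ih _ _ (by omega), Finset.sum_range_succ' _ (i + 1)]
      simp only [add_zero]
      rw [Finset.sum_congr rfl fun j _ => by rw [show a + 1 + j = a + (j + 1) by ring]]
      ring

namespace EvenChar

variable {D : ℕ} {χ : ℤ → ℤ}

theorem sum_range_period (h : EvenChar D χ) : ∑ r ∈ Finset.range D, χ r = 0 := by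
  have h0 := h.gauss 0
  simp only [Int.cast_zero, mul_zero, zero_div, Complex.exp_zero, mul_one, h.map_zero] at h0
  exact_mod_cast h0

theorem sum_range_add_mul (h : EvenChar D χ) (q r : ℕ) :
    ∑ j ∈ Finset.range (r + D * q), χ j = ∑ j ∈ Finset.range r, χ j := by
  induction q with
  | zero => simp
  | succ q ih =>
    rw [show r + D * (q + 1) = D + (r + D * q) by ring, Finset.sum_range_add,
      h.sum_range_period, zero_add, ← ih]
    refine Finset.sum_congr rfl fun j _ => ?_
    rw [Nat.cast_add, add_comm, h.periodic]

theorem partialSum_toArith (h : EvenChar D χ) (v : ℕ) :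
    partialSum h.toArith v = ∑ j ∈ Finset.range (v + 1), χ j := by
  rw [partialSum, Finset.sum_range_succ', Nat.cast_zero, h.map_zero, add_zero,
    Finset.range_eq_Ico, ← Finset.Ico_add_one_add_one_eq_Ioc, ← Finset.sum_Ico_add' (fun k => h.toArith k)]
  rfl

theorem partialSum_toArith_mod (h : EvenChar D χ) (v : ℕ) :
    partialSum h.toArith (v % D) = partialSum h.toArith v := by
  rw [partialSum_toArith, partialSum_toArith, ← h.sum_range_add_mul (v / D),
    add_right_comm, Nat.mod_add_div]

theorem toArith_mul_idealMoebius (h : EvenChar D χ) :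
    h.toArith * h.idealMoebius = ArithmeticFunction.moebius := by
  calc h.toArith * h.idealMoebius
      = ArithmeticFunction.moebius * (h.idealCount * h.idealMoebius) := by
        rw [idealCount, mul_assoc, ← mul_assoc, ArithmeticFunction.moebius_mul_coe_zeta, one_mul]
    _ = _ := by rw [h.idealCount_mul_idealMoebius, mul_one]

end EvenChar

theorem charTable_spec {D : ℕ} (hD : IsFundamental D) (n : ℕ) :
    ∀ p ∈ charTable D n, p.2 = partialSum (evenChar_kroneckerChar hD).toArith p.1 := by
  intro p hp
  rw [charTable] at hp
  obtain ⟨v, hv, rfl⟩ := List.mem_map.1 hp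
  rcases Nat.eq_zero_or_pos n with rfl | hn
  · simp [floorValues] at hv
  have hvn : v ≤ n := le_of_mem_floorValues n hn v hv
  have hD0 : 0 < D := hD.1.pos
  have hlt : v % D < min (n + 1) D :=
    lt_min ((Nat.mod_le v D).trans_lt (by omega)) (Nat.mod_lt _ hD0)
  rw [runningSums_getD _ _ _ _ hlt, ← EvenChar.partialSum_toArith_mod,
    EvenChar.partialSum_toArith, zero_add]
  simp only [zero_add, kroneckerFuel_eq hD]

theorem partialSum_of_idealMoebiusSum {D : ℕ} (hD : IsFundamental D) {n : ℕ} {M : ℤ}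
    (h : idealMoebiusSum D n = some M) :
    partialSum (evenChar_kroneckerChar hD).idealMoebius n = M := by
  rw [idealMoebiusSum] at h
  split at h
  · exact absurd h (by simp)
  rename_i L hL
  split at h
  · rename_i k m T hT
    rw [natBeq_eq_decide] at h
    by_cases hk : k = n
    · simp only [hk, decide_true, cond_true, Option.some.injEq] at h
      have hR : ∀ p ∈ L.reverse, 0 < p.1 → p.2 = partialSum ((evenChar_kroneckerChar hD).toArith *
          (evenChar_kroneckerChar hD).idealMoebius) p.1 := fun p hp _ => by
        rw [EvenChar.toArith_mul_idealMoebius]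
        exact moebiusTable_spec hL p (List.mem_reverse.1 hp)
      have h1 : (evenChar_kroneckerChar hD).toArith 1 = 1 := by
        rw [EvenChar.toArith_apply, Nat.cast_one, (evenChar_kroneckerChar hD).map_one]
      have := invertTable_spec h1 (charTable_spec hD n) hR (by simp) hT _ List.mem_cons_self
      rw [← h, ← hk]
      exact this.symm
    · simp [hk] at h
  · exact absurd h (by simp)

theorem summatory_of_idealMoebiusSum {D : ℕ} (hD : IsFundamental D) {n : ℕ} {M : ℤ}
    (h : idealMoebiusSum D n = some M) :
    summatory (fun n => (evenChar_kroneckerChar hD).idealMoebius n) n = M := by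
  rw [← partialSum_of_idealMoebiusSum hD h, summatory, partialSum, Nat.floor_natCast]
  push_cast
  rfl

theorem eulerMascheroniConstant_lt : Real.eulerMascheroniConstant < 0.58501 := by
  have h := Real.eulerMascheroniConstant_lt_eulerMascheroniSeq' 64
  have h2 := Real.log_two_gt_d9
  have hH : (harmonic 64 : ℝ) ≤ 4.7438910 := by
    have : harmonic 64 ≤ 4.7438910 := by
      norm_num [harmonic, Finset.sum_range_succ]
    exact_mod_cast (Rat.cast_le (K := ℝ)).2 this |>.trans_eq (by norm_num)
  have h64 : Real.log 64 = 6 * Real.log 2 := by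
    rw [show (64 : ℝ) = 2 ^ 6 by norm_num, Real.log_pow]
    norm_num
  simp only [Real.eulerMascheroniSeq', Nat.cast_ofNat, h64] at h
  norm_num at h hH h2 ⊢
  linarith

theorem log_pi_add_one_add_eulerMascheroniConstant_le :
    Real.log π + 1 + Real.eulerMascheroniConstant ≤ Real.log 236 / 2 := by
  have hγ := eulerMascheroniConstant_lt
  have h3 : Real.exp 3.17002 ≤ 20.0856 * 1.18533 := by
    have h1 : Real.exp 0.17002 ≤ 1.18533 := by
      refine (Real.exp_bound' (n := 5) (by norm_num) (by norm_num) (by norm_num)).trans ?_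
      norm_num [Finset.sum_range_succ, Nat.factorial]
    have h2 : Real.exp 3 ≤ 20.0856 := by
      rw [show (3 : ℝ) = (3 : ℕ) * 1 by norm_num, Real.exp_nat_mul]
      calc Real.exp 1 ^ 3 ≤ 2.7182818286 ^ 3 :=
            pow_le_pow_left₀ (Real.exp_pos _).le Real.exp_one_lt_d9.le 3
        _ ≤ _ := by norm_num
    rw [show (3.17002 : ℝ) = 3 + 0.17002 by norm_num, Real.exp_add]
    exact mul_le_mul h2 h1 (Real.exp_pos _).le (by norm_num)
  have hpi : π ^ 2 ≤ 9.8697 := by nlinarith [Real.pi_lt_d4, Real.pi_pos]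
  have h236 : π ^ 2 * Real.exp 3.17002 ≤ 236 :=
    (mul_le_mul hpi h3 (Real.exp_pos _).le (by norm_num)).trans (by norm_num)
  have := Real.log_le_log (by positivity) h236
  rw [Real.log_mul (by positivity) (by positivity), Real.log_exp, Real.log_pow] at this
  norm_num at this hγ ⊢
  linarith

/-- An affine function of `log n`, with an explicit slope and an explicit intercept, is within
`√n + 336 D^{-3/2} / n` of the summatory function of the Möbius function. -/
theorem exists_abs_summatory_add_le {D : ℕ} {χ : ℤ → ℤ} (h : EvenChar D χ)
    (hM : MertensBound (fun n => h.idealMoebius n)) :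
    ∃ α τ : ℝ, 7.29 / D ≤ α ∧ Real.log (D / 236) / 2 ≤ τ ∧ ∀ n : ℕ, 1 ≤ n →
      |summatory (fun n => h.idealMoebius n) n + α * (Real.log n + τ)| ≤
        √n + 336 / (D * √D) / n := by
  have hD := h.pos
  have hρ := h.residue_pos
  have hpi3 := Real.pi_lt_d4
  refine ⟨4 / EvenChar.residue χ D, Real.log D / 2 - Real.log π - 1 - Real.eulerMascheroniConstant -
    (deriv h.xi 0).re / EvenChar.residue χ D, ?_, ?_, fun n hn => ?_⟩
  · have hpi : π ^ 2 ≤ 9.8697 := by nlinarith [Real.pi_lt_d4, Real.pi_pos]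
    rw [div_le_div_iff₀ hD hρ]
    nlinarith [h.residue_le, mul_le_mul_of_nonneg_right hpi hD.le]
  · have h1 : (deriv h.xi 0).re / EvenChar.residue χ D ≤ 0 :=
      div_nonpos_of_nonpos_of_nonneg h.re_deriv_xi_zero_nonpos hρ.le
    have h2 := log_pi_add_one_add_eulerMascheroniConstant_le
    rw [Real.log_div hD.ne' (by norm_num)]
    linarith
  · have h1 := h.zetaData.abs_summatory_add_le hM hn
    have h2 : 4 * (π ^ 2 / 6) ^ 2 * Real.exp (-3 * (Real.log D / 2 - Real.log π)) ≤
        336 / (D * √D) := by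
      have e1 : Real.exp (-3 * (Real.log D / 2 - Real.log π)) = π ^ 3 / (D * √D) := by
        have e2 : Real.exp (Real.log D / 2) = √D := by
          rw [Real.exp_half, Real.exp_log hD]
        rw [show -3 * (Real.log D / 2 - Real.log π) =
          (3 : ℕ) * Real.log π - (Real.log D + Real.log D / 2) by push_cast; ring, Real.exp_sub,
          Real.exp_nat_mul, Real.exp_add, Real.exp_log hD, Real.exp_log Real.pi_pos, e2]
      rw [e1, ← mul_div_assoc]
      refine div_le_div_of_nonneg_right ?_ (by positivity)
      have : π ^ 7 ≤ 3.14160 ^ 7 := pow_le_pow_left₀ Real.pi_pos.le (by linarith) 7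
      norm_num at this ⊢
      nlinarith
    have h3 : 4 * (π ^ 2 / 6) ^ 2 * Real.exp (-3 * (Real.log D / 2 - Real.log π)) / n ≤
        336 / (D * √D) / n := div_le_div_of_nonneg_right h2 (by positivity)
    refine le_trans (le_of_eq ?_) (h1.trans (by linarith))
    congr 2
    ring

theorem not_mertensBound_of_large {D : ℕ} {χ : ℤ → ℤ} (h : EvenChar D χ) (hD : 2000 ≤ D) :
    ¬ MertensBound (fun n => h.idealMoebius n) := by
  intro hM
  obtain ⟨α, τ, hα, hτ, H⟩ := exists_abs_summatory_add_le h hM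
  have hDR : (2000 : ℝ) ≤ D := by exact_mod_cast hD
  have h1 : summatory (fun n => h.idealMoebius n) (1 : ℕ) = 1 := by
    have := h.isMultiplicative_idealMoebius.map_one
    simp [summatory, this]
  have h2 := (le_abs_self _).trans (H 1 le_rfl)
  rw [h1, Nat.cast_one, Real.log_one, Real.sqrt_one, zero_add, div_one] at h2
  have hlog : 2.079 ≤ Real.log (D / 236) := by
    calc (2.079 : ℝ) ≤ 3 * Real.log 2 := by linarith [Real.log_two_gt_d9]
      _ = Real.log 8 := by
        rw [show (8 : ℝ) = 2 ^ 3 by norm_num, Real.log_pow]; norm_num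
      _ ≤ _ := Real.log_le_log (by norm_num) (by rw [le_div_iff₀ (by norm_num)]; linarith)
  have hτ' : 1.0395 ≤ τ := by linarith
  have hsqrt : 44.7 ≤ √(D : ℝ) := Real.le_sqrt_of_sq_le (by norm_num; linarith)
  have h3 : 7.29 / D * 1.0395 ≤ 336 / (D * √D) := by
    have : 7.29 / D * 1.0395 ≤ α * τ :=
      mul_le_mul hα hτ' (by norm_num) ((by positivity : (0 : ℝ) ≤ 7.29 / D).trans hα)
    linarith
  rw [div_mul_eq_mul_div, div_le_div_iff₀ (by positivity) (by positivity)] at h3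
  nlinarith

def sqrtFuel (N : ℕ) : ℕ → ℕ → ℕ
  | 0, r => r
  | k + 1, r => bif ((r + 2 ^ k) * (r + 2 ^ k)).ble N then sqrtFuel N k (r + 2 ^ k)
      else sqrtFuel N k r

/-- An integer approximating `10 ^ 5 * √n` from above. -/
def sqrtBound (n : ℕ) : ℕ := sqrtFuel (n * 10 ^ 10) 25 0 + 1

/-- An integer approximating `10 ^ 5 * (336 D^{-3/2} / n)` from above. -/
def remainderBound (D n : ℕ) : ℕ := sqrtFuel ((336 * 10 ^ 5) ^ 2 / (D ^ 3 * n ^ 2)) 25 0 + 1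

def errorBound (D n : ℕ) : ℕ := sqrtBound n + remainderBound D n

/-- Whether `errorBound D n` is a correct bound. -/
def errorBoundValid (D n : ℕ) : Bool :=
  Nat.ble 1 n && (n * 10 ^ 10).ble (sqrtBound n ^ 2) &&
    ((336 * 10 ^ 5) ^ 2).ble (remainderBound D n ^ 2 * (D ^ 3 * n ^ 2))

/-- Whether the values at `n` and, if `n₁` is positive, at `n₁` show that the Möbius sums for
discriminant `D` are not all of square root size. -/
def refutes : ℕ × ℕ × ℕ × ℕ → Bool
  | (D, n, n₁, i) =>
    match idealMoebiusSum D n with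
    | none => false
    | some M => errorBoundValid D n &&
      bif n₁.beq 0 then Nat.ble 236 (n * n * D) && decide ((errorBound D n : ℤ) < 10 ^ 5 * M)
      else match idealMoebiusSum D n₁ with
        | none => false
        | some M₁ => errorBoundValid D n₁ && Nat.ble 100 i &&
          (n ^ 200 * 236 ^ (i - 100)).ble (n₁ ^ (2 * i) * D ^ (i - 100)) &&
          decide (i * ((errorBound D n₁ : ℤ) - 10 ^ 5 * M₁) <
            100 * (-(10 ^ 5 * M) - errorBound D n))

theorem le_errorBound {D n : ℕ} (hD : 0 < D) (h : errorBoundValid D n = true) :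
    √(n : ℝ) + 336 / (D * √D) / n ≤ errorBound D n / 10 ^ 5 := by
  simp only [errorBoundValid, Bool.and_eq_true, Nat.ble_eq] at h
  obtain ⟨⟨h0, h1⟩, h2⟩ := h
  have hn : (0 : ℝ) < n := by exact_mod_cast h0
  have hDR : (0 : ℝ) < D := by exact_mod_cast hD
  have e1 : √(n : ℝ) ≤ sqrtBound n / 10 ^ 5 := by
    refine Real.sqrt_le_iff.2 ⟨by positivity, ?_⟩
    rw [div_pow, le_div_iff₀ (by positivity)]
    have : ((n * 10 ^ 10 : ℕ) : ℝ) ≤ ((sqrtBound n ^ 2 : ℕ) : ℝ) := by exact_mod_cast h1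
    push_cast at this
    linarith
  have e2 : 336 / (D * √D) / n ≤ remainderBound D n / 10 ^ 5 := by
    rw [div_div, div_le_div_iff₀ (by positivity) (by positivity)]
    refine le_of_sq_le_sq ?_ (by positivity)
    have h3 : (((336 * 10 ^ 5) ^ 2 : ℕ) : ℝ) ≤
        ((remainderBound D n ^ 2 * (D ^ 3 * n ^ 2) : ℕ) : ℝ) := by exact_mod_cast h2
    push_cast at h3
    refine le_trans (by norm_num) (h3.trans (le_of_eq ?_))
    simp only [mul_pow, Real.sq_sqrt hDR.le]
    ring
  rw [errorBound, Nat.cast_add, add_div]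
  exact add_le_add e1 e2

theorem not_mertensBound_of_refutes {D : ℕ} (hD : IsFundamental D) {t : ℕ × ℕ × ℕ}
    (h : refutes (D, t) = true) :
    ¬ MertensBound (fun n => (evenChar_kroneckerChar hD).idealMoebius n) := by
  obtain ⟨n, n₁, i⟩ := t
  intro hM
  obtain ⟨α, τ, hα, hτ, H⟩ := exists_abs_summatory_add_le _ hM
  have hD0 : 0 < D := hD.1.pos
  have hDR : (0 : ℝ) < D := by exact_mod_cast hD0
  have hα0 : 0 < α := lt_of_lt_of_le (by positivity) hα
  have bound : ∀ {n : ℕ} {M : ℤ}, idealMoebiusSum D n = some M → errorBoundValid D n = true →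
      |(M : ℝ) + α * (Real.log n + τ)| ≤ errorBound D n / 10 ^ 5 := by
    intro n M hS hV
    have h1 : 1 ≤ n := by
      simp only [errorBoundValid, Bool.and_eq_true, Nat.ble_eq] at hV
      exact hV.1.1
    rw [← summatory_of_idealMoebiusSum hD hS]
    exact (H n h1).trans (le_errorBound hD0 hV)
  have one_le : ∀ {n : ℕ}, errorBoundValid D n = true → (0 : ℝ) < n := by
    intro n hV
    simp only [errorBoundValid, Bool.and_eq_true, Nat.ble_eq] at hV
    exact_mod_cast hV.1.1
  rw [refutes] at h
  split at h
  · exact absurd h (by simp)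
  rename_i M hS
  rw [natBeq_eq_decide, Bool.and_eq_true] at h
  obtain ⟨hV, h⟩ := h
  have hb := bound hS hV
  have hn := one_le hV
  by_cases hn1 : n₁ = 0
  · simp only [hn1, decide_true, cond_true, Bool.and_eq_true, Nat.ble_eq, decide_eq_true_eq] at h
    obtain ⟨h236, hU⟩ := h
    have hlog : 0 ≤ Real.log n + τ := by
      have h1 : (236 : ℝ) ≤ n * n * D := by exact_mod_cast h236
      have h2 := Real.log_le_log (by norm_num) h1
      rw [Real.log_mul (by positivity) hDR.ne', Real.log_mul hn.ne' hn.ne'] at h2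
      rw [Real.log_div hDR.ne' (by norm_num)] at hτ
      linarith
    have hU' : (errorBound D n : ℝ) < 10 ^ 5 * M := by exact_mod_cast hU
    have h3 := (le_abs_self _).trans hb
    have h4 := mul_nonneg hα0.le hlog
    rw [le_div_iff₀ (by positivity)] at h3
    nlinarith
  · simp only [hn1, decide_false, cond_false] at h
    split at h
    · exact absurd h (by simp)
    rename_i M₁ hS₁
    simp only [Bool.and_eq_true, Nat.ble_eq, decide_eq_true_eq] at h
    obtain ⟨⟨⟨hV₁, hi⟩, hpow⟩, hU⟩ := h
    have hb₁ := bound hS₁ hV₁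
    have hn₁ := one_le hV₁
    obtain ⟨j, rfl⟩ := Nat.exists_eq_add_of_le hi
    rw [Nat.add_sub_cancel_left] at hpow
    have hlog : 100 * (Real.log n + τ) ≤ (100 + j : ℝ) * (Real.log n₁ + τ) := by
      have h1 : (n : ℝ) ^ 200 * 236 ^ j ≤ (n₁ : ℝ) ^ (2 * (100 + j)) * D ^ j := by
        exact_mod_cast hpow
      have h2 := Real.log_le_log (by positivity) h1
      rw [Real.log_mul (by positivity) (by positivity), Real.log_mul (by positivity)
        (by positivity), Real.log_pow, Real.log_pow, Real.log_pow, Real.log_pow] at h2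
      push_cast at h2
      rw [Real.log_div hDR.ne' (by norm_num)] at hτ
      nlinarith [mul_le_mul_of_nonneg_left hτ (Nat.cast_nonneg (α := ℝ) j)]
    have hU' : (100 + j : ℝ) * (errorBound D n₁ - 10 ^ 5 * M₁) <
        100 * (-(10 ^ 5 * M) - errorBound D n) := by exact_mod_cast hU
    have h3 := (abs_le.1 hb).1
    have h4 := (abs_le.1 hb₁).2
    rw [← neg_div, div_le_iff₀ (by positivity)] at h3
    rw [le_div_iff₀ (by positivity)] at h4
    have h5 := mul_le_mul_of_nonneg_left hlog hα0.le
    have h6 : (100 + j : ℝ) * ((M₁ + α * (Real.log n₁ + τ)) * 10 ^ 5) ≤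
        (100 + j : ℝ) * errorBound D n₁ := mul_le_mul_of_nonneg_left h4 (by positivity)
    nlinarith

/-- Whether `D` passes the congruence conditions of a fundamental discriminant below `2000`. -/
def fundamentalTest (D : ℕ) : Bool :=
  Nat.blt 1 D && ((D % 4).beq 1 || (D % 16).beq 12 || (D % 16).beq 8) &&
    [3, 5, 7, 9, 11, 13, 15, 17, 19, 21, 23, 25, 27, 29, 31, 33, 35, 37, 39, 41, 43].all
      fun d => !(D % (d * d)).beq 0

theorem IsFundamental.fundamentalTest {D : ℕ} (h : IsFundamental D) :
    fundamentalTest D = true := by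
  have key : ∀ d : ℕ, Odd d → 1 < d → ¬ d * d ∣ D := by
    intro d hd h1 hdvd
    have aux : ∀ m c, Squarefree m → c * m = D → Nat.Coprime (d * d) c → False :=
      fun m c hm hc hco => h1.ne' (Nat.isUnit_iff.1 (hm d (hco.dvd_of_dvd_mul_left (hc ▸ hdvd))))
    have hco : ∀ k, Nat.Coprime (d * d) (2 ^ k) := fun k =>
      Nat.Coprime.pow_right k (Nat.Coprime.mul_left (Nat.coprime_two_right.2 hd)
        (Nat.coprime_two_right.2 hd))
    rcases h.2 with ⟨-, hs⟩ | ⟨hm, hs⟩ | ⟨hm, hs⟩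
    · exact aux D 1 hs (one_mul D) (Nat.coprime_one_right _)
    · exact aux (D / 4) 4 hs (by omega) (hco 2)
    · exact aux (D / 8) 8 hs (by omega) (hco 3)
  have h1 := h.1
  have h2 : D % 4 = 1 ∨ D % 16 = 12 ∨ D % 16 = 8 := by
    rcases h.2 with ⟨h, -⟩ | ⟨h, -⟩ | ⟨h, -⟩ <;> omega
  simp only [_root_.fundamentalTest, natBeq_eq_decide, natBlt_eq_decide, Bool.and_eq_true,
    Bool.or_eq_true, decide_eq_true_eq, List.all_eq_true, Bool.not_eq_true', decide_eq_false_iff_not]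
  refine ⟨⟨h1, by tauto⟩, fun d hd h0 => key d ?_ ?_ (Nat.dvd_of_mod_eq_zero h0)⟩ <;>
  · simp only [List.mem_cons, List.not_mem_nil, or_false] at hd
    rcases hd with rfl | rfl | rfl | rfl | rfl | rfl | rfl | rfl | rfl | rfl | rfl | rfl | rfl |
      rfl | rfl | rfl | rfl | rfl | rfl | rfl | rfl <;> decide

/-- Certificates for `refutes`, for all fundamental discriminants from `13` to `1997`. -/
def certificates : List (ℕ × ℕ × ℕ × ℕ) := [
  (13, 277, 92, 136), (17, 1868, 38, 268), (21, 105, 35, 147), (24, 470, 159, 128),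
  (28, 318, 111, 129), (29, 245, 65, 143), (33, 93, 0, 0), (37, 33, 0, 0), (40, 185, 0, 0),
  (41, 215, 0, 0), (44, 1007, 0, 0), (53, 187, 0, 0), (56, 99, 0, 0), (57, 978, 146, 145),
  (60, 35, 0, 0), (61, 163, 39, 148), (65, 454, 0, 0), (69, 68, 0, 0), (73, 23, 9, 159),
  (76, 15, 0, 0), (77, 437, 0, 0), (85, 228, 57, 140), (88, 39, 0, 0), (89, 34, 0, 0),
  (92, 166, 0, 0), (93, 217, 0, 0), (97, 66, 6, 278), (101, 221, 0, 0), (104, 187, 0, 0),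
  (105, 113, 26, 152), (109, 21, 0, 0), (113, 26, 0, 0), (120, 65, 0, 0), (124, 179, 15, 204),
  (129, 127, 10, 228), (133, 93, 0, 0), (136, 173, 15, 201), (137, 523, 122, 133),
  (140, 301, 0, 0), (141, 601, 55, 164), (145, 10, 0, 0), (149, 217, 0, 0), (152, 1359, 0, 0),
  (156, 347, 65, 143), (157, 407, 0, 0), (161, 46, 0, 0), (165, 164, 0, 0), (168, 329, 0, 0),
  (172, 39, 0, 0), (173, 41, 4, 290), (177, 154, 6, 297), (181, 55, 0, 0), (184, 15, 0, 0),
  (185, 86, 0, 0), (188, 1661, 0, 0), (193, 21, 0, 0), (197, 43, 4, 284), (201, 190, 10, 233),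
  (204, 455, 94, 136), (205, 52, 0, 0), (209, 98, 0, 0), (213, 43, 3, 355), (217, 39, 0, 0),
  (220, 57, 0, 0), (221, 11, 4, 175), (229, 57, 0, 0), (232, 87, 0, 0), (233, 62, 0, 0),
  (236, 166, 0, 0), (237, 31, 12, 139), (241, 10, 0, 0), (248, 289, 9, 257), (249, 14, 0, 0),
  (253, 141, 0, 0), (257, 178, 0, 0), (264, 95, 0, 0), (265, 10, 0, 0), (268, 93, 0, 0),
  (269, 13, 1, 4020), (273, 38, 0, 0), (277, 188, 0, 0), (280, 357, 93, 130), (281, 9, 1, 2618),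
  (284, 9, 1, 2474), (285, 37, 1, 3929), (293, 49, 1, 3698), (296, 7, 1, 1819), (301, 5, 1, 1424),
  (305, 119, 0, 0), (309, 7, 1, 1545), (312, 13, 1, 1938), (313, 3, 1, 879), (316, 5, 1, 1203),
  (317, 11, 1, 1726), (321, 5, 1, 1147), (328, 19, 1, 1889), (329, 9, 1, 1423),
  (332, 29, 1, 2074), (337, 3, 1, 717), (341, 13, 1, 1494), (344, 7, 1, 1133), (345, 22, 0, 0),
  (348, 19, 1, 1617), (349, 5, 1, 923), (353, 17, 1, 1508), (357, 11, 1, 1259), (364, 5, 1, 843),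
  (365, 9, 1, 1108), (373, 7, 1, 951), (376, 5, 1, 792), (377, 37, 1, 1642), (380, 9, 1, 1023),
  (381, 5, 1, 773), (385, 3, 1, 549), (389, 7, 1, 879), (393, 3, 1, 531), (397, 25, 1, 1338),
  (401, 7, 1, 835), (408, 11, 1, 977), (409, 3, 1, 500), (412, 3, 1, 495), (413, 29, 1, 1304),
  (417, 3, 1, 486), (421, 5, 1, 657), (424, 3, 1, 476), (428, 13, 1, 962), (429, 5, 1, 639),
  (433, 3, 1, 463), (437, 49, 1, 1364), (440, 29, 1, 1182), (444, 5, 1, 610), (445, 5, 1, 608),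
  (449, 7, 1, 706), (453, 31, 1, 1154), (456, 5, 1, 589), (457, 3, 1, 433), (460, 3, 1, 430),
  (461, 17, 1, 947), (465, 3, 1, 424), (469, 5, 1, 569), (472, 3, 1, 417), (473, 11, 1, 790),
  (476, 7, 1, 655), (481, 3, 1, 409), (485, 7, 1, 641), (488, 41, 1, 1123), (489, 3, 1, 402),
  (492, 29, 1, 1017), (493, 29, 1, 1015), (497, 13, 1, 789), (501, 5, 1, 528), (505, 3, 1, 389),
  (508, 3, 1, 387), (509, 11, 1, 724), (517, 29, 1, 959), (520, 3, 1, 379), (521, 26, 0, 0),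
  (524, 23, 1, 887), (533, 11, 1, 689), (536, 7, 1, 575), (537, 3, 1, 368), (541, 5, 1, 489),
  (545, 221, 0, 0), (552, 25, 1, 858), (553, 3, 1, 359), (556, 3, 1, 357), (557, 17, 1, 760),
  (561, 3, 1, 354), (565, 5, 1, 469), (568, 3, 1, 351), (569, 7, 1, 543), (572, 43, 1, 950),
  (573, 13, 1, 679), (577, 3, 1, 346), (581, 7, 1, 532), (584, 13, 1, 667), (589, 5, 1, 452),
  (593, 23, 1, 781), (597, 7, 1, 520), (601, 3, 1, 336), (604, 3, 1, 334), (609, 3, 1, 332),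
  (613, 7, 1, 508), (616, 3, 1, 330), (617, 11, 1, 600), (620, 7, 1, 503), (629, 31, 1, 801),
  (632, 11, 1, 587), (633, 3, 1, 323), (636, 5, 1, 425), (641, 7, 1, 490), (645, 7, 1, 488),
  (649, 3, 1, 318), (652, 3, 1, 317), (653, 11, 1, 572), (661, 5, 1, 413), (664, 3, 1, 313),
  (665, 235, 0, 0), (668, 43, 1, 823), (669, 5, 1, 409), (673, 3, 1, 310), (677, 41, 1, 805),
  (680, 7, 1, 468), (681, 3, 1, 308), (685, 5, 1, 403), (689, 166, 0, 0), (696, 5, 1, 398),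
  (697, 3, 1, 303), (701, 7, 1, 458), (705, 3, 1, 301), (709, 5, 1, 393), (712, 3, 1, 299),
  (713, 17, 1, 613), (716, 7, 1, 451), (717, 41, 1, 769), (721, 3, 1, 297), (728, 43, 1, 768),
  (732, 13, 1, 554), (733, 31, 1, 707), (737, 11, 1, 522), (741, 5, 1, 382), (744, 5, 1, 381),
  (745, 3, 1, 292), (748, 3, 1, 291), (749, 7, 1, 437), (753, 3, 1, 290), (757, 7, 1, 434),
  (760, 3, 1, 288), (761, 23, 1, 636), (764, 7, 1, 432), (769, 3, 1, 287), (773, 17, 1, 578),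
  (776, 37, 1, 707), (777, 3, 1, 285), (780, 31, 1, 675), (781, 5, 1, 369), (785, 7, 1, 424),
  (789, 5, 1, 367), (793, 3, 1, 282), (796, 3, 1, 281), (797, 13, 1, 522), (805, 5, 1, 363),
  (808, 3, 1, 279), (809, 7, 1, 416), (812, 11, 1, 489), (813, 7, 1, 415), (817, 3, 1, 277),
  (821, 7, 1, 413), (824, 53, 1, 736), (829, 5, 1, 357), (840, 43, 1, 693), (844, 3, 1, 273),
  (849, 3, 1, 272), (853, 31, 1, 635), (856, 3, 1, 271), (857, 41, 1, 676), (860, 43, 1, 682),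
  (861, 5, 1, 349), (865, 3, 1, 270), (869, 7, 1, 399), (872, 11, 1, 467), (876, 5, 1, 346),
  (877, 7, 1, 397), (881, 20, 1, 555), (885, 11, 1, 463), (888, 61, 1, 721), (889, 3, 1, 266),
  (892, 3, 1, 266), (893, 13, 1, 486), (897, 3, 1, 265), (901, 5, 1, 341), (904, 3, 1, 264),
  (905, 7, 1, 390), (908, 89, 1, 767), (913, 3, 1, 263), (917, 11, 1, 454), (920, 17, 1, 517),
  (921, 3, 1, 262), (924, 5, 1, 336), (929, 274, 0, 0), (933, 7, 1, 384), (937, 3, 1, 260),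
  (940, 3, 1, 259), (941, 43, 1, 644), (949, 5, 1, 332), (952, 3, 1, 258), (953, 13, 1, 468),
  (956, 7, 1, 379), (957, 47, 1, 651), (965, 13, 1, 465), (969, 3, 1, 256), (973, 7, 1, 375),
  (977, 11, 1, 438), (984, 5, 1, 326), (985, 3, 1, 254), (988, 3, 1, 254), (989, 7, 1, 372),
  (993, 3, 1, 253), (997, 23, 1, 536), (1001, 7, 1, 370), (1004, 13, 1, 455), (1005, 7, 1, 369),
  (1009, 3, 1, 252), (1013, 13, 1, 453), (1016, 7, 1, 367), (1020, 31, 1, 570), (1021, 5, 1, 320),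
  (1032, 61, 1, 658), (1033, 3, 1, 249), (1036, 3, 1, 249), (1037, 11, 1, 424), (1041, 3, 1, 249),
  (1045, 5, 1, 317), (1048, 3, 1, 248), (1049, 20, 1, 502), (1052, 13, 1, 444), (1057, 3, 1, 247),
  (1061, 7, 1, 359), (1064, 7, 1, 359), (1065, 3, 1, 246), (1068, 11, 1, 418), (1069, 5, 1, 314),
  (1073, 31, 1, 554), (1077, 53, 1, 624), (1081, 3, 1, 245), (1084, 3, 1, 245),
  (1085, 47, 1, 605), (1093, 7, 1, 354), (1096, 3, 1, 244), (1097, 29, 1, 539), (1101, 5, 1, 309),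
  (1105, 3, 1, 243), (1109, 11, 1, 410), (1112, 67, 1, 643), (1113, 3, 1, 242), (1117, 7, 1, 351),
  (1121, 7, 1, 350), (1128, 13, 1, 428), (1129, 3, 1, 241), (1132, 3, 1, 241), (1133, 59, 1, 620),
  (1137, 3, 1, 240), (1141, 5, 1, 305), (1144, 3, 1, 240), (1145, 7, 1, 347), (1148, 11, 1, 404),
  (1149, 5, 1, 304), (1153, 3, 1, 239), (1157, 13, 1, 423), (1160, 13, 1, 423), (1164, 5, 1, 302),
  (1165, 5, 1, 302), (1169, 7, 1, 344), (1173, 7, 1, 343), (1177, 3, 1, 237), (1180, 3, 1, 237),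
  (1181, 11, 1, 398), (1185, 3, 1, 237), (1189, 5, 1, 300), (1192, 3, 1, 236), (1193, 13, 1, 417),
  (1196, 43, 1, 564), (1201, 3, 1, 236), (1205, 7, 1, 339), (1208, 11, 1, 394), (1209, 3, 1, 235),
  (1212, 13, 1, 414), (1213, 7, 1, 338), (1217, 31, 1, 519), (1221, 5, 1, 296), (1228, 3, 1, 234),
  (1229, 7, 1, 336), (1237, 23, 1, 479), (1240, 3, 1, 233), (1241, 7, 1, 335), (1244, 13, 1, 409),
  (1245, 23, 1, 478), (1249, 3, 1, 232), (1253, 43, 1, 551), (1256, 53, 1, 575),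
  (1257, 3, 1, 232), (1261, 5, 1, 293), (1265, 403, 0, 0), (1272, 41, 1, 541), (1273, 3, 1, 231),
  (1276, 3, 1, 231), (1277, 13, 1, 404), (1281, 3, 1, 230), (1285, 5, 1, 290), (1288, 3, 1, 230),
  (1289, 7, 1, 330), (1292, 11, 1, 383), (1293, 47, 1, 553), (1297, 3, 1, 229),
  (1301, 11, 1, 381), (1304, 7, 1, 328), (1308, 73, 1, 602), (1309, 5, 1, 288),
  (1313, 11, 1, 380), (1317, 7, 1, 327), (1320, 7, 1, 327), (1321, 3, 1, 228), (1324, 3, 1, 228),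
  (1329, 3, 1, 228), (1333, 41, 1, 529), (1336, 3, 1, 227), (1337, 31, 1, 496),
  (1340, 13, 1, 396), (1345, 3, 1, 227), (1349, 13, 1, 395), (1353, 3, 1, 226), (1356, 5, 1, 285),
  (1357, 43, 1, 531), (1361, 23, 1, 458), (1365, 7, 1, 322), (1373, 11, 1, 373),
  (1381, 5, 1, 283), (1384, 3, 1, 225), (1385, 73, 1, 585), (1388, 13, 1, 390), (1389, 5, 1, 282),
  (1393, 3, 1, 224), (1397, 11, 1, 370), (1401, 3, 1, 224), (1405, 5, 1, 281), (1409, 7, 1, 318),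
  (1416, 5, 1, 280), (1417, 3, 1, 223), (1420, 3, 1, 223), (1429, 5, 1, 279), (1432, 3, 1, 222),
  (1433, 13, 1, 385), (1436, 7, 1, 316), (1437, 7, 1, 316), (1441, 3, 1, 222), (1448, 79, 1, 582),
  (1453, 7, 1, 315), (1457, 11, 1, 364), (1461, 5, 1, 277), (1464, 5, 1, 277), (1465, 3, 1, 221),
  (1468, 3, 1, 221), (1469, 13, 1, 381), (1473, 3, 1, 220), (1477, 7, 1, 313), (1480, 3, 1, 220),
  (1481, 7, 1, 312), (1484, 7, 1, 312), (1489, 3, 1, 220), (1493, 19, 1, 420), (1496, 13, 1, 378),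
  (1497, 3, 1, 219), (1501, 5, 1, 274), (1505, 13, 1, 377), (1509, 5, 1, 274), (1513, 3, 1, 219),
  (1516, 3, 1, 219), (1517, 17, 1, 405), (1528, 3, 1, 218), (1529, 365, 0, 0), (1532, 17, 1, 403),
  (1533, 11, 1, 357), (1537, 3, 1, 218), (1541, 7, 1, 308), (1544, 7, 1, 308), (1545, 3, 1, 217),
  (1549, 5, 1, 272), (1553, 37, 1, 484), (1560, 31, 1, 464), (1561, 3, 1, 217), (1564, 3, 1, 217),
  (1565, 7, 1, 306), (1569, 3, 1, 216), (1576, 3, 1, 216), (1577, 11, 1, 353), (1580, 71, 1, 549),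
  (1581, 5, 1, 270), (1585, 3, 1, 216), (1589, 7, 1, 305), (1592, 131, 1, 611), (1596, 5, 1, 269),
  (1597, 7, 1, 304), (1601, 37, 1, 478), (1605, 7, 1, 304), (1608, 73, 1, 548), (1609, 3, 1, 215),
  (1612, 3, 1, 215), (1613, 17, 1, 395), (1621, 5, 1, 268), (1624, 3, 1, 214), (1628, 11, 1, 349),
  (1633, 3, 1, 214), (1637, 13, 1, 365), (1640, 7, 1, 301), (1641, 3, 1, 214), (1644, 5, 1, 266),
  (1645, 5, 1, 266), (1649, 7, 1, 301), (1653, 7, 1, 300), (1657, 3, 1, 213), (1660, 3, 1, 213),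
  (1661, 7, 1, 300), (1669, 5, 1, 265), (1672, 3, 1, 213), (1673, 11, 1, 345), (1676, 13, 1, 362),
  (1677, 7, 1, 299), (1685, 23, 1, 420), (1688, 11, 1, 344), (1689, 3, 1, 212),
  (1693, 37, 1, 467), (1697, 76, 1, 540), (1704, 5, 1, 263), (1705, 3, 1, 212), (1708, 3, 1, 212),
  (1709, 7, 1, 297), (1713, 3, 1, 211), (1717, 7, 1, 297), (1720, 3, 1, 211), (1721, 20, 1, 402),
  (1724, 7, 1, 296), (1729, 3, 1, 211), (1733, 13, 1, 358), (1736, 7, 1, 296), (1740, 7, 1, 295),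
  (1741, 5, 1, 262), (1745, 7, 1, 295), (1749, 5, 1, 261), (1752, 11, 1, 340), (1753, 3, 1, 210),
  (1756, 3, 1, 210), (1757, 23, 1, 413), (1761, 3, 1, 210), (1765, 5, 1, 260), (1768, 3, 1, 210),
  (1769, 17, 1, 382), (1772, 11, 1, 338), (1777, 3, 1, 209), (1781, 13, 1, 354),
  (1784, 17, 1, 381), (1785, 3, 1, 209), (1788, 43, 1, 472), (1789, 5, 1, 259),
  (1793, 11, 1, 337), (1797, 13, 1, 353), (1801, 3, 1, 209), (1804, 3, 1, 209), (1816, 3, 1, 208),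
  (1817, 13, 1, 352), (1820, 11, 1, 335), (1821, 5, 1, 258), (1829, 7, 1, 291),
  (1832, 17, 1, 377), (1833, 3, 1, 208), (1837, 31, 1, 435), (1841, 7, 1, 290),
  (1848, 31, 1, 434), (1852, 3, 1, 207), (1853, 23, 1, 405), (1857, 3, 1, 207), (1861, 5, 1, 256),
  (1864, 3, 1, 207), (1865, 41, 1, 460), (1868, 13, 1, 348), (1869, 5, 1, 256), (1873, 3, 1, 207),
  (1877, 61, 1, 497), (1880, 7, 1, 288), (1884, 5, 1, 255), (1885, 5, 1, 255), (1889, 23, 1, 402),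
  (1893, 59, 1, 492), (1896, 5, 1, 255), (1897, 3, 1, 206), (1901, 7, 1, 287), (1905, 3, 1, 206),
  (1909, 5, 1, 254), (1912, 3, 1, 206), (1913, 29, 1, 422), (1916, 61, 1, 493), (1921, 3, 1, 205),
  (1928, 13, 1, 345), (1929, 3, 1, 205), (1932, 43, 1, 458), (1933, 7, 1, 286),
  (1937, 13, 1, 344), (1941, 5, 1, 253), (1945, 3, 1, 205), (1948, 3, 1, 205), (1949, 13, 1, 343),
  (1957, 7, 1, 284), (1961, 7, 1, 284), (1964, 7, 1, 284), (1965, 61, 1, 488), (1969, 3, 1, 204),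
  (1973, 13, 1, 342), (1976, 7, 1, 284), (1977, 3, 1, 204), (1981, 5, 1, 252), (1985, 7, 1, 283),
  (1992, 11, 1, 325), (1993, 3, 1, 203), (1996, 3, 1, 203), (1997, 17, 1, 366)]

set_option maxRecDepth 100000 in
theorem refutes_certificates : certificates.all refutes = true := by decide +kernel

theorem refutes_eight : refutes (8, 1609, 11263, 100) = true := by decide +kernel

theorem refutes_twelve : refutes (12, 63899, 4897, 137) = true := by decide +kernel

set_option maxRecDepth 100000 in
theorem filter_fundamentalTest :
    (List.range 2000).filter fundamentalTest = 5 :: 8 :: 12 :: certificates.map Prod.fst := by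
  decide +kernel

theorem exists_refutes {D : ℕ} (hD : IsFundamental D) (h5 : D ≠ 5) (hlt : D < 2000) :
    ∃ t, refutes (D, t) = true := by
  have hmem : D ∈ (List.range 2000).filter fundamentalTest :=
    List.mem_filter.2 ⟨List.mem_range.2 hlt, hD.fundamentalTest⟩
  rw [filter_fundamentalTest, List.mem_cons, List.mem_cons, List.mem_cons, List.mem_map] at hmem
  rcases hmem with rfl | rfl | rfl | ⟨⟨_, t⟩, ht, rfl⟩
  · exact absurd rfl h5
  · exact ⟨_, refutes_eight⟩
  · exact ⟨_, refutes_twelve⟩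
  · exact ⟨t, List.all_eq_true.1 refutes_certificates _ ht⟩

theorem not_mertensBound_idealMoebius {D : ℕ} (hD : IsFundamental D) (h5 : D ≠ 5) :
    ¬ MertensBound (fun n => (evenChar_kroneckerChar hD).idealMoebius n) := by
  rcases le_or_gt 2000 D with h | h
  · exact not_mertensBound_of_large _ h
  · obtain ⟨t, ht⟩ := exists_refutes hD h5 h
    exact not_mertensBound_of_refutes hD ht

end

/-- The naïve Mertens-type conjecture is false over every real quadratic field
except `ℚ(√5)` (the real quadratic field of discriminant `5`). -/
theorem naive_mertens_false_real_quadratic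
    (K : Type) [Field K] [NumberField K]
    (hdeg : Module.finrank ℚ K = 2)
    (hreal : 0 < NumberField.discr K)
    (hne : NumberField.discr K ≠ 5) :
    ¬ NaiveMertensConj K := by
  intro h
  lift NumberField.discr K to ℕ using hreal.le with D hD
  have hfund := isFundamental_of_discr_eq hdeg hD.symm
  have hM := h.mertensBound
  rw [moebiusNormSum_eq hdeg hD.symm] at hM
  exact not_mertensBound_idealMoebius hfund (by exact_mod_cast hne) hM
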